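/- There exists a polynomial P(ξ,η) of total degree 2 with real coefficients such that for every ε > 0 there is a constant C(ε) with the following property: for all real x ≥ 2 and all real Q with 1 ≤ Q ≤ x, | V(x,Q) − (Q x / π²)(log(Q²/x))³ − Q x P(log x, log Q) | ≤ C(ε) ( x^{7/4} (log x)³ + Q² (x/Q)^{ε} (log x)² ). -/

import Mathlib

open Classical Finset

/-- The Ramanujan sum `c_r(a) = Σ_{1 ≤ b ≤ r, (b,r)=1} e(ba/r)` (a real number). -/
noncomputable def ramanujanSum (r a : ℕ) : ℝ :=
  (∑ b ∈ (Finset.Icc 1 r).filter (fun b => Nat.gcd b r = 1),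
    Complex.exp (2 * Real.pi * Complex.I * b * a / r)).re

/-- `A(x;q,a) = Σ_{n ≤ x, n ≡ a (mod q)} d(n)`. -/
noncomputable def Adiv (x : ℝ) (q a : ℕ) : ℝ :=
  ∑ n ∈ (Finset.Icc 1 ⌊x⌋₊).filter (fun n => n % q = a % q), (n.divisors.card : ℝ)

/-- `M(x;q,a) = (x/q) Σ_{r | q} (c_r(a)/r)(log(x/r²) + 2γ − 1)`. -/
noncomputable def Mdiv (x : ℝ) (q a : ℕ) : ℝ :=
  x / q * ∑ r ∈ q.divisors, ramanujanSum r a / r *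
    (Real.log (x / r ^ 2) + 2 * Real.eulerMascheroniConstant - 1)

/-- `V(x,Q) = Σ_{q ≤ Q} Σ_{a=1}^{q} (A(x;q,a) − M(x;q,a))²`. -/
noncomputable def Vdiv (x Q : ℝ) : ℝ :=
  ∑ q ∈ Finset.Icc 1 ⌊Q⌋₊, ∑ a ∈ Finset.Icc 1 q, (Adiv x q a - Mdiv x q a) ^ 2

/-- `e(t) = exp(2πit)`. -/
noncomputable def expTwoPi (t : ℝ) : ℂ := Complex.exp (2 * Real.pi * Complex.I * t)

lemma expTwoPi_add (s t : ℝ) : expTwoPi (s + t) = expTwoPi s * expTwoPi t := by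
  simp only [expTwoPi, ← Complex.exp_add]; congr 1; push_cast; ring

lemma expTwoPi_int (k : ℤ) : expTwoPi k = 1 := by
  rw [expTwoPi, Complex.exp_eq_one_iff]; exact ⟨k, by push_cast; ring⟩

lemma norm_expTwoPi (t : ℝ) : ‖expTwoPi t‖ = 1 := by
  rw [expTwoPi, show (2 * Real.pi * Complex.I * t : ℂ) = ((2 * Real.pi * t : ℝ) : ℂ) * Complex.I by
    push_cast; ring, Complex.norm_exp_ofReal_mul_I]

lemma expTwoPi_eq_one_iff (t : ℝ) : expTwoPi t = 1 ↔ ∃ k : ℤ, t = k := by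
  constructor
  · intro h
    rw [expTwoPi, Complex.exp_eq_one_iff] at h
    obtain ⟨k, hk⟩ := h
    refine ⟨k, ?_⟩
    have h2 : (2 * Real.pi * Complex.I : ℂ) ≠ 0 := by simp [Real.pi_ne_zero]
    have : (2 * Real.pi * Complex.I : ℂ) * t = 2 * Real.pi * Complex.I * k := by rw [hk]; ring
    exact_mod_cast mul_left_cancel₀ h2 this
  · rintro ⟨k, rfl⟩; exact expTwoPi_int k

lemma expTwoPi_nsmul (n : ℕ) (t : ℝ) : expTwoPi (n * t) = expTwoPi t ^ n := by
  rw [expTwoPi, expTwoPi, ← Complex.exp_nat_mul]; congr 1; push_cast; ring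

lemma star_expTwoPi (t : ℝ) : (starRingEnd ℂ) (expTwoPi t) = expTwoPi (-t) := by
  rw [expTwoPi, expTwoPi, ← Complex.exp_conj]; congr 1; simp [Complex.conj_ofNat]

/-- Orthogonality of the additive characters modulo `q`. -/
lemma sum_expTwoPi_div (q : ℕ) (hq : 0 < q) (k : ℤ) :
    ∑ b ∈ Icc 1 q, expTwoPi ((b : ℝ) * (k / q)) = if (q : ℤ) ∣ k then (q : ℂ) else 0 := by
  have hq' : (q : ℝ) ≠ 0 := by positivity
  have h1 : ∀ b : ℕ, expTwoPi ((b : ℝ) * (k / q)) = expTwoPi (k / q) ^ b := fun b =>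
    expTwoPi_nsmul b _
  simp_rw [h1]
  have hz : expTwoPi ((k : ℝ) / q) ^ q = 1 := by
    rw [← expTwoPi_nsmul, mul_div_cancel₀ _ hq', expTwoPi_int]
  split_ifs with h
  · obtain ⟨m, rfl⟩ := h
    have : expTwoPi (((q * m : ℤ) : ℝ) / q) = 1 := by
      push_cast; rw [mul_div_cancel_left₀ _ hq', expTwoPi_int]
    rw [this]; simp
  · have hne : expTwoPi ((k : ℝ) / q) ≠ 1 := by
      intro h1
      obtain ⟨m, hm⟩ := (expTwoPi_eq_one_iff _).1 h1
      apply h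
      refine ⟨m, ?_⟩
      rw [div_eq_iff hq'] at hm
      have : (k : ℝ) = ((q * m : ℤ) : ℝ) := by push_cast; rw [hm]; ring
      exact_mod_cast this
    have h2 := geom_sum_eq hne q
    rw [hz, sub_self, zero_div] at h2
    have h3 : ∑ b ∈ Icc 1 q, expTwoPi ((k : ℝ) / q) ^ b
        = expTwoPi ((k : ℝ) / q) * ∑ b ∈ range q, expTwoPi ((k : ℝ) / q) ^ b := by
      rw [mul_sum, show Icc 1 q = Ico 1 (q + 1) from rfl, Finset.sum_Ico_eq_sum_range]
      simp [pow_add]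
    rw [h3, h2, mul_zero]

/-- The complex Ramanujan sum. -/
noncomputable def ramC (r : ℕ) (a : ℤ) : ℂ :=
  ∑ b ∈ (Icc 1 r).filter (fun b => Nat.gcd b r = 1), expTwoPi ((b : ℝ) * (a / r))

/-- Grouping the residues `b` modulo `q` according to the reduced fraction `b / q`. -/
lemma sum_Icc_eq_sum_divisors_coprime {α : Type*} [AddCommMonoid α] (q : ℕ) (hq : 0 < q)
    (H : ℕ → ℕ → α) :
    ∑ b ∈ Icc 1 q, H (q / Nat.gcd b q) (b / Nat.gcd b q)
      = ∑ r ∈ q.divisors, ∑ b ∈ (Icc 1 r).filter (fun b => Nat.gcd b r = 1), H r b := by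
  rw [Finset.sum_sigma']
  refine Finset.sum_bij' (fun b _ => (⟨q / Nat.gcd b q, b / Nat.gcd b q⟩ : Σ _ : ℕ, ℕ))
    (fun p _ => p.2 * (q / p.1)) ?_ ?_ ?_ ?_ ?_
  · intro b hb
    simp only [mem_Icc] at hb
    have hg : 0 < Nat.gcd b q := Nat.gcd_pos_of_pos_right _ hq
    have hgb := Nat.gcd_dvd_left b q
    have hgq := Nat.gcd_dvd_right b q
    simp only [mem_sigma, Nat.mem_divisors, mem_filter, mem_Icc]
    refine ⟨⟨Nat.div_dvd_of_dvd hgq, hq.ne'⟩, ⟨?_, ?_⟩, ?_⟩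
    · exact Nat.div_pos (Nat.le_of_dvd hb.1 hgb) hg
    · exact Nat.div_le_div_right hb.2
    · exact Nat.coprime_div_gcd_div_gcd hg
  · rintro ⟨r, b⟩ hp
    simp only [mem_sigma, Nat.mem_divisors, mem_filter, mem_Icc] at hp
    obtain ⟨⟨hrq, -⟩, ⟨h1, h2⟩, h3⟩ := hp
    obtain ⟨m, rfl⟩ := hrq
    have hr : 0 < r := Nat.pos_of_mul_pos_right hq |> fun _ => by
      rcases Nat.eq_zero_or_pos r with h | h
      · simp [h] at hq
      · exact h
    have hm : 0 < m := by
      rcases Nat.eq_zero_or_pos m with h | h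
      · simp [h] at hq
      · exact h
    simp only [mem_Icc, Nat.mul_div_cancel_left m hr]
    exact ⟨Nat.mul_pos h1 hm, Nat.mul_le_mul_right m h2⟩
  · intro b hb
    have hg : 0 < Nat.gcd b q := Nat.gcd_pos_of_pos_right _ hq
    have hgb := Nat.gcd_dvd_left b q
    have hgq := Nat.gcd_dvd_right b q
    simp only
    rw [Nat.div_div_self hgq hq.ne', Nat.div_mul_cancel hgb]
  · rintro ⟨r, b⟩ hp
    simp only [mem_sigma, Nat.mem_divisors, mem_filter, mem_Icc] at hp
    obtain ⟨⟨hrq, -⟩, ⟨h1, h2⟩, h3⟩ := hp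
    obtain ⟨m, rfl⟩ := hrq
    have hr : 0 < r := by
      rcases Nat.eq_zero_or_pos r with h | h
      · simp [h] at hq
      · exact h
    have hm : 0 < m := by
      rcases Nat.eq_zero_or_pos m with h | h
      · simp [h] at hq
      · exact h
    have hg : Nat.gcd (b * m) (r * m) = m := by rw [Nat.gcd_mul_right, h3, one_mul]
    simp only [Nat.mul_div_cancel_left m hr, hg, Nat.mul_div_cancel _ hm]
  · intro b hb; rfl

lemma sum_divisors_ramC (g : ℕ) (hg : 0 < g) (a : ℤ) :
    ∑ r ∈ g.divisors, ramC r a = if (g : ℤ) ∣ a then (g : ℂ) else 0 := by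
  rw [← sum_expTwoPi_div g hg a]
  simp only [ramC]
  rw [← sum_Icc_eq_sum_divisors_coprime g hg (fun r b => expTwoPi ((b : ℝ) * (a / r)))]
  refine Finset.sum_congr rfl fun b hb => ?_
  have hgp : 0 < Nat.gcd b g := Nat.gcd_pos_of_pos_right _ hg
  have hgp' : (Nat.gcd b g : ℝ) ≠ 0 := by positivity
  have hg' : (g : ℝ) ≠ 0 := by positivity
  rw [Nat.cast_div (Nat.gcd_dvd_left b g) hgp', Nat.cast_div (Nat.gcd_dvd_right b g) hgp']
  congr 1; field_simp

/-- Möbius inversion for Ramanujan sums. -/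
lemma ramC_eq_sum_moebius (r : ℕ) (hr : 0 < r) (a : ℤ) :
    ramC r a = ∑ p ∈ r.divisorsAntidiagonal,
      (ArithmeticFunction.moebius p.1 : ℂ) * (if (p.2 : ℤ) ∣ a then (p.2 : ℂ) else 0) := by
  have := (ArithmeticFunction.sum_eq_iff_sum_mul_moebius_eq (R := ℂ) (f := fun r => ramC r a)
    (g := fun g => if (g : ℤ) ∣ a then (g : ℂ) else 0)).1 (fun n hn => sum_divisors_ramC n hn a) r
        hr
  exact this.symm

lemma ofReal_ramanujanSum (r : ℕ) (hr : 0 < r) (a : ℕ) : (ramanujanSum r a : ℂ) = ramC r a := by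
  have h1 : ramanujanSum r a = (ramC r a).re := by
    simp only [ramanujanSum, ramC, expTwoPi]
    congr 1
    refine Finset.sum_congr rfl fun b _ => ?_
    congr 1; push_cast; ring
  rw [h1]
  have h2 : ramC r a = ((∑ p ∈ r.divisorsAntidiagonal, (ArithmeticFunction.moebius p.1 : ℝ) *
      (if (p.2 : ℤ) ∣ (a : ℤ) then (p.2 : ℝ) else 0) : ℝ) : ℂ) := by
    rw [ramC_eq_sum_moebius r hr a]; push_cast
    refine Finset.sum_congr rfl fun p _ => ?_
    split_ifs <;> simp
  rw [h2, Complex.ofReal_re]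

lemma ramanujanSum_eq_sum_moebius (r : ℕ) (hr : 0 < r) (a : ℕ) :
    ramanujanSum r a = ∑ p ∈ r.divisorsAntidiagonal,
      (ArithmeticFunction.moebius p.1 : ℝ) * (if p.2 ∣ a then (p.2 : ℝ) else 0) := by
  have h := ofReal_ramanujanSum r hr a
  rw [ramC_eq_sum_moebius r hr a] at h
  have h2 : ((ramanujanSum r a : ℝ) : ℂ) = ((∑ p ∈ r.divisorsAntidiagonal,
      (ArithmeticFunction.moebius p.1 : ℝ) * (if p.2 ∣ a then (p.2 : ℝ) else 0) : ℝ) : ℂ) := by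
    rw [h]; push_cast
    refine Finset.sum_congr rfl fun p _ => ?_
    simp only [Int.natCast_dvd_natCast]
    split_ifs <;> simp
  exact_mod_cast h2

lemma sum_divisors_ramanujanSum (g : ℕ) (hg : 0 < g) (a : ℕ) :
    ∑ r ∈ g.divisors, ramanujanSum r a = if g ∣ a then (g : ℝ) else 0 := by
  have h := sum_divisors_ramC g hg a
  have h2 : ((∑ r ∈ g.divisors, ramanujanSum r a : ℝ) : ℂ) =
      ((if g ∣ a then (g : ℝ) else 0 : ℝ) : ℂ) := by
    push_cast
    rw [Finset.sum_congr rfl fun r hr => ofReal_ramanujanSum r (Nat.pos_of_mem_divisors hr) a, h]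
    simp only [Int.natCast_dvd_natCast]
    split_ifs <;> simp
  exact_mod_cast h2

lemma card_coprime_filter (r : ℕ) :
    ((Icc 1 r).filter (fun b => Nat.gcd b r = 1)).card = Nat.totient r := by
  rw [Nat.totient_eq_card_coprime]
  rcases Nat.eq_zero_or_pos r with rfl | hr
  · simp
  rcases Nat.lt_or_ge 1 r with h1 | h1
  · congr 1
    ext b
    simp only [mem_filter, mem_Icc, mem_range, Nat.coprime_comm (n := r), Nat.Coprime]
    constructor
    · rintro ⟨⟨h2, h3⟩, h4⟩
      refine ⟨lt_of_le_of_ne h3 ?_, h4⟩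
      rintro rfl; simp at h4; omega
    · rintro ⟨h2, h4⟩
      refine ⟨⟨?_, h2.le⟩, h4⟩
      rcases Nat.eq_zero_or_pos b with rfl | h
      · simp at h4; omega
      · exact h
  · have : r = 1 := by omega
    subst this; simp

lemma abs_ramanujanSum_le (r a : ℕ) : |ramanujanSum r a| ≤ Nat.totient r := by
  rw [ramanujanSum, ← card_coprime_filter r]
  refine (Complex.abs_re_le_norm _).trans ((norm_sum_le _ _).trans ?_)
  rw [Finset.card_eq_sum_ones]; push_cast
  refine Finset.sum_le_sum fun b _ => ?_
  have := norm_expTwoPi ((b : ℝ) * (a / r))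
  rw [expTwoPi] at this
  rw [← this]
  apply le_of_eq
  congr 2; push_cast; ring

lemma ramanujanSum_congr (r : ℕ) (hr : 0 < r) {a b : ℕ} (h : a ≡ b [MOD r]) :
    ramanujanSum r a = ramanujanSum r b := by
  rw [ramanujanSum_eq_sum_moebius r hr, ramanujanSum_eq_sum_moebius r hr]
  refine Finset.sum_congr rfl fun p hp => ?_
  have hp2 : p.2 ∣ r := Nat.dvd_of_mem_divisors (Nat.snd_mem_divisors_of_mem_antidiagonal hp)
  have : p.2 ∣ a ↔ p.2 ∣ b := (h.of_dvd hp2).dvd_iff (dvd_refl _)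
  simp only [this]

/-- The real harmonic numbers. -/
noncomputable def harmonicReal (n : ℕ) : ℝ := ∑ j ∈ Icc 1 n, 1 / (j : ℝ)

lemma harmonicReal_eq (n : ℕ) : harmonicReal n = (harmonic n : ℝ) := by
  rw [harmonicReal, harmonic_eq_sum_Icc]; push_cast; simp [one_div]

lemma abs_harmonicReal_sub_le {s : ℝ} (hs : 1 ≤ s) :
    |harmonicReal ⌊s⌋₊ - Real.log s - Real.eulerMascheroniConstant| ≤ 1 / ⌊s⌋₊ := by
  set n := ⌊s⌋₊ with hn
  have hn1 : 1 ≤ n := (Nat.one_le_floor_iff s).2 hs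
  have hns : (n : ℝ) ≤ s := Nat.floor_le (by linarith)
  have hsn : s < n + 1 := Nat.lt_floor_add_one s
  have hn0 : (0 : ℝ) < n := by exact_mod_cast hn1
  have h1 := Real.eulerMascheroniSeq_lt_eulerMascheroniConstant n
  have h2 := Real.eulerMascheroniConstant_lt_eulerMascheroniSeq' n
  rw [Real.eulerMascheroniSeq, ← harmonicReal_eq] at h1
  rw [Real.eulerMascheroniSeq', if_neg (by omega), ← harmonicReal_eq] at h2
  have h3 : Real.log n ≤ Real.log s := Real.log_le_log hn0 hns
  have h4 : Real.log s ≤ Real.log (n + 1) := Real.log_le_log (by linarith) hsn.le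
  have h5 : Real.log (n + 1) - Real.log n ≤ 1 / n := by
    rw [← Real.log_div (by positivity) (by positivity)]
    have := Real.log_le_sub_one_of_pos (show (0 : ℝ) < (n + 1) / n by positivity)
    have h6 : ((n : ℝ) + 1) / n - 1 = 1 / n := by field_simp; ring
    linarith
  rw [abs_le]; constructor <;> linarith

lemma eulerMascheroni_bounds : 0 < Real.eulerMascheroniConstant ∧
    Real.eulerMascheroniConstant < 1 :=
  ⟨by linarith [Real.one_half_lt_eulerMascheroniConstant],
    by linarith [Real.eulerMascheroniConstant_lt_two_thirds]⟩

lemma abs_mul_harmonicReal_sub_le {s : ℝ} (hs : 0 < s) :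
    |s * (harmonicReal ⌊s⌋₊ - Real.log s - Real.eulerMascheroniConstant)| ≤ 2 := by
  rcases le_or_gt 1 s with h | h
  · have hn1 : 1 ≤ ⌊s⌋₊ := (Nat.one_le_floor_iff s).2 h
    have hsn : s < ⌊s⌋₊ + 1 := Nat.lt_floor_add_one s
    have hn0 : (1 : ℝ) ≤ ⌊s⌋₊ := by exact_mod_cast hn1
    rw [abs_mul, abs_of_pos hs]
    calc s * _ ≤ s * (1 / ⌊s⌋₊) := by gcongr; exact abs_harmonicReal_sub_le h
      _ ≤ 2 := by rw [mul_one_div, div_le_iff₀ (by linarith)]; linarith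
  · have h0 : ⌊s⌋₊ = 0 := Nat.floor_eq_zero.2 h
    have hlog := Real.abs_log_mul_self_lt s hs h.le
    have hg := eulerMascheroni_bounds
    have : harmonicReal 0 = 0 := by simp [harmonicReal]
    rw [h0, this, show s * (0 - Real.log s - Real.eulerMascheroniConstant)
      = -(Real.log s * s) - s * Real.eulerMascheroniConstant by ring]
    rw [abs_lt] at hlog
    have h5 : s * Real.eulerMascheroniConstant ≤ 1 := by nlinarith
    have h6 : 0 ≤ s * Real.eulerMascheroniConstant := by nlinarith
    rw [abs_le]; constructor <;> linarith

/-- The Dirichlet hyperbola method for a symmetric summand. -/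
lemma sum_divisorsAntidiagonal_hyperbola (f : ℕ → ℕ → ℝ) (hf : ∀ u v, f u v = f v u) (N : ℕ) :
    ∑ n ∈ Icc 1 N, ∑ p ∈ n.divisorsAntidiagonal, f p.1 p.2
      = 2 * (∑ u ∈ Icc 1 (Nat.sqrt N), ∑ v ∈ Icc 1 (N / u), f u v)
        - ∑ u ∈ Icc 1 (Nat.sqrt N), ∑ v ∈ Icc 1 (Nat.sqrt N), f u v := by
  set Y := Nat.sqrt N
  have hY1 : Y * Y ≤ N := Nat.sqrt_le N
  have hY2 : N < (Y + 1) * (Y + 1) := Nat.lt_succ_sqrt N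
  set S := ((Icc 1 N) ×ˢ (Icc 1 N)).filter (fun p : ℕ × ℕ => p.1 * p.2 ≤ N) with hS
  have hmemS : ∀ p : ℕ × ℕ, p ∈ S ↔ 1 ≤ p.1 ∧ 1 ≤ p.2 ∧ p.1 * p.2 ≤ N := by
    intro p
    simp only [hS, mem_filter, mem_product, mem_Icc]
    constructor
    · rintro ⟨⟨⟨h1, h2⟩, h3, h4⟩, h5⟩; exact ⟨h1, h3, h5⟩
    · rintro ⟨h1, h3, h5⟩
      exact ⟨⟨⟨h1, by nlinarith⟩, h3, by nlinarith⟩, h5⟩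
  have e1 : ∑ n ∈ Icc 1 N, ∑ p ∈ n.divisorsAntidiagonal, f p.1 p.2 = ∑ p ∈ S, f p.1 p.2 := by
    rw [Finset.sum_sigma']
    refine Finset.sum_nbij' (fun x : Σ _ : ℕ, ℕ × ℕ => x.2) (fun p => ⟨p.1 * p.2, p⟩) ?_ ?_ ?_ ?_ ?_
    · rintro ⟨n, p⟩ h
      simp only [mem_sigma, mem_Icc, Nat.mem_divisorsAntidiagonal] at h
      rw [hmemS]
      obtain ⟨⟨h1, h2⟩, h3, h4⟩ := h
      refine ⟨Nat.pos_of_ne_zero ?_, Nat.pos_of_ne_zero ?_, by simpa [h3] using h2⟩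
      · intro h0; rw [h0, Nat.zero_mul] at h3; omega
      · intro h0; rw [h0, Nat.mul_zero] at h3; omega
    · rintro p h
      rw [hmemS] at h
      simp only [mem_sigma, mem_Icc, Nat.mem_divisorsAntidiagonal]
      have : 0 < p.1 * p.2 := Nat.mul_pos h.1 h.2.1
      exact ⟨⟨this, h.2.2⟩, by trivial, this.ne'⟩
    · rintro ⟨n, p⟩ h
      simp only [mem_sigma, mem_Icc, Nat.mem_divisorsAntidiagonal] at h
      simp [h.2.1]
    · rintro p h; rfl
    · rintro ⟨n, p⟩ h; rfl
  have e2 : ∑ u ∈ Icc 1 Y, ∑ v ∈ Icc 1 (N / u), f u v = ∑ p ∈ S.filter (fun p => p.1 ≤ Y),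
      f p.1 p.2 := by
    rw [Finset.sum_sigma']
    refine Finset.sum_nbij' (fun x : Σ _ : ℕ, ℕ => (x.1, x.2)) (fun p => ⟨p.1, p.2⟩) ?_ ?_ ?_ ?_ ?_
    · rintro ⟨u, v⟩ h
      simp only [mem_sigma, mem_Icc] at h
      rw [mem_filter, hmemS]
      obtain ⟨⟨h1, h2⟩, h3, h4⟩ := h
      refine ⟨⟨h1, h3, ?_⟩, h2⟩
      rw [mul_comm]; exact (Nat.le_div_iff_mul_le h1).1 h4
    · rintro p h
      rw [mem_filter, hmemS] at h
      simp only [mem_sigma, mem_Icc]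
      refine ⟨⟨h.1.1, h.2⟩, h.1.2.1, ?_⟩
      rw [Nat.le_div_iff_mul_le h.1.1, mul_comm]; exact h.1.2.2
    all_goals rintro _ _; rfl
  have e3 : ∑ p ∈ S.filter (fun p => p.1 ≤ Y), f p.1 p.2 = ∑ p ∈ S.filter (fun p => p.2 ≤ Y),
      f p.1 p.2 := by
    refine Finset.sum_nbij' Prod.swap Prod.swap ?_ ?_ ?_ ?_ ?_
    · rintro p h
      rw [mem_filter, hmemS] at h ⊢
      simp only [Prod.fst_swap, Prod.snd_swap]
      exact ⟨⟨h.1.2.1, h.1.1, by rw [mul_comm]; exact h.1.2.2⟩, h.2⟩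
    · rintro p h
      rw [mem_filter, hmemS] at h ⊢
      simp only [Prod.fst_swap, Prod.snd_swap]
      exact ⟨⟨h.1.2.1, h.1.1, by rw [mul_comm]; exact h.1.2.2⟩, h.2⟩
    · rintro p _; simp
    · rintro p _; simp
    · rintro p _; exact hf _ _
  have e4 : ∑ u ∈ Icc 1 Y, ∑ v ∈ Icc 1 Y, f u v
      = ∑ p ∈ S.filter (fun p => p.1 ≤ Y) ∩ S.filter (fun p => p.2 ≤ Y), f p.1 p.2 := by
    rw [← Finset.sum_product']
    refine Finset.sum_congr ?_ (fun _ _ => rfl)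
    ext p
    simp only [mem_inter, mem_filter, hmemS, mem_product, mem_Icc]
    constructor
    · rintro ⟨⟨h1, h2⟩, h3, h4⟩
      have : p.1 * p.2 ≤ N := (Nat.mul_le_mul h2 h4).trans hY1
      exact ⟨⟨⟨h1, h3, this⟩, h2⟩, ⟨h1, h3, this⟩, h4⟩
    · rintro ⟨⟨⟨h1, h3, this⟩, h2⟩, _, h4⟩; exact ⟨⟨h1, h2⟩, h3, h4⟩
  have e5 : S.filter (fun p => p.1 ≤ Y) ∪ S.filter (fun p => p.2 ≤ Y) = S := by
    ext p
    simp only [mem_union, mem_filter, hmemS]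
    constructor
    · rintro (h | h) <;> exact h.1
    · intro h
      by_cases h1 : p.1 ≤ Y
      · exact Or.inl ⟨h, h1⟩
      · refine Or.inr ⟨h, ?_⟩
        by_contra h2
        push Not at h1 h2
        have : (Y + 1) * (Y + 1) ≤ p.1 * p.2 := Nat.mul_le_mul h1 h2
        omega
  have e6 := Finset.sum_union_inter (s₁ := S.filter (fun p => p.1 ≤ Y))
    (s₂ := S.filter (fun p => p.2 ≤ Y)) (f := fun p => f p.1 p.2)
  rw [e5, ← e4, ← e3, ← e2] at e6
  rw [e1]; linarith

/-- Counting integers in a residue class. -/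
lemma abs_card_modEq_sub_le (N m v : ℕ) (hm : 0 < m) :
    |(((Icc 1 N).filter (fun n => n ≡ v [MOD m])).card : ℝ) - N / m| ≤ 1 := by
  have h := Nat.Ioc_filter_modEq_card 0 N hm v
  have hm' : (0 : ℚ) < m := by exact_mod_cast hm
  have e : (Icc 1 N).filter (fun n => n ≡ v [MOD m]) =
      (Ioc 0 N).filter (fun n => n ≡ v [MOD m]) := by
    ext; simp only [mem_filter, mem_Icc, mem_Ioc]; rfl
  have h1 : ((((Icc 1 N).filter (fun n => n ≡ v [MOD m])).card : ℤ) : ℚ)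
      = ((⌊((N : ℚ) - v) / m⌋ - ⌊((0 : ℕ) - v : ℚ) / m⌋ : ℤ) : ℚ) := by
    rw [e]
    have h2 : ⌊((0 : ℕ) - v : ℚ) / m⌋ ≤ ⌊((N : ℚ) - v) / m⌋ := by
      apply Int.floor_le_floor; gcongr; simp
    have h3 : (((Ioc 0 N).filter (fun n => n ≡ v [MOD m])).card : ℤ)
      = (⌊((N : ℚ) - v) / m⌋ - ⌊((0 : ℕ) - v : ℚ) / m⌋ : ℤ) := by
      convert h using 1
      · rw [max_eq_left (by linarith)]
    exact_mod_cast h3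
  have a1 := Int.floor_le (((N : ℚ) - v) / m)
  have a2 := Int.lt_floor_add_one (((N : ℚ) - v) / m)
  have a3 := Int.floor_le (((0 : ℕ) - v : ℚ) / m)
  have a4 := Int.lt_floor_add_one (((0 : ℕ) - v : ℚ) / m)
  have a5 : ((N : ℚ) - v) / m - ((0 : ℕ) - v : ℚ) / m = N / m := by field_simp; simp
  have h6 : |((((Icc 1 N).filter (fun n => n ≡ v [MOD m])).card : ℤ) : ℚ) - N / m| ≤ 1 := by
    rw [h1]; push_cast at *
    rw [abs_le]; constructor <;> linarith
  have h7 : ((|((((Icc 1 N).filter (fun n => n ≡ v [MOD m])).card : ℤ) : ℚ) - N / m| : ℚ) : ℝ) ≤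
      1 := by
    exact_mod_cast h6
  push_cast at h7
  exact h7

/-- `F_r(t) = t (log (t / r²) + 2γ - 1)`. -/
noncomputable def mainF (r : ℕ) (t : ℝ) : ℝ :=
  t * (Real.log (t / r ^ 2) + 2 * Real.eulerMascheroniConstant - 1)

/-- The divisor-counting function, real valued. -/
noncomputable def divCount (n : ℕ) : ℝ := (n.divisors.card : ℝ)

lemma Mdiv_eq (x : ℝ) (q a : ℕ) :
    Mdiv x q a = 1 / q * ∑ r ∈ q.divisors, ramanujanSum r a / r * mainF r x := by
  simp only [Mdiv, mainF, Finset.mul_sum]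
  refine Finset.sum_congr rfl fun r _ => ?_
  ring

lemma sum_filter_dvd_Icc {α : Type*} [AddCommMonoid α] (g : ℕ → α) (r N : ℕ) (hr : 0 < r) :
    ∑ u ∈ (Icc 1 N).filter (fun u => r ∣ u), g u = ∑ m ∈ Icc 1 (N / r), g (r * m) := by
  symm
  refine Finset.sum_nbij' (fun m => r * m) (fun u => u / r) ?_ ?_ ?_ ?_ ?_
  · intro m hm
    simp only [mem_Icc, mem_filter] at hm ⊢
    refine ⟨⟨Nat.mul_pos hr hm.1, ?_⟩, dvd_mul_right _ _⟩
    rw [mul_comm]; exact (Nat.le_div_iff_mul_le hr).1 hm.2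
  · intro u hu
    simp only [mem_Icc, mem_filter] at hu ⊢
    exact ⟨Nat.div_pos (Nat.le_of_dvd hu.1.1 hu.2) hr, Nat.div_le_div_right hu.1.2⟩
  · intro m hm; simp [Nat.mul_div_cancel_left m hr]
  · intro u hu
    simp only [mem_filter] at hu
    exact Nat.mul_div_cancel' hu.2
  · intro m hm; rfl

/-- Counting solutions `v ≤ z` of `u v ≡ a (mod q)`. -/
lemma abs_card_mul_modEq_sub_le (q u a z : ℕ) (hq : 0 < q) :
    |(((Icc 1 z).filter (fun v => u * v % q = a % q)).card : ℝ)
      - z / q * (if Nat.gcd q u ∣ a then (Nat.gcd q u : ℝ) else 0)| ≤ 1 := by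
  set g := Nat.gcd q u with hg
  have hgpos : 0 < g := Nat.gcd_pos_of_pos_left _ hq
  have hgq : g ∣ q := Nat.gcd_dvd_left q u
  have hgu : g ∣ u := Nat.gcd_dvd_right q u
  split_ifs with h
  · obtain ⟨v0, hv0⟩ : ∃ v0 : ℕ, u * v0 ≡ a [MOD q] := by
      obtain ⟨k, hk⟩ := h
      have hb := Nat.gcd_eq_gcd_ab q u
      refine ⟨((Nat.gcdB q u * k) % q).toNat, ?_⟩
      rw [← Int.natCast_modEq_iff]
      push_cast
      rw [Int.toNat_of_nonneg (Int.emod_nonneg _ (by exact_mod_cast hq.ne'))]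
      have h1 : (Nat.gcdB q u * k) % q ≡ Nat.gcdB q u * k [ZMOD q] := Int.mod_modEq _ _
      refine (h1.mul_left (u : ℤ)).trans ?_
      rw [hk, Int.modEq_iff_dvd]
      refine ⟨Nat.gcdA q u * k, ?_⟩
      push_cast
      rw [hg, hb]; ring
    have hset : (Icc 1 z).filter (fun v => u * v % q = a % q)
        = (Icc 1 z).filter (fun v => v ≡ v0 [MOD (q / g)]) := by
      refine Finset.filter_congr fun v _ => ?_
      constructor
      · intro hv
        have : u * v ≡ u * v0 [MOD q] := (show u * v ≡ a [MOD q] from hv).trans hv0.symm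
        exact Nat.ModEq.cancel_left_div_gcd hq this
      · intro hv
        have h1 : u * v ≡ u * v0 [MOD u * (q / g)] := Nat.ModEq.mul_left' u hv
        have h2 : q ∣ u * (q / g) := by
          obtain ⟨u', hu'⟩ := hgu
          rw [hu', mul_comm g, mul_assoc, Nat.mul_div_cancel' hgq]; exact dvd_mul_left _ _
        exact (h1.of_dvd h2).trans hv0
    rw [hset]
    have := abs_card_modEq_sub_le z (q / g) v0 (Nat.div_pos (Nat.le_of_dvd hq hgq) hgpos)
    have hgr : (g : ℝ) ≠ 0 := by positivity
    rw [Nat.cast_div hgq hgr] at this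
    convert this using 3
    field_simp
  · have hempty : (Icc 1 z).filter (fun v => u * v % q = a % q) = ∅ := by
      refine Finset.filter_false_of_mem fun v _ hv => h ?_
      have h1 : u * v ≡ a [MOD q] := hv
      exact ((h1.of_dvd hgq).dvd_iff (dvd_refl g)).1 (hgu.mul_right v)
    rw [hempty]; simp

/-- The sum over multiples of `r` occurring in the hyperbola method. -/
lemma abs_sum_multiples_sub_le (r : ℕ) (hr : 0 < r) {t : ℝ} (ht : 0 < t) :
    |∑ u ∈ (Icc 1 ⌊√t⌋₊).filter (fun u => r ∣ u), (2 * t / u - √t) - mainF r t / r| ≤ 5 * √t := by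
  have hr' : (0 : ℝ) < r := by exact_mod_cast hr
  set Y := √t with hY
  have hYp : 0 < Y := Real.sqrt_pos.2 ht
  have hYt : Y ^ 2 = t := Real.sq_sqrt ht.le
  set s := Y / r with hs
  have hsp : 0 < s := by positivity
  have hfl : ⌊Y⌋₊ / r = ⌊s⌋₊ := by rw [hs, Nat.floor_div_natCast]
  rw [sum_filter_dvd_Icc _ _ _ hr, hfl]
  have h1 : ∑ m ∈ Icc 1 ⌊s⌋₊, (2 * t / ((r * m : ℕ) : ℝ) - Y)
      = Y * (2 * s * harmonicReal ⌊s⌋₊ - ⌊s⌋₊) := by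
    rw [Finset.sum_sub_distrib, harmonicReal, Finset.mul_sum, mul_sub, Finset.mul_sum]
    congr 1
    · refine Finset.sum_congr rfl fun m hm => ?_
      have : (m : ℝ) ≠ 0 := by
        have := (mem_Icc.1 hm).1; positivity
      push_cast
      rw [hs, ← hYt]; field_simp
    · simp [mul_comm]
  have h2 : mainF r t / r = Y * (s * (2 * Real.log s + 2 * Real.eulerMascheroniConstant - 1)) := by
    have : Real.log (t / r ^ 2) = 2 * Real.log s := by
      rw [← hYt, ← div_pow, Real.log_pow, ← hs]; norm_num
    rw [mainF, this, hs, ← hYt]; field_simp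
  have h3 := abs_mul_harmonicReal_sub_le hsp
  have h4 : (⌊s⌋₊ : ℝ) ≤ s := Nat.floor_le hsp.le
  have h5 := Nat.lt_floor_add_one s
  rw [h1, h2]
  have h6 : Y * (2 * s * harmonicReal ⌊s⌋₊ - ⌊s⌋₊)
      - Y * (s * (2 * Real.log s + 2 * Real.eulerMascheroniConstant - 1))
      = Y * (2 * (s * (harmonicReal ⌊s⌋₊ - Real.log s - Real.eulerMascheroniConstant)) +
          (s - ⌊s⌋₊)) := by
    ring
  rw [h6, abs_mul, abs_of_pos hYp, mul_comm 5]
  gcongr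
  rw [abs_le] at h3 ⊢
  constructor <;> linarith

lemma natSqrt_floor {t : ℝ} (ht : 0 ≤ t) : Nat.sqrt ⌊t⌋₊ = ⌊√t⌋₊ := by
  symm
  rw [Nat.floor_eq_iff (Real.sqrt_nonneg t)]
  constructor
  · apply Real.le_sqrt_of_sq_le
    have h1 : (((Nat.sqrt ⌊t⌋₊) ^ 2 : ℕ) : ℝ) ≤ (⌊t⌋₊ : ℝ) := by exact_mod_cast Nat.sqrt_le' _
    push_cast at h1
    exact h1.trans (Nat.floor_le ht)
  · rw [Real.sqrt_lt' (by positivity)]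
    have h1 : ⌊t⌋₊ + 1 ≤ (Nat.sqrt ⌊t⌋₊ + 1) ^ 2 := Nat.lt_succ_sqrt' _
    have h2 : ((⌊t⌋₊ : ℝ) + 1) ≤ ((Nat.sqrt ⌊t⌋₊ : ℝ) + 1) ^ 2 := by exact_mod_cast h1
    exact (Nat.lt_floor_add_one t).trans_le h2

lemma divisors_gcd_eq_filter (q u : ℕ) (hq : 0 < q) :
    (Nat.gcd q u).divisors = q.divisors.filter (fun r => r ∣ u) := by
  ext r
  simp only [Nat.mem_divisors, mem_filter, Nat.dvd_gcd_iff]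
  have : Nat.gcd q u ≠ 0 := (Nat.gcd_pos_of_pos_left _ hq).ne'
  have := hq.ne'
  tauto

/-- The divisor function in residue classes, uniformly in the modulus. -/
lemma abs_Adiv_sub_Mdiv_le (t : ℝ) (ht : 0 < t) (q a : ℕ) (hq : 0 < q) :
    |Adiv t q a - Mdiv t q a| ≤ 11 * √t := by
  have hq' : (0 : ℝ) < q := by exact_mod_cast hq
  set N := ⌊t⌋₊ with hN
  set Y := √t with hYdef
  have hY0 : 0 ≤ Y := Real.sqrt_nonneg t
  have hYN : Nat.sqrt N = ⌊Y⌋₊ := by rw [hN, hYdef, natSqrt_floor ht.le]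
  set f : ℕ → ℕ → ℝ := fun u v => if u * v % q = a % q then 1 else 0 with hf
  set ρ : ℕ → ℝ := fun u => if Nat.gcd q u ∣ a then (Nat.gcd q u : ℝ) else 0 with hρ
  have hρq : ∀ u, 0 ≤ ρ u ∧ ρ u ≤ q := by
    intro u
    simp only [hρ]
    split_ifs
    · exact ⟨by positivity, by exact_mod_cast Nat.le_of_dvd hq (Nat.gcd_dvd_left q u)⟩
    · exact ⟨le_rfl, hq'.le⟩
  have hA : Adiv t q a = ∑ n ∈ Icc 1 N, ∑ p ∈ n.divisorsAntidiagonal, f p.1 p.2 := by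
    rw [Adiv, Finset.sum_filter]
    refine Finset.sum_congr rfl fun n _ => ?_
    have : ∀ p ∈ n.divisorsAntidiagonal, f p.1 p.2 = if n % q = a % q then 1 else 0 := by
      intro p hp
      rw [Nat.mem_divisorsAntidiagonal] at hp
      simp only [hf, hp.1]
    rw [Finset.sum_congr rfl this]
    have hc : (n.divisorsAntidiagonal.card : ℝ) = n.divisors.card := by
      rw [← Nat.map_div_right_divisors, Finset.card_map]
    split_ifs <;> simp [hc]
  rw [sum_divisorsAntidiagonal_hyperbola f (fun u v => by simp only [hf, mul_comm]), hYN] at hA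
  have hcnt : ∀ u z, |∑ v ∈ Icc 1 z, f u v - z / q * ρ u| ≤ 1 := by
    intro u z
    have := abs_card_mul_modEq_sub_le q u a z hq
    simpa only [hf, hρ, Finset.sum_boole] using this
  have hterm : ∀ u ∈ Icc 1 ⌊Y⌋₊,
      |(2 * ∑ v ∈ Icc 1 (N / u), f u v - ∑ v ∈ Icc 1 ⌊Y⌋₊, f u v) - ρ u / q * (2 * t / u - Y)| ≤
          6 := by
    intro u hu
    have hu1 := (mem_Icc.1 hu).1
    have hu' : (0 : ℝ) < u := by exact_mod_cast hu1
    have c1 := hcnt u (N / u)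
    have c2 := hcnt u ⌊Y⌋₊
    have hρ1 : 0 ≤ ρ u / q ∧ ρ u / q ≤ 1 := by
      refine ⟨div_nonneg (hρq u).1 hq'.le, ?_⟩
      rw [div_le_one hq']; exact (hρq u).2
    have d1 : |((N / u : ℕ) : ℝ) - t / u| ≤ 1 := by
      rw [hN, ← Nat.floor_div_natCast]
      have e1 := Nat.floor_le (show 0 ≤ t / u by positivity)
      have e2 := Nat.lt_floor_add_one (t / u)
      rw [abs_le]; constructor <;> linarith
    have d2 : |((⌊Y⌋₊ : ℕ) : ℝ) - Y| ≤ 1 := by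
      have e1 := Nat.floor_le hY0
      have e2 := Nat.lt_floor_add_one Y
      rw [abs_le]; constructor <;> linarith
    have key : (2 * ∑ v ∈ Icc 1 (N / u), f u v - ∑ v ∈ Icc 1 ⌊Y⌋₊, f u v) - ρ u / q *
        (2 * t / u - Y)
      = 2 * (∑ v ∈ Icc 1 (N / u), f u v - ((N / u : ℕ) : ℝ) / q * ρ u)
        - (∑ v ∈ Icc 1 ⌊Y⌋₊, f u v - (⌊Y⌋₊ : ℝ) / q * ρ u)
        + ρ u / q * (2 * (((N / u : ℕ) : ℝ) - t / u) - ((⌊Y⌋₊ : ℝ) - Y)) := by ring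
    have d3 : |ρ u / q * (2 * (((N / u : ℕ) : ℝ) - t / u) - ((⌊Y⌋₊ : ℝ) - Y))| ≤ 3 := by
      rw [abs_mul, abs_of_nonneg hρ1.1]
      have : |2 * (((N / u : ℕ) : ℝ) - t / u) - ((⌊Y⌋₊ : ℝ) - Y)| ≤ 3 := by
        rw [abs_le] at d1 d2 ⊢; constructor <;> linarith
      calc _ ≤ 1 * (3 : ℝ) := by gcongr; exact hρ1.2
        _ = 3 := one_mul _
    rw [key]
    rw [abs_le] at c1 c2 d3 ⊢
    constructor <;> linarith
  have hmain : ∑ u ∈ Icc 1 ⌊Y⌋₊, ρ u / q * (2 * t / u - Y)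
      = 1 / q * ∑ r ∈ q.divisors, ramanujanSum r a *
          ∑ u ∈ (Icc 1 ⌊Y⌋₊).filter (fun u => r ∣ u), (2 * t / u - Y) := by
    simp only [Finset.mul_sum, Finset.sum_filter]
    rw [Finset.sum_comm]
    refine Finset.sum_congr rfl fun u hu => ?_
    have h1 : ρ u = ∑ r ∈ q.divisors, if r ∣ u then ramanujanSum r a else 0 := by
      rw [← Finset.sum_filter, ← divisors_gcd_eq_filter q u hq,
        sum_divisors_ramanujanSum _ (Nat.gcd_pos_of_pos_left _ hq)]
    rw [h1, Finset.sum_div, Finset.sum_mul]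
    refine Finset.sum_congr rfl fun r hr => ?_
    split_ifs <;> ring
  have hA2 : |Adiv t q a - ∑ u ∈ Icc 1 ⌊Y⌋₊, ρ u / q * (2 * t / u - Y)| ≤ 6 * Y := by
    rw [hA, Finset.mul_sum, ← Finset.sum_sub_distrib, ← Finset.sum_sub_distrib]
    refine (Finset.abs_sum_le_sum_abs _ _).trans ((Finset.sum_le_sum hterm).trans ?_)
    rw [Finset.sum_const, Nat.card_Icc, nsmul_eq_mul, Nat.add_sub_cancel, mul_comm]
    gcongr; exact Nat.floor_le hY0
  have hM2 : |∑ u ∈ Icc 1 ⌊Y⌋₊, ρ u / q * (2 * t / u - Y) - Mdiv t q a| ≤ 5 * Y := by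
    rw [hmain, Mdiv_eq, ← mul_sub, ← Finset.sum_sub_distrib, abs_mul, abs_of_pos (by positivity)]
    have : ∑ r ∈ q.divisors, (Nat.totient r : ℝ) = q := by exact_mod_cast Nat.sum_totient q
    calc _ ≤ 1 / (q : ℝ) * ∑ r ∈ q.divisors, (Nat.totient r : ℝ) * (5 * Y) := by
          gcongr
          refine (Finset.abs_sum_le_sum_abs _ _).trans (Finset.sum_le_sum fun r hr => ?_)
          have h1 := abs_sum_multiples_sub_le r (Nat.pos_of_mem_divisors hr) ht
          rw [show ∀ S : ℝ, ramanujanSum r a * S - ramanujanSum r a / r * mainF r t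
            = ramanujanSum r a * (S - mainF r t / r) by intro S; ring, abs_mul]
          gcongr
          · exact abs_ramanujanSum_le r a
      _ = 5 * Y := by rw [← Finset.sum_mul, this]; field_simp
  have := abs_sub_le (Adiv t q a) (∑ u ∈ Icc 1 ⌊Y⌋₊, ρ u / q * (2 * t / u - Y)) (Mdiv t q a)
  linarith

/-- Parseval's identity modulo `q`. -/
lemma parseval_mod (q : ℕ) (hq : 0 < q) (c : ℕ → ℂ) :
    ∑ a ∈ Icc 1 q, ‖(1 / q : ℂ) * ∑ b ∈ Icc 1 q, expTwoPi ((a : ℝ) * (b / q)) * c b‖ ^ 2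
      = 1 / q * ∑ b ∈ Icc 1 q, ‖c b‖ ^ 2 := by
  have hq' : (q : ℂ) ≠ 0 := by exact_mod_cast hq.ne'
  have hsq : ∀ z : ℂ, ((‖z‖ ^ 2 : ℝ) : ℂ) = z * (starRingEnd ℂ) z := fun z => by
    rw [Complex.mul_conj, Complex.normSq_eq_norm_sq]
  apply Complex.ofReal_injective
  push_cast
  have hsq' : ∀ z : ℂ, (‖z‖ : ℂ) ^ 2 = z * (starRingEnd ℂ) z := fun z => by
    rw [← hsq]; push_cast; rfl
  simp_rw [hsq', map_mul, map_sum, map_mul, star_expTwoPi]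
  have h1 : ∀ a : ℕ, (1 / q : ℂ) * (∑ b ∈ Icc 1 q, expTwoPi ((a : ℝ) * (b / q)) * c b) *
      ((starRingEnd ℂ) (1 / q : ℂ) *
        ∑ b ∈ Icc 1 q, expTwoPi (-((a : ℝ) * (b / q))) * (starRingEnd ℂ) (c b))
      = ∑ b ∈ Icc 1 q, ∑ b' ∈ Icc 1 q, (1 / q : ℂ) ^ 2 * (c b * (starRingEnd ℂ) (c b')) *
          expTwoPi ((a : ℝ) * (((b : ℤ) - (b' : ℤ) : ℤ) / q)) := by
    intro a
    have : (starRingEnd ℂ) (1 / q : ℂ) = 1 / q := by simp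
    rw [this, mul_mul_mul_comm, Finset.sum_mul_sum, Finset.mul_sum]
    refine Finset.sum_congr rfl fun b _ => ?_
    rw [Finset.mul_sum]
    refine Finset.sum_congr rfl fun b' _ => ?_
    rw [show (a : ℝ) * (((b : ℤ) - (b' : ℤ) : ℤ) / q) = (a : ℝ) * (b / q) + -((a : ℝ) * (b' / q)) by
      push_cast; ring, expTwoPi_add]
    ring
  simp_rw [h1]
  rw [Finset.sum_comm]
  rw [Finset.mul_sum]
  refine Finset.sum_congr rfl fun b hb => ?_
  rw [Finset.sum_comm]
  simp_rw [← Finset.mul_sum, sum_expTwoPi_div q hq]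
  have h2 : ∀ b' ∈ Icc 1 q, (1 / q : ℂ) ^ 2 * (c b * (starRingEnd ℂ) (c b')) *
      (if (q : ℤ) ∣ ((b : ℤ) - (b' : ℤ)) then (q : ℂ) else 0)
      = if b' = b then (1 / q : ℂ) * (c b * (starRingEnd ℂ) (c b)) else 0 := by
    intro b' hb'
    rw [mem_Icc] at hb hb'
    by_cases h : b' = b
    · subst h; simp; field_simp
    · have : ¬ (q : ℤ) ∣ ((b : ℤ) - (b' : ℤ)) := by
        intro hd
        have h3 := Int.eq_zero_of_abs_lt_dvd hd (by rw [abs_lt]; constructor <;> omega)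
        omega
      simp [h, this]
  rw [Finset.sum_congr rfl h2, Finset.sum_ite_eq' (Icc 1 q) b]
  simp [hb]

/-- The exponential sum `S(α) = Σ_{n ≤ x} d(n) e(nα)`. -/
noncomputable def divExpSum (x α : ℝ) : ℂ :=
  ∑ n ∈ Icc 1 ⌊x⌋₊, (divCount n : ℂ) * expTwoPi (n * α)

/-- `Σ*_{b mod r} |S(b/r) - F_r(x)/r|²`. -/
noncomputable def farey2 (x : ℝ) (r : ℕ) : ℝ :=
  ∑ b ∈ (Icc 1 r).filter (fun b => Nat.gcd b r = 1),
    ‖divExpSum x (b / r) - (mainF r x / r : ℝ)‖ ^ 2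

lemma Mdiv_eq_dft (x : ℝ) (q : ℕ) (hq : 0 < q) (a : ℕ) :
    ((Mdiv x q a : ℝ) : ℂ) = (1 / q : ℂ) * ∑ b ∈ Icc 1 q, expTwoPi ((a : ℝ) * (b / q)) *
      ((mainF (q / Nat.gcd b q) x / (q / Nat.gcd b q : ℕ) : ℝ) : ℂ) := by
  have h1 : ∀ b ∈ Icc 1 q, expTwoPi ((a : ℝ) * (b / q)) *
      ((mainF (q / Nat.gcd b q) x / (q / Nat.gcd b q : ℕ) : ℝ) : ℂ) =
      (fun r b : ℕ => expTwoPi ((b : ℝ) * (((a : ℤ) : ℝ) / (r : ℝ))) * ((mainF r x / r : ℝ) : ℂ))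
        (q / Nat.gcd b q) (b / Nat.gcd b q) := by
    intro b hb
    have hgp : 0 < Nat.gcd b q := Nat.gcd_pos_of_pos_right _ hq
    have hgp' : (Nat.gcd b q : ℝ) ≠ 0 := by positivity
    have hg' : (q : ℝ) ≠ 0 := by positivity
    simp only
    congr 2
    rw [Nat.cast_div (Nat.gcd_dvd_left b q) hgp', Nat.cast_div (Nat.gcd_dvd_right b q) hgp']
    push_cast
    field_simp
  rw [Finset.sum_congr rfl h1, sum_Icc_eq_sum_divisors_coprime q hq
    (fun r b : ℕ => expTwoPi ((b : ℝ) * (((a : ℤ) : ℝ) / (r : ℝ))) * ((mainF r x / r : ℝ) : ℂ))]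
  rw [Mdiv_eq]; push_cast
  congr 1
  refine Finset.sum_congr rfl fun r hr => ?_
  rw [ofReal_ramanujanSum r (Nat.pos_of_mem_divisors hr), ramC, ← Finset.sum_mul]
  push_cast; ring

lemma Adiv_eq_dft (x : ℝ) (q : ℕ) (hq : 0 < q) (a : ℕ) :
    ((Adiv x q a : ℝ) : ℂ) = (1 / q : ℂ) * ∑ b ∈ Icc 1 q, expTwoPi ((a : ℝ) * (b / q)) *
      (starRingEnd ℂ) (divExpSum x (b / q)) := by
  have hq' : (q : ℂ) ≠ 0 := by exact_mod_cast hq.ne'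
  simp only [divExpSum, map_sum, map_mul, star_expTwoPi, Finset.mul_sum]
  rw [Finset.sum_comm, Adiv, Finset.sum_filter]
  push_cast
  refine Finset.sum_congr rfl fun n _ => ?_
  have h1 : ∀ b ∈ Icc 1 q, (1 / q : ℂ) * (expTwoPi ((a : ℝ) * (b / q)) *
      ((starRingEnd ℂ) (divCount n : ℂ) * expTwoPi (-((n : ℝ) * (b / q)))))
      = (1 / q : ℂ) * divCount n * expTwoPi ((b : ℝ) * (((a : ℤ) - (n : ℤ) : ℤ) / q)) := by
    intro b _
    rw [show (b : ℝ) * (((a : ℤ) - (n : ℤ) : ℤ) / q) = (a : ℝ) * (b / q) + -((n : ℝ) * (b / q)) by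
      push_cast; ring, expTwoPi_add, Complex.conj_ofReal]
    ring
  rw [Finset.sum_congr rfl h1, ← Finset.mul_sum, sum_expTwoPi_div q hq]
  have h2 : n % q = a % q ↔ (q : ℤ) ∣ ((a : ℤ) - (n : ℤ)) := by
    rw [← Int.modEq_iff_dvd, Int.natCast_modEq_iff]; rfl
  simp only [← h2, divCount]
  split_ifs
  · push_cast; field_simp
  · simp

lemma sum_sq_Adiv_sub_Mdiv (x : ℝ) (q : ℕ) (hq : 0 < q) :
    ∑ a ∈ Icc 1 q, (Adiv x q a - Mdiv x q a) ^ 2 = 1 / q * ∑ r ∈ q.divisors, farey2 x r := by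
  have h := parseval_mod q hq (fun b => (starRingEnd ℂ) (divExpSum x (b / q)) -
    ((mainF (q / Nat.gcd b q) x / (q / Nat.gcd b q : ℕ) : ℝ) : ℂ))
  simp only [mul_sub, Finset.sum_sub_distrib] at h
  simp only [← Mdiv_eq_dft x q hq, ← Adiv_eq_dft x q hq] at h
  have h2 : ∀ a, (Adiv x q a - Mdiv x q a) ^ 2 = ‖(Adiv x q a : ℂ) - (Mdiv x q a : ℂ)‖ ^ 2 := by
    intro a
    rw [← Complex.ofReal_sub, Complex.norm_real, Real.norm_eq_abs, sq_abs]
  simp_rw [h2]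
  rw [h]
  congr 1
  simp only [farey2]
  rw [← sum_Icc_eq_sum_divisors_coprime q hq
    (fun r b => ‖divExpSum x (b / r) - (mainF r x / r : ℝ)‖ ^ 2)]
  refine Finset.sum_congr rfl fun b hb => ?_
  have hgp : 0 < Nat.gcd b q := Nat.gcd_pos_of_pos_right _ hq
  have hgp' : (Nat.gcd b q : ℝ) ≠ 0 := by positivity
  have hg' : (q : ℝ) ≠ 0 := by positivity
  have h3 : ((b / Nat.gcd b q : ℕ) : ℝ) / ((q / Nat.gcd b q : ℕ) : ℝ) = b / q := by
    rw [Nat.cast_div (Nat.gcd_dvd_left b q) hgp', Nat.cast_div (Nat.gcd_dvd_right b q) hgp']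
    field_simp
  rw [h3]
  congr 1
  rw [← RCLike.norm_conj, map_sub, Complex.conj_conj, Complex.conj_ofReal]

lemma sum_sq_Mdiv (x : ℝ) (q : ℕ) (hq : 0 < q) :
    ∑ a ∈ Icc 1 q, Mdiv x q a ^ 2
      = 1 / q * ∑ r ∈ q.divisors, (Nat.totient r : ℝ) * (mainF r x / r) ^ 2 := by
  have h := parseval_mod q hq (fun b =>
    ((mainF (q / Nat.gcd b q) x / (q / Nat.gcd b q : ℕ) : ℝ) : ℂ))
  simp only [← Mdiv_eq_dft x q hq, Complex.norm_real, Real.norm_eq_abs, sq_abs] at h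
  rw [h, sum_Icc_eq_sum_divisors_coprime q hq (fun r b => (mainF r x / r) ^ 2)]
  congr 1
  refine Finset.sum_congr rfl fun r _ => ?_
  rw [Finset.sum_const, card_coprime_filter, nsmul_eq_mul]

/-- `C_r(t) = Σ_{n ≤ t} d(n) c_r(n)`. -/
noncomputable def ramDivSum (r : ℕ) (t : ℝ) : ℝ :=
  ∑ n ∈ Icc 1 ⌊t⌋₊, divCount n * ramanujanSum r n

lemma ramanujanSum_self_of_dvd (s g : ℕ) (hs : 0 < s) (h : s ∣ g) :
    ramanujanSum s g = Nat.totient s := by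
  have h1 : ramanujanSum s g = ramanujanSum s 0 :=
    ramanujanSum_congr s hs ((Nat.modEq_zero_iff_dvd).2 h)
  rw [h1, ramanujanSum, ← card_coprime_filter]
  simp

lemma abs_ramDivSum_sub_le (r : ℕ) (hr : 0 < r) (t : ℝ) (ht : 0 < t) :
    |ramDivSum r t - Nat.totient r * mainF r t / r| ≤ 11 * √t * (r * divCount r) := by
  have h1 : ramDivSum r t = ∑ p ∈ r.divisorsAntidiagonal,
      (ArithmeticFunction.moebius p.1 : ℝ) * (p.2 * Adiv t p.2 p.2) := by
    simp only [ramDivSum, Adiv, Finset.sum_filter, Finset.mul_sum]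
    rw [Finset.sum_comm]
    refine Finset.sum_congr rfl fun n _ => ?_
    rw [ramanujanSum_eq_sum_moebius r hr, Finset.mul_sum]
    refine Finset.sum_congr rfl fun p _ => ?_
    have : n % p.2 = p.2 % p.2 ↔ p.2 ∣ n := by rw [Nat.mod_self, Nat.dvd_iff_mod_eq_zero]
    simp only [this, divCount]
    split_ifs <;> ring
  have h2 : ∀ g : ℕ, 0 < g → (g : ℝ) * Mdiv t g g
      = ∑ s ∈ g.divisors, (Nat.totient s : ℝ) * mainF s t / s := by
    intro g hg
    have hg' : (g : ℝ) ≠ 0 := by positivity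
    rw [Mdiv_eq, ← mul_assoc, mul_one_div_cancel hg', one_mul]
    refine Finset.sum_congr rfl fun s hs => ?_
    rw [ramanujanSum_self_of_dvd s g (Nat.pos_of_mem_divisors hs) (Nat.dvd_of_mem_divisors hs)]
    ring
  have h3 := (ArithmeticFunction.sum_eq_iff_sum_mul_moebius_eq (R := ℝ)
    (f := fun s => (Nat.totient s : ℝ) * mainF s t / s)
    (g := fun g => (g : ℝ) * Mdiv t g g)).1 (fun n hn => (h2 n hn).symm) r hr
  rw [h1, ← h3, ← Finset.sum_sub_distrib]
  have h4 : ∑ p ∈ r.divisorsAntidiagonal, (p.2 : ℝ) ≤ r * divCount r := by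
    rw [Nat.sum_divisorsAntidiagonal' (fun _ b => (b : ℝ))]
    rw [divCount, mul_comm, ← nsmul_eq_mul]
    refine Finset.sum_le_card_nsmul _ _ _ fun g hg => ?_
    exact_mod_cast Nat.divisor_le hg
  calc _ ≤ ∑ p ∈ r.divisorsAntidiagonal, 11 * √t * (p.2 : ℝ) := by
        refine (Finset.abs_sum_le_sum_abs _ _).trans (Finset.sum_le_sum fun p hp => ?_)
        have hp2 : 0 < p.2 :=
          Nat.pos_of_mem_divisors (Nat.snd_mem_divisors_of_mem_antidiagonal hp)
        have hB := abs_Adiv_sub_Mdiv_le t ht p.2 p.2 hp2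
        have hmu : |(ArithmeticFunction.moebius p.1 : ℝ)| ≤ 1 := by
          exact_mod_cast ArithmeticFunction.abs_moebius_le_one
        rw [← mul_sub, ← mul_sub, abs_mul, abs_mul, Nat.abs_cast]
        calc _ ≤ 1 * ((p.2 : ℝ) * (11 * √t)) := by gcongr
          _ = _ := by ring
    _ ≤ _ := by rw [← Finset.mul_sum]; gcongr

lemma harmonicReal_nonneg (n : ℕ) : 0 ≤ harmonicReal n :=
  Finset.sum_nonneg fun _ _ => by positivity

lemma harmonicReal_mono {m n : ℕ} (h : m ≤ n) : harmonicReal m ≤ harmonicReal n :=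
  Finset.sum_le_sum_of_subset_of_nonneg (Finset.Icc_subset_Icc_right h) fun _ _ _ => by positivity

lemma harmonicReal_floor_le {t : ℝ} (ht : 1 ≤ t) : harmonicReal ⌊t⌋₊ ≤ 1 + Real.log t := by
  have h1 : 1 ≤ ⌊t⌋₊ := (Nat.one_le_floor_iff t).2 ht
  rw [harmonicReal_eq]
  refine (harmonic_le_one_add_log _).trans ?_
  have : Real.log ⌊t⌋₊ ≤ Real.log t :=
    Real.log_le_log (by exact_mod_cast h1) (Nat.floor_le (by linarith))
  linarith

/-- Interchanging a sum over `n ≤ N` and over factorisations `n = r m`. -/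
lemma sum_Icc_divisorsAntidiagonal {α : Type*} [AddCommMonoid α] (g : ℕ → ℕ → α) (N : ℕ) :
    ∑ n ∈ Icc 1 N, ∑ p ∈ n.divisorsAntidiagonal, g p.1 p.2
      = ∑ r ∈ Icc 1 N, ∑ m ∈ Icc 1 (N / r), g r m := by
  rw [Finset.sum_sigma', Finset.sum_sigma']
  refine Finset.sum_nbij' (fun x : Σ _ : ℕ, ℕ × ℕ => (⟨x.2.1, x.2.2⟩ : Σ _ : ℕ, ℕ))
    (fun p => ⟨p.1 * p.2, (p.1, p.2)⟩) ?_ ?_ ?_ ?_ ?_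
  · rintro ⟨n, p⟩ h
    simp only [mem_sigma, mem_Icc, Nat.mem_divisorsAntidiagonal] at h ⊢
    obtain ⟨⟨h1, h2⟩, h3, h4⟩ := h
    have p1 : 0 < p.1 := Nat.pos_of_ne_zero fun h0 => by rw [h0, Nat.zero_mul] at h3; omega
    have p2 : 0 < p.2 := Nat.pos_of_ne_zero fun h0 => by rw [h0, Nat.mul_zero] at h3; omega
    refine ⟨⟨p1, by nlinarith⟩, p2, ?_⟩
    rw [Nat.le_div_iff_mul_le p1, mul_comm, h3]; exact h2
  · rintro ⟨r, m⟩ h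
    simp only [mem_sigma, mem_Icc, Nat.mem_divisorsAntidiagonal] at h ⊢
    obtain ⟨⟨h1, h2⟩, h3, h4⟩ := h
    have : 0 < r * m := Nat.mul_pos h1 h3
    refine ⟨⟨this, ?_⟩, by trivial, this.ne'⟩
    rw [mul_comm]; exact (Nat.le_div_iff_mul_le h1).1 h4
  · rintro ⟨n, p⟩ h
    simp only [mem_sigma, mem_Icc, Nat.mem_divisorsAntidiagonal] at h
    simp [h.2.1]
  · rintro ⟨r, m⟩ h; rfl
  · rintro ⟨n, p⟩ h; rfl

lemma sum_Icc_divisors {α : Type*} [AddCommMonoid α] (g : ℕ → ℕ → α) (N : ℕ) :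
    ∑ n ∈ Icc 1 N, ∑ r ∈ n.divisors, g r (n / r)
      = ∑ r ∈ Icc 1 N, ∑ m ∈ Icc 1 (N / r), g r m := by
  rw [← sum_Icc_divisorsAntidiagonal]
  exact Finset.sum_congr rfl fun n _ => (Nat.sum_divisorsAntidiagonal g).symm

lemma sum_Icc_comm_div {α : Type*} [AddCommMonoid α] (g : ℕ → ℕ → α) (N : ℕ) :
    ∑ r ∈ Icc 1 N, ∑ m ∈ Icc 1 (N / r), g r m = ∑ m ∈ Icc 1 N, ∑ r ∈ Icc 1 (N / m), g r m := by
  rw [← sum_Icc_divisorsAntidiagonal, ← sum_Icc_divisorsAntidiagonal (fun a b => g b a)]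
  refine Finset.sum_congr rfl fun n _ => ?_
  rw [← Nat.map_swap_divisorsAntidiagonal, Finset.sum_map]
  rw [Nat.map_swap_divisorsAntidiagonal]
  rfl

lemma sum_one_div_mul_sum_divisors (f : ℕ → ℝ) (N : ℕ) :
    ∑ q ∈ Icc 1 N, 1 / (q : ℝ) * ∑ r ∈ q.divisors, f r
      = ∑ r ∈ Icc 1 N, ∑ m ∈ Icc 1 (N / r), f r / r * (1 / m) := by
  rw [← sum_Icc_divisors (fun r m => f r / r * (1 / (m : ℝ)))]
  refine Finset.sum_congr rfl fun q hq => ?_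
  rw [Finset.mul_sum]
  refine Finset.sum_congr rfl fun r hr => ?_
  have hr0 : (r : ℝ) ≠ 0 := by exact_mod_cast (Nat.pos_of_mem_divisors hr).ne'
  have hq0 : (q : ℝ) ≠ 0 := by have := (mem_Icc.1 hq).1; positivity
  rw [Nat.cast_div (Nat.dvd_of_mem_divisors hr) hr0]
  field_simp

lemma sum_one_div_mul_sum_divisors_eq_harmonic (f : ℕ → ℝ) (N : ℕ) :
    ∑ q ∈ Icc 1 N, 1 / (q : ℝ) * ∑ r ∈ q.divisors, f r
      = ∑ r ∈ Icc 1 N, f r / r * harmonicReal (N / r) := by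
  rw [sum_one_div_mul_sum_divisors]
  simp only [harmonicReal, Finset.mul_sum]

lemma sum_one_div_mul_sum_divisors_le (f : ℕ → ℝ) (hf : ∀ r, 0 ≤ f r) (N : ℕ) :
    ∑ q ∈ Icc 1 N, 1 / (q : ℝ) * ∑ r ∈ q.divisors, f r
      ≤ harmonicReal N * ∑ r ∈ Icc 1 N, f r / r := by
  rw [sum_one_div_mul_sum_divisors_eq_harmonic, mul_comm, Finset.sum_mul]
  refine Finset.sum_le_sum fun r _ => ?_
  have := hf r
  gcongr
  exact harmonicReal_mono (Nat.div_le_self N r)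

lemma divCount_nonneg (n : ℕ) : 0 ≤ divCount n := Nat.cast_nonneg _

lemma divCount_eq_sum (n : ℕ) : divCount n = ∑ _r ∈ n.divisors, (1 : ℝ) := by
  simp [divCount]

lemma sum_divCount_div_le (N : ℕ) : ∑ r ∈ Icc 1 N, divCount r / r ≤ harmonicReal N ^ 2 := by
  have h := sum_one_div_mul_sum_divisors_le (fun _ => 1) (fun _ => zero_le_one) N
  simp only [← divCount_eq_sum] at h
  calc _ = ∑ q ∈ Icc 1 N, 1 / (q : ℝ) * divCount q := Finset.sum_congr rfl fun _ _ => by ring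
    _ ≤ _ := h
    _ = _ := by rw [sq]; rfl

lemma sum_divCount_le (N : ℕ) : ∑ r ∈ Icc 1 N, divCount r ≤ N * harmonicReal N := by
  have h := sum_Icc_divisors (fun _ _ => (1 : ℝ)) N
  simp only [← divCount_eq_sum] at h
  rw [h, harmonicReal, Finset.mul_sum]
  refine Finset.sum_le_sum fun r _ => ?_
  simp only [sum_const, Nat.card_Icc, Nat.add_sub_cancel, nsmul_eq_mul, mul_one, mul_one_div]
  exact Nat.cast_div_le

lemma one_le_two_mul_log {x : ℝ} (hx : 2 ≤ x) : 1 ≤ 2 * Real.log x := by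
  have := Real.log_le_log (by norm_num) hx
  have := Real.log_two_gt_d9
  linarith

lemma abs_log_div_sq_le {x : ℝ} (r : ℕ) (hr : 1 ≤ r) (hrx : (r : ℝ) ≤ x) {t : ℝ} (ht1 : 1 ≤ t)
    (htx : t ≤ x) : |Real.log (t / r ^ 2)| ≤ 2 * Real.log x := by
  have hr' : (1 : ℝ) ≤ r := by exact_mod_cast hr
  have h1 := Real.log_nonneg hr'
  have h2 := Real.log_nonneg ht1
  have h3 := Real.log_le_log (by linarith) hrx
  have h4 := Real.log_le_log (by linarith) htx
  rw [Real.log_div (by linarith) (by positivity), Real.log_pow, abs_le]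
  constructor <;> push_cast <;> linarith

lemma abs_mainF_le {x : ℝ} (hx : 2 ≤ x) (r : ℕ) (hr : 1 ≤ r) (hrx : (r : ℝ) ≤ x) {t : ℝ}
    (ht1 : 1 ≤ t) (htx : t ≤ x) : |mainF r t| ≤ 4 * t * Real.log x := by
  have h1 := abs_log_div_sq_le r hr hrx ht1 htx
  have h2 := one_le_two_mul_log hx
  have hg := eulerMascheroni_bounds
  rw [mainF, abs_mul, abs_of_pos (by linarith : (0 : ℝ) < t), mul_comm 4, mul_assoc]
  gcongr
  rw [abs_le] at h1 ⊢
  constructor <;> linarith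

/-- The mixed second moment in terms of Ramanujan-weighted divisor sums. -/
lemma sum_Adiv_mul_Mdiv (x : ℝ) (q : ℕ) (hq : 0 < q) :
    ∑ a ∈ Icc 1 q, Adiv x q a * Mdiv x q a
      = 1 / q * ∑ r ∈ q.divisors, mainF r x / r * ramDivSum r x := by
  have hM : ∀ n a, n % q = a % q → Mdiv x q a = Mdiv x q n := by
    intro n a h
    rw [Mdiv_eq, Mdiv_eq]
    congr 1
    refine Finset.sum_congr rfl fun r hr => ?_
    rw [ramanujanSum_congr r (Nat.pos_of_mem_divisors hr)
      (Nat.ModEq.of_dvd (Nat.dvd_of_mem_divisors hr) (show a ≡ n [MOD q] from h.symm))]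
  have h1 : ∑ a ∈ Icc 1 q, Adiv x q a * Mdiv x q a
      = ∑ n ∈ Icc 1 ⌊x⌋₊, divCount n * Mdiv x q n := by
    simp only [Adiv, Finset.sum_filter, Finset.sum_mul]
    rw [Finset.sum_comm]
    refine Finset.sum_congr rfl fun n _ => ?_
    have h2 : ∀ a ∈ Icc 1 q, (if n % q = a % q then (n.divisors.card : ℝ) else 0) * Mdiv x q a
        = if a = (if n % q = 0 then q else n % q) then divCount n * Mdiv x q n else 0 := by
      intro a ha
      rw [mem_Icc] at ha
      have hiff : n % q = a % q ↔ a = (if n % q = 0 then q else n % q) := by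
        have hlt := Nat.mod_lt n hq
        rcases eq_or_lt_of_le ha.2 with h | h
        · subst h
          rw [Nat.mod_self]
          split_ifs with h0
          · simp [h0]
          · constructor <;> intro h3 <;> omega
        · rw [Nat.mod_eq_of_lt h]
          split_ifs with h0
          · constructor <;> intro h3 <;> omega
          · exact eq_comm
      by_cases h : n % q = a % q
      · rw [if_pos h, if_pos (hiff.1 h), hM n a h]; rfl
      · rw [if_neg h, if_neg (fun h' => h (hiff.2 h')), zero_mul]
    rw [Finset.sum_congr rfl h2, Finset.sum_ite_eq' (Icc 1 q), if_pos]
    rw [mem_Icc]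
    have hlt := Nat.mod_lt n hq
    split_ifs <;> omega
  rw [h1]
  simp only [Mdiv_eq, Finset.mul_sum]
  rw [Finset.sum_comm]
  refine Finset.sum_congr rfl fun r _ => ?_
  rw [ramDivSum, Finset.mul_sum, Finset.mul_sum]
  refine Finset.sum_congr rfl fun n _ => ?_
  ring

lemma abs_sum_Adiv_mul_Mdiv_sub_le {x : ℝ} (hx : 2 ≤ x) (q : ℕ) (hq : 0 < q) (hqx : (q : ℝ) ≤ x) :
    |∑ a ∈ Icc 1 q, Adiv x q a * Mdiv x q a - ∑ a ∈ Icc 1 q, Mdiv x q a ^ 2|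
      ≤ 44 * (x * √x * Real.log x) * (1 / q * ∑ r ∈ q.divisors, divCount r) := by
  have hlog : 0 ≤ Real.log x := Real.log_nonneg (by linarith)
  rw [sum_Adiv_mul_Mdiv x q hq, sum_sq_Mdiv x q hq, ← mul_sub, ← Finset.sum_sub_distrib, abs_mul,
    abs_of_nonneg (by positivity), mul_left_comm]
  gcongr
  rw [Finset.mul_sum]
  refine (Finset.abs_sum_le_sum_abs _ _).trans (Finset.sum_le_sum fun r hr => ?_)
  have hr1 : 0 < r := Nat.pos_of_mem_divisors hr
  have hr' : (0 : ℝ) < r := by exact_mod_cast hr1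
  have hrq : (r : ℝ) ≤ q := by exact_mod_cast Nat.divisor_le hr
  have h1 := abs_ramDivSum_sub_le r hr1 x (by linarith)
  have h2 := abs_mainF_le hx r hr1 (hrq.trans hqx) (by linarith : 1 ≤ x) le_rfl
  have h3 : mainF r x / r * ramDivSum r x - Nat.totient r * (mainF r x / r) ^ 2
      = mainF r x / r * (ramDivSum r x - Nat.totient r * mainF r x / r) := by ring
  rw [h3, abs_mul, abs_div, Nat.abs_cast]
  calc |mainF r x| / r * |ramDivSum r x - Nat.totient r * mainF r x / r|
      ≤ 4 * x * Real.log x / r * (11 * √x * (r * divCount r)) := by gcongr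
    _ = _ := by field_simp; ring

lemma abs_Vdiv_sub_le {x Q : ℝ} (hx : 2 ≤ x) (hQ : 1 ≤ Q) (hQx : Q ≤ x) :
    |Vdiv x Q - ∑ q ∈ Icc 1 ⌊Q⌋₊, (∑ a ∈ Icc 1 q, Adiv x q a ^ 2 - ∑ a ∈ Icc 1 q, Mdiv x q a ^ 2)|
      ≤ 88 * (x * √x * Real.log x) * (1 + Real.log x) ^ 3 := by
  have hlog : 0 ≤ Real.log x := Real.log_nonneg (by linarith)
  have h1 : Vdiv x Q - ∑ q ∈ Icc 1 ⌊Q⌋₊,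
      (∑ a ∈ Icc 1 q, Adiv x q a ^ 2 - ∑ a ∈ Icc 1 q, Mdiv x q a ^ 2)
      = ∑ q ∈ Icc 1 ⌊Q⌋₊, (-2) *
        (∑ a ∈ Icc 1 q, Adiv x q a * Mdiv x q a - ∑ a ∈ Icc 1 q, Mdiv x q a ^ 2) := by
    rw [Vdiv, ← Finset.sum_sub_distrib]
    refine Finset.sum_congr rfl fun q _ => ?_
    simp only [← Finset.sum_sub_distrib, Finset.mul_sum]
    refine Finset.sum_congr rfl fun a _ => ?_
    ring
  rw [h1]
  have hH : harmonicReal ⌊Q⌋₊ ≤ 1 + Real.log x :=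
    (harmonicReal_floor_le hQ).trans (by gcongr)
  have hH0 := harmonicReal_nonneg ⌊Q⌋₊
  calc _ ≤ ∑ q ∈ Icc 1 ⌊Q⌋₊, 2 * (44 * (x * √x * Real.log x) *
          (1 / q * ∑ r ∈ q.divisors, divCount r)) := by
        refine (Finset.abs_sum_le_sum_abs _ _).trans (Finset.sum_le_sum fun q hq => ?_)
        rw [mem_Icc] at hq
        rw [abs_mul, show |(-2 : ℝ)| = 2 by norm_num]
        gcongr
        refine abs_sum_Adiv_mul_Mdiv_sub_le hx q hq.1 ?_
        have : (q : ℝ) ≤ ⌊Q⌋₊ := by exact_mod_cast hq.2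
        exact this.trans ((Nat.floor_le (by linarith)).trans hQx)
    _ = 88 * (x * √x * Real.log x) * ∑ q ∈ Icc 1 ⌊Q⌋₊,
        (1 / (q : ℝ) * ∑ r ∈ q.divisors, divCount r) := by
        rw [Finset.mul_sum]; refine Finset.sum_congr rfl fun q _ => ?_; ring
    _ ≤ 88 * (x * √x * Real.log x) * (harmonicReal ⌊Q⌋₊ * harmonicReal ⌊Q⌋₊ ^ 2) := by
        gcongr
        refine (sum_one_div_mul_sum_divisors_le divCount divCount_nonneg _).trans ?_
        gcongr
        exact sum_divCount_div_le _
    _ ≤ 88 * (x * √x * Real.log x) * (1 + Real.log x) ^ 3 := by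
        rw [← pow_succ']
        gcongr

/-- Pairs `n + u < m ≤ x` with `m ≡ n (mod k)`, weighted by `d(n) d(m)`. -/
noncomputable def corrSum (x : ℝ) (k : ℕ) (u : ℝ) : ℝ :=
  ∑ n ∈ Icc 1 ⌊x⌋₊, ∑ m ∈ (Icc 1 ⌊x⌋₊).filter (fun m : ℕ => n % k = m % k ∧ (n : ℝ) + u < m),
    divCount n * divCount m

noncomputable def divSqSum (x : ℝ) : ℝ := ∑ n ∈ Icc 1 ⌊x⌋₊, divCount n ^ 2

noncomputable def switchSum (x Q : ℝ) : ℝ := ∑ k ∈ Icc 1 ⌊x / Q⌋₊, corrSum x k (k * Q)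

lemma sum_sq_Adiv (x : ℝ) (q : ℕ) (hq : 0 < q) :
    ∑ a ∈ Icc 1 q, Adiv x q a ^ 2 = divSqSum x + 2 * corrSum x q 0 := by
  have h1 : ∑ a ∈ Icc 1 q, Adiv x q a ^ 2 = ∑ n ∈ Icc 1 ⌊x⌋₊, ∑ m ∈ Icc 1 ⌊x⌋₊,
      if n % q = m % q then divCount n * divCount m else 0 := by
    have : ∀ a, Adiv x q a ^ 2 = ∑ n ∈ Icc 1 ⌊x⌋₊, ∑ m ∈ Icc 1 ⌊x⌋₊,
        if n % q = a % q ∧ m % q = a % q then divCount n * divCount m else 0 := by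
      intro a
      rw [Adiv, sq, Finset.sum_filter, Finset.sum_mul_sum]
      refine Finset.sum_congr rfl fun n _ => Finset.sum_congr rfl fun m _ => ?_
      simp only [divCount]
      split_ifs <;> simp_all
    simp_rw [this]
    rw [Finset.sum_comm]
    refine Finset.sum_congr rfl fun n _ => ?_
    rw [Finset.sum_comm]
    refine Finset.sum_congr rfl fun m _ => ?_
    by_cases h : n % q = m % q
    · simp only [h, and_self, if_true]
      rw [Finset.sum_eq_single (if m % q = 0 then q else m % q)]
      · rw [if_pos]
        split_ifs with h1
        · rw [h1, Nat.mod_self]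
        · rw [Nat.mod_mod]
      · intro b hb hb'
        rw [if_neg]
        intro h2
        rw [mem_Icc] at hb
        apply hb'
        rcases hb.2.lt_or_eq with h3 | h3
        · rw [Nat.mod_eq_of_lt h3] at h2
          rw [h2, if_neg (by omega)]
        · subst h3; simp [h2]
      · intro h2
        exfalso; apply h2
        rw [mem_Icc]
        have := Nat.mod_lt m hq
        split_ifs <;> omega
    · rw [if_neg h]
      refine Finset.sum_eq_zero fun a _ => if_neg fun h' => h (h'.1.trans h'.2.symm)
  rw [h1]
  have h2 : ∀ n m : ℕ, (if n % q = m % q then divCount n * divCount m else 0)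
      = (if n = m then divCount n * divCount m else 0)
        + (if n % q = m % q ∧ n < m then divCount n * divCount m else 0)
        + (if m % q = n % q ∧ m < n then divCount m * divCount n else 0) := by
    intro n m
    rcases lt_trichotomy n m with h | h | h
    · simp [h, h.ne, h.not_gt]
    · simp [h]
    · simp only [h, h.ne', h.not_gt, and_true, and_false, if_false, zero_add, eq_comm, mul_comm]
  simp_rw [h2, Finset.sum_add_distrib]
  have h3 : ∑ n ∈ Icc 1 ⌊x⌋₊, ∑ m ∈ Icc 1 ⌊x⌋₊,
      (if n % q = m % q ∧ n < m then divCount n * divCount m else 0) = corrSum x q 0 := by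
    rw [corrSum]
    refine Finset.sum_congr rfl fun n _ => ?_
    rw [Finset.sum_filter]
    simp
  rw [h3, Finset.sum_comm (f := fun n m => if m % q = n % q ∧ m < n then
    divCount m * divCount n else 0), h3, divSqSum]
  have h4 : ∑ n ∈ Icc 1 ⌊x⌋₊, ∑ m ∈ Icc 1 ⌊x⌋₊, (if n = m then divCount n * divCount m else 0)
      = ∑ n ∈ Icc 1 ⌊x⌋₊, divCount n ^ 2 := by
    refine Finset.sum_congr rfl fun n hn => ?_
    rw [Finset.sum_ite_eq, if_pos hn, sq]
  rw [h4]; ring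

/-- The divisors `q` of `D` up to `Q` are paired with the complementary divisors `k ≥ D / Q`. -/
lemma card_dvd_switch (D N : ℕ) (Q : ℝ) (hQ : 0 < Q) (hD : 0 < D) (x : ℝ) (hDx : (D : ℝ) ≤ x)
    (hN : N = ⌊Q⌋₊) :
    ((Icc 1 N).filter (· ∣ D)).card + ((Icc 1 ⌊x / Q⌋₊).filter
      (fun k : ℕ => k ∣ D ∧ (k : ℝ) * Q < D)).card = D.divisors.card := by
  have h1 : (Icc 1 N).filter (· ∣ D) = D.divisors.filter (fun q : ℕ => (q : ℝ) ≤ Q) := by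
    ext q
    rw [Finset.mem_filter, Finset.mem_filter, mem_Icc, Nat.mem_divisors, hN, Nat.le_floor_iff hQ.le]
    constructor
    · rintro ⟨⟨h1, h2⟩, h3⟩; exact ⟨⟨h3, hD.ne'⟩, h2⟩
    · rintro ⟨⟨h1, h2⟩, h3⟩; exact ⟨⟨Nat.pos_of_dvd_of_pos h1 hD, h3⟩, h1⟩
  have h2 : ((Icc 1 ⌊x / Q⌋₊).filter (fun k : ℕ => k ∣ D ∧ (k : ℝ) * Q < D)).card
      = (D.divisors.filter (fun q : ℕ => ¬ (q : ℝ) ≤ Q)).card := by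
    refine Finset.card_nbij' (fun k => D / k) (fun k => D / k) ?_ ?_ ?_ ?_
    · intro k hk
      simp only [Finset.coe_filter, Set.mem_ofPred_eq, mem_Icc, Nat.mem_divisors] at hk ⊢
      obtain ⟨⟨h1, h2⟩, ⟨c, hc⟩, h4⟩ := hk
      have hk0 : (0 : ℝ) < k := by exact_mod_cast h1
      rw [hc, Nat.mul_div_cancel_left _ (by omega)]
      refine ⟨⟨⟨k, by ring⟩, by omega⟩, ?_⟩
      rw [hc] at h4; push_cast at h4
      exact not_le.2 (lt_of_mul_lt_mul_left h4 hk0.le)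
    · intro q hq
      simp only [Finset.coe_filter, Set.mem_ofPred_eq, mem_Icc, Nat.mem_divisors] at hq ⊢
      obtain ⟨⟨⟨c, hc⟩, h2⟩, h3⟩ := hq
      have hq0 : 0 < q := Nat.pos_of_ne_zero (by rintro rfl; simp at hc; omega)
      have hc0 : 0 < c := Nat.pos_of_ne_zero (by rintro rfl; simp at hc; omega)
      have hc0' : (0 : ℝ) < c := by exact_mod_cast hc0
      have h5 : (c : ℝ) * Q < D := by
        rw [hc]; push_cast; rw [mul_comm]
        exact mul_lt_mul_of_pos_right (not_le.1 h3) hc0'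
      rw [hc, Nat.mul_div_cancel_left _ hq0]
      refine ⟨⟨hc0, ?_⟩, ⟨q, by ring⟩, by rw [← hc]; exact h5⟩
      apply Nat.le_floor
      rw [le_div_iff₀ hQ]; linarith
    · intro k hk
      simp only [Finset.coe_filter, Set.mem_ofPred_eq, mem_Icc] at hk
      exact Nat.div_div_self hk.2.1 hD.ne'
    · intro k hk
      simp only [Finset.coe_filter, Set.mem_ofPred_eq, Nat.mem_divisors] at hk
      exact Nat.div_div_self hk.1.1 hD.ne'
  rw [h1, h2, Finset.card_filter_add_card_filter_not]

lemma sum_corrSum_add_switchSum (x Q : ℝ) (hx : 0 ≤ x) (hQ : 0 < Q) :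
    ∑ q ∈ Icc 1 ⌊Q⌋₊, corrSum x q 0 + switchSum x Q
      = ∑ n ∈ Icc 1 ⌊x⌋₊, ∑ m ∈ (Icc 1 ⌊x⌋₊).filter (fun m => n < m),
          divCount n * divCount m * (m - n).divisors.card := by
  have key : ∀ (K : ℕ) (u : ℕ → ℝ) (hu : ∀ k, 0 ≤ u k), ∑ k ∈ Icc 1 K, corrSum x k (u k)
      = ∑ n ∈ Icc 1 ⌊x⌋₊, ∑ m ∈ (Icc 1 ⌊x⌋₊).filter (fun m => n < m),
          divCount n * divCount m *
            (((Icc 1 K).filter (fun k : ℕ => k ∣ m - n ∧ u k < (m - n : ℕ))).card : ℝ) := by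
    intro K u hu
    simp only [corrSum, Finset.sum_filter]
    rw [Finset.sum_comm]
    refine Finset.sum_congr rfl fun n _ => ?_
    rw [Finset.sum_comm]
    refine Finset.sum_congr rfl fun m _ => ?_
    by_cases h : n < m
    · rw [if_pos h, Finset.card_filter, Nat.cast_sum, Finset.mul_sum]
      refine Finset.sum_congr rfl fun k hk => ?_
      have h1 : n % k = m % k ↔ k ∣ m - n := Nat.modEq_iff_dvd' h.le
      have h2 : ((n : ℝ) + u k < m) ↔ u k < (m - n : ℕ) := by
        rw [Nat.cast_sub h.le]; constructor <;> intro h <;> linarith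
      simp only [h1, h2]
      split_ifs <;> simp
    · rw [if_neg h]
      refine Finset.sum_eq_zero fun k _ => if_neg ?_
      rintro ⟨-, h2⟩
      have : (m : ℝ) ≤ n := by exact_mod_cast not_lt.1 h
      linarith [hu k]
  rw [key _ (fun _ => 0) (fun _ => le_rfl), switchSum,
      key _ (fun k => k * Q) (fun k => by positivity),
    ← Finset.sum_add_distrib]
  refine Finset.sum_congr rfl fun n hn => ?_
  rw [← Finset.sum_add_distrib]
  refine Finset.sum_congr rfl fun m hm => ?_
  rw [Finset.mem_filter, mem_Icc] at hm
  have hD : 0 < m - n := by omega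
  rw [← card_dvd_switch (m - n) ⌊Q⌋₊ Q hQ hD x ?_ rfl]
  · rw [Nat.cast_add, mul_add]
    congr 4
    ext k
    simp [hD]
  · have : (m - n : ℕ) ≤ ⌊x⌋₊ := by omega
    exact (Nat.cast_le.2 this).trans (Nat.floor_le hx)

lemma sum_sum_sq_Adiv_sub (x Q R : ℝ) (hx : 0 ≤ x) (hQ : 0 < Q) (hR : 0 < R) :
    ∑ q ∈ Icc 1 ⌊Q⌋₊, ∑ a ∈ Icc 1 q, Adiv x q a ^ 2 - ∑ q ∈ Icc 1 ⌊R⌋₊, ∑ a ∈ Icc 1 q,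
        Adiv x q a ^ 2
      = ((⌊Q⌋₊ : ℝ) - ⌊R⌋₊) * divSqSum x + 2 * (switchSum x R - switchSum x Q) := by
  have h : ∀ P : ℝ, ∑ q ∈ Icc 1 ⌊P⌋₊, ∑ a ∈ Icc 1 q, Adiv x q a ^ 2
      = ⌊P⌋₊ * divSqSum x + 2 * ∑ q ∈ Icc 1 ⌊P⌋₊, corrSum x q 0 := by
    intro P
    rw [Finset.mul_sum, show (⌊P⌋₊ : ℝ) * divSqSum x = ∑ q ∈ Icc 1 ⌊P⌋₊, divSqSum x by simp,
      ← Finset.sum_add_distrib]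
    refine Finset.sum_congr rfl fun q hq => sum_sq_Adiv x q ?_
    rw [mem_Icc] at hq; omega
  rw [h, h]
  have h1 := sum_corrSum_add_switchSum x Q hx hQ
  have h2 := sum_corrSum_add_switchSum x R hx hR
  linear_combination 2 * h1 - 2 * h2

/-- `f y = O_δ(y ^ (p + δ))` for every `δ > 0`, uniformly for `y ≥ 1`. -/
def PowBound (p : ℝ) (f : ℝ → ℝ) : Prop :=
  ∀ δ : ℝ, 0 < δ → ∃ C : ℝ, 0 ≤ C ∧ ∀ y : ℝ, 1 ≤ y → |f y| ≤ C * y ^ (p + δ)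

namespace PowBound

lemma of_small {p : ℝ} {f : ℝ → ℝ} (δ₀ : ℝ) (h₀ : 0 < δ₀)
    (h : ∀ δ : ℝ, 0 < δ → δ ≤ δ₀ → ∃ C : ℝ, 0 ≤ C ∧ ∀ y : ℝ, 1 ≤ y → |f y| ≤ C * y ^ (p + δ)) :
    PowBound p f := by
  intro δ hδ
  obtain ⟨C, hC, hb⟩ := h (min δ δ₀) (lt_min hδ h₀) (min_le_right _ _)
  refine ⟨C, hC, fun y hy => (hb y hy).trans ?_⟩
  gcongr
  exact min_le_left _ _

lemma of_le {p : ℝ} {f : ℝ → ℝ} (C : ℝ) (h : ∀ y : ℝ, 1 ≤ y → |f y| ≤ C * y ^ p) :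
    PowBound p f := by
  intro δ hδ
  refine ⟨|C|, abs_nonneg _, fun y hy => (h y hy).trans ?_⟩
  have h0 : 0 < y := by linarith
  have h1 : y ^ p ≤ y ^ (p + δ) := Real.rpow_le_rpow_of_exponent_le hy (by linarith)
  have h2 := Real.rpow_nonneg h0.le p
  exact mul_le_mul (le_abs_self C) h1 h2 (abs_nonneg _)

lemma of_abs_le {p : ℝ} {f g : ℝ → ℝ} (hg : PowBound p g) (h : ∀ y : ℝ, 1 ≤ y → |f y| ≤ |g y|) :
    PowBound p f := by
  intro δ hδ
  obtain ⟨C, hC, hb⟩ := hg δ hδ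
  exact ⟨C, hC, fun y hy => (h y hy).trans (hb y hy)⟩

lemma congr {p : ℝ} {f g : ℝ → ℝ} (hg : PowBound p g) (h : ∀ y : ℝ, 1 ≤ y → f y = g y) :
    PowBound p f := hg.of_abs_le fun y hy => by rw [h y hy]

lemma mono {p q : ℝ} {f : ℝ → ℝ} (hf : PowBound p f) (h : p ≤ q) : PowBound q f := by
  intro δ hδ
  obtain ⟨C, hC, hb⟩ := hf δ hδ
  refine ⟨C, hC, fun y hy => (hb y hy).trans ?_⟩
  gcongr

lemma add {p : ℝ} {f g : ℝ → ℝ} (hf : PowBound p f) (hg : PowBound p g) :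
    PowBound p (fun y => f y + g y) := by
  intro δ hδ
  obtain ⟨C, hC, hb⟩ := hf δ hδ
  obtain ⟨D, hD, hd⟩ := hg δ hδ
  refine ⟨C + D, by positivity, fun y hy => (abs_add_le _ _).trans ?_⟩
  rw [add_mul]
  exact add_le_add (hb y hy) (hd y hy)

lemma mul {p q : ℝ} {f g : ℝ → ℝ} (hf : PowBound p f) (hg : PowBound q g) :
    PowBound (p + q) (fun y => f y * g y) := by
  intro δ hδ
  obtain ⟨C, hC, hb⟩ := hf (δ / 2) (by positivity)
  obtain ⟨D, hD, hd⟩ := hg (δ / 2) (by positivity)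
  refine ⟨C * D, by positivity, fun y hy => ?_⟩
  have h0 : 0 < y := by linarith
  rw [abs_mul]
  calc |f y| * |g y| ≤ (C * y ^ (p + δ / 2)) * (D * y ^ (q + δ / 2)) :=
        mul_le_mul (hb y hy) (hd y hy) (abs_nonneg _) ((abs_nonneg _).trans (hb y hy))
    _ = C * D * (y ^ (p + δ / 2) * y ^ (q + δ / 2)) := by ring
    _ = _ := by rw [← Real.rpow_add h0]; ring_nf

lemma const (c : ℝ) : PowBound 0 (fun _ => c) :=
  of_le |c| fun y _ => by simp

lemma const_mul {p : ℝ} {f : ℝ → ℝ} (c : ℝ) (hf : PowBound p f) :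
    PowBound p (fun y => c * f y) := by
  simpa using (const c).mul hf

lemma neg {p : ℝ} {f : ℝ → ℝ} (hf : PowBound p f) : PowBound p (fun y => - f y) :=
  hf.of_abs_le fun y _ => by rw [abs_neg]

lemma sub {p : ℝ} {f g : ℝ → ℝ} (hf : PowBound p f) (hg : PowBound p g) :
    PowBound p (fun y => f y - g y) :=
  (hf.add hg.neg).congr fun y _ => by ring

lemma sum {ι : Type*} {p : ℝ} {f : ι → ℝ → ℝ} (s : Finset ι) (hf : ∀ i ∈ s, PowBound p (f i)) :
    PowBound p (fun y => ∑ i ∈ s, f i y) := by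
  induction s using Finset.induction_on with
  | empty =>
    refine of_le 0 fun y _ => ?_
    simp
  | insert i s hi ih =>
    refine ((hf i (Finset.mem_insert_self i s)).add
      (ih fun j hj => hf j (Finset.mem_insert_of_mem hj))).congr fun y _ => ?_
    rw [Finset.sum_insert hi]

lemma log : PowBound 0 Real.log := by
  intro δ hδ
  refine ⟨1 / δ, by positivity, fun y hy => ?_⟩
  rw [abs_of_nonneg (Real.log_nonneg hy), zero_add]
  have := Real.log_le_rpow_div (by linarith : (0 : ℝ) ≤ y) hδ
  rwa [div_mul_eq_mul_div, one_mul]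

lemma pow {f : ℝ → ℝ} (hf : PowBound 0 f) (n : ℕ) : PowBound 0 (fun y => f y ^ n) := by
  induction n with
  | zero => simpa using const 1
  | succ n ih => simpa [pow_succ] using ih.mul hf

lemma log_pow (n : ℕ) : PowBound 0 (fun y => Real.log y ^ n) := log.pow n

lemma rpow (p : ℝ) : PowBound p (fun y => y ^ p) :=
  of_le 1 fun y hy => by
    rw [abs_of_nonneg (Real.rpow_nonneg (by linarith) _), one_mul]

lemma inv : PowBound (-1) (fun y => y⁻¹) :=
  (rpow (-1)).congr fun y _ => by rw [Real.rpow_neg_one]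

lemma inv_sq : PowBound (-2) (fun y => (y ^ 2)⁻¹) :=
  (rpow (-2)).congr fun y hy => by
    rw [Real.rpow_neg (by linarith)]; norm_num

lemma id : PowBound 1 (fun y => y) := (rpow 1).congr fun y _ => by rw [Real.rpow_one]

lemma intervalIntegrable {p : ℝ} {f : ℝ → ℝ} (hf : PowBound p f) (hm : Measurable f)
    {a b : ℝ} (ha : 1 ≤ a) (hb : 1 ≤ b) : IntervalIntegrable f MeasureTheory.volume a b := by
  obtain ⟨C, hC, hbd⟩ := hf 1 one_pos
  have hg : IntervalIntegrable (fun y : ℝ => C * y ^ (p + 1)) MeasureTheory.volume a b := by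
    apply ContinuousOn.intervalIntegrable
    intro y hy
    have : 1 ≤ y := by
      rcases Set.mem_uIcc.1 hy with h | h
      · exact ha.trans h.1
      · exact hb.trans h.1
    exact (continuousAt_const.mul (Real.continuousAt_rpow_const _ _
        (Or.inl (by linarith)))).continuousWithinAt
  refine hg.mono_fun hm.aestronglyMeasurable ?_
  filter_upwards [MeasureTheory.ae_restrict_mem measurableSet_uIoc] with y hy
  have h1 : 1 ≤ y := by
    rcases Set.mem_uIoc.1 hy with h | h
    · exact ha.trans h.1.le
    · exact hb.trans h.1.le
  rw [Real.norm_eq_abs, Real.norm_eq_abs]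
  exact (hbd y h1).trans (le_abs_self _)

lemma integrableOn {p : ℝ} {f : ℝ → ℝ} (hf : PowBound p f) (hm : Measurable f) (hp : p < -1) :
    MeasureTheory.IntegrableOn f (Set.Ioi 1) := by
  obtain ⟨C, hC, hbd⟩ := hf ((-1 - p) / 2) (by linarith)
  refine MeasureTheory.Integrable.mono'
    ((integrableOn_Ioi_rpow_of_lt (a := p + (-1 - p) / 2) (by linarith) one_pos).const_mul C)
    hm.aestronglyMeasurable ?_
  filter_upwards [MeasureTheory.ae_restrict_mem measurableSet_Ioi] with y hy
  exact hbd y (le_of_lt hy)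

lemma integral_sub_const {p : ℝ} {f : ℝ → ℝ} (hf : PowBound p f) (hm : Measurable f)
    (hp : p < -1) :
    PowBound (p + 1) (fun y => (∫ t in (1 : ℝ)..y, f t) - ∫ t in Set.Ioi (1 : ℝ), f t) := by
  refine of_small ((-1 - p) / 2) (by linarith) fun δ hδ hδ' => ?_
  obtain ⟨C, hC, hbd⟩ := hf δ hδ
  refine ⟨C / (-(p + δ + 1)), div_nonneg hC (by linarith), fun y hy => ?_⟩
  have hii := hf.integrableOn hm hp
  have hy0 : 0 < y := by linarith
  have h1 : (∫ t in (1 : ℝ)..y, f t) - ∫ t in Set.Ioi (1 : ℝ), f t = - ∫ t in Set.Ioi y, f t := by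
    have := intervalIntegral.integral_interval_add_Ioi hii (hii.mono_set (Set.Ioi_subset_Ioi hy))
    linarith
  rw [h1, abs_neg]
  have h2 : ∫ t in Set.Ioi y, C * t ^ (p + δ) = C / (-(p + δ + 1)) * y ^ (p + 1 + δ) := by
    rw [MeasureTheory.integral_const_mul, integral_Ioi_rpow_of_lt (by linarith) hy0,
      show p + 1 + δ = p + δ + 1 by ring]
    have : p + δ + 1 ≠ 0 := by linarith
    field_simp
  rw [← h2, ← Real.norm_eq_abs]
  refine MeasureTheory.norm_integral_le_of_norm_le
    ((integrableOn_Ioi_rpow_of_lt (by linarith) hy0).const_mul C) ?_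
  filter_upwards [MeasureTheory.ae_restrict_mem measurableSet_Ioi] with t ht
  exact hbd t (hy.trans (le_of_lt ht))

lemma exists_integral_sub_const {p : ℝ} {f : ℝ → ℝ} (hf : PowBound p f) (hm : Measurable f)
    (hp : p < -1) : ∃ c : ℝ, PowBound (p + 1) (fun y => (∫ t in (1 : ℝ)..y, f t) - c) :=
  ⟨_, hf.integral_sub_const hm hp⟩

lemma integral {p : ℝ} {f : ℝ → ℝ} (hf : PowBound p f) (hp : -1 ≤ p) :
    PowBound (p + 1) (fun y => ∫ t in (1 : ℝ)..y, f t) := by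
  intro δ hδ
  obtain ⟨C, hC, hbd⟩ := hf δ hδ
  refine ⟨C / (p + δ + 1), div_nonneg hC (by linarith), fun y hy => ?_⟩
  have hy0 : 0 < y := by linarith
  have h2 : ∫ t in (1 : ℝ)..y, C * t ^ (p + δ) = C * ((y ^ (p + δ + 1) - 1) / (p + δ + 1)) := by
    rw [intervalIntegral.integral_const_mul, integral_rpow (Or.inl (by linarith)), Real.one_rpow]
  have h3 : |∫ t in (1 : ℝ)..y, f t| ≤ ∫ t in (1 : ℝ)..y, C * t ^ (p + δ) := by
    rw [← Real.norm_eq_abs]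
    refine intervalIntegral.norm_integral_le_of_norm_le hy ?_ ?_
    · filter_upwards with t ht
      exact hbd t ht.1.le
    · exact ((intervalIntegral.intervalIntegrable_rpow' (by linarith))).const_mul C
  refine h3.trans ?_
  rw [h2, show p + 1 + δ = p + δ + 1 by ring, div_mul_eq_mul_div, ← mul_div_assoc]
  have : 0 < p + δ + 1 := by linarith
  gcongr
  linarith

end PowBound

lemma measurable_intervalIntegral_right {f : ℝ → ℝ} (hf : Measurable f) (a : ℝ) :
    Measurable (fun y => ∫ t in a..y, f t) := by
  have h : ∀ s : Set (ℝ × ℝ), MeasurableSet s →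
      Measurable (fun y : ℝ => ∫ t, s.indicator (fun q : ℝ × ℝ => f q.2) (y, t)) := by
    intro s hs
    have : MeasureTheory.StronglyMeasurable (s.indicator (fun q : ℝ × ℝ => f q.2)) :=
      ((hf.comp measurable_snd).indicator hs).stronglyMeasurable
    exact this.integral_prod_right'.measurable
  simp only [intervalIntegral]
  refine Measurable.sub ?_ ?_
  · convert h {q | a < q.2 ∧ q.2 ≤ q.1} ?_ using 2 with y
    · rw [← MeasureTheory.integral_indicator measurableSet_Ioc]
      rfl
    · exact (measurableSet_lt measurable_const measurable_snd).inter
        (measurableSet_le measurable_snd measurable_fst)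
  · convert h {q | q.1 < q.2 ∧ q.2 ≤ a} ?_ using 2 with y
    · rw [← MeasureTheory.integral_indicator measurableSet_Ioc]
      rfl
    · exact (measurableSet_lt measurable_fst measurable_snd).inter
        (measurableSet_le measurable_snd measurable_const)

/-- Interchange of a finite sum of tails of integrals with the integral. -/
lemma sum_integral_swap {a b : ℝ} (ha : a ≤ 1) (hab : a ≤ b) (h : ℕ → ℝ → ℝ)
    (hii : ∀ n ∈ Icc 1 ⌊b⌋₊, IntervalIntegrable (h n) MeasureTheory.volume n b) :
    ∑ n ∈ Icc 1 ⌊b⌋₊, ∫ t in (n : ℝ)..b, h n t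
      = ∫ t in a..b, ∑ n ∈ Icc 1 ⌊t⌋₊, h n t := by
  have hnb : ∀ n ∈ Icc 1 ⌊b⌋₊, a ≤ n ∧ (n : ℝ) ≤ b := by
    intro n hn
    rw [mem_Icc] at hn
    have h1 : (1 : ℝ) ≤ n := by exact_mod_cast hn.1
    exact ⟨ha.trans h1, (Nat.le_floor_iff' (by omega)).1 hn.2⟩
  have hz : ∀ n ∈ Icc 1 ⌊b⌋₊, Set.EqOn (fun t : ℝ => if (n : ℝ) ≤ t then h n t else 0)
      (fun _ => 0) (Set.Ioo a n) := fun n _ t ht => if_neg (not_le.2 ht.2)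
  have he : ∀ n ∈ Icc 1 ⌊b⌋₊, Set.EqOn (fun t : ℝ => if (n : ℝ) ≤ t then h n t else 0)
      (h n) (Set.Ioo n b) := fun n _ t ht => if_pos ht.1.le
  have hi1 : ∀ n ∈ Icc 1 ⌊b⌋₊, IntervalIntegrable (fun t : ℝ => if (n : ℝ) ≤ t then h n t else 0)
      MeasureTheory.volume a n := by
    intro n hn
    refine (intervalIntegrable_const (c := (0 : ℝ))).congr_uIoo ?_
    rw [Set.uIoo_of_le (hnb n hn).1]
    exact (hz n hn).symm
  have hi2 : ∀ n ∈ Icc 1 ⌊b⌋₊, IntervalIntegrable (fun t : ℝ => if (n : ℝ) ≤ t then h n t else 0)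
      MeasureTheory.volume n b := by
    intro n hn
    refine (hii n hn).congr_uIoo ?_
    rw [Set.uIoo_of_le (hnb n hn).2]
    exact (he n hn).symm
  have h1 : ∫ t in a..b, ∑ n ∈ Icc 1 ⌊t⌋₊, h n t
      = ∫ t in a..b, ∑ n ∈ Icc 1 ⌊b⌋₊, if (n : ℝ) ≤ t then h n t else 0 := by
    refine intervalIntegral.integral_congr_Ioo_of_le hab fun t ht => ?_
    rw [← Finset.sum_filter]
    refine Finset.sum_congr ?_ fun _ _ => rfl
    ext n
    rw [Finset.mem_filter, mem_Icc, mem_Icc]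
    constructor
    · rintro ⟨h1, h2⟩
      exact ⟨⟨h1, h2.trans (Nat.floor_le_floor ht.2.le)⟩, (Nat.le_floor_iff' (by omega)).1 h2⟩
    · rintro ⟨⟨h1, h2⟩, h3⟩
      exact ⟨h1, (Nat.le_floor_iff' (by omega)).2 h3⟩
  rw [h1, intervalIntegral.integral_finsetSum fun n hn => (hi1 n hn).trans (hi2 n hn)]
  refine Finset.sum_congr rfl fun n hn => ?_
  rw [← intervalIntegral.integral_add_adjacent_intervals (hi1 n hn) (hi2 n hn),
    intervalIntegral.integral_congr_Ioo_of_le (hnb n hn).1 (hz n hn),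
    intervalIntegral.integral_congr_Ioo_of_le (hnb n hn).2 (he n hn)]
  simp

lemma log_le_half_sub_inv {y : ℝ} (hy : 1 ≤ y) : Real.log y ≤ (y - y⁻¹) / 2 := by
  have h := Real.self_le_sinh_iff.2 (Real.log_nonneg hy)
  rwa [Real.sinh_log (by linarith)] at h

lemma abs_harmonicReal_sub_half_le {N : ℕ} (hN : 1 ≤ N) :
    |harmonicReal N - Real.log N - Real.eulerMascheroniConstant - 1 / (2 * N)| ≤
        1 / (N : ℝ) ^ 2 := by
  have hH : ∀ n : ℕ, harmonicReal (n + 1) = harmonicReal n + 1 / ((n : ℝ) + 1) := by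
    intro n
    rw [harmonicReal, harmonicReal, Finset.sum_Icc_succ_top (by omega)]
    push_cast; rfl
  have hlog : ∀ n : ℕ, 1 ≤ n → Real.log (n + 1 : ℕ) = Real.log n + Real.log (1 + 1 / n) := by
    intro n hn
    have hn0 : (n : ℝ) ≠ 0 := by positivity
    rw [← Real.log_mul hn0 (by positivity)]
    congr 1
    push_cast
    field_simp
  have hlim : Filter.Tendsto (fun n : ℕ => harmonicReal n - Real.log n) Filter.atTop
      (nhds Real.eulerMascheroniConstant) := by
    simp_rw [harmonicReal_eq]
    exact Real.tendsto_harmonic_sub_log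
  have hinv : Filter.Tendsto (fun n : ℕ => ((n : ℝ))⁻¹) Filter.atTop (nhds 0) :=
    tendsto_inv_atTop_nhds_zero_nat
  have hlima : Filter.Tendsto (fun n : ℕ => harmonicReal n - Real.log n - (n : ℝ)⁻¹ / 2)
      Filter.atTop
      (nhds Real.eulerMascheroniConstant) := by
    simpa using hlim.sub (hinv.div_const 2)
  have hlimb : Filter.Tendsto (fun n : ℕ => harmonicReal n - Real.log n - (n : ℝ)⁻¹ / 2
      + (n : ℝ)⁻¹ ^ 2) Filter.atTop (nhds Real.eulerMascheroniConstant) := by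
    simpa using hlima.add (hinv.pow 2)
  have hup : harmonicReal N - Real.log N - (N : ℝ)⁻¹ / 2 ≤ Real.eulerMascheroniConstant := by
    refine ge_of_tendsto hlima ?_
    filter_upwards [Filter.eventually_ge_atTop N] with n hn
    induction n, hn using Nat.le_induction with
    | base => exact le_rfl
    | succ n hn ih =>
      refine ih.trans ?_
      have hn1 : 1 ≤ n := hN.trans hn
      have hn0 : (0 : ℝ) < n := by exact_mod_cast hn1
      rw [hH, hlog n hn1]
      have h1 := log_le_half_sub_inv (y := 1 + 1 / (n : ℝ)) (by linarith [one_div_pos.2 hn0])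
      have h2 : (1 + 1 / (n : ℝ) - (1 + 1 / (n : ℝ))⁻¹) / 2
          = ((n : ℝ)⁻¹ + 1 / ((n : ℝ) + 1)) / 2 := by field_simp; ring
      rw [h2] at h1
      push_cast
      rw [inv_eq_one_div ((n : ℝ) + 1)]
      linarith
  have hlow : Real.eulerMascheroniConstant ≤ harmonicReal N - Real.log N - (N : ℝ)⁻¹ / 2
      + (N : ℝ)⁻¹ ^ 2 := by
    refine le_of_tendsto hlimb ?_
    filter_upwards [Filter.eventually_ge_atTop N] with n hn
    induction n, hn using Nat.le_induction with
    | base => exact le_rfl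
    | succ n hn ih =>
      refine le_trans ?_ ih
      have hn1 : 1 ≤ n := hN.trans hn
      have hn0 : (0 : ℝ) < n := by exact_mod_cast hn1
      rw [hH, hlog n hn1]
      have h1 := Real.le_log_one_add_of_nonneg (x := 1 / (n : ℝ)) (by positivity)
      have h2 : 2 * (1 / (n : ℝ)) / (1 / n + 2) - (((n : ℝ)⁻¹ + ((n : ℝ) + 1)⁻¹) / 2
          - (n : ℝ)⁻¹ ^ 2 + ((n : ℝ) + 1)⁻¹ ^ 2)
          = ((2 * n + 1) ^ 2 * 2 - n * (n + 1)) / (2 * n ^ 2 * (n + 1) ^ 2 * (2 * n + 1)) := by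
        field_simp; ring
      have h3 : 0 ≤ ((2 * (n : ℝ) + 1) ^ 2 * 2 - n * (n + 1)) /
          (2 * n ^ 2 * (n + 1) ^ 2 * (2 * n + 1)) :=
        div_nonneg (by nlinarith) (by positivity)
      push_cast
      rw [one_div ((n : ℝ) + 1)]
      linarith
  have e1 : 1 / (2 * (N : ℝ)) = (N : ℝ)⁻¹ / 2 := by rw [one_div, mul_inv]; ring
  have e2 : 1 / (N : ℝ) ^ 2 = (N : ℝ)⁻¹ ^ 2 := by rw [one_div, inv_pow]
  rw [e1, e2, abs_le]
  have := sq_nonneg ((N : ℝ)⁻¹)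
  constructor <;> linarith

/-- `Σ_{j ≤ w} (w - j) / j`. -/
noncomputable def harmonicRiesz (w : ℝ) : ℝ := w * harmonicReal ⌊w⌋₊ - ⌊w⌋₊

lemma harmonicRiesz_eq_sum (w : ℝ) : harmonicRiesz w = ∑ j ∈ Icc 1 ⌊w⌋₊, (w - j) / j := by
  rw [harmonicRiesz, harmonicReal, Finset.mul_sum]
  have : (⌊w⌋₊ : ℝ) = ∑ j ∈ Icc 1 ⌊w⌋₊, (1 : ℝ) := by simp
  conv_lhs => rw [this, ← Finset.sum_sub_distrib]
  refine Finset.sum_congr rfl fun j hj => ?_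
  rw [mem_Icc] at hj
  have : (j : ℝ) ≠ 0 := by have := hj.1; positivity
  field_simp

lemma abs_harmonicRiesz_sub_le {w : ℝ} (hw : 1 ≤ w) :
    |harmonicRiesz w - (w * (Real.log w + Real.eulerMascheroniConstant - 1) + 1 / 2)| ≤ 10 / w := by
  set N := ⌊w⌋₊ with hN
  have hN1 : 1 ≤ N := (Nat.one_le_floor_iff w).2 hw
  have hN0 : (0 : ℝ) < N := by exact_mod_cast hN1
  have hN1' : (1 : ℝ) ≤ N := by exact_mod_cast hN1
  have hNw : (N : ℝ) ≤ w := Nat.floor_le (by linarith)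
  have hwN : w < N + 1 := Nat.lt_floor_add_one w
  have h1 := abs_harmonicReal_sub_half_le hN1
  set z := (w - N) / N with hz
  have hz0 : 0 ≤ z := div_nonneg (by linarith) hN0.le
  have hzN : z ≤ 1 / N := by rw [hz]; gcongr; linarith
  have hwz : w = N * (1 + z) := by rw [hz]; field_simp; ring
  have hlog : Real.log w = Real.log N + Real.log (1 + z) := by
    rw [hwz, Real.log_mul hN0.ne' (by linarith)]
  have h2 : |Real.log (1 + z) - z| ≤ (1 / N) ^ 2 := by
    have hu := Real.log_le_sub_one_of_pos (x := 1 + z) (by linarith)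
    have hl := Real.one_sub_inv_le_log_of_pos (x := 1 + z) (by linarith)
    have h3 : z - z ^ 2 ≤ 1 - (1 + z)⁻¹ := by
      have : 1 - (1 + z)⁻¹ - (z - z ^ 2) = z ^ 3 * (1 + z)⁻¹ := by field_simp; ring
      have : 0 ≤ z ^ 3 * (1 + z)⁻¹ := by positivity
      linarith
    have h4 : z ^ 2 ≤ (1 / (N : ℝ)) ^ 2 := by gcongr
    rw [abs_le]
    constructor <;> linarith
  set e1 := harmonicReal N - Real.log N - Real.eulerMascheroniConstant - 1 / (2 * N) with he1
  set e2 := Real.log (1 + z) - z with he2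
  have hmain : harmonicRiesz w - (w * (Real.log w + Real.eulerMascheroniConstant - 1) + 1 / 2)
      = (1 / 2 - (w - N)) * z + w * (e1 - e2) := by
    have hzz : z * N = w - N := by rw [hz]; field_simp
    have hw2 : w * (1 / (2 * N)) = 1 / 2 + z / 2 := by rw [hwz]; field_simp
    have hw3 : w * z = (w - N) + (w - N) * z := by rw [← hzz]; nth_rewrite 1 [hwz]; ring
    rw [harmonicRiesz, ← hN, hlog, he1, he2]
    linear_combination hw2 - hw3
  rw [hmain]
  have h5 : |(1 / 2 - (w - N)) * z| ≤ 1 * (1 / N) := by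
    rw [abs_mul, abs_of_nonneg hz0]
    gcongr
    rw [abs_le]; constructor <;> linarith
  have h6 : |w * (e1 - e2)| ≤ w * (1 / N ^ 2 + (1 / N) ^ 2) := by
    rw [abs_mul, abs_of_nonneg (by linarith : 0 ≤ w)]
    gcongr
    exact (abs_sub _ _).trans (add_le_add h1 h2)
  refine (abs_add_le _ _).trans ((add_le_add h5 h6).trans ?_)
  have hN2 : 1 / (N : ℝ) ≤ 2 / w := by
    rw [div_le_div_iff₀ hN0 (by linarith)]; linarith
  have hw0 : 0 < w := by linarith
  calc 1 * (1 / (N : ℝ)) + w * (1 / N ^ 2 + (1 / N) ^ 2)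
      = 1 / N + 2 * w * (1 / N * (1 / N)) := by ring
    _ ≤ 2 / w + 2 * w * (2 / w * (2 / w)) := by gcongr
    _ = 10 / w := by field_simp; norm_num

lemma measurable_floor_comp {α : Type*} [MeasurableSpace α] (f : ℕ → α) :
    Measurable (fun t : ℝ => f ⌊t⌋₊) :=
  (measurable_from_nat (f := f)).comp Nat.measurable_floor

lemma measurable_harmonicRiesz : Measurable harmonicRiesz :=
  (measurable_id.mul (measurable_floor_comp harmonicReal)).sub
    (measurable_floor_comp (fun n : ℕ => (n : ℝ)))

lemma harmonicRiesz_powBound : PowBound (-1) (fun w => harmonicRiesz w -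
    (w * (Real.log w + Real.eulerMascheroniConstant - 1) + 1 / 2)) :=
  PowBound.of_le 10 fun y hy => by
    rw [Real.rpow_neg_one, ← div_eq_mul_inv]; exact abs_harmonicRiesz_sub_le hy

/-- Partial sums of a series whose terms are `O(n ^ (p + δ))` with `p < -1`. -/
lemma exists_sum_sub_const_powBound {p : ℝ} (hp : p < -1) (a : ℕ → ℝ)
    (ha : PowBound p (fun t => a ⌊t⌋₊)) :
    ∃ c : ℝ, PowBound (p + 1) (fun y => (∑ n ∈ Icc 1 ⌊y⌋₊, a n) - c) := by
  have hm : Measurable (fun t : ℝ => a ⌊t⌋₊) := measurable_floor_comp a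
  obtain ⟨c, hc⟩ := ha.exists_integral_sub_const hm hp
  refine ⟨c, ?_⟩
  have hsum : ∀ y : ℝ, 1 ≤ y → ∑ n ∈ Icc 1 ⌊y⌋₊, a n
      = (∫ t in (1 : ℝ)..y, a ⌊t⌋₊) + ((⌊y⌋₊ : ℝ) + 1 - y) * a ⌊y⌋₊ := by
    intro y hy
    have hN1 : 1 ≤ ⌊y⌋₊ := (Nat.one_le_floor_iff y).2 hy
    have hstep : ∀ n : ℕ, 1 ≤ n → ∀ b : ℝ, (n : ℝ) ≤ b → b ≤ n + 1 →
        ∫ t in (n : ℝ)..b, a ⌊t⌋₊ = (b - n) * a n := by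
      intro n hn b hb hb'
      have : ∫ t in (n : ℝ)..b, a ⌊t⌋₊ = ∫ t in (n : ℝ)..b, a n := by
        refine intervalIntegral.integral_congr_Ioo_of_le hb fun t ht => ?_
        have : ⌊t⌋₊ = n := (Nat.floor_eq_iff (by linarith [ht.1, n.cast_nonneg (α := ℝ)])).2
          ⟨ht.1.le, by linarith [ht.2]⟩
        simp only [this]
      rw [this, intervalIntegral.integral_const, smul_eq_mul]
    have hN : ∀ N : ℕ, 1 ≤ N → ∫ t in (1 : ℝ)..N, a ⌊t⌋₊ = ∑ n ∈ Ico 1 N, a n := by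
      intro N hN
      induction N, hN using Nat.le_induction with
      | base => simp
      | succ n hn ih =>
        have h1 : (1 : ℝ) ≤ n := by exact_mod_cast hn
        rw [← intervalIntegral.integral_add_adjacent_intervals
          (ha.intervalIntegrable hm le_rfl h1) (ha.intervalIntegrable hm h1 (b := (n + 1 : ℕ))
          (by push_cast; linarith)), ih, Finset.sum_Ico_succ_top hn,
          hstep n hn _ (by push_cast; linarith) (by push_cast; rfl)]
        push_cast; ring
    have h1 : (1 : ℝ) ≤ ⌊y⌋₊ := by exact_mod_cast hN1
    have hfl := Nat.floor_le (by linarith : 0 ≤ y)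
    have hlt := Nat.lt_floor_add_one y
    rw [← intervalIntegral.integral_add_adjacent_intervals
          (ha.intervalIntegrable hm le_rfl h1) (ha.intervalIntegrable hm h1 hy), hN _ hN1,
          hstep _ hN1 _ hfl hlt.le, ← Finset.Ico_insert_right hN1, Finset.sum_insert (by simp)]
    ring
  have h2 : PowBound (p + 1) (fun y => ((⌊y⌋₊ : ℝ) + 1 - y) * a ⌊y⌋₊) :=
    (ha.mono (by linarith)).of_abs_le fun y hy => by
      have hfl := Nat.floor_le (by linarith : 0 ≤ y)
      have hlt := Nat.lt_floor_add_one y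
      rw [abs_mul]
      refine mul_le_of_le_one_left (abs_nonneg _) ?_
      rw [abs_le]; constructor <;> linarith
  refine (hc.add h2).congr fun y hy => ?_
  rw [hsum y hy]; ring

lemma powBound_floor {p : ℝ} (a : ℕ → ℝ) (f : ℝ → ℝ) (hf : PowBound p f)
    (h : ∀ n : ℕ, 1 ≤ n → |a n| ≤ |f n|) : PowBound p (fun t => a ⌊t⌋₊) := by
  intro δ hδ
  obtain ⟨C, hC, hb⟩ := hf δ hδ
  refine ⟨C * 2 ^ |p + δ|, by positivity, fun y hy => ?_⟩
  have hN1 : 1 ≤ ⌊y⌋₊ := (Nat.one_le_floor_iff y).2 hy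
  have h1 : (1 : ℝ) ≤ ⌊y⌋₊ := by exact_mod_cast hN1
  have hfl := Nat.floor_le (by linarith : 0 ≤ y)
  have hlt := Nat.lt_floor_add_one y
  refine (h _ hN1).trans ((hb _ h1).trans ?_)
  rw [mul_assoc]
  gcongr
  rcases le_total 0 (p + δ) with h0 | h0
  · calc (⌊y⌋₊ : ℝ) ^ (p + δ) ≤ y ^ (p + δ) := by gcongr
      _ ≤ 2 ^ |p + δ| * y ^ (p + δ) := by
        refine le_mul_of_one_le_left (by positivity) ?_
        exact Real.one_le_rpow (by norm_num) (abs_nonneg _)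
  · rw [abs_of_nonpos h0]
    have h2 : (y / 2) ≤ ⌊y⌋₊ := by linarith
    calc (⌊y⌋₊ : ℝ) ^ (p + δ) ≤ (y / 2) ^ (p + δ) :=
          Real.rpow_le_rpow_of_nonpos (by linarith) h2 h0
      _ = _ := by
        rw [Real.div_rpow (by linarith) (by norm_num), Real.rpow_neg (by norm_num)]
        field_simp

lemma hasSum_moebius_div_sq :
    HasSum (fun n : ℕ => (ArithmeticFunction.moebius n : ℝ) / (n : ℝ) ^ 2) (6 / Real.pi ^ 2) := by
  have h2 : (1 : ℝ) < (2 : ℂ).re := by norm_num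
  have h := ArithmeticFunction.LSeries_zeta_mul_Lseries_moebius h2
  rw [ArithmeticFunction.LSeries_zeta_eq_riemannZeta h2, riemannZeta_two] at h
  have hpi : (Real.pi : ℂ) ≠ 0 := by exact_mod_cast Real.pi_ne_zero
  have h3 : LSeries (fun n => ((ArithmeticFunction.moebius n : ℤ) : ℂ)) 2 =
      ((6 / Real.pi ^ 2 : ℝ) : ℂ) := by
    push_cast
    rw [eq_div_iff (pow_ne_zero 2 hpi)]
    linear_combination 6 * h
  have h4 : LSeriesSummable (fun n => ((ArithmeticFunction.moebius n : ℤ) : ℂ)) 2 :=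
    ArithmeticFunction.LSeriesSummable_moebius_iff.2 h2
  have h5 := h4.LSeriesHasSum
  rw [LSeriesHasSum, h3] at h5
  rw [← Complex.hasSum_ofReal]
  convert h5 using 2 with n
  rw [LSeries.term_def]
  split_ifs with h0
  · simp [h0]
  · push_cast
    norm_num

lemma moebius_sum_powBound : PowBound (-1) (fun y =>
    (∑ d ∈ Icc 1 ⌊y⌋₊, (ArithmeticFunction.moebius d : ℝ) / (d : ℝ) ^ 2) - 6 / Real.pi ^ 2) := by
  have hb : PowBound (-2) (fun t : ℝ =>
      (fun n : ℕ => (ArithmeticFunction.moebius n : ℝ) / (n : ℝ) ^ 2) ⌊t⌋₊) :=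
    powBound_floor (fun n : ℕ => (ArithmeticFunction.moebius n : ℝ) / (n : ℝ) ^ 2) _
      PowBound.inv_sq fun n hn => by
      have h1 : |(ArithmeticFunction.moebius n : ℝ)| ≤ 1 := by
        exact_mod_cast ArithmeticFunction.abs_moebius_le_one
      simp only [div_eq_mul_inv, abs_mul]
      exact mul_le_of_le_one_left (abs_nonneg _) h1
  obtain ⟨c, hc⟩ := exists_sum_sub_const_powBound (p := -2) (by norm_num)
    (fun n : ℕ => (ArithmeticFunction.moebius n : ℝ) / (n : ℝ) ^ 2) hb
  have hc1 : c = 6 / Real.pi ^ 2 := by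
    have h1 : Filter.Tendsto (fun N : ℕ => ∑ d ∈ Icc 1 N,
        (ArithmeticFunction.moebius d : ℝ) / (d : ℝ) ^ 2)
        Filter.atTop (nhds (6 / Real.pi ^ 2)) := by
      have := (hasSum_moebius_div_sq.tendsto_sum_nat).comp (Filter.tendsto_add_atTop_nat 1)
      refine this.congr fun N => ?_
      simp only [Function.comp_apply]
      rw [Finset.range_eq_Ico, Finset.sum_eq_sum_Ico_succ_bot (by omega)]
      simp only [ArithmeticFunction.map_zero, Int.cast_zero, zero_div, zero_add]
      rfl
    refine tendsto_nhds_unique ?_ h1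
    obtain ⟨C, hC, hb⟩ := hc (1 / 2) (by norm_num)
    rw [tendsto_iff_norm_sub_tendsto_zero]
    refine squeeze_zero' (Filter.Eventually.of_forall fun _ => norm_nonneg _)
      (g := fun N : ℕ => C * (N : ℝ) ^ (-(1 / 2) : ℝ)) ?_ ?_
    · filter_upwards [Filter.eventually_ge_atTop 1] with N hN
      have := hb N (by exact_mod_cast hN)
      simp only [Nat.floor_natCast] at this
      rw [Real.norm_eq_abs]
      norm_num at this ⊢
      exact this
    · have := ((tendsto_rpow_neg_atTop (show (0 : ℝ) < 1 / 2 by norm_num)).comp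
        tendsto_natCast_atTop_atTop).const_mul C
      simpa using this
  rw [← hc1]
  norm_num at hc
  exact hc

/-- `Σ_{r ≤ R} φ(r) / r`. -/
noncomputable def totSum (R : ℝ) : ℝ := ∑ r ∈ Icc 1 ⌊R⌋₊, (Nat.totient r : ℝ) / r

lemma totient_div_eq {r : ℕ} (hr : 0 < r) :
    (Nat.totient r : ℝ) / r = ∑ d ∈ r.divisors, (ArithmeticFunction.moebius d : ℝ) / d := by
  rw [← ramanujanSum_self_of_dvd r 0 hr (dvd_zero r), ramanujanSum_eq_sum_moebius r hr,
    Finset.sum_div, Nat.sum_divisorsAntidiagonal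
      (fun a b => (ArithmeticFunction.moebius a : ℝ) * (if b ∣ 0 then (b : ℝ) else 0) / r)]
  refine Finset.sum_congr rfl fun d hd => ?_
  obtain ⟨c, hc⟩ := Nat.dvd_of_mem_divisors hd
  have hd0 : 0 < d := Nat.pos_of_mem_divisors hd
  have hc0 : 0 < c := Nat.pos_of_ne_zero (by rintro rfl; simp at hc; omega)
  rw [if_pos (dvd_zero _), hc, Nat.mul_div_cancel_left _ hd0]
  have h1 : (d : ℝ) ≠ 0 := by positivity
  have h2 : (c : ℝ) ≠ 0 := by positivity
  push_cast
  field_simp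

lemma totSum_powBound : PowBound 0 (fun R => totSum R - 6 / Real.pi ^ 2 * R) := by
  have h1 : ∀ R : ℝ, totSum R = ∑ d ∈ Icc 1 ⌊R⌋₊,
      (ArithmeticFunction.moebius d : ℝ) / d * (⌊R⌋₊ / d : ℕ) := by
    intro R
    rw [totSum]
    have : ∀ r ∈ Icc 1 ⌊R⌋₊, (Nat.totient r : ℝ) / r
        = ∑ d ∈ r.divisors, (fun a _ => (ArithmeticFunction.moebius a : ℝ) / a) d (r / d) := by
      intro r hr
      rw [mem_Icc] at hr
      exact totient_div_eq (by omega)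
    rw [Finset.sum_congr rfl this,
      sum_Icc_divisors (fun a _ => (ArithmeticFunction.moebius a : ℝ) / a)]
    refine Finset.sum_congr rfl fun d _ => ?_
    rw [Finset.sum_const, Nat.card_Icc, nsmul_eq_mul, mul_comm]
    simp
  have h2 : PowBound 0 (fun R => ∑ d ∈ Icc 1 ⌊R⌋₊,
      (ArithmeticFunction.moebius d : ℝ) / d * ((⌊R⌋₊ / d : ℕ) - R / d)) := by
    refine ((PowBound.const 1).add PowBound.log).of_abs_le fun R hR => ?_
    have hlog := Real.log_nonneg hR
    rw [abs_of_nonneg (by linarith : (0 : ℝ) ≤ 1 + Real.log R)]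
    refine (Finset.abs_sum_le_sum_abs _ _).trans
      (le_trans (Finset.sum_le_sum fun d hd => ?_) (harmonicReal_floor_le hR))
    rw [mem_Icc] at hd
    have hd0 : (0 : ℝ) < d := by have := hd.1; positivity
    have hmu : |(ArithmeticFunction.moebius d : ℝ)| ≤ 1 := by
      exact_mod_cast ArithmeticFunction.abs_moebius_le_one
    rw [← Nat.floor_div_natCast R d]
    have hRd : 0 ≤ R / d := by positivity
    have h3 := Nat.floor_le hRd
    have h4 := Nat.lt_floor_add_one (R / d)
    rw [abs_mul, abs_div, abs_of_pos hd0]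
    calc |(ArithmeticFunction.moebius d : ℝ)| / d * |(⌊R / d⌋₊ : ℝ) - R / d| ≤ 1 / d * 1 := by
          gcongr
          rw [abs_le]; constructor <;> linarith
      _ = 1 / d := mul_one _
  have h3 := PowBound.id.mul moebius_sum_powBound
  norm_num at h3
  refine (h2.add h3).congr fun R hR => ?_
  rw [h1]
  have : R * (∑ d ∈ Icc 1 ⌊R⌋₊, (ArithmeticFunction.moebius d : ℝ) / (d : ℝ) ^ 2)
      = ∑ d ∈ Icc 1 ⌊R⌋₊, (ArithmeticFunction.moebius d : ℝ) / d * (R / d) := by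
    rw [Finset.mul_sum]
    refine Finset.sum_congr rfl fun d _ => ?_
    rw [sq]; simp only [div_eq_mul_inv, mul_inv]; ring
  rw [mul_sub, this]
  simp only [mul_sub, Finset.sum_sub_distrib]
  ring

lemma measurable_totSum : Measurable totSum :=
  measurable_floor_comp (fun N : ℕ => ∑ r ∈ Icc 1 N, (Nat.totient r : ℝ) / r)

/-- Interchange of sum and integral for `Σ_{r ≤ y} c_r ∫_1^{y/r} g`. -/
lemma sum_integral_div_swap {y : ℝ} (hy : 1 ≤ y) (c : ℕ → ℝ) (g : ℝ → ℝ)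
    (hg : ∀ b, 1 ≤ b → IntervalIntegrable g MeasureTheory.volume 1 b) :
    ∑ r ∈ Icc 1 ⌊y⌋₊, c r * ∫ w in (1 : ℝ)..(y / r), g w
      = ∫ w in (1 : ℝ)..y, g w * ∑ r ∈ Icc 1 ⌊y / w⌋₊, c r := by
  have hr : ∀ r ∈ Icc 1 ⌊y⌋₊, (0 : ℝ) < r ∧ 1 ≤ y / r ∧ y / r ≤ y := by
    intro r hr
    rw [mem_Icc] at hr
    have h1 : (1 : ℝ) ≤ r := by exact_mod_cast hr.1
    have h2 : (r : ℝ) ≤ y := (Nat.le_floor_iff' (by omega)).1 hr.2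
    exact ⟨by linarith, by rw [one_le_div (by linarith)]; exact h2, div_le_self (by linarith) h1⟩
  have hz : ∀ r ∈ Icc 1 ⌊y⌋₊, Set.EqOn (fun w : ℝ => if w ≤ y / r then c r * g w else 0)
      (fun _ => 0) (Set.Ioo (y / r) y) := fun r _ w hw => if_neg (not_le.2 hw.1)
  have he : ∀ r ∈ Icc 1 ⌊y⌋₊, Set.EqOn (fun w : ℝ => if w ≤ y / r then c r * g w else 0)
      (fun w => c r * g w) (Set.Ioo 1 (y / r)) := fun r _ w hw => if_pos hw.2.le
  have hi1 : ∀ r ∈ Icc 1 ⌊y⌋₊, IntervalIntegrable (fun w : ℝ => if w ≤ y / r then c r * g w else 0)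
      MeasureTheory.volume 1 (y / r) := by
    intro r hr'
    refine ((hg _ (hr r hr').2.1).const_mul (c r)).congr_uIoo ?_
    rw [Set.uIoo_of_le (hr r hr').2.1]
    exact (he r hr').symm
  have hi2 : ∀ r ∈ Icc 1 ⌊y⌋₊, IntervalIntegrable (fun w : ℝ => if w ≤ y / r then c r * g w else 0)
      MeasureTheory.volume (y / r) y := by
    intro r hr'
    refine (intervalIntegrable_const (c := (0 : ℝ))).congr_uIoo ?_
    rw [Set.uIoo_of_le (hr r hr').2.2]
    exact (hz r hr').symm
  have h1 : ∫ w in (1 : ℝ)..y, g w * ∑ r ∈ Icc 1 ⌊y / w⌋₊, c r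
      = ∫ w in (1 : ℝ)..y, ∑ r ∈ Icc 1 ⌊y⌋₊, if w ≤ y / r then c r * g w else 0 := by
    refine intervalIntegral.integral_congr_Ioo_of_le hy fun w hw => ?_
    have hw0 : 0 < w := by linarith [hw.1]
    rw [← Finset.sum_filter, ← Finset.sum_mul, mul_comm]
    congr 1
    refine Finset.sum_congr ?_ fun _ _ => rfl
    ext r
    rw [Finset.mem_filter, mem_Icc, mem_Icc]
    constructor
    · rintro ⟨h1, h2⟩
      have h0 : (0 : ℝ) < r := by positivity
      have h3 := (Nat.le_floor_iff' (by omega)).1 h2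
      have h4 : (r : ℝ) ≤ y := h3.trans (div_le_self (by linarith) hw.1.le)
      refine ⟨⟨h1, (Nat.le_floor_iff' (by omega)).2 h4⟩, ?_⟩
      rw [le_div_iff₀ hw0] at h3
      rw [le_div_iff₀ h0]; linarith
    · rintro ⟨⟨h1, h2⟩, h3⟩
      have h0 : (0 : ℝ) < r := by positivity
      refine ⟨h1, (Nat.le_floor_iff' (by omega)).2 ?_⟩
      rw [le_div_iff₀ h0] at h3
      rw [le_div_iff₀ hw0]; linarith
  rw [h1, intervalIntegral.integral_finsetSum fun r hr => (hi1 r hr).trans (hi2 r hr)]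
  refine Finset.sum_congr rfl fun r hr' => ?_
  rw [← intervalIntegral.integral_add_adjacent_intervals (hi1 r hr') (hi2 r hr'),
    intervalIntegral.integral_congr_Ioo_of_le (hr r hr').2.1 (he r hr'),
    intervalIntegral.integral_congr_Ioo_of_le (hr r hr').2.2 (hz r hr'),
    intervalIntegral.integral_const_mul]
  simp

/-- `Σ_{r ≤ y} (φ(r) / r) f(y / r)`. -/
noncomputable def totConv (f : ℝ → ℝ) (y : ℝ) : ℝ :=
  ∑ r ∈ Icc 1 ⌊y⌋₊, (Nat.totient r : ℝ) / r * f (y / r)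

lemma totConv_congr {f g : ℝ → ℝ} (h : ∀ Z, 1 ≤ Z → f Z = g Z) (y : ℝ) :
    totConv f y = totConv g y := by
  refine Finset.sum_congr rfl fun r hr => ?_
  rw [mem_Icc] at hr
  have h0 : (0 : ℝ) < r := by have := hr.1; positivity
  rw [h _ ((one_le_div h0).2 ((Nat.le_floor_iff' (by omega)).1 hr.2))]

lemma totConv_add (f g : ℝ → ℝ) (y : ℝ) :
    totConv (fun Z => f Z + g Z) y = totConv f y + totConv g y := by
  simp only [totConv, mul_add, Finset.sum_add_distrib]

lemma totConv_const_mul (c : ℝ) (f : ℝ → ℝ) (y : ℝ) :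
    totConv (fun Z => c * f Z) y = c * totConv f y := by
  simp only [totConv, Finset.mul_sum]
  exact Finset.sum_congr rfl fun r _ => by ring

lemma totConv_eq {f g : ℝ → ℝ} {c p : ℝ} (hgm : Measurable g) (hg : PowBound p g)
    (h : ∀ Z, 1 ≤ Z → f Z = c + ∫ w in (1 : ℝ)..Z, g w) {y : ℝ} (hy : 1 ≤ y) :
    totConv f y = c * totSum y + 6 / Real.pi ^ 2 * y * (∫ w in (1 : ℝ)..y, g w * w⁻¹)
      + ∫ w in (1 : ℝ)..y, g w * (totSum (y / w) - 6 / Real.pi ^ 2 * (y / w)) := by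
  have h1 : totConv f y = c * totSum y + ∫ w in (1 : ℝ)..y, g w * totSum (y / w) := by
    rw [totConv_congr h, totConv_add]
    congr 1
    · rw [totConv, ← Finset.sum_mul, totSum, mul_comm]
    · exact sum_integral_div_swap hy (fun r => (Nat.totient r : ℝ) / r) g
        (fun b hb => hg.intervalIntegrable hgm le_rfl hb)
  have hi1 : IntervalIntegrable (fun w => g w * w⁻¹) MeasureTheory.volume 1 y :=
    (hg.mul PowBound.inv).intervalIntegrable (hgm.mul measurable_id.inv) le_rfl hy
  have hi2 : IntervalIntegrable (fun w => g w * totSum (y / w)) MeasureTheory.volume 1 y := by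
    have hm : Measurable (fun w => g w * totSum (y / w)) :=
      hgm.mul (measurable_totSum.comp (measurable_const.div measurable_id))
    refine ((hg.const_mul (y + y)).intervalIntegrable (hgm.const_mul _) le_rfl hy).mono_fun
      hm.aestronglyMeasurable ?_
    filter_upwards [MeasureTheory.ae_restrict_mem measurableSet_uIoc] with w hw
    rw [Set.uIoc_of_le hy] at hw
    have hw0 : 0 < w := by linarith [hw.1]
    rw [norm_mul, norm_mul, mul_comm]
    gcongr
    rw [Real.norm_eq_abs, Real.norm_eq_abs, abs_of_nonneg (by linarith : 0 ≤ y + y),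
      abs_of_nonneg (Finset.sum_nonneg fun r _ => by positivity)]
    calc totSum (y / w) ≤ ∑ r ∈ Icc 1 ⌊y / w⌋₊, (1 : ℝ) := by
          refine Finset.sum_le_sum fun r hr => ?_
          rw [mem_Icc] at hr
          have h0 : (0 : ℝ) < r := by have := hr.1; positivity
          rw [div_le_one h0]
          exact_mod_cast Nat.totient_le r
      _ = ⌊y / w⌋₊ := by simp
      _ ≤ y / w := Nat.floor_le (by positivity)
      _ ≤ y := div_le_self (by linarith) hw.1.le
      _ ≤ y + y := by linarith
  rw [h1, ← intervalIntegral.integral_const_mul, add_assoc,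
    ← intervalIntegral.integral_add (hi1.const_mul _)]
  · congr 1
    refine intervalIntegral.integral_congr fun w _ => ?_
    rw [div_eq_mul_inv]; ring
  · refine (hi2.sub (hi1.const_mul (6 / Real.pi ^ 2 * y))).congr fun w _ => ?_
    rw [div_eq_mul_inv y w]; ring

/-- The error term in `Σ_{r ≤ R} φ(r) / r = 6 / π² * R + …`. -/
noncomputable def totErr (R : ℝ) : ℝ := totSum R - 6 / Real.pi ^ 2 * R

lemma measurable_totErr : Measurable totErr := measurable_totSum.sub (measurable_id.const_mul _)

lemma totErr_powBound : PowBound 0 totErr := totSum_powBound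

lemma integral_comp_div_left {y : ℝ} (hy : 1 ≤ y) (g : ℝ → ℝ) :
    ∫ w in (1 : ℝ)..y, g w = ∫ v in (1 : ℝ)..y, y / v ^ 2 * g (y / v) := by
  rw [intervalIntegral.integral_of_le hy, intervalIntegral.integral_of_le hy,
    ← MeasureTheory.integral_Icc_eq_integral_Ioc, ← MeasureTheory.integral_Icc_eq_integral_Ioc]
  have himg : (fun v : ℝ => y / v) '' Set.Icc 1 y = Set.Icc 1 y := by
    have hmaps : Set.MapsTo (fun v : ℝ => y / v) (Set.Icc 1 y) (Set.Icc 1 y) := by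
      intro v hv
      have hv0 : 0 < v := by linarith [hv.1]
      exact ⟨(one_le_div hv0).2 hv.2, div_le_self (by linarith) hv.1⟩
    refine Set.Subset.antisymm hmaps.image_subset fun v hv => ⟨y / v, hmaps hv, ?_⟩
    have hv0 : v ≠ 0 := by linarith [hv.1]
    have hy0 : y ≠ 0 := by linarith
    simp only
    field_simp
  conv_lhs => rw [← himg]
  rw [MeasureTheory.integral_image_eq_integral_abs_deriv_smul (f' := fun v => - (y / v ^ 2))
    measurableSet_Icc]
  · refine MeasureTheory.setIntegral_congr_fun measurableSet_Icc fun v hv => ?_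
    have hv0 : 0 < v := by linarith [hv.1]
    simp only [smul_eq_mul, abs_neg]
    rw [abs_of_nonneg (by positivity)]
  · intro v hv
    have hv0 : v ≠ 0 := by linarith [hv.1]
    refine (((hasDerivAt_inv hv0).const_mul y).hasDerivWithinAt).congr_deriv ?_
    rw [div_eq_mul_inv]; ring
  · intro a ha b hb hab
    have ha0 : a ≠ 0 := by linarith [ha.1]
    have hb0 : b ≠ 0 := by linarith [hb.1]
    have hy0 : y ≠ 0 := by linarith
    simp only at hab
    field_simp at hab
    exact hab.symm

lemma exists_integral_mul_totErr (p i : ℕ) : ∃ q : Polynomial ℝ, q.natDegree ≤ i ∧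
    PowBound 0 (fun y => (∫ w in (1 : ℝ)..y, w ^ p * Real.log w ^ i * totErr (y / w))
      - y ^ (p + 1) * q.eval (Real.log y)) := by
  have hm : ∀ k, Measurable (fun v : ℝ => (v ^ (p + 2))⁻¹ * Real.log v ^ k * totErr v) := fun k =>
    (((measurable_id.pow_const _).inv).mul (Real.measurable_log.pow_const _)).mul measurable_totErr
  have hpb : ∀ k, PowBound (-(p + 2 : ℝ))
      (fun v : ℝ => (v ^ (p + 2))⁻¹ * Real.log v ^ k * totErr v) := by
    intro k
    have h1 : PowBound (-(p + 2 : ℝ)) (fun v : ℝ => (v ^ (p + 2))⁻¹) :=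
      (PowBound.rpow _).congr fun y hy => by
        rw [Real.rpow_neg (by linarith)]
        congr 1
        exact_mod_cast (Real.rpow_natCast y (p + 2)).symm
    have := (h1.mul (PowBound.log_pow k)).mul totErr_powBound
    simpa only [add_zero] using this
  have hex : ∀ k, ∃ c : ℝ, PowBound (-(p + 2 : ℝ) + 1) (fun y => (∫ v in (1 : ℝ)..y,
      (v ^ (p + 2))⁻¹ * Real.log v ^ k * totErr v) - c) := fun k =>
    (hpb k).exists_integral_sub_const (hm k)
      (by have : (0 : ℝ) ≤ p := Nat.cast_nonneg p; linarith)
  choose c hc using hex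
  refine ⟨∑ k ∈ range (i + 1), Polynomial.C ((-1) ^ k * (i.choose k) * c k) *
      Polynomial.X ^ (i - k),
    ?_, ?_⟩
  · refine Polynomial.natDegree_sum_le_of_forall_le _ _ fun k _ => ?_
    exact (Polynomial.natDegree_C_mul_X_pow_le _ _).trans (Nat.sub_le _ _)
  have hsum : PowBound 0 (fun y => ∑ k ∈ range (i + 1), (-1) ^ k * (i.choose k : ℝ) *
      (y ^ (p + 1) * (Real.log y ^ (i - k) * ((∫ v in (1 : ℝ)..y,
      (v ^ (p + 2))⁻¹ * Real.log v ^ k * totErr v) - c k)))) := by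
    refine PowBound.sum _ fun k _ => ?_
    refine PowBound.const_mul _ ?_
    have h1 : PowBound (p + 1 : ℝ) (fun y : ℝ => y ^ (p + 1)) :=
      (PowBound.rpow _).congr fun y _ => by exact_mod_cast (Real.rpow_natCast y (p + 1)).symm
    have := h1.mul ((PowBound.log_pow (i - k)).mul (hc k))
    convert this using 1
    ring
  refine hsum.congr fun y hy => ?_
  have hy0 : 0 < y := by linarith
  rw [integral_comp_div_left hy]
  have h2 : ∀ v ∈ Set.uIcc 1 y, y / v ^ 2 * ((y / v) ^ p * Real.log (y / v) ^ i *
      totErr (y / (y / v)))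
      = ∑ k ∈ range (i + 1), (-1) ^ k * (i.choose k : ℝ) * (y ^ (p + 1) * (Real.log y ^ (i - k))) *
        ((v ^ (p + 2))⁻¹ * Real.log v ^ k * totErr v) := by
    intro v hv
    rw [Set.uIcc_of_le hy] at hv
    have hv0 : 0 < v := by linarith [hv.1]
    rw [show y / (y / v) = v by field_simp, Real.log_div hy0.ne' hv0.ne',
      show Real.log y - Real.log v = - Real.log v + Real.log y by ring, add_pow,
      Finset.mul_sum, Finset.sum_mul, Finset.mul_sum]
    refine Finset.sum_congr rfl fun k _ => ?_
    rw [neg_pow, div_pow, pow_add v p 2, mul_inv]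
    simp only [div_eq_mul_inv]
    ring
  rw [intervalIntegral.integral_congr h2, intervalIntegral.integral_finsetSum fun k _ =>
    ((hpb k).intervalIntegrable (hm k) le_rfl hy).const_mul _]
  simp only [intervalIntegral.integral_const_mul]
  rw [Polynomial.eval_finsetSum, Finset.mul_sum, ← Finset.sum_sub_distrib]
  refine Finset.sum_congr rfl fun k _ => ?_
  simp only [Polynomial.eval_mul, Polynomial.eval_C, Polynomial.eval_pow, Polynomial.eval_X]
  ring

/-- `F y = y² P(log y) + y R(log y) + O(y^ε)` with `R` of degree at most `n` and with
coefficient `a` at `n`. -/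
def HasExp (n : ℕ) (a : ℝ) (F : ℝ → ℝ) : Prop :=
  ∃ P R : Polynomial ℝ, R.natDegree ≤ n ∧ R.coeff n = a ∧
    PowBound 0 (fun y => F y - (y ^ 2 * P.eval (Real.log y) + y * R.eval (Real.log y)))

namespace HasExp

lemma congr {n : ℕ} {a : ℝ} {F G : ℝ → ℝ} (hF : HasExp n a F) (h : ∀ y, 1 ≤ y → G y = F y) :
    HasExp n a G := by
  obtain ⟨P, R, h1, h2, h3⟩ := hF
  exact ⟨P, R, h1, h2, h3.congr fun y hy => by rw [h y hy]⟩

lemma add {n : ℕ} {a b : ℝ} {F G : ℝ → ℝ} (hF : HasExp n a F) (hG : HasExp n b G) :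
    HasExp n (a + b) (fun y => F y + G y) := by
  obtain ⟨P, R, h1, h2, h3⟩ := hF
  obtain ⟨P', R', h1', h2', h3'⟩ := hG
  refine ⟨P + P', R + R', (Polynomial.natDegree_add_le _ _).trans (max_le h1 h1'), ?_,
    (h3.add h3').congr fun y _ => ?_⟩
  · rw [Polynomial.coeff_add, h2, h2']
  · simp only [Polynomial.eval_add]; ring

lemma const_mul {n : ℕ} {a : ℝ} {F : ℝ → ℝ} (c : ℝ) (hF : HasExp n a F) :
    HasExp n (c * a) (fun y => c * F y) := by
  obtain ⟨P, R, h1, h2, h3⟩ := hF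
  refine ⟨Polynomial.C c * P, Polynomial.C c * R, (Polynomial.natDegree_C_mul_le _ _).trans h1, ?_,
    (h3.const_mul c).congr fun y _ => ?_⟩
  · rw [Polynomial.coeff_C_mul, h2]
  · simp only [Polynomial.eval_mul, Polynomial.eval_C]; ring

lemma lift {m n : ℕ} {a : ℝ} {F : ℝ → ℝ} (hF : HasExp m a F) (h : m < n) : HasExp n 0 F := by
  obtain ⟨P, R, h1, h2, h3⟩ := hF
  exact ⟨P, R, h1.trans h.le, Polynomial.coeff_eq_zero_of_natDegree_lt (h1.trans_lt h), h3⟩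

lemma of_powBound {n : ℕ} {F : ℝ → ℝ} (hF : PowBound 0 F) : HasExp n 0 F :=
  ⟨0, 0, by simp, by simp, hF.congr fun y _ => by simp⟩

lemma monomial (n : ℕ) (a : ℝ) : HasExp n a (fun y => y * (a * Real.log y ^ n)) :=
  ⟨0, Polynomial.C a * Polynomial.X ^ n, Polynomial.natDegree_C_mul_X_pow_le _ _, by simp,
    (PowBound.const 0).congr fun y _ => by simp⟩

lemma of_quadratic (P : Polynomial ℝ) (n : ℕ) : HasExp n 0 (fun y => y ^ 2 * P.eval (Real.log y)) :=
  ⟨P, 0, by simp, by simp, (PowBound.const 0).congr fun y _ => by simp⟩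

lemma sum {ι : Type*} {n : ℕ} {a : ι → ℝ} {F : ι → ℝ → ℝ} (s : Finset ι)
    (h : ∀ i ∈ s, HasExp n (a i) (F i)) : HasExp n (∑ i ∈ s, a i) (fun y => ∑ i ∈ s, F i y) := by
  induction s using Finset.induction_on with
  | empty => simpa using of_powBound (n := n) ((PowBound.const 0))
  | insert i s hi ih =>
    simp only [Finset.sum_insert hi]
    exact (h i (Finset.mem_insert_self _ _)).add
      (ih fun j hj => h j (Finset.mem_insert_of_mem hj))

end HasExp

lemma hasExp_totSum : HasExp 0 (6 / Real.pi ^ 2) totSum :=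
  ((HasExp.monomial 0 (6 / Real.pi ^ 2)).add (HasExp.of_powBound totErr_powBound)).congr
    (fun y _ => by rw [totErr]; ring) |> fun h => by simpa using h

lemma hasDerivAt_pow_mul_log_pow (p i : ℕ) {w : ℝ} (hw : 0 < w) :
    HasDerivAt (fun w : ℝ => w ^ (p + 1) * Real.log w ^ i)
      (w ^ p * ((p + 1) * Real.log w ^ i + i * Real.log w ^ (i - 1))) w := by
  have := (hasDerivAt_pow (p + 1) w).mul ((Real.hasDerivAt_log hw.ne').pow i)
  refine this.congr_deriv ?_
  simp only [Nat.add_sub_cancel, Pi.pow_apply]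
  push_cast
  field_simp
  ring_nf

lemma intervalIntegrable_of_continuousOn_Ici {f : ℝ → ℝ} (hf : ContinuousOn f (Set.Ici 1)) {y : ℝ}
    (hy : 1 ≤ y) : IntervalIntegrable f MeasureTheory.volume 1 y := by
  apply ContinuousOn.intervalIntegrable
  rw [Set.uIcc_of_le hy]
  exact hf.mono Set.Icc_subset_Ici_self

lemma integral_deriv_eq_sub_of_Ici {f g : ℝ → ℝ} (h : ∀ w, 1 ≤ w → HasDerivAt f (g w) w)
    (hg : ContinuousOn g (Set.Ici 1)) {y : ℝ} (hy : 1 ≤ y) :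
    ∫ w in (1 : ℝ)..y, g w = f y - f 1 := by
  apply intervalIntegral.integral_eq_sub_of_hasDerivAt
  · intro w hw
    rw [Set.uIcc_of_le hy] at hw
    exact h w hw.1
  · exact intervalIntegrable_of_continuousOn_Ici hg hy

lemma continuousOn_log_Ici : ContinuousOn Real.log (Set.Ici 1) :=
  Real.continuousOn_log.mono fun w hw => by
    have : (1 : ℝ) ≤ w := hw
    simp only [Set.mem_compl_iff, Set.mem_singleton_iff]; linarith

lemma exists_integral_log_pow (i : ℕ) : ∃ (q : Polynomial ℝ) (c : ℝ), ∀ y : ℝ, 1 ≤ y →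
    ∫ w in (1 : ℝ)..y, Real.log w ^ i = y * q.eval (Real.log y) + c := by
  induction i with
  | zero =>
    refine ⟨1, -1, fun y _ => ?_⟩
    simp [sub_eq_add_neg]
  | succ i ih =>
    obtain ⟨q, c, h⟩ := ih
    refine ⟨Polynomial.X ^ (i + 1) - Polynomial.C ((i : ℝ) + 1) * q, -((i + 1) * c), fun y hy => ?_⟩
    have h1 : ∫ w in (1 : ℝ)..y, (Real.log w ^ (i + 1) + (i + 1) * Real.log w ^ i)
        = y * Real.log y ^ (i + 1) := by
      rw [integral_deriv_eq_sub_of_Ici (f := fun w => w * Real.log w ^ (i + 1)) ?_ ?_ hy]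
      · simp
      · intro w hw
        refine (hasDerivAt_pow_mul_log_pow 0 (i + 1) (by linarith : 0 < w)).congr_of_eventuallyEq ?_
          |>.congr_deriv ?_
        · exact Filter.Eventually.of_forall fun w => by simp
        · simp
      · exact (continuousOn_log_Ici.pow _).add (continuousOn_const.mul (continuousOn_log_Ici.pow _))
    rw [intervalIntegral.integral_add, intervalIntegral.integral_const_mul, h y hy] at h1
    · simp only [Polynomial.eval_sub, Polynomial.eval_pow, Polynomial.eval_X, Polynomial.eval_mul,
        Polynomial.eval_C]
      linear_combination h1
    · exact intervalIntegrable_of_continuousOn_Ici (continuousOn_log_Ici.pow _) hy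
    · exact intervalIntegrable_of_continuousOn_Ici
        (continuousOn_const.mul (continuousOn_log_Ici.pow _)) hy

lemma totConv_pow_mul_log_pow (p i : ℕ) {y : ℝ} (hy : 1 ≤ y) :
    totConv (fun Z => Z ^ (p + 1) * Real.log Z ^ i) y = 0 ^ i * totSum y
      + 6 / Real.pi ^ 2 * y * (∫ w in (1 : ℝ)..y,
        w ^ p * ((p + 1) * Real.log w ^ i + i * Real.log w ^ (i - 1)) * w⁻¹)
      + ((p + 1) * (∫ w in (1 : ℝ)..y, w ^ p * Real.log w ^ i * totErr (y / w))
        + i * ∫ w in (1 : ℝ)..y, w ^ p * Real.log w ^ (i - 1) * totErr (y / w)) := by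
  have hpow : PowBound p (fun w : ℝ => w ^ p) := (PowBound.rpow p).congr fun y _ => by simp
  have hpb : PowBound p (fun w : ℝ => w ^ p * ((p + 1) * Real.log w ^ i + i *
      Real.log w ^ (i - 1))) := by
    have := hpow.mul (((PowBound.log_pow i).const_mul ((p : ℝ) + 1)).add
      ((PowBound.log_pow (i - 1)).const_mul i))
    simpa using this
  have hii : ∀ k, IntervalIntegrable (fun w => w ^ p * Real.log w ^ k * totErr (y / w))
      MeasureTheory.volume 1 y := by
    intro k
    obtain ⟨C, hC, hb⟩ := totErr_powBound 1 one_pos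
    have hk : PowBound p (fun w : ℝ => w ^ p * Real.log w ^ k) := by
      simpa using hpow.mul (PowBound.log_pow k)
    have hkm : Measurable (fun w : ℝ => w ^ p * Real.log w ^ k) :=
      (measurable_id.pow_const _).mul (Real.measurable_log.pow_const _)
    refine ((hk.intervalIntegrable hkm le_rfl hy).mul_const (C * y)).mono_fun
      (hkm.mul (measurable_totErr.comp (measurable_const.div measurable_id))).aestronglyMeasurable
          ?_
    filter_upwards [MeasureTheory.ae_restrict_mem measurableSet_uIoc] with w hw
    rw [Set.uIoc_of_le hy] at hw
    have hw0 : 0 < w := by linarith [hw.1]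
    rw [norm_mul, norm_mul _ (C * y)]
    gcongr
    rw [Real.norm_eq_abs, Real.norm_eq_abs]
    refine (hb (y / w) ((one_le_div hw0).2 hw.2)).trans ?_
    rw [abs_of_nonneg (by positivity : 0 ≤ C * y), zero_add, Real.rpow_one]
    gcongr
    exact div_le_self (by linarith) hw.1.le
  have hgm : Measurable (fun w : ℝ => w ^ p * ((p + 1) * Real.log w ^ i + i *
      Real.log w ^ (i - 1))) :=
    ((measurable_id.pow_const p)).mul (((Real.measurable_log.pow_const i).const_mul _).add
      ((Real.measurable_log.pow_const (i - 1)).const_mul _))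
  rw [totConv_eq hgm hpb (c := 0 ^ i) ?_ hy]
  · congr 1
    rw [← intervalIntegral.integral_const_mul, ← intervalIntegral.integral_const_mul,
      ← intervalIntegral.integral_add ((hii _).const_mul _) ((hii _).const_mul _)]
    refine intervalIntegral.integral_congr fun w _ => ?_
    simp only [totErr]
    ring
  · intro Z hZ
    have := integral_deriv_eq_sub_of_Ici
      (fun w (hw : 1 ≤ w) => hasDerivAt_pow_mul_log_pow p i (by linarith : 0 < w)) ?_ hZ
    · rw [this]
      simp
    · exact (continuousOn_id.pow _).mul ((continuousOn_const.mul (continuousOn_log_Ici.pow _)).add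
        (continuousOn_const.mul (continuousOn_log_Ici.pow _)))

lemma hasExp_integral_mul_totErr_zero (i : ℕ) :
    HasExp (i + 1) 0 (fun y => ∫ w in (1 : ℝ)..y, w ^ 0 * Real.log w ^ i * totErr (y / w)) := by
  obtain ⟨q, hq, h⟩ := exists_integral_mul_totErr 0 i
  exact ⟨0, q, by omega, Polynomial.coeff_eq_zero_of_natDegree_lt (by omega),
    h.congr fun y _ => by simp⟩

lemma hasExp_integral_mul_totErr_one (i n : ℕ) :
    HasExp n 0 (fun y => ∫ w in (1 : ℝ)..y, w ^ 1 * Real.log w ^ i * totErr (y / w)) := by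
  obtain ⟨q, hq, h⟩ := exists_integral_mul_totErr 1 i
  exact ⟨q, 0, by simp, by simp, h.congr fun y _ => by simp⟩

lemma hasExp_totConv_linear_monomial (i : ℕ) :
    HasExp (i + 1) (6 / Real.pi ^ 2 / (i + 1)) (totConv (fun Z => Z * Real.log Z ^ i)) := by
  have h1 : HasExp (i + 1) 0 (fun y => 0 ^ i * totSum y) := by
    simpa using (hasExp_totSum.lift (Nat.succ_pos i)).const_mul (0 ^ i)
  have h2 := HasExp.monomial (i + 1) (6 / Real.pi ^ 2 / (i + 1))
  have h3 := (HasExp.monomial i (6 / Real.pi ^ 2)).lift (Nat.lt_succ_self i)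
  have h4 := (HasExp.monomial 0 (-(6 / Real.pi ^ 2) * 0 ^ i)).lift (Nat.succ_pos i)
  have h5 := hasExp_integral_mul_totErr_zero i
  have h6 : HasExp (i + 1) 0 (fun y => (i : ℝ) *
      ∫ w in (1 : ℝ)..y, w ^ 0 * Real.log w ^ (i - 1) * totErr (y / w)) := by
    rcases i with _ | i
    · simpa using HasExp.of_powBound (n := 0 + 1) (PowBound.const 0)
    · simpa using ((hasExp_integral_mul_totErr_zero i).lift (Nat.lt_succ_self (i + 1))).const_mul
        ((i + 1 : ℕ) : ℝ)
  have h7 := ((((h1.add h2).add h3).add h4).add h5).add h6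
  simp only [zero_add, add_zero] at h7
  refine h7.congr fun y hy => ?_
  have h8 := totConv_pow_mul_log_pow 0 i hy
  have h9 : ∫ w in (1 : ℝ)..y, w ^ 0 * (((0 : ℕ) + 1) * Real.log w ^ i + i * Real.log w ^ (i - 1))
      * w⁻¹
      = Real.log y ^ (i + 1) / (i + 1) + Real.log y ^ i - 0 ^ i := by
    rw [integral_deriv_eq_sub_of_Ici
      (f := fun w => Real.log w ^ (i + 1) / (i + 1) + Real.log w ^ i) ?_ ?_ hy]
    · simp
    · intro w hw
      have hw0 : w ≠ 0 := by linarith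
      have hi0 : (i : ℝ) + 1 ≠ 0 := by positivity
      refine ((((Real.hasDerivAt_log hw0).pow (i + 1)).div_const _).add
        ((Real.hasDerivAt_log hw0).pow i)).congr_deriv ?_
      simp only [Nat.add_sub_cancel]
      push_cast
      field_simp
      ring
    · refine ((continuousOn_id.pow _).mul ((continuousOn_const.mul (continuousOn_log_Ici.pow _)).add
        (continuousOn_const.mul (continuousOn_log_Ici.pow _)))).mul (continuousOn_inv₀.mono ?_)
      intro w hw
      have : (1 : ℝ) ≤ w := hw
      simp only [Set.mem_compl_iff, Set.mem_singleton_iff]; linarith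
  rw [h9] at h8
  simp only [zero_add, pow_one] at h8
  rw [h8]
  simp only [Nat.cast_zero, zero_add, one_mul, pow_zero, mul_one]
  ring

lemma hasExp_totConv_quadratic_monomial (i : ℕ) :
    HasExp 1 0 (totConv (fun Z => Z ^ 2 * Real.log Z ^ i)) := by
  have h1 : HasExp 1 0 (fun y => 0 ^ i * totSum y) := by
    simpa using (hasExp_totSum.lift Nat.one_pos).const_mul (0 ^ i)
  have h2 : ∀ k, HasExp 1 0 (fun y => y * ∫ w in (1 : ℝ)..y, Real.log w ^ k) := by
    intro k
    obtain ⟨q, c, h⟩ := exists_integral_log_pow k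
    have := (HasExp.of_quadratic q 1).add ((HasExp.monomial 0 c).lift Nat.one_pos)
    simp only [add_zero] at this
    refine this.congr fun y hy => ?_
    rw [h y hy]; ring
  have h7 := ((h1.add ((h2 i).const_mul (6 / Real.pi ^ 2 * 2))).add
    ((h2 (i - 1)).const_mul (6 / Real.pi ^ 2 * i))).add
    (((hasExp_integral_mul_totErr_one i 1).const_mul 2).add
      ((hasExp_integral_mul_totErr_one (i - 1) 1).const_mul i))
  simp only [mul_zero, add_zero] at h7
  refine h7.congr fun y hy => ?_
  rw [totConv_pow_mul_log_pow 1 i hy]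
  have h9 : ∫ w in (1 : ℝ)..y, w ^ 1 * (((1 : ℕ) + 1) * Real.log w ^ i + i * Real.log w ^ (i - 1))
      * w⁻¹
      = 2 * (∫ w in (1 : ℝ)..y, Real.log w ^ i) + i * ∫ w in (1 : ℝ)..y, Real.log w ^ (i - 1) := by
    rw [← intervalIntegral.integral_const_mul, ← intervalIntegral.integral_const_mul,
      ← intervalIntegral.integral_add]
    · refine intervalIntegral.integral_congr fun w hw => ?_
      rw [Set.uIcc_of_le hy] at hw
      have hw0 : w ≠ 0 := by linarith [hw.1]
      simp only [pow_one, Nat.cast_one]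
      field_simp
      ring
    · exact intervalIntegrable_of_continuousOn_Ici
        (continuousOn_const.mul (continuousOn_log_Ici.pow _)) hy
    · exact intervalIntegrable_of_continuousOn_Ici
        (continuousOn_const.mul (continuousOn_log_Ici.pow _)) hy
  rw [h9]
  push_cast
  ring

lemma exists_polynomial_mul_add_derivative {m : ℝ} (hm : m ≠ 0) (n : ℕ) (B : Polynomial ℝ)
    (hB : B.natDegree ≤ n) : ∃ A : Polynomial ℝ, A.natDegree ≤ n ∧ A.coeff n = B.coeff n / m ∧
      Polynomial.C m * A + Polynomial.derivative A = B := by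
  induction n generalizing B with
  | zero =>
    obtain ⟨b, rfl⟩ := Polynomial.natDegree_eq_zero.1 (Nat.le_zero.1 hB)
    refine ⟨Polynomial.C (b / m), by simp, by simp, ?_⟩
    rw [Polynomial.derivative_C, add_zero, ← Polynomial.C_mul]
    congr 1; field_simp
  | succ n ih =>
    obtain ⟨A, h1, -, h3⟩ := ih (Polynomial.derivative B)
      ((Polynomial.natDegree_derivative_le B).trans (by omega))
    refine ⟨Polynomial.C m⁻¹ * (B - A), ?_, ?_, ?_⟩
    · exact (Polynomial.natDegree_C_mul_le _ _).trans ((Polynomial.natDegree_sub_le _ _).trans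
        (max_le hB (by omega)))
    · rw [Polynomial.coeff_C_mul, Polynomial.coeff_sub,
        Polynomial.coeff_eq_zero_of_natDegree_lt (by omega : A.natDegree < n + 1)]
      field_simp; ring
    · have h4 : Polynomial.C m * Polynomial.C m⁻¹ = 1 := by
        rw [← Polynomial.C_mul, mul_inv_cancel₀ hm, Polynomial.C_1]
      rw [Polynomial.derivative_C_mul, Polynomial.derivative_sub, ← h3]
      linear_combination B * h4

lemma hasDerivAt_eval_log (B : Polynomial ℝ) {w : ℝ} (hw : 0 < w) :
    HasDerivAt (fun w => B.eval (Real.log w)) ((Polynomial.derivative B).eval (Real.log w) * w⁻¹) w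
        :=
  (B.hasDerivAt (Real.log w)).comp w (Real.hasDerivAt_log hw.ne')

lemma continuousOn_eval_log (B : Polynomial ℝ) : ContinuousOn (fun w => B.eval (Real.log w))
    (Set.Ici 1) :=
  B.continuous.comp_continuousOn continuousOn_log_Ici

lemma measurable_eval_log (B : Polynomial ℝ) : Measurable (fun w => B.eval (Real.log w)) :=
  B.continuous.measurable.comp Real.measurable_log

lemma exists_integral_eval_log (p n : ℕ) (B : Polynomial ℝ) (hB : B.natDegree ≤ n) :
    ∃ A : Polynomial ℝ, A.natDegree ≤ n ∧ A.coeff n = B.coeff n / (p + 1) ∧ ∃ c : ℝ, ∀ y, 1 ≤ y →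
      ∫ w in (1 : ℝ)..y, w ^ p * B.eval (Real.log w) = y ^ (p + 1) * A.eval (Real.log y) + c := by
  obtain ⟨A, h1, h2, h3⟩ := exists_polynomial_mul_add_derivative
    (by positivity : ((p : ℝ) + 1) ≠ 0) n B hB
  refine ⟨A, h1, h2, - A.eval 0, fun y hy => ?_⟩
  rw [integral_deriv_eq_sub_of_Ici (f := fun w => w ^ (p + 1) * A.eval (Real.log w)) ?_ ?_ hy]
  · simp [sub_eq_add_neg]
  · intro w hw
    have hw0 : 0 < w := by linarith
    refine ((hasDerivAt_pow (p + 1) w).mul (hasDerivAt_eval_log A hw0)).congr_deriv ?_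
    rw [← h3]
    simp only [Nat.add_sub_cancel, Polynomial.eval_add, Polynomial.eval_mul, Polynomial.eval_C]
    push_cast
    field_simp
    ring
  · exact (continuousOn_id.pow _).mul (continuousOn_eval_log B)

/-- `f` is continuously differentiable on `[1, ∞)` with
`f' w = w A(log w) + B(log w) + O(w ^ (-1 + ε))`, where `B` has degree at most `n` and
coefficient `b` at `n`. -/
def HasDerivExp (n : ℕ) (b : ℝ) (f : ℝ → ℝ) : Prop :=
  ∃ g : ℝ → ℝ, (∀ w, 1 ≤ w → HasDerivAt f (g w) w) ∧ ContinuousOn g (Set.Ici 1) ∧ Measurable g ∧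
    ∃ A B : Polynomial ℝ, B.natDegree ≤ n ∧ B.coeff n = b ∧
      PowBound (-1) (fun w => g w - (w * A.eval (Real.log w) + B.eval (Real.log w)))

namespace HasDerivExp

lemma add {n : ℕ} {a b : ℝ} {F G : ℝ → ℝ} (hF : HasDerivExp n a F) (hG : HasDerivExp n b G) :
    HasDerivExp n (a + b) (fun y => F y + G y) := by
  obtain ⟨g, h1, h2, h3, A, B, h4, h5, h6⟩ := hF
  obtain ⟨g', h1', h2', h3', A', B', h4', h5', h6'⟩ := hG
  refine ⟨fun w => g w + g' w, fun w hw => (h1 w hw).add (h1' w hw), h2.add h2', h3.add h3', A + A',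
    B + B', (Polynomial.natDegree_add_le _ _).trans (max_le h4 h4'), ?_,
    (h6.add h6').congr fun y _ => ?_⟩
  · rw [Polynomial.coeff_add, h5, h5']
  · simp only [Polynomial.eval_add]; ring

lemma const_mul {n : ℕ} {a : ℝ} {F : ℝ → ℝ} (c : ℝ) (hF : HasDerivExp n a F) :
    HasDerivExp n (c * a) (fun y => c * F y) := by
  obtain ⟨g, h1, h2, h3, A, B, h4, h5, h6⟩ := hF
  refine ⟨fun w => c * g w, fun w hw => (h1 w hw).const_mul c, h2.const_smul c, h3.const_mul c,
    Polynomial.C c * A, Polynomial.C c * B, (Polynomial.natDegree_C_mul_le _ _).trans h4, ?_,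
    (h6.const_mul c).congr fun y _ => ?_⟩
  · rw [Polynomial.coeff_C_mul, h5]
  · simp only [Polynomial.eval_mul, Polynomial.eval_C]; ring

lemma exists_eq {n : ℕ} {b : ℝ} {f : ℝ → ℝ} (hf : HasDerivExp n b f) :
    ∃ (A B : Polynomial ℝ) (c : ℝ) (e : ℝ → ℝ), B.natDegree ≤ n ∧ B.coeff n = b ∧ Measurable e ∧
      PowBound (-1) e ∧ ∀ Z, 1 ≤ Z → f Z = Z ^ 2 * A.eval (Real.log Z) + Z * B.eval (Real.log Z)
        + (c + ∫ w in (1 : ℝ)..Z, e w) := by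
  obtain ⟨g, h1, h2, h3, A, B, h4, h5, h6⟩ := hf
  obtain ⟨A', -, -, c, hA⟩ := exists_integral_eval_log 1 A.natDegree A le_rfl
  obtain ⟨B', hB1, hB2, c', hB⟩ := exists_integral_eval_log 0 n B h4
  have hem : Measurable (fun w => g w - (w * A.eval (Real.log w) + B.eval (Real.log w))) :=
    h3.sub ((measurable_id.mul (measurable_eval_log A)).add (measurable_eval_log B))
  refine ⟨A', B', f 1 + c + c', _, hB1, by simpa [h5] using hB2, hem, h6, fun Z hZ => ?_⟩
  have hi1 : IntervalIntegrable (fun w => w ^ 1 * A.eval (Real.log w)) MeasureTheory.volume 1 Z :=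
    intervalIntegrable_of_continuousOn_Ici ((continuousOn_id.pow _).mul (continuousOn_eval_log A))
        hZ
  have hi2 : IntervalIntegrable (fun w => w ^ 0 * B.eval (Real.log w)) MeasureTheory.volume 1 Z :=
    intervalIntegrable_of_continuousOn_Ici ((continuousOn_id.pow _).mul (continuousOn_eval_log B))
        hZ
  have hi3 := intervalIntegrable_of_continuousOn_Ici h2 hZ
  have h7 : ∫ w in (1 : ℝ)..Z, (g w - (w * A.eval (Real.log w) + B.eval (Real.log w)))
      = (∫ w in (1 : ℝ)..Z, g w) - ((∫ w in (1 : ℝ)..Z, w ^ 1 * A.eval (Real.log w)) +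
        ∫ w in (1 : ℝ)..Z, w ^ 0 * B.eval (Real.log w)) := by
    rw [← intervalIntegral.integral_add hi1 hi2, ← intervalIntegral.integral_sub hi3 (hi1.add hi2)]
    simp only [pow_one, pow_zero, one_mul]
  rw [h7, hA Z hZ, hB Z hZ, integral_deriv_eq_sub_of_Ici h1 h2 hZ]
  ring

lemma log_mul {n : ℕ} {b : ℝ} {f : ℝ → ℝ} (hf : HasDerivExp n b f) :
    HasDerivExp (n + 1) b (fun Z => Real.log Z * f Z) := by
  obtain ⟨A', B', c, e, hB1, hB2, hem, he, hfe⟩ := hf.exists_eq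
  obtain ⟨g, h1, h2, h3, A, B, h4, h5, h6⟩ := hf
  have hcont : ContinuousOn f (Set.Ici 1) := fun w hw => (h1 w hw).continuousAt.continuousWithinAt
  have hfm : Measurable (fun Z => (Z ^ 2 * A'.eval (Real.log Z) + Z * B'.eval (Real.log Z)
        + (c + ∫ w in (1 : ℝ)..Z, e w))) :=
    (((measurable_id.pow_const 2).mul (measurable_eval_log A')).add
      (measurable_id.mul (measurable_eval_log B'))).add
      (measurable_const.add (measurable_intervalIntegral_right hem 1))
  refine ⟨fun w => Real.log w * g w + w⁻¹ * (w ^ 2 * A'.eval (Real.log w) + w * B'.eval (Real.log w)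
        + (c + ∫ w in (1 : ℝ)..w, e w)), fun w hw => ?_, ?_,
    (Real.measurable_log.mul h3).add (measurable_id.inv.mul hfm),
    Polynomial.X * A + A', Polynomial.X * B + B', ?_, ?_, ?_⟩
  · beta_reduce
    rw [← hfe w hw]
    refine ((Real.hasDerivAt_log (by linarith)).mul (h1 w hw)).congr_deriv ?_
    ring
  · refine (continuousOn_log_Ici.mul h2).add (ContinuousOn.congr (f := fun w => w⁻¹ * f w) ?_ ?_)
    · refine (continuousOn_inv₀.mono ?_).mul hcont
      intro w hw
      have : (1 : ℝ) ≤ w := hw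
      simp only [Set.mem_compl_iff, Set.mem_singleton_iff]; linarith
    · intro w hw
      simp only [hfe w hw]
  · refine (Polynomial.natDegree_add_le _ _).trans (max_le ?_ (by omega))
    refine (Polynomial.natDegree_mul_le).trans ?_
    rw [Polynomial.natDegree_X]; omega
  · rw [Polynomial.coeff_add, Polynomial.coeff_X_mul, h5,
      Polynomial.coeff_eq_zero_of_natDegree_lt (by omega : B'.natDegree < n + 1), add_zero]
  · have h7 : PowBound 0 (fun y => ∫ w in (1 : ℝ)..y, e w) := by
      simpa using he.integral le_rfl
    have h8 := PowBound.log.mul h6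
    have h9 := PowBound.inv.mul ((PowBound.const c).add h7)
    rw [zero_add] at h8
    rw [add_zero] at h9
    refine (h8.add h9).congr fun w hw => ?_
    have hw0 : w ≠ 0 := by linarith
    simp only [Polynomial.eval_add, Polynomial.eval_mul, Polynomial.eval_X]
    field_simp
    ring

end HasDerivExp

lemma totConv_sum {ι : Type*} (s : Finset ι) (f : ι → ℝ → ℝ) (y : ℝ) :
    totConv (fun Z => ∑ i ∈ s, f i Z) y = ∑ i ∈ s, totConv (f i) y := by
  simp only [totConv, Finset.mul_sum]
  exact Finset.sum_comm

lemma hasExp_totConv_quadratic (A : Polynomial ℝ) :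
    HasExp 1 0 (totConv (fun Z => Z ^ 2 * A.eval (Real.log Z))) := by
  have h := HasExp.sum (range (A.natDegree + 1)) (fun i _ =>
    (hasExp_totConv_quadratic_monomial i).const_mul (A.coeff i))
  simp only [mul_zero, Finset.sum_const_zero] at h
  refine h.congr fun y _ => ?_
  simp only [← totConv_const_mul, ← totConv_sum]
  congr 1
  funext Z
  rw [Polynomial.eval_eq_sum_range, Finset.mul_sum]
  exact Finset.sum_congr rfl fun i _ => by ring

lemma hasExp_totConv_linear (n : ℕ) (B : Polynomial ℝ) (hB : B.natDegree ≤ n) :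
    HasExp (n + 1) (6 / Real.pi ^ 2 * B.coeff n / (n + 1))
        (totConv (fun Z => Z * B.eval (Real.log Z))) := by
  have h : ∀ i ∈ range (n + 1), HasExp (n + 1)
      (if i = n then 6 / Real.pi ^ 2 * B.coeff n / (n + 1) else 0)
      (fun y => B.coeff i * totConv (fun Z => Z * Real.log Z ^ i) y) := by
    intro i hi
    have hi' : i ≤ n := by simpa [Nat.lt_succ_iff] using hi
    have h1 := (hasExp_totConv_linear_monomial i).const_mul (B.coeff i)
    split_ifs with hin
    · subst hin
      convert h1 using 1
      ring
    · exact h1.lift (by omega)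
  have h2 := HasExp.sum (range (n + 1)) h
  rw [Finset.sum_ite_eq' (range (n + 1)) n, if_pos (by simp)] at h2
  refine h2.congr fun y _ => ?_
  simp only [← totConv_const_mul, ← totConv_sum]
  congr 1
  funext Z
  rw [Polynomial.eval_eq_sum_range' (by omega : B.natDegree < n + 1), Finset.mul_sum]
  exact Finset.sum_congr rfl fun i _ => by ring

lemma hasExp_totConv_integral (c : ℝ) {e : ℝ → ℝ} (hem : Measurable e) (he : PowBound (-1) e) :
    HasExp 1 0 (totConv (fun Z => c + ∫ w in (1 : ℝ)..Z, e w)) := by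
  have h1 := ((hasExp_totSum.const_mul c).lift Nat.one_pos)
  have h2 := he.mul PowBound.inv
  obtain ⟨c', hc'⟩ := PowBound.exists_integral_sub_const h2 (hem.mul measurable_id.inv)
      (by norm_num)
  have h3 : PowBound 0 (fun y => 6 / Real.pi ^ 2 * (y * ((∫ w in (1 : ℝ)..y, e w * w⁻¹) - c')))
      := by
    refine PowBound.const_mul _ ?_
    have := PowBound.id.mul hc'
    convert this using 1
    norm_num
  have h4 := (HasExp.monomial 0 (6 / Real.pi ^ 2 * c')).lift Nat.one_pos
  have h5 : PowBound 0 (fun y => ∫ w in (1 : ℝ)..y, e w * totErr (y / w)) := by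
    intro δ hδ
    obtain ⟨C, hC, hb⟩ := he (δ / 2) (by positivity)
    obtain ⟨D, hD, hd⟩ := totErr_powBound (δ / 4) (by positivity)
    refine ⟨C * D * (4 / δ), by positivity, fun y hy => ?_⟩
    have hy0 : 0 < y := by linarith
    have hcont : ContinuousOn (fun w : ℝ => w ^ (δ / 4 - 1)) (Set.uIcc 1 y) := by
      intro w hw
      rw [Set.uIcc_of_le hy] at hw
      exact (Real.continuousAt_rpow_const w _ (Or.inl (by linarith [hw.1]))).continuousWithinAt
    have h6 : |∫ w in (1 : ℝ)..y, e w * totErr (y / w)|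
        ≤ ∫ w in (1 : ℝ)..y, C * D * y ^ (δ / 4) * w ^ (δ / 4 - 1) := by
      rw [← Real.norm_eq_abs]
      refine intervalIntegral.norm_integral_le_of_norm_le hy ?_
        (hcont.intervalIntegrable.const_mul _)
      refine Filter.Eventually.of_forall fun w hw => ?_
      have hw0 : 0 < w := by linarith [hw.1]
      rw [norm_mul, Real.norm_eq_abs, Real.norm_eq_abs]
      calc |e w| * |totErr (y / w)| ≤ (C * w ^ (-1 + δ / 2)) * (D * (y / w) ^ (0 + δ / 4)) := by
            gcongr
            · exact hb w hw.1.le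
            · exact hd _ ((one_le_div hw0).2 hw.2)
        _ = C * D * y ^ (δ / 4) * w ^ (δ / 4 - 1) := by
            rw [zero_add, Real.div_rpow hy0.le hw0.le,
              show -1 + δ / 2 = (δ / 4 - 1) + δ / 4 by ring, Real.rpow_add hw0 (δ / 4 - 1)]
            have := (Real.rpow_pos_of_pos hw0 (δ / 4)).ne'
            field_simp
    refine h6.trans ?_
    rw [intervalIntegral.integral_const_mul, integral_rpow (Or.inl (by linarith)), sub_add_cancel,
      Real.one_rpow, zero_add, show δ = δ / 4 + (δ / 4 + δ / 2) by ring, Real.rpow_add hy0]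
    have e1 : (1 : ℝ) ≤ y ^ (δ / 2) := Real.one_le_rpow hy (by positivity)
    have e2 : (1 : ℝ) ≤ y ^ (δ / 4) := Real.one_le_rpow hy (by positivity)
    have e3 : y ^ (δ / 4) - 1 ≤ y ^ (δ / 4 + δ / 2) := by
      rw [Real.rpow_add hy0]; nlinarith
    have e4 : (δ / 4 + (δ / 4 + δ / 2)) = δ := by ring
    rw [e4]
    calc C * D * y ^ (δ / 4) * ((y ^ (δ / 4) - 1) / (δ / 4))
        ≤ C * D * y ^ (δ / 4) * (y ^ (δ / 4 + δ / 2) / (δ / 4)) := by gcongr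
      _ = _ := by field_simp
  have h7 := ((h1.add (HasExp.of_powBound h3)).add h4).add (HasExp.of_powBound h5)
  simp only [add_zero] at h7
  refine h7.congr fun y hy => ?_
  rw [totConv_eq hem he (fun Z _ => rfl) hy]
  simp only [totErr]
  ring

lemma HasDerivExp.hasExp_totConv {n : ℕ} {b : ℝ} {f : ℝ → ℝ} (hf : HasDerivExp n b f) :
    HasExp (n + 1) (6 / Real.pi ^ 2 * b / (n + 1)) (totConv f) := by
  obtain ⟨A, B, c, e, hB1, hB2, hem, he, hfe⟩ := hf.exists_eq
  have hl : ∀ {F : ℝ → ℝ}, HasExp 1 0 F → HasExp (n + 1) 0 F := by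
    intro F hF
    rcases n with _ | n
    · exact hF
    · exact hF.lift (by omega)
  have h := ((hl (hasExp_totConv_quadratic A)).add (hasExp_totConv_linear n B hB1)).add
    (hl (hasExp_totConv_integral c hem he))
  rw [zero_add, add_zero, hB2] at h
  refine h.congr fun y _ => ?_
  rw [totConv_congr hfe, totConv_add, totConv_add]

lemma PowBound.of_le_of_two_le {p : ℝ} {f g : ℝ → ℝ} (hg : PowBound p g) (B : ℝ)
    (h1 : ∀ y, 1 ≤ y → y ≤ 2 → |f y| ≤ B) (h2 : ∀ y, 2 ≤ y → |f y| ≤ |g y|) : PowBound p f := by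
  have hB : 0 ≤ B := (abs_nonneg _).trans (h1 1 le_rfl one_le_two)
  have habs : PowBound p (fun y => |g y|) := hg.of_abs_le fun y _ => (abs_abs _).le
  refine (habs.add ((PowBound.rpow p).const_mul (B * 2 ^ |p|))).of_abs_le fun y hy => ?_
  have hy0 : 0 < y := by linarith
  have hnn : 0 ≤ B * 2 ^ |p| * y ^ p := by positivity
  rw [abs_of_nonneg (add_nonneg (abs_nonneg _) hnn)]
  rcases le_total y 2 with hy2 | hy2
  · refine (h1 y hy hy2).trans ?_
    have h3 : (1 : ℝ) ≤ 2 ^ |p| * y ^ p := by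
      calc (1 : ℝ) ≤ 2 ^ |p| * 2 ^ (-|p|) := by
            rw [← Real.rpow_add two_pos, add_neg_cancel, Real.rpow_zero]
        _ ≤ 2 ^ |p| * y ^ (-|p|) := by
            gcongr 2 ^ |p| * ?_
            exact Real.rpow_le_rpow_of_nonpos hy0 hy2 (neg_nonpos.2 (abs_nonneg p))
        _ ≤ 2 ^ |p| * y ^ p := by
            gcongr
            exact neg_abs_le p
    nlinarith [abs_nonneg (g y)]
  · exact (h2 y hy2).trans (le_add_of_nonneg_right hnn)

/-- `∫_{1/w}^{1-1/w} log τ / (1 - τ) dτ`. -/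
noncomputable def dilogIntegral (w : ℝ) : ℝ :=
  ∫ τ in w⁻¹..(1 - w⁻¹), Real.log τ / (1 - τ)

lemma continuousAt_log_div_one_sub {τ : ℝ} (h0 : 0 < τ) (h1 : τ < 1) :
    ContinuousAt (fun τ : ℝ => Real.log τ / (1 - τ)) τ :=
  (Real.continuousAt_log h0.ne').div (continuousAt_const.sub continuousAt_id) (by linarith)

lemma intervalIntegrable_log_div_one_sub {a b : ℝ} (ha0 : 0 < a) (ha1 : a < 1) (hb0 : 0 < b)
    (hb1 : b < 1) : IntervalIntegrable (fun τ : ℝ => Real.log τ / (1 - τ)) MeasureTheory.volume a b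
        := by
  apply ContinuousOn.intervalIntegrable
  intro τ hτ
  have h1 : τ ∈ Set.Ioo (0 : ℝ) 1 := (Set.ordConnected_Ioo.uIcc_subset ⟨ha0, ha1⟩ ⟨hb0, hb1⟩) hτ
  exact (continuousAt_log_div_one_sub h1.1 h1.2).continuousWithinAt

lemma hasDerivAt_integral_log_div_one_sub {b : ℝ} (hb0 : 0 < b) (hb1 : b < 1) :
    HasDerivAt (fun b => ∫ τ in (1 / 2 : ℝ)..b, Real.log τ / (1 - τ)) (Real.log b / (1 - b)) b := by
  refine intervalIntegral.integral_hasDerivAt_right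
    (intervalIntegrable_log_div_one_sub (by norm_num) (by norm_num) hb0 hb1) ?_
    (continuousAt_log_div_one_sub hb0 hb1)
  exact (ContinuousOn.stronglyMeasurableAtFilter (s := Set.Ioo 0 1) isOpen_Ioo
    (fun τ hτ => (continuousAt_log_div_one_sub hτ.1 hτ.2).continuousWithinAt) b ⟨hb0, hb1⟩)

lemma hasDerivAt_dilogIntegral {w : ℝ} (hw : 1 < w) :
    HasDerivAt dilogIntegral
      (Real.log (1 - w⁻¹) / w - Real.log w / (w * (w - 1))) w := by
  have hw0 : 0 < w := by linarith
  have hi0 : 0 < w⁻¹ := by positivity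
  have hi1 : w⁻¹ < 1 := inv_lt_one_of_one_lt₀ hw
  have heq : dilogIntegral =ᶠ[nhds w] fun w =>
      (∫ τ in (1 / 2 : ℝ)..(1 - w⁻¹), Real.log τ / (1 - τ)) -
        ∫ τ in (1 / 2 : ℝ)..w⁻¹, Real.log τ / (1 - τ) := by
    filter_upwards [Ioi_mem_nhds hw] with v hv
    have hv' : (1 : ℝ) < v := hv
    have hv0 : 0 < v⁻¹ := inv_pos.2 (by linarith)
    have hv1 : v⁻¹ < 1 := inv_lt_one_of_one_lt₀ hv'
    rw [dilogIntegral, intervalIntegral.integral_interval_sub_left] <;>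
      exact intervalIntegrable_log_div_one_sub (by norm_num) (by norm_num) (by linarith)
          (by linarith)
  refine HasDerivAt.congr_of_eventuallyEq ?_ heq
  have h1 := hasDerivAt_inv hw0.ne'
  have h2 := (hasDerivAt_integral_log_div_one_sub hi0 hi1).comp w h1
  have h3 := (hasDerivAt_integral_log_div_one_sub (b := 1 - w⁻¹) (by linarith) (by linarith)).comp w
    (h1.const_sub 1)
  refine (h3.sub h2).congr_deriv ?_
  rw [Real.log_inv]
  have : w - 1 ≠ 0 := by linarith
  field_simp
  ring

lemma abs_log_one_sub_add_le {z : ℝ} (h0 : 0 ≤ z) (h1 : z ≤ 1 / 2) :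
    |Real.log (1 - z) + z| ≤ 2 * z ^ 2 := by
  have h2 : 0 < 1 - z := by linarith
  have h3 := Real.log_le_sub_one_of_pos h2
  have h4 := Real.one_sub_inv_le_log_of_pos h2
  have h5 : (1 - z)⁻¹ ≤ 1 + z + 2 * z ^ 2 := by
    rw [inv_le_comm₀ h2 (by positivity), inv_le_iff_one_le_mul₀ (by positivity)]
    nlinarith [mul_nonneg (sq_nonneg z) (by linarith : 0 ≤ 1 / 2 - z)]
  rw [abs_le]
  constructor <;> nlinarith [sq_nonneg z]

lemma dilogIntegral_powBound : ∃ c : ℝ, ∃ R : ℝ → ℝ, PowBound (-2) R ∧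
    ∀ w, 2 ≤ w → dilogIntegral w = c + (Real.log w + 2) / w + R w := by
  set d : ℝ → ℝ := fun w => Real.log (1 - w⁻¹) / w - Real.log w / (w * (w - 1)) with hd
  set e : ℝ → ℝ := fun w => if w < 2 then 0 else d w + (Real.log w + 1) / w ^ 2 with he
  have hem : Measurable e := by
    refine Measurable.ite measurableSet_Iio measurable_const ?_
    have h1 : Measurable (fun w : ℝ => Real.log (1 - w⁻¹)) :=
      Real.measurable_log.comp (measurable_const.sub measurable_id.inv)
    exact ((h1.div measurable_id).sub (Real.measurable_log.div
      (measurable_id.mul (measurable_id.sub_const 1)))).add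
        ((Real.measurable_log.add_const 1).div (measurable_id.pow_const 2))
  have hepb : PowBound (-3) e := by
    have h1 := (PowBound.inv_sq.mul PowBound.inv).mul
      ((PowBound.const 2).add (PowBound.log.const_mul 2))
    norm_num at h1
    refine h1.of_abs_le fun w hw => ?_
    have hlog := Real.log_nonneg hw
    rw [he]
    dsimp only
    split_ifs with h2
    · rw [abs_zero]; exact abs_nonneg _
    push Not at h2
    have hw0 : 0 < w := by linarith
    have hw1 : 0 < w - 1 := by linarith
    have hz : w⁻¹ ≤ 1 / 2 := by rw [inv_le_comm₀ hw0 (by norm_num)]; norm_num; exact h2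
    have h3 := abs_log_one_sub_add_le (inv_nonneg.2 hw0.le) hz
    have h4 : d w + (Real.log w + 1) / w ^ 2
        = (Real.log (1 - w⁻¹) + w⁻¹) * w⁻¹ - Real.log w * ((w ^ 2)⁻¹ * (w - 1)⁻¹) := by
      rw [hd]; field_simp; ring
    have h5 : (w - 1)⁻¹ ≤ 2 * w⁻¹ := by
      rw [inv_le_iff_one_le_mul₀ hw1]
      have := mul_inv_cancel₀ hw0.ne'
      nlinarith
    rw [h4]
    refine le_trans ((abs_sub _ _).trans ?_) (le_abs_self _)
    rw [abs_mul, abs_of_pos (inv_pos.2 hw0), abs_of_nonneg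
        (by positivity : 0 ≤ Real.log w * ((w ^ 2)⁻¹ * (w - 1)⁻¹))]
    calc |Real.log (1 - w⁻¹) + w⁻¹| * w⁻¹ + Real.log w * ((w ^ 2)⁻¹ * (w - 1)⁻¹)
        ≤ (2 * w⁻¹ ^ 2) * w⁻¹ + Real.log w * ((w ^ 2)⁻¹ * (2 * w⁻¹)) := by gcongr
      _ = _ := by rw [inv_pow]; ring
  obtain ⟨c, hc⟩ := hepb.exists_integral_sub_const hem (by norm_num)
  norm_num at hc
  refine ⟨dilogIntegral 2 - (Real.log 2 + 2) / 2 + c, _, hc, fun w hw => ?_⟩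
  have h1 : ∫ t in (1 : ℝ)..w, e t = ∫ t in (2 : ℝ)..w, (d t + (Real.log t + 1) / t ^ 2) := by
    rw [← intervalIntegral.integral_add_adjacent_intervals
      (hepb.intervalIntegrable hem le_rfl one_le_two)
      (hepb.intervalIntegrable hem one_le_two (by linarith)),
      intervalIntegral.integral_congr_Ioo_of_le (g := fun _ => 0) one_le_two,
      intervalIntegral.integral_congr_Ioo_of_le (f := e)
        (g := fun t => d t + (Real.log t + 1) / t ^ 2) hw]
    · simp
    · intro t ht
      exact if_neg (not_lt.2 ht.1.le)
    · intro t ht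
      exact if_pos ht.2
  have h2 : ∫ t in (2 : ℝ)..w, (d t + (Real.log t + 1) / t ^ 2)
      = (dilogIntegral w - (Real.log w + 2) / w) - (dilogIntegral 2 - (Real.log 2 + 2) / 2) := by
    apply intervalIntegral.integral_eq_sub_of_hasDerivAt
      (f := fun w => dilogIntegral w - (Real.log w + 2) / w)
    · intro t ht
      rw [Set.uIcc_of_le hw] at ht
      have ht0 : t ≠ 0 := by linarith [ht.1]
      refine ((hasDerivAt_dilogIntegral (by linarith [ht.1])).sub
        (((Real.hasDerivAt_log ht0).add_const 2).div (hasDerivAt_id t) ht0)).congr_deriv ?_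
      simp only [hd, id]
      field_simp
      ring
    · refine (hepb.intervalIntegrable hem one_le_two (by linarith : 1 ≤ w)).congr_uIoo ?_
      rw [Set.uIoo_of_le hw]
      intro t ht
      exact if_neg (not_lt.2 ht.1.le)
  rw [h1, h2]
  ring

lemma integral_log_div_sub {w : ℝ} (hw : 2 ≤ w) :
    ∫ t in (1 : ℝ)..(w - 1), Real.log t / (w - t) = Real.log w * Real.log (w - 1) +
        dilogIntegral w := by
  have hw0 : 0 < w := by linarith
  have hi0 : 0 < w⁻¹ := by positivity
  have hi1 : w⁻¹ < 1 := inv_lt_one_of_one_lt₀ (by linarith)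
  have hle : w⁻¹ ≤ 1 - w⁻¹ := by
    have : w⁻¹ ≤ 1 / 2 := by rw [inv_le_comm₀ hw0 (by norm_num)]; norm_num; exact hw
    linarith
  have h1 := intervalIntegral.smul_integral_comp_mul_left (a := w⁻¹) (b := 1 - w⁻¹)
    (fun t => Real.log t / (w - t)) w
  rw [mul_inv_cancel₀ hw0.ne', mul_sub, mul_inv_cancel₀ hw0.ne', mul_one] at h1
  have hic : IntervalIntegrable (fun τ : ℝ => Real.log w * (1 - τ)⁻¹) MeasureTheory.volume w⁻¹
      (1 - w⁻¹) := by
    apply ContinuousOn.intervalIntegrable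
    intro τ hτ
    rw [Set.uIcc_of_le hle] at hτ
    exact (continuousAt_const.mul ((continuousAt_const.sub continuousAt_id).inv₀
      (by linarith [hτ.2] : 1 - τ ≠ 0))).continuousWithinAt
  rw [← h1, smul_eq_mul, ← intervalIntegral.integral_const_mul, dilogIntegral]
  have h2 : ∫ τ in w⁻¹..(1 - w⁻¹), (1 - τ)⁻¹ = Real.log (w - 1) := by
    rw [intervalIntegral.integral_comp_sub_left (fun τ => τ⁻¹) 1,
      show (1 : ℝ) - (1 - w⁻¹) = w⁻¹ by ring, integral_inv_of_pos hi0 (by linarith)]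
    congr 1; field_simp
  rw [← h2, ← intervalIntegral.integral_const_mul, ← intervalIntegral.integral_add hic
    (intervalIntegrable_log_div_one_sub hi0 hi1 (by linarith) (by linarith))]
  refine intervalIntegral.integral_congr fun τ hτ => ?_
  rw [Set.uIcc_of_le hle] at hτ
  have hτ0 : 0 < τ := by linarith [hτ.1]
  have hτ1 : 1 - τ ≠ 0 := by linarith [hτ.2]
  rw [Real.log_mul hw0.ne' hτ0.ne', show w - w * τ = w * (1 - τ) by ring]
  field_simp

/-- `Σ_{j ≤ w} (w - j) log (w - j) / j`. -/
noncomputable def logRiesz (w : ℝ) : ℝ :=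
  ∑ j ∈ Icc 1 ⌊w⌋₊, (w - j) * Real.log (w - j) / j

lemma continuous_sum_Icc_floor (c : ℕ → ℝ) {G : ℝ → ℝ} (hG : Continuous G)
    (hG0 : ∀ v ≤ 0, G v = 0) : Continuous fun w : ℝ => ∑ j ∈ Icc 1 ⌊w⌋₊, c j * G (w - j) := by
  rw [continuous_iff_continuousAt]
  intro w
  have hev : (fun w : ℝ => ∑ j ∈ Icc 1 ⌊w⌋₊, c j * G (w - j)) =ᶠ[nhds w]
      fun v : ℝ => ∑ j ∈ Icc 1 (⌊w⌋₊ + 1), c j * G (v - j) := by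
    filter_upwards [Iio_mem_nhds (Nat.lt_floor_add_one w)] with v hv
    have hv1 : v < ((⌊w⌋₊ + 1 : ℕ) : ℝ) := by push_cast; exact hv
    have hv2 : ⌊v⌋₊ < ⌊w⌋₊ + 1 := (Nat.floor_lt' (by omega)).2 hv1
    refine Finset.sum_subset (Icc_subset_Icc_right hv2.le) fun j hj hj' => ?_
    rw [mem_Icc] at hj hj'
    have h1 : v < j := (Nat.floor_lt' (by omega)).1 (by omega)
    rw [hG0 _ (by linarith), mul_zero]
  refine ContinuousAt.congr ?_ hev.symm
  exact (continuous_finsetSum _ fun j _ => continuous_const.mul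
    (hG.comp (continuous_id.sub continuous_const))).continuousAt

lemma continuous_harmonicRiesz : Continuous harmonicRiesz := by
  refine (continuous_sum_Icc_floor (fun j => 1 / (j : ℝ)) (G := fun v => max v 0)
    (continuous_id.max continuous_const) fun v hv => max_eq_right hv).congr fun w => ?_
  rw [harmonicRiesz_eq_sum]
  refine Finset.sum_congr rfl fun j hj => ?_
  rw [mem_Icc] at hj
  have h1 : (j : ℝ) ≤ w := (Nat.le_floor_iff' (by omega)).1 hj.2
  rw [max_eq_left (by linarith)]
  ring

lemma continuous_logRiesz : Continuous logRiesz := by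
  refine (continuous_sum_Icc_floor (fun j => 1 / (j : ℝ))
      (G := fun v => max v 0 * Real.log (max v 0))
    (Real.continuous_mul_log.comp (continuous_id.max continuous_const)) fun v hv => by
      rw [max_eq_right hv, zero_mul]).congr fun w => ?_
  refine Finset.sum_congr rfl fun j hj => ?_
  rw [mem_Icc] at hj
  have h1 : (j : ℝ) ≤ w := (Nat.le_floor_iff' (by omega)).1 hj.2
  rw [max_eq_left (by linarith)]
  ring

lemma mul_log_sub_eq {w : ℝ} {j : ℕ} (hj : (j : ℝ) ≤ w - 1) :
    (w - j) * Real.log (w - j) = (w - 1 - j) + ∫ t in (j : ℝ)..(w - 1), (t - j) / (w - t) := by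
  rw [intervalIntegral.integral_eq_sub_of_hasDerivAt
    (f := fun t => -((w - j) * Real.log (w - t)) - t)]
  · rw [show w - (w - 1) = 1 by ring, Real.log_one]; ring
  · intro t ht
    rw [Set.uIcc_of_le hj] at ht
    have hne : w - t ≠ 0 := by linarith [ht.2]
    refine (((((hasDerivAt_id t).const_sub w).log hne).const_mul (w - j)).neg.sub
      (hasDerivAt_id t)).congr_deriv ?_
    simp only [id]
    field_simp
    ring
  · apply ContinuousOn.intervalIntegrable
    intro t ht
    rw [Set.uIcc_of_le hj] at ht
    exact ((continuousAt_id.sub continuousAt_const).div (continuousAt_const.sub continuousAt_id)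
      (by linarith [ht.2] : w - t ≠ 0)).continuousWithinAt

lemma logRiesz_eq {w : ℝ} (hw : 2 ≤ w) :
    logRiesz w = harmonicRiesz (w - 1) + (∫ t in (1 : ℝ)..(w - 1), harmonicRiesz t / (w - t))
      + (w - ⌊w⌋₊) * Real.log (w - ⌊w⌋₊) / ⌊w⌋₊ := by
  have hfl : ⌊w⌋₊ = ⌊w - 1⌋₊ + 1 := by
    rw [Nat.floor_sub_one]
    have : 1 ≤ ⌊w⌋₊ := (Nat.one_le_floor_iff w).2 (by linarith)
    omega
  have h1 : ∫ t in (1 : ℝ)..(w - 1), harmonicRiesz t / (w - t)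
      = ∑ j ∈ Icc 1 ⌊w - 1⌋₊, ∫ t in (j : ℝ)..(w - 1), (t - j) / (w - t) / j := by
    rw [sum_integral_swap (a := 1) le_rfl (by linarith : 1 ≤ w - 1)
      (fun j t => (t - j) / (w - t) / j)]
    · refine intervalIntegral.integral_congr fun t _ => ?_
      simp only [harmonicRiesz_eq_sum, Finset.sum_div]
      exact Finset.sum_congr rfl fun j _ => by rw [div_right_comm]
    · intro n hn
      rw [mem_Icc] at hn
      have hn1 : (n : ℝ) ≤ w - 1 := (Nat.le_floor_iff' (by omega)).1 hn.2
      apply ContinuousOn.intervalIntegrable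
      intro t ht
      rw [Set.uIcc_of_le hn1] at ht
      exact (((continuousAt_id.sub continuousAt_const).div (continuousAt_const.sub continuousAt_id)
        (by linarith [ht.2] : w - t ≠ 0)).div_const _).continuousWithinAt
  rw [logRiesz, hfl, Finset.sum_Icc_succ_top (by omega), h1, harmonicRiesz_eq_sum,
    ← Finset.sum_add_distrib]
  congr 1
  refine Finset.sum_congr rfl fun j hj => ?_
  rw [mem_Icc] at hj
  rw [mul_log_sub_eq ((Nat.le_floor_iff' (by omega)).1 hj.2), add_div,
    intervalIntegral.integral_div]

lemma integral_quadratic_div_sub {w g : ℝ} (hw : 2 ≤ w) :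
    ∫ t in (1 : ℝ)..(w - 1), (t * Real.log t + g * t + 1 / 2) / (w - t)
      = w * (Real.log w * Real.log (w - 1) + dilogIntegral w)
        - ((w - 1) * Real.log (w - 1) - (w - 2))
        + g * (w * Real.log (w - 1) - (w - 2)) + Real.log (w - 1) / 2 := by
  have hle : (1 : ℝ) ≤ w - 1 := by linarith
  have hlog : IntervalIntegrable Real.log MeasureTheory.volume 1 (w - 1) :=
    intervalIntegral.intervalIntegrable_log'
  have hinv : IntervalIntegrable (fun t : ℝ => (w - t)⁻¹) MeasureTheory.volume 1 (w - 1) := by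
    apply ContinuousOn.intervalIntegrable
    intro t ht
    rw [Set.uIcc_of_le hle] at ht
    exact ((continuousAt_const.sub continuousAt_id).inv₀
      (by linarith [ht.2] : w - t ≠ 0)).continuousWithinAt
  have hld : IntervalIntegrable (fun t : ℝ => Real.log t / (w - t)) MeasureTheory.volume 1 (w - 1)
      := by
    apply ContinuousOn.intervalIntegrable
    intro t ht
    rw [Set.uIcc_of_le hle] at ht
    exact ((Real.continuousAt_log (by linarith [ht.1])).div (continuousAt_const.sub continuousAt_id)
      (by linarith [ht.2] : w - t ≠ 0)).continuousWithinAt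
  have h1 : ∫ t in (1 : ℝ)..(w - 1), (w - t)⁻¹ = Real.log (w - 1) := by
    rw [intervalIntegral.integral_comp_sub_left (fun τ => τ⁻¹) w,
      show w - (w - 1) = 1 by ring, integral_inv_of_pos one_pos (by linarith), div_one]
  have h2 : ∫ t in (1 : ℝ)..(w - 1), (t * Real.log t + g * t + 1 / 2) / (w - t)
      = ∫ t in (1 : ℝ)..(w - 1), (w * (Real.log t / (w - t)) - Real.log t
        + ((g * w + 1 / 2) * (w - t)⁻¹ - g)) := by
    refine intervalIntegral.integral_congr fun t ht => ?_
    rw [Set.uIcc_of_le hle] at ht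
    have : w - t ≠ 0 := by linarith [ht.2]
    field_simp
    ring
  rw [h2, intervalIntegral.integral_add ((hld.const_mul w).sub hlog)
      ((hinv.const_mul _).sub intervalIntegrable_const),
    intervalIntegral.integral_sub (hld.const_mul w) hlog,
    intervalIntegral.integral_sub (hinv.const_mul _) intervalIntegrable_const,
    intervalIntegral.integral_const_mul, intervalIntegral.integral_const_mul, h1,
    integral_log_div_sub hw, integral_log]
  simp
  ring

lemma abs_integral_harmonicRiesz_error_le {w : ℝ} (hw : 2 ≤ w) :
    |∫ t in (1 : ℝ)..(w - 1),
      (harmonicRiesz t - (t * (Real.log t + Real.eulerMascheroniConstant - 1) + 1 / 2)) / (w - t)|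
      ≤ 20 * Real.log w / w := by
  have hle : (1 : ℝ) ≤ w - 1 := by linarith
  have hinv : IntervalIntegrable (fun t : ℝ => (w - t)⁻¹) MeasureTheory.volume 1 (w - 1) := by
    apply ContinuousOn.intervalIntegrable
    intro t ht
    rw [Set.uIcc_of_le hle] at ht
    exact ((continuousAt_const.sub continuousAt_id).inv₀
      (by linarith [ht.2] : w - t ≠ 0)).continuousWithinAt
  have hinv' : IntervalIntegrable (fun t : ℝ => t⁻¹) MeasureTheory.volume 1 (w - 1) := by
    apply ContinuousOn.intervalIntegrable
    intro t ht
    rw [Set.uIcc_of_le hle] at ht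
    exact (continuousAt_id.inv₀ (by linarith [ht.1] : t ≠ 0)).continuousWithinAt
  have h1 : ∫ t in (1 : ℝ)..(w - 1), (w - t)⁻¹ = Real.log (w - 1) := by
    rw [intervalIntegral.integral_comp_sub_left (fun τ => τ⁻¹) w,
      show w - (w - 1) = 1 by ring, integral_inv_of_pos one_pos (by linarith), div_one]
  have h1' : ∫ t in (1 : ℝ)..(w - 1), t⁻¹ = Real.log (w - 1) := by
    rw [integral_inv_of_pos one_pos (by linarith), div_one]
  have hG : IntervalIntegrable (fun t : ℝ => 10 / w * (t⁻¹ + (w - t)⁻¹)) MeasureTheory.volume 1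
      (w - 1) :=
    (hinv'.add hinv).const_mul _
  rw [← Real.norm_eq_abs]
  refine (intervalIntegral.norm_integral_le_of_norm_le hle ?_ hG).trans ?_
  · refine Filter.Eventually.of_forall fun t ht => ?_
    have ht0 : 0 < t := by linarith [ht.1]
    have hwt : 0 < w - t := by linarith [ht.2]
    rw [Real.norm_eq_abs, abs_div, abs_of_pos hwt]
    calc _ ≤ 10 / t / (w - t) := by
          gcongr
          exact abs_harmonicRiesz_sub_le ht.1.le
      _ = _ := by field_simp; ring
  · rw [intervalIntegral.integral_const_mul, intervalIntegral.integral_add hinv' hinv, h1, h1']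
    have h3 : Real.log (w - 1) ≤ Real.log w := Real.log_le_log (by linarith) (by linarith)
    rw [div_mul_eq_mul_div]
    exact div_le_div_of_nonneg_right (by linarith) (by linarith)

lemma abs_self_mul_log_le_one {v : ℝ} (h0 : 0 ≤ v) (h1 : v ≤ 1) : |v * Real.log v| ≤ 1 := by
  rcases h0.eq_or_lt with h | h
  · rw [← h]; simp
  have h3 := Real.log_le_sub_one_of_pos h
  have h4 := Real.one_sub_inv_le_log_of_pos h
  have h5 : v * (1 - v⁻¹) ≤ v * Real.log v := mul_le_mul_of_nonneg_left h4 h0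
  rw [mul_sub, mul_inv_cancel₀ h.ne'] at h5
  rw [abs_le]
  constructor <;> nlinarith

lemma logRiesz_powBound : ∃ c : ℝ, PowBound (-1) fun w => logRiesz w -
    (w * (Real.log w ^ 2 + (Real.eulerMascheroniConstant - 1) * Real.log w + c)
      + (1 + Real.log w) / 2) := by
  obtain ⟨c, R, hR, hc⟩ := dilogIntegral_powBound
  set γ := Real.eulerMascheroniConstant with hγ
  refine ⟨c + 1, ?_⟩
  have hcont : ContinuousOn (fun w => logRiesz w -
    (w * (Real.log w ^ 2 + (γ - 1) * Real.log w + (c + 1))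
      + (1 + Real.log w) / 2)) (Set.Icc 1 2) := by
    have hl : ContinuousOn Real.log (Set.Icc 1 2) :=
      continuousOn_log_Ici.mono Set.Icc_subset_Ici_self
    exact continuous_logRiesz.continuousOn.sub ((continuousOn_id.mul
      (((hl.pow 2).add (continuousOn_const.mul hl)).add continuousOn_const)).add
        ((continuousOn_const.add hl).div_const 2))
  obtain ⟨B, hB⟩ := isCompact_Icc.exists_bound_of_continuousOn hcont
  have hR1 : PowBound (-1) (fun w => w * R w) := by
    have := PowBound.id.mul hR
    norm_num at this
    exact this
  have hR2 : PowBound (-1) (fun w => |w * R w|) := hR1.of_abs_le fun y _ => (abs_abs _).le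
  have hmain : PowBound (-1) (fun w => w⁻¹ * (30 * (1 + Real.log w)) + |w * R w|) := by
    have := PowBound.inv.mul (((PowBound.const 1).add PowBound.log).const_mul 30)
    norm_num at this
    exact this.add hR2
  refine hmain.of_le_of_two_le B (fun y h1 h2 => hB y ⟨h1, h2⟩) fun w hw => ?_
  have hw0 : 0 < w := by linarith
  have hω := Real.log_nonneg (by linarith : (1 : ℝ) ≤ w)
  refine le_trans ?_ (le_abs_self _)
  set l := Real.log (1 - w⁻¹) with hl
  have hz : w⁻¹ ≤ 1 / 2 := by rw [inv_le_comm₀ hw0 (by norm_num)]; norm_num; exact hw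
  have hi0 : 0 < w⁻¹ := by positivity
  have hL : Real.log (w - 1) = Real.log w + l := by
    rw [hl, ← Real.log_mul hw0.ne' (by linarith)]
    congr 1; field_simp
  have h3 := abs_log_one_sub_add_le hi0.le hz
  rw [← hl] at h3
  have hwl : |w * l + 1| ≤ 2 * w⁻¹ := by
    have : w * l + 1 = w * (l + w⁻¹) := by field_simp
    rw [this, abs_mul, abs_of_pos hw0]
    calc _ ≤ w * (2 * w⁻¹ ^ 2) := by gcongr
      _ = _ := by field_simp
  have hlb : |l| ≤ 2 * w⁻¹ := by
    have : l = (l + w⁻¹) - w⁻¹ := by ring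
    rw [this]
    refine (abs_sub _ _).trans ?_
    rw [abs_of_pos hi0]
    nlinarith
  set ε1 := harmonicRiesz (w - 1) - ((w - 1) * (Real.log (w - 1) + γ - 1) + 1 / 2) with hε1
  have hεb : |ε1| ≤ 20 * w⁻¹ := by
    refine (abs_harmonicRiesz_sub_le (by linarith : (1 : ℝ) ≤ w - 1)).trans ?_
    rw [div_le_iff₀ (by linarith)]
    nlinarith [mul_inv_cancel₀ hw0.ne']
  set rest := (w - ⌊w⌋₊) * Real.log (w - ⌊w⌋₊) / ⌊w⌋₊ with hrest
  have hrestb : |rest| ≤ 2 * w⁻¹ := by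
    have hf1 := Nat.floor_le hw0.le
    have hf2 := Nat.lt_floor_add_one w
    have hf0 : (0 : ℝ) < ⌊w⌋₊ := by linarith
    rw [hrest, abs_div, abs_of_pos hf0, div_le_iff₀ hf0]
    have := abs_self_mul_log_le_one (v := w - ⌊w⌋₊) (by linarith) (by linarith)
    refine this.trans ?_
    nlinarith [mul_inv_cancel₀ hw0.ne']
  set Ei := ∫ t in (1 : ℝ)..(w - 1),
      (harmonicRiesz t - (t * (Real.log t + γ - 1) + 1 / 2)) / (w - t) with hEi
  have hEib : |Ei| ≤ 20 * Real.log w / w := abs_integral_harmonicRiesz_error_le hw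
  have hii : ∫ t in (1 : ℝ)..(w - 1), harmonicRiesz t / (w - t) = Ei +
      ∫ t in (1 : ℝ)..(w - 1), (t * Real.log t + (γ - 1) * t + 1 / 2) / (w - t) := by
    have hle : (1 : ℝ) ≤ w - 1 := by linarith
    have hlc : ContinuousOn Real.log (Set.uIcc 1 (w - 1)) := by
      rw [Set.uIcc_of_le hle]
      exact continuousOn_log_Ici.mono Set.Icc_subset_Ici_self
    have hne : ∀ t ∈ Set.uIcc 1 (w - 1), w - t ≠ 0 := by
      intro t ht
      rw [Set.uIcc_of_le hle] at ht
      linarith [ht.2]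
    rw [hEi, ← intervalIntegral.integral_add]
    · refine intervalIntegral.integral_congr fun t ht => ?_
      rw [← add_div]
      congr 1
      ring
    · apply ContinuousOn.intervalIntegrable
      exact (continuous_harmonicRiesz.continuousOn.sub ((continuousOn_id.mul ((hlc.add
        continuousOn_const).sub continuousOn_const)).add continuousOn_const)).div
          (continuousOn_const.sub continuousOn_id) hne
    · apply ContinuousOn.intervalIntegrable
      exact (((continuousOn_id.mul hlc).add (continuousOn_const.mul continuousOn_id)).add
        continuousOn_const).div (continuousOn_const.sub continuousOn_id) hne
  have hkey : logRiesz w - (w * (Real.log w ^ 2 + (γ - 1) * Real.log w + (c + 1))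
      + (1 + Real.log w) / 2) = (γ - 1 + Real.log w) * (w * l + 1) + l / 2 + w * R w + ε1 + Ei +
          rest := by
    rw [logRiesz_eq hw, hii, integral_quadratic_div_sub hw, hc w hw, ← hrest,
      show harmonicRiesz (w - 1) = ε1 + ((w - 1) * (Real.log (w - 1) + γ - 1) + 1 / 2) by
        rw [hε1]; ring, hL]
    field_simp
    ring
  rw [hkey]
  have hγb := eulerMascheroni_bounds
  have hg1 : |γ - 1 + Real.log w| ≤ 1 + Real.log w := by
    rw [abs_le]; constructor <;> linarith [hγb.1, hγb.2]
  have ht1 : |(γ - 1 + Real.log w) * (w * l + 1)| ≤ (1 + Real.log w) * (2 * w⁻¹) := by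
    rw [abs_mul]; gcongr
  have ht2 : |l / 2| ≤ w⁻¹ := by rw [abs_div, abs_two]; linarith
  have ht3 : 20 * Real.log w / w = 20 * Real.log w * w⁻¹ := rfl
  rw [ht3] at hEib
  have hnn : 0 ≤ Real.log w * w⁻¹ := by positivity
  calc _ ≤ |(γ - 1 + Real.log w) * (w * l + 1)| + |l / 2| + |w * R w| + |ε1| + |Ei| + |rest| := by
        refine (abs_add_le _ _).trans (add_le_add_left ?_ _)
        refine (abs_add_le _ _).trans (add_le_add_left ?_ _)
        refine (abs_add_le _ _).trans (add_le_add_left ?_ _)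
        refine (abs_add_le _ _).trans (add_le_add_left ?_ _)
        exact abs_add_le _ _
    _ ≤ _ := by nlinarith

lemma HasDerivExp.of_integral {n : ℕ} {b : ℝ} {g : ℝ → ℝ} (hg : ContinuousOn g (Set.Ioi 0))
    (hm : Measurable g) (A B : Polynomial ℝ) (hB : B.natDegree ≤ n) (hb : B.coeff n = b)
    (h : PowBound (-1) (fun w => g w - (w * A.eval (Real.log w) + B.eval (Real.log w)))) :
    HasDerivExp n b (fun Z => ∫ w in (1 : ℝ)..Z, g w) := by
  refine ⟨g, fun w hw => ?_, hg.mono (Set.Ici_subset_Ioi.2 one_pos), hm, A, B, hB, hb, h⟩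
  have hw0 : (0 : ℝ) < w := by linarith
  refine intervalIntegral.integral_hasDerivAt_right ?_
    (hm.stronglyMeasurable.aestronglyMeasurable.stronglyMeasurableAtFilter)
    (hg.continuousAt (Ioi_mem_nhds hw0))
  apply (hg.mono _).intervalIntegrable
  intro t ht
  rw [Set.uIcc_of_le hw] at ht
  exact lt_of_lt_of_le one_pos ht.1

lemma continuousOn_log_Ioi : ContinuousOn Real.log (Set.Ioi 0) :=
  Real.continuousOn_log.mono fun _ ht => ne_of_gt ht

/-- The coefficient of `η²` in the inner integral of the switched main term. -/
noncomputable def innerTwo (Z : ℝ) : ℝ := ∫ w in (1 : ℝ)..Z, harmonicRiesz w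

/-- The coefficient of `η` in the inner integral of the switched main term. -/
noncomputable def innerOne (Z : ℝ) : ℝ :=
  ∫ w in (1 : ℝ)..Z, (logRiesz w - harmonicRiesz w + Real.log w * harmonicRiesz w)

/-- The constant term of the inner integral of the switched main term. -/
noncomputable def innerZero (Z : ℝ) : ℝ :=
  ∫ w in (1 : ℝ)..Z, Real.log w * (logRiesz w - harmonicRiesz w)

open Polynomial in
lemma harmonicRiesz_exp : PowBound (-1) (fun w => harmonicRiesz w -
    (w * (X + C (Real.eulerMascheroniConstant - 1) : ℝ[X]).eval (Real.log w)
      + (C (1 / 2) : ℝ[X]).eval (Real.log w))) :=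
  harmonicRiesz_powBound.congr fun w _ => by
    simp only [Polynomial.eval_add, Polynomial.eval_X, Polynomial.eval_C]; ring

lemma hasDerivExp_innerTwo : HasDerivExp 0 (1 / 2) innerTwo :=
  HasDerivExp.of_integral continuous_harmonicRiesz.continuousOn measurable_harmonicRiesz _ _
    (Polynomial.natDegree_C _).le Polynomial.coeff_C_zero harmonicRiesz_exp

lemma hasDerivExp_innerOne : HasDerivExp 1 1 innerOne := by
  obtain ⟨c, hc⟩ := logRiesz_powBound
  have hlog : PowBound (-1) (fun w => Real.log w * (harmonicRiesz w -
      (w * (Real.log w + Real.eulerMascheroniConstant - 1) + 1 / 2))) := by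
    have := PowBound.log.mul harmonicRiesz_powBound
    norm_num at this
    exact this
  refine HasDerivExp.of_integral
    ((continuous_logRiesz.continuousOn.sub continuous_harmonicRiesz.continuousOn).add
      (continuousOn_log_Ioi.mul continuous_harmonicRiesz.continuousOn))
    ((continuous_logRiesz.measurable.sub measurable_harmonicRiesz).add
      (Real.measurable_log.mul measurable_harmonicRiesz))
    (Polynomial.X ^ 2 + Polynomial.C (Real.eulerMascheroniConstant - 1) * Polynomial.X
      + Polynomial.C c - (Polynomial.X + Polynomial.C (Real.eulerMascheroniConstant - 1))
      + Polynomial.X * (Polynomial.X + Polynomial.C (Real.eulerMascheroniConstant - 1)))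
    Polynomial.X Polynomial.natDegree_X_le Polynomial.coeff_X_one
    (((hc.sub harmonicRiesz_powBound).add hlog).congr fun w _ => ?_)
  simp
  ring

lemma hasDerivExp_innerZero : HasDerivExp 2 (1 / 2) innerZero := by
  obtain ⟨c, hc⟩ := logRiesz_powBound
  have hlog := PowBound.log.mul (hc.sub harmonicRiesz_powBound)
  norm_num at hlog
  refine HasDerivExp.of_integral
    (continuousOn_log_Ioi.mul
      (continuous_logRiesz.continuousOn.sub continuous_harmonicRiesz.continuousOn))
    (Real.measurable_log.mul (continuous_logRiesz.measurable.sub measurable_harmonicRiesz))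
    (Polynomial.X * (Polynomial.X ^ 2 + Polynomial.C (Real.eulerMascheroniConstant - 1) *
        Polynomial.X
      + Polynomial.C c - (Polynomial.X + Polynomial.C (Real.eulerMascheroniConstant - 1))))
    (Polynomial.C (1 / 2) * Polynomial.X ^ 2) (Polynomial.natDegree_C_mul_X_pow_le _ _) (by simp)
    (hlog.congr fun w _ => ?_)
  simp
  ring

/-- The coefficient of `θ` in the switched main term. -/
noncomputable def switchOne : ℝ → ℝ :=
  totConv fun Z => 2 * (Real.log Z * innerTwo Z) + innerOne Z

/-- The constant term of the switched main term. -/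
noncomputable def switchZero : ℝ → ℝ :=
  totConv fun Z => Real.log Z * (Real.log Z * innerTwo Z) + Real.log Z * innerOne Z + innerZero Z

lemma sum_totient_inner_eq (y θ : ℝ) :
    ∑ r ∈ Icc 1 ⌊y⌋₊, (r.totient : ℝ) / r * ((θ + Real.log (y / r)) ^ 2 * innerTwo (y / r)
      + (θ + Real.log (y / r)) * innerOne (y / r) + innerZero (y / r))
      = θ ^ 2 * totConv innerTwo y + θ * switchOne y + switchZero y := by
  rw [switchOne, switchZero]
  simp only [totConv]
  rw [Finset.mul_sum, Finset.mul_sum, ← Finset.sum_add_distrib, ← Finset.sum_add_distrib]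
  exact Finset.sum_congr rfl fun r _ => by ring

lemma hasExp_switchTwo : HasExp 1 (3 / Real.pi ^ 2) (totConv innerTwo) := by
  have := hasDerivExp_innerTwo.hasExp_totConv
  norm_num at this
  convert this using 1
  ring

lemma hasExp_switchOne : HasExp 2 (6 / Real.pi ^ 2) switchOne := by
  have := ((hasDerivExp_innerTwo.log_mul.const_mul 2).add hasDerivExp_innerOne).hasExp_totConv
  norm_num at this
  exact this

lemma hasExp_switchZero : HasExp 3 (4 / Real.pi ^ 2) switchZero := by
  have := ((hasDerivExp_innerTwo.log_mul.log_mul.add hasDerivExp_innerOne.log_mul).add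
    hasDerivExp_innerZero).hasExp_totConv
  norm_num at this
  rw [show 6 / Real.pi ^ 2 * 2 / 3 = 4 / Real.pi ^ 2 by ring] at this
  exact this

/-- The main term of the correlation sum with shift `u` attached to the modulus `r`. -/
noncomputable def corrIntegral (r : ℕ) (x u : ℝ) : ℝ :=
  ∫ t in (0 : ℝ)..(x - u),
    mainF r t * (Real.log ((t + u) / r ^ 2) + 2 * Real.eulerMascheroniConstant)

lemma corrIntegral_eq (r j : ℕ) (hr : 0 < r) (hj : 0 < j) {Q y : ℝ} (hQ : 0 < Q)
    (hjy : (j : ℝ) ≤ y / r) :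
    corrIntegral r (y * Q) ((r * j : ℕ) * Q) = (r * Q) ^ 2 * ∫ w in (j : ℝ)..(y / r),
      (w - j) * (Real.log (w - j) + (Real.log (Q / r) + 2 * Real.eulerMascheroniConstant) - 1)
        * (Real.log w + (Real.log (Q / r) + 2 * Real.eulerMascheroniConstant)) := by
  have hr0 : (0 : ℝ) < r := by exact_mod_cast hr
  have hj0 : (0 : ℝ) < j := by exact_mod_cast hj
  have h := intervalIntegral.smul_integral_comp_mul_sub (a := (j : ℝ)) (b := y / r)
    (fun t => mainF r t * (Real.log ((t + (r * j : ℕ) * Q) / r ^ 2)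
      + 2 * Real.eulerMascheroniConstant)) (r * Q) (r * Q * j)
  rw [sub_self, show r * Q * (y / r) - r * Q * j = y * Q - (r * j : ℕ) * Q by
    push_cast; field_simp] at h
  rw [corrIntegral, ← h, smul_eq_mul, sq (r * Q : ℝ), mul_assoc (r * Q : ℝ) (r * Q)]
  congr 1
  rw [← intervalIntegral.integral_const_mul]
  refine intervalIntegral.integral_congr fun w hw => ?_
  rw [Set.uIcc_of_le hjy] at hw
  have hw0 : 0 < w := by linarith [hw.1]
  have h1 : Real.log ((r * Q * w - r * Q * j + (r * j : ℕ) * Q) / r ^ 2)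
      = Real.log w + Real.log (Q / r) := by
    rw [← Real.log_mul hw0.ne' (by positivity)]
    congr 1
    push_cast
    field_simp
    ring
  rw [h1, mainF]
  rcases hw.1.eq_or_lt with h2 | h2
  · rw [← h2]; simp
  · have h3 : Real.log ((r * Q * w - r * Q * j) / r ^ 2) = Real.log (w - j) + Real.log (Q / r) := by
      rw [← Real.log_mul (by linarith) (by positivity)]
      congr 1
      field_simp
    rw [h3]
    ring

lemma intervalIntegrable_inner (j : ℕ) (hj : 0 < j) {Z : ℝ} (hZ : (j : ℝ) ≤ Z) (η : ℝ) :
    IntervalIntegrable (fun w => (w - j) * (Real.log (w - j) + η - 1) * (Real.log w + η) / j)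
      MeasureTheory.volume j Z := by
  have hj0 : (0 : ℝ) < j := by exact_mod_cast hj
  have h1 : Continuous (fun w : ℝ => (w - j) * Real.log (w - j)) :=
    Real.continuous_mul_log.comp (continuous_id.sub continuous_const)
  have h2 : ContinuousOn (fun w : ℝ => (w - j) * Real.log (w - j) + (η - 1) * (w - j))
      (Set.uIcc j Z) :=
    (h1.add (continuous_const.mul (continuous_id.sub continuous_const))).continuousOn
  have h3 : ContinuousOn Real.log (Set.uIcc j Z) := by
    rw [Set.uIcc_of_le hZ]
    exact continuousOn_log_Ioi.mono fun t ht => lt_of_lt_of_le hj0 ht.1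
  have h4 : ContinuousOn (fun w : ℝ => Real.log w + η) (Set.uIcc j Z) := h3.add continuousOn_const
  refine (((h2.mul h4).div_const (j : ℝ)).congr fun w _ => ?_).intervalIntegrable
  simp only [Pi.mul_apply]
  ring

lemma sum_integral_inner {Z : ℝ} (hZ : 1 ≤ Z) (η : ℝ) :
    ∑ j ∈ Icc 1 ⌊Z⌋₊, ∫ w in (j : ℝ)..Z,
      (w - j) * (Real.log (w - j) + η - 1) * (Real.log w + η) / j
      = η ^ 2 * innerTwo Z + η * innerOne Z + innerZero Z := by
  rw [sum_integral_swap (a := 1) le_rfl hZ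
    (fun j w => (w - j) * (Real.log (w - j) + η - 1) * (Real.log w + η) / j)
    (fun n hn => by
      rw [mem_Icc] at hn
      exact intervalIntegrable_inner n hn.1 ((Nat.le_floor_iff' (by omega)).1 hn.2) η)]
  have hl : ContinuousOn Real.log (Set.uIcc 1 Z) := by
    rw [Set.uIcc_of_le hZ]
    exact continuousOn_log_Ici.mono Set.Icc_subset_Ici_self
  have hk1 : ContinuousOn harmonicRiesz (Set.uIcc 1 Z) := continuous_harmonicRiesz.continuousOn
  have hk2 : ContinuousOn logRiesz (Set.uIcc 1 Z) := continuous_logRiesz.continuousOn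
  rw [innerTwo, innerOne, innerZero, ← intervalIntegral.integral_const_mul,
    ← intervalIntegral.integral_const_mul, ← intervalIntegral.integral_add,
    ← intervalIntegral.integral_add]
  · refine intervalIntegral.integral_congr fun w _ => ?_
    have h1 : ∑ j ∈ Icc 1 ⌊w⌋₊, (w - j) * (Real.log (w - j) + η - 1) * (Real.log w + η) / j
        = (logRiesz w + (η - 1) * harmonicRiesz w) * (Real.log w + η) := by
      rw [logRiesz, harmonicRiesz_eq_sum, Finset.mul_sum, ← Finset.sum_add_distrib, Finset.sum_mul]
      exact Finset.sum_congr rfl fun j _ => by ring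
    rw [h1]
    ring
  · exact ((continuousOn_const.mul hk1).add (continuousOn_const.mul
      ((hk2.sub hk1).add (hl.mul hk1)))).intervalIntegrable
  · exact (hl.mul (hk2.sub hk1)).intervalIntegrable
  · exact (continuousOn_const.mul hk1).intervalIntegrable
  · exact (continuousOn_const.mul ((hk2.sub hk1).add (hl.mul hk1))).intervalIntegrable

lemma sum_corrIntegral_eq {x Q : ℝ} (hQ : 0 < Q) (hQx : Q ≤ x) :
    ∑ k ∈ Icc 1 ⌊x / Q⌋₊, 1 / (k : ℝ) * ∑ r ∈ k.divisors,
        (r.totient : ℝ) / r ^ 2 * corrIntegral r x (k * Q)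
      = Q ^ 2 * ((Real.log (Q ^ 2 / x) + 2 * Real.eulerMascheroniConstant) ^ 2
          * totConv innerTwo (x / Q)
        + (Real.log (Q ^ 2 / x) + 2 * Real.eulerMascheroniConstant) * switchOne (x / Q)
        + switchZero (x / Q)) := by
  have hx : 0 < x := by linarith
  set y := x / Q with hy
  have hy0 : 0 < y := by positivity
  have hyQ : x = y * Q := by rw [hy]; field_simp
  have h1 : ∑ k ∈ Icc 1 ⌊y⌋₊, 1 / (k : ℝ) * ∑ r ∈ k.divisors,
        (r.totient : ℝ) / r ^ 2 * corrIntegral r x (k * Q)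
      = ∑ r ∈ Icc 1 ⌊y⌋₊, ∑ j ∈ Icc 1 (⌊y⌋₊ / r), 1 / ((r * j : ℕ) : ℝ) * ((r.totient : ℝ) / r ^ 2
          * corrIntegral r x ((r * j : ℕ) * Q)) := by
    rw [← sum_Icc_divisors (fun r j => 1 / ((r * j : ℕ) : ℝ) * ((r.totient : ℝ) / r ^ 2
          * corrIntegral r x ((r * j : ℕ) * Q)))]
    refine Finset.sum_congr rfl fun k _ => ?_
    rw [Finset.mul_sum]
    refine Finset.sum_congr rfl fun r hr => ?_
    rw [Nat.mul_div_cancel' (Nat.dvd_of_mem_divisors hr)]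
  rw [h1, ← sum_totient_inner_eq, Finset.mul_sum]
  refine Finset.sum_congr rfl fun r hr => ?_
  rw [mem_Icc] at hr
  have hr0 : (0 : ℝ) < r := by exact_mod_cast hr.1
  have hry : (r : ℝ) ≤ y := (Nat.le_floor_iff' (by omega)).1 hr.2
  have hZ : 1 ≤ y / r := by rwa [one_le_div hr0]
  have hη : Real.log (Q ^ 2 / x) + 2 * Real.eulerMascheroniConstant + Real.log (y / r)
      = Real.log (Q / r) + 2 * Real.eulerMascheroniConstant := by
    have : Real.log (Q / r) = Real.log (Q ^ 2 / x) + Real.log (y / r) := by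
      rw [← Real.log_mul (by positivity) (by positivity)]
      congr 1
      rw [hy]
      field_simp
    rw [this]; ring
  rw [hη, ← sum_integral_inner hZ, Finset.mul_sum, Finset.mul_sum, Nat.floor_div_natCast]
  refine Finset.sum_congr rfl fun j hj => ?_
  rw [mem_Icc] at hj
  have hj0 : (0 : ℝ) < j := by exact_mod_cast hj.1
  have hjy : (j : ℝ) ≤ y / r := by
    rw [← Nat.floor_div_natCast] at hj
    exact (Nat.le_floor_iff' (by omega)).1 hj.2
  rw [hyQ, corrIntegral_eq r j hr.1 hj.1 hQ hjy, intervalIntegral.integral_div]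
  push_cast
  field_simp

lemma corrSum_eq (x : ℝ) (k : ℕ) {u : ℝ} (hu : 0 ≤ u) (hux : u ≤ x) :
    corrSum x k u = ∑ n ∈ Icc 1 ⌊x - u⌋₊, divCount n * (Adiv x k n - Adiv (n + u) k n) := by
  have hx : 0 ≤ x := hu.trans hux
  rw [corrSum]
  symm
  have hsub : Icc 1 ⌊x - u⌋₊ ⊆ Icc 1 ⌊x⌋₊ := Icc_subset_Icc_right (Nat.floor_le_floor (by linarith))
  rw [← Finset.sum_subset hsub]
  · refine Finset.sum_congr rfl fun n hn => ?_
    rw [mem_Icc] at hn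
    have hn1 : (n : ℝ) ≤ x - u := (Nat.le_floor_iff' (by omega)).1 hn.2
    rw [← Finset.mul_sum]
    congr 1
    rw [sub_eq_iff_eq_add, Adiv, Adiv, add_comm,
      ← Finset.sum_filter_add_sum_filter_not _ (fun m : ℕ => (m : ℝ) ≤ n + u)]
    congr 1
    · refine Finset.sum_congr ?_ fun _ _ => rfl
      ext m
      simp only [mem_filter, mem_Icc]
      constructor
      · rintro ⟨⟨⟨h1, h2⟩, h3⟩, h4⟩
        exact ⟨⟨h1, Nat.le_floor h4⟩, h3⟩
      · rintro ⟨⟨h1, h2⟩, h3⟩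
        have h4 : (m : ℝ) ≤ n + u := (Nat.le_floor_iff' (by omega)).1 h2
        exact ⟨⟨⟨h1, Nat.le_floor (by linarith)⟩, h3⟩, h4⟩
    · refine Finset.sum_congr ?_ fun _ _ => rfl
      ext m
      simp only [mem_filter, mem_Icc, not_le]
      constructor
      · rintro ⟨⟨h1, h3⟩, h4⟩
        exact ⟨h1, h3.symm, h4⟩
      · rintro ⟨h1, h3, h4⟩
        exact ⟨⟨h1, h3.symm⟩, h4⟩
  · intro n hn hn'
    rw [mem_Icc] at hn hn'
    apply Finset.sum_eq_zero
    intro m hm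
    rw [mem_filter, mem_Icc] at hm
    exfalso
    apply hn'
    refine ⟨hn.1, Nat.le_floor ?_⟩
    have : (m : ℝ) ≤ x := (Nat.le_floor_iff' (by omega)).1 hm.1.2
    linarith [hm.2.2]

lemma hasDerivAt_mainF (r : ℕ) (hr : 0 < r) {t : ℝ} (ht : 0 < t) :
    HasDerivAt (mainF r) (Real.log (t / r ^ 2) + 2 * Real.eulerMascheroniConstant) t := by
  have hr0 : (0 : ℝ) < r := by exact_mod_cast hr
  have h1 : HasDerivAt (fun t : ℝ => t / (r : ℝ) ^ 2) (1 / (r : ℝ) ^ 2) t :=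
    (hasDerivAt_id t).div_const _
  refine ((hasDerivAt_id t).mul (((h1.log (by positivity)).add_const
    (2 * Real.eulerMascheroniConstant)).sub_const 1)).congr_deriv ?_
  simp only [id]
  field_simp
  ring

lemma continuousOn_log_shift (r : ℕ) (hr : 0 < r) {a b u : ℝ} (hab : a ≤ b) (hau : 0 < a + u) :
    ContinuousOn (fun t : ℝ => Real.log ((t + u) / r ^ 2) + 2 * Real.eulerMascheroniConstant)
      (Set.uIcc a b) := by
  have hr0 : (0 : ℝ) < r := by exact_mod_cast hr
  have h1 : ContinuousOn (fun t : ℝ => (t + u) / (r : ℝ) ^ 2) (Set.uIcc a b) :=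
    (continuousOn_id.add continuousOn_const).div_const _
  refine (h1.log fun t ht => ?_).add continuousOn_const
  rw [Set.uIcc_of_le hab] at ht
  have : 0 < t + u := by linarith [ht.1]
  positivity

lemma mainF_sub_eq_integral (r : ℕ) (hr : 0 < r) {a b u : ℝ} (hab : a ≤ b) (hau : 0 < a + u) :
    mainF r (b + u) - mainF r (a + u)
      = ∫ t in a..b, (Real.log ((t + u) / r ^ 2) + 2 * Real.eulerMascheroniConstant) := by
  symm
  refine intervalIntegral.integral_eq_sub_of_hasDerivAt (f := fun t => mainF r (t + u)) ?_
    (continuousOn_log_shift r hr hab hau).intervalIntegrable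
  intro t ht
  rw [Set.uIcc_of_le hab] at ht
  exact (hasDerivAt_mainF r hr (by linarith [ht.1])).comp_add_const t u

lemma sum_divCount_mul_ramanujanSum_eq_integral (r : ℕ) (hr : 0 < r) {x u : ℝ} (hu : 0 < u)
    (hux : u ≤ x) :
    ∑ n ∈ Icc 1 ⌊x - u⌋₊, divCount n * ramanujanSum r n * (mainF r x - mainF r (n + u))
      = ∫ t in (0 : ℝ)..(x - u), ramDivSum r t *
        (Real.log ((t + u) / r ^ 2) + 2 * Real.eulerMascheroniConstant) := by
  have hmem : ∀ n ∈ Icc 1 ⌊x - u⌋₊, (n : ℝ) ≤ x - u := fun n hn => by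
    rw [mem_Icc] at hn
    exact (Nat.le_floor_iff' (by omega)).1 hn.2
  have h := sum_integral_swap (a := 0) (b := x - u) zero_le_one (by linarith) (fun n t =>
    divCount n * ramanujanSum r n *
      (Real.log ((t + u) / r ^ 2) + 2 * Real.eulerMascheroniConstant)) (fun n hn =>
      ((continuousOn_log_shift r hr (hmem n hn)
        (add_pos_of_nonneg_of_pos n.cast_nonneg hu)).intervalIntegrable).const_mul _)
  simp only [← Finset.sum_mul] at h
  refine Eq.trans (Finset.sum_congr rfl fun n hn => ?_) h
  rw [intervalIntegral.integral_const_mul, ← mainF_sub_eq_integral r hr (hmem n hn)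
    (add_pos_of_nonneg_of_pos n.cast_nonneg hu), sub_add_cancel]

lemma continuous_mainF (r : ℕ) (hr : 0 < r) : Continuous (mainF r) := by
  have hr0 : (0 : ℝ) < r := by exact_mod_cast hr
  refine (Real.continuous_mul_log.add (continuous_id.mul (continuous_const
    (y := -Real.log (r ^ 2) + 2 * Real.eulerMascheroniConstant - 1)))).congr fun t => ?_
  rcases eq_or_ne t 0 with rfl | ht
  · simp [mainF]
  · rw [mainF, Real.log_div ht (by positivity)]
    simp only [Pi.add_apply, Pi.mul_apply, id]
    ring

lemma intervalIntegrable_ramDivSum (r : ℕ) {b : ℝ} (hb : 0 ≤ b) :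
    IntervalIntegrable (ramDivSum r) MeasureTheory.volume 0 b := by
  rw [intervalIntegrable_iff_integrableOn_Ioc_of_le hb]
  refine MeasureTheory.Measure.integrableOn_of_bounded
    (M := ∑ n ∈ Icc 1 ⌊b⌋₊, |divCount n * ramanujanSum r n|) (by simp)
    (measurable_floor_comp (fun N => ∑ n ∈ Icc 1 N, divCount n *
        ramanujanSum r n)).aestronglyMeasurable
    ?_
  refine (MeasureTheory.ae_restrict_iff' measurableSet_Ioc).2
      (Filter.Eventually.of_forall fun t ht => ?_)
  rw [Real.norm_eq_abs]
  exact (Finset.abs_sum_le_sum_abs _ _).trans (Finset.sum_le_sum_of_subset_of_nonneg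
    (Icc_subset_Icc_right (Nat.floor_le_floor ht.2)) fun _ _ _ => abs_nonneg _)

lemma abs_integral_ramDivSum_sub_le {x u : ℝ} (hx : 2 ≤ x) (r : ℕ) (hr : 0 < r) (hrx : (r : ℝ) ≤ x)
    (hu : 1 ≤ u) (hux : u ≤ x) :
    |(∫ t in (0 : ℝ)..(x - u), ramDivSum r t *
        (Real.log ((t + u) / r ^ 2) + 2 * Real.eulerMascheroniConstant))
      - r.totient / r * corrIntegral r x u| ≤ 66 * (x * √x * Real.log x) * (r * divCount r) := by
  have hb : 0 ≤ x - u := by linarith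
  have hlog := continuousOn_log_shift r hr (u := u) hb (by linarith)
  have hlogx := Real.log_nonneg (by linarith : 1 ≤ x)
  have hii : IntervalIntegrable (fun t => r.totient / r * (mainF r t *
      (Real.log ((t + u) / r ^ 2) + 2 * Real.eulerMascheroniConstant))) MeasureTheory.volume 0
          (x - u) :=
    (((continuous_mainF r hr).continuousOn).mul hlog).intervalIntegrable.const_mul _
  rw [corrIntegral, ← intervalIntegral.integral_const_mul, ← intervalIntegral.integral_sub
    ((intervalIntegrable_ramDivSum r hb).mul_continuousOn hlog)
    hii,
    ← Real.norm_eq_abs]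
  have hd := divCount_nonneg r
  have hbd : ∀ t ∈ Set.uIoc 0 (x - u), ‖ramDivSum r t *
        (Real.log ((t + u) / r ^ 2) + 2 * Real.eulerMascheroniConstant) - r.totient / r *
        (mainF r t * (Real.log ((t + u) / r ^ 2) + 2 * Real.eulerMascheroniConstant))‖
        ≤ 11 * √x * (r * divCount r) * (6 * Real.log x) := by
    intro t ht
    rw [Set.uIoc_of_le hb] at ht
    have h1 := abs_ramDivSum_sub_le r hr t ht.1
    have h2 := abs_log_div_sq_le r hr hrx (t := t + u) (by linarith [ht.1]) (by linarith [ht.2])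
    have h3 := one_le_two_mul_log hx
    have hg := eulerMascheroni_bounds
    rw [show ramDivSum r t *
        (Real.log ((t + u) / r ^ 2) + 2 * Real.eulerMascheroniConstant) - r.totient / r *
        (mainF r t * (Real.log ((t + u) / r ^ 2) + 2 * Real.eulerMascheroniConstant))
        = (ramDivSum r t - r.totient * mainF r t / r) *
        (Real.log ((t + u) / r ^ 2) + 2 * Real.eulerMascheroniConstant) by ring,
      Real.norm_eq_abs, abs_mul]
    have h4 : √t ≤ √x := Real.sqrt_le_sqrt (by linarith [ht.2])
    have h5 : |Real.log ((t + u) / r ^ 2) + 2 * Real.eulerMascheroniConstant| ≤ 6 * Real.log x := by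
      rw [abs_le] at h2 ⊢
      constructor <;> linarith [h2.1, h2.2]
    calc _ ≤ 11 * √t * (r * divCount r) * (6 * Real.log x) := by gcongr
      _ ≤ _ := by gcongr
  refine (intervalIntegral.norm_integral_le_of_norm_le_const hbd).trans ?_
  rw [sub_zero, abs_of_nonneg hb]
  calc _ ≤ 11 * √x * (r * divCount r) * (6 * Real.log x) * x := by gcongr; linarith
    _ = _ := by ring

lemma abs_corrSum_sub_le {x u : ℝ} (hx : 2 ≤ x) (k : ℕ) (hk : 0 < k) (hkx : (k : ℝ) ≤ x)
    (hu : 1 ≤ u) (hux : u ≤ x) :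
    |corrSum x k u - 1 / k * ∑ r ∈ k.divisors, (r.totient : ℝ) / r ^ 2 * corrIntegral r x u|
      ≤ 22 * (x * √x) * (1 + Real.log x)
        + 66 * (x * √x * Real.log x) * (1 / k * ∑ r ∈ k.divisors, divCount r) := by
  have hk0 : (0 : ℝ) < k := by exact_mod_cast hk
  have hlogx := Real.log_nonneg (by linarith : 1 ≤ x)
  set S := ∑ n ∈ Icc 1 ⌊x - u⌋₊, divCount n * (Mdiv x k n - Mdiv (n + u) k n) with hS
  have h1 : |corrSum x k u - S| ≤ 22 * (x * √x) * (1 + Real.log x) := by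
    rw [corrSum_eq x k (by linarith) hux, hS, ← Finset.sum_sub_distrib]
    refine (Finset.abs_sum_le_sum_abs _ _).trans ?_
    calc _ ≤ ∑ n ∈ Icc 1 ⌊x - u⌋₊, divCount n * (22 * √x) := by
          refine Finset.sum_le_sum fun n hn => ?_
          rw [mem_Icc] at hn
          have hn1 : (n : ℝ) ≤ x - u := (Nat.le_floor_iff' (by omega)).1 hn.2
          have hn0 : (0 : ℝ) ≤ n := n.cast_nonneg
          rw [← mul_sub, abs_mul, abs_of_nonneg (divCount_nonneg n)]
          refine mul_le_mul_of_nonneg_left ?_ (divCount_nonneg n)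
          have h2 := abs_Adiv_sub_Mdiv_le x (by linarith) k n hk
          have h3 := abs_Adiv_sub_Mdiv_le (n + u) (by linarith) k n hk
          have h4 : √(n + u) ≤ √x := Real.sqrt_le_sqrt (by linarith)
          rw [abs_le] at h2 h3 ⊢
          constructor <;> linarith [h2.1, h2.2, h3.1, h3.2]
      _ = (∑ n ∈ Icc 1 ⌊x - u⌋₊, divCount n) * (22 * √x) := by rw [Finset.sum_mul]
      _ ≤ (∑ n ∈ Icc 1 ⌊x⌋₊, divCount n) * (22 * √x) := by
          refine mul_le_mul_of_nonneg_right ?_ (by positivity)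
          exact Finset.sum_le_sum_of_subset_of_nonneg
            (Icc_subset_Icc_right (Nat.floor_le_floor (sub_le_self x (zero_le_one.trans hu)))) fun
                n _ _ => divCount_nonneg n
      _ ≤ (x * (1 + Real.log x)) * (22 * √x) := by
          gcongr
          refine (sum_divCount_le _).trans ?_
          exact mul_le_mul (Nat.floor_le (by linarith)) (harmonicReal_floor_le (by linarith))
            (harmonicReal_nonneg _) (by linarith)
      _ = _ := by ring
  have h2 : S = 1 / k * ∑ r ∈ k.divisors, 1 / (r : ℝ) * ∫ t in (0 : ℝ)..(x - u), ramDivSum r t *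
        (Real.log ((t + u) / r ^ 2) + 2 * Real.eulerMascheroniConstant) := by
    rw [hS]
    simp only [Mdiv_eq, ← mul_sub, ← Finset.sum_sub_distrib]
    simp only [mul_left_comm _ (1 / (k : ℝ)), ← Finset.mul_sum]
    congr 1
    simp only [Finset.mul_sum]
    rw [Finset.sum_comm]
    refine Finset.sum_congr rfl fun r hr => ?_
    rw [← sum_divCount_mul_ramanujanSum_eq_integral r (Nat.pos_of_mem_divisors hr)
      (show 0 < u by linarith) hux,
      Finset.mul_sum]
    exact Finset.sum_congr rfl fun n _ => by ring
  have h3 : |S - 1 / k * ∑ r ∈ k.divisors, (r.totient : ℝ) / r ^ 2 * corrIntegral r x u|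
      ≤ 66 * (x * √x * Real.log x) * (1 / k * ∑ r ∈ k.divisors, divCount r) := by
    rw [h2, ← mul_sub, ← Finset.sum_sub_distrib, abs_mul,
        abs_of_pos (by positivity : 0 < 1 / (k : ℝ)),
      mul_left_comm, Finset.mul_sum]
    refine mul_le_mul_of_nonneg_left ((Finset.abs_sum_le_sum_abs _ _).trans
      (Finset.sum_le_sum fun r hr => ?_)) (by positivity)
    have hr0 : 0 < r := Nat.pos_of_mem_divisors hr
    have hr1 : (0 : ℝ) < r := by exact_mod_cast hr0
    have hrx : (r : ℝ) ≤ x := le_trans (by exact_mod_cast Nat.divisor_le hr) hkx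
    have h4 := abs_integral_ramDivSum_sub_le hx r hr0 hrx hu hux
    rw [show 1 / (r : ℝ) * (∫ t in (0 : ℝ)..(x - u), ramDivSum r t *
        (Real.log ((t + u) / r ^ 2) + 2 * Real.eulerMascheroniConstant))
        - (r.totient : ℝ) / r ^ 2 * corrIntegral r x u
        = 1 / (r : ℝ) * ((∫ t in (0 : ℝ)..(x - u), ramDivSum r t *
        (Real.log ((t + u) / r ^ 2) + 2 * Real.eulerMascheroniConstant))
        - (r.totient : ℝ) / r * corrIntegral r x u) by field_simp, abs_mul,
        abs_of_pos (by positivity : 0 < 1 / (r : ℝ))]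
    calc _ ≤ 1 / (r : ℝ) * (66 * (x * √x * Real.log x) * (r * divCount r)) := by gcongr
      _ = _ := by field_simp
  calc _ = |(corrSum x k u - S) + (S - 1 / k * ∑ r ∈ k.divisors,
        (r.totient : ℝ) / r ^ 2 * corrIntegral r x u)| := by congr 1; ring
    _ ≤ _ := (abs_add_le _ _).trans (add_le_add h1 h3)

/-- The main term of `switchSum x Q`. -/
noncomputable def switchMain (x Q : ℝ) : ℝ :=
  Q ^ 2 * ((Real.log (Q ^ 2 / x) + 2 * Real.eulerMascheroniConstant) ^ 2
      * totConv innerTwo (x / Q)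
    + (Real.log (Q ^ 2 / x) + 2 * Real.eulerMascheroniConstant) * switchOne (x / Q)
    + switchZero (x / Q))

lemma abs_switchSum_sub_le {x Q : ℝ} (hx : 2 ≤ x) (hQ : 1 ≤ Q) (hQx : Q ≤ x) :
    |switchSum x Q - switchMain x Q| ≤ 22 * (x * √x) * (1 + Real.log x) * (x / Q)
      + 66 * (x * √x * Real.log x) * (1 + Real.log x) ^ 3 := by
  have hQ0 : 0 < Q := by linarith
  have hlogx := Real.log_nonneg (by linarith : 1 ≤ x)
  have hy1 : 1 ≤ x / Q := by rwa [one_le_div hQ0]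
  have hyx : x / Q ≤ x := div_le_self (by linarith) hQ
  rw [switchMain, ← sum_corrIntegral_eq hQ0 hQx, switchSum, ← Finset.sum_sub_distrib]
  refine (Finset.abs_sum_le_sum_abs _ _).trans ?_
  have h1 : ∀ k ∈ Icc 1 ⌊x / Q⌋₊, |corrSum x k (k * Q) - 1 / (k : ℝ) * ∑ r ∈ k.divisors,
      (r.totient : ℝ) / r ^ 2 * corrIntegral r x (k * Q)| ≤ 22 * (x * √x) * (1 + Real.log x)
        + 66 * (x * √x * Real.log x) * (1 / k * ∑ r ∈ k.divisors, divCount r) := by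
    intro k hk
    rw [mem_Icc] at hk
    have hk1 : (1 : ℝ) ≤ k := by exact_mod_cast hk.1
    have hky : (k : ℝ) ≤ x / Q := (Nat.le_floor_iff' (by omega)).1 hk.2
    exact abs_corrSum_sub_le hx k hk.1 (hky.trans hyx) (by nlinarith) (by rwa [← le_div_iff₀ hQ0])
  refine (Finset.sum_le_sum h1).trans ?_
  rw [Finset.sum_add_distrib, sum_const, Nat.card_Icc, Nat.add_sub_cancel,
    nsmul_eq_mul]
  have h2 : harmonicReal ⌊x / Q⌋₊ ≤ 1 + Real.log x :=
    (harmonicReal_floor_le hy1).trans (by gcongr)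
  have h3 := harmonicReal_nonneg ⌊x / Q⌋₊
  have h4 : ∑ k ∈ Icc 1 ⌊x / Q⌋₊, 1 / (k : ℝ) * ∑ r ∈ k.divisors, divCount r
      ≤ (1 + Real.log x) ^ 3 := by
    refine (sum_one_div_mul_sum_divisors_le _ divCount_nonneg _).trans ?_
    calc _ ≤ harmonicReal ⌊x / Q⌋₊ * harmonicReal ⌊x / Q⌋₊ ^ 2 := by
          gcongr
          exact sum_divCount_div_le _
      _ = harmonicReal ⌊x / Q⌋₊ ^ 3 := by ring
      _ ≤ _ := by gcongr
  have h5 : (⌊x / Q⌋₊ : ℝ) ≤ x / Q := Nat.floor_le (by positivity)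
  have h6 : 0 ≤ 22 * (x * √x) * (1 + Real.log x) := by positivity
  rw [mul_comm (⌊x / Q⌋₊ : ℝ), ← Finset.mul_sum]
  exact add_le_add (mul_le_mul_of_nonneg_left h5 h6) (mul_le_mul_of_nonneg_left h4 (by positivity))

/-- `f y = O(y ^ (-1/2))` on `[1, ∞)`. -/
def RootBound (f : ℝ → ℝ) : Prop := ∃ C : ℝ, 0 ≤ C ∧ ∀ y : ℝ, 1 ≤ y → |f y| ≤ C / √y

lemma RootBound.powBound {f : ℝ → ℝ} (hf : RootBound f) : PowBound (-(1 / 2)) f := by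
  obtain ⟨C, -, h⟩ := hf
  refine PowBound.of_le C fun y hy => (h y hy).trans_eq ?_
  rw [Real.rpow_neg (by linarith), ← Real.sqrt_eq_rpow, div_eq_mul_inv]

lemma RootBound.add {f g : ℝ → ℝ} (hf : RootBound f) (hg : RootBound g) :
    RootBound (fun y => f y + g y) := by
  obtain ⟨C, hC, h⟩ := hf
  obtain ⟨D, hD, k⟩ := hg
  refine ⟨C + D, by positivity, fun y hy => (abs_add_le _ _).trans ?_⟩
  rw [add_div]
  exact add_le_add (h y hy) (k y hy)

lemma RootBound.congr {f g : ℝ → ℝ} (hg : RootBound g) (h : ∀ y : ℝ, 1 ≤ y → f y = g y) :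
    RootBound f := by
  obtain ⟨C, hC, k⟩ := hg
  exact ⟨C, hC, fun y hy => by rw [h y hy]; exact k y hy⟩

lemma RootBound.exists_integral_sub_const {f : ℝ → ℝ} (hf : RootBound f) (hm : Measurable f) :
    ∃ c, RootBound (fun y => (∫ t in (1 : ℝ)..y, f t * t⁻¹) - c) := by
  have hp := hf.powBound.mul PowBound.inv
  have hm' : Measurable (fun t => f t * t⁻¹) := hm.mul measurable_id.inv
  have hii := hp.integrableOn hm' (by norm_num)
  obtain ⟨C, hC, hb⟩ := hf
  refine ⟨∫ t in Set.Ioi (1 : ℝ), f t * t⁻¹, 2 * C, by positivity, fun y hy => ?_⟩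
  have hy0 : 0 < y := by linarith
  have h1 : (∫ t in (1 : ℝ)..y, f t * t⁻¹) - ∫ t in Set.Ioi (1 : ℝ), f t * t⁻¹
      = - ∫ t in Set.Ioi y, f t * t⁻¹ := by
    have := intervalIntegral.integral_interval_add_Ioi hii (hii.mono_set (Set.Ioi_subset_Ioi hy))
    linarith
  simp only
  rw [h1, abs_neg]
  have h2 : ∫ t in Set.Ioi y, C * t ^ (-(3 / 2) : ℝ) = 2 * C / √y := by
    rw [MeasureTheory.integral_const_mul, integral_Ioi_rpow_of_lt (by norm_num) hy0,
      Real.sqrt_eq_rpow, show (-(3 / 2) + 1 : ℝ) = -(1 / 2) by norm_num, Real.rpow_neg hy0.le]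
    field_simp
  rw [← h2, ← Real.norm_eq_abs]
  refine MeasureTheory.norm_integral_le_of_norm_le
    ((integrableOn_Ioi_rpow_of_lt (by norm_num) hy0).const_mul C) ?_
  filter_upwards [MeasureTheory.ae_restrict_mem measurableSet_Ioi] with t ht
  have ht' : y < t := ht
  have ht0 : 0 < t := by linarith
  have h3 : t ^ (-(3 / 2) : ℝ) = 1 / √t * t⁻¹ := by
    rw [Real.sqrt_eq_rpow, ← Real.rpow_neg_one t, one_div, ← Real.rpow_neg ht0.le,
      ← Real.rpow_add ht0]
    norm_num
  rw [Real.norm_eq_abs, abs_mul, abs_of_pos (inv_pos.2 ht0), h3]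
  calc _ ≤ C / √t * t⁻¹ := by
        gcongr
        exact hb t (by linarith)
    _ = _ := by ring

noncomputable def divSum (y : ℝ) : ℝ := ∑ n ∈ Icc 1 ⌊y⌋₊, divCount n

noncomputable def divLogSum (y : ℝ) : ℝ := ∑ n ∈ Icc 1 ⌊y⌋₊, divCount n / n

lemma measurable_divSum : Measurable divSum :=
  measurable_floor_comp (fun N => ∑ n ∈ Icc 1 N, divCount n)

lemma measurable_divLogSum : Measurable divLogSum :=
  measurable_floor_comp (fun N => ∑ n ∈ Icc 1 N, divCount n / n)

lemma abs_divSum_sub_le {t : ℝ} (ht : 0 < t) :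
    |divSum t - t * (Real.log t + 2 * Real.eulerMascheroniConstant - 1)| ≤ 11 * √t := by
  have h := abs_Adiv_sub_Mdiv_le t ht 1 0 one_pos
  have h1 : Adiv t 1 0 = divSum t := by
    rw [Adiv, divSum]
    simp [divCount, Nat.mod_one]
  have h2 : Mdiv t 1 0 = t * (Real.log t + 2 * Real.eulerMascheroniConstant - 1) := by
    simp [Mdiv, ramanujanSum]
  rwa [h1, h2] at h

lemma divSum_nonneg (y : ℝ) : 0 ≤ divSum y := Finset.sum_nonneg fun n _ => divCount_nonneg n

lemma divSum_le {y : ℝ} (hy : 1 ≤ y) : divSum y ≤ y * (1 + Real.log y) := by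
  refine (sum_divCount_le _).trans ?_
  exact mul_le_mul (Nat.floor_le (by linarith)) (harmonicReal_floor_le hy) (harmonicReal_nonneg _)
    (by linarith)

lemma divLogSum_le {y : ℝ} (hy : 1 ≤ y) : divLogSum y ≤ (1 + Real.log y) ^ 2 := by
  refine (sum_divCount_div_le _).trans ?_
  have := harmonicReal_nonneg ⌊y⌋₊
  gcongr
  exact harmonicReal_floor_le hy

lemma intervalIntegrable_inv_sq_of_one_le {a b : ℝ} (ha : 1 ≤ a) (hb : 1 ≤ b) :
    IntervalIntegrable (fun t : ℝ => (t ^ 2)⁻¹) MeasureTheory.volume a b :=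
  PowBound.inv_sq.intervalIntegrable (measurable_id.pow_const 2).inv ha hb

lemma divLogSum_eq {y : ℝ} (hy : 1 ≤ y) :
    divLogSum y = divSum y / y + ∫ t in (1 : ℝ)..y, divSum t * (t ^ 2)⁻¹ := by
  have hs := sum_integral_swap le_rfl hy (fun n t => divCount n * (t ^ 2)⁻¹) (fun n hn => by
    rw [mem_Icc] at hn
    have h1 : (1 : ℝ) ≤ n := by exact_mod_cast hn.1
    exact (intervalIntegrable_inv_sq_of_one_le h1 hy).const_mul _)
  simp only [← Finset.sum_mul] at hs
  rw [show (fun t => divSum t * (t ^ 2)⁻¹) = fun t => (∑ n ∈ Icc 1 ⌊t⌋₊, divCount n) * (t ^ 2)⁻¹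
    from rfl, ← hs, divLogSum, divSum, Finset.sum_div, ← Finset.sum_add_distrib]
  refine Finset.sum_congr rfl fun n hn => ?_
  rw [mem_Icc] at hn
  have h1 : (1 : ℝ) ≤ n := by exact_mod_cast hn.1
  have h2 : (n : ℝ) ≤ y := (Nat.le_floor_iff' (by omega)).1 hn.2
  have h3 : ∫ t in (n : ℝ)..y, (t ^ 2)⁻¹ = -y⁻¹ - -(n : ℝ)⁻¹ := by
    refine intervalIntegral.integral_eq_sub_of_hasDerivAt (f := fun t => -t⁻¹) ?_
      (intervalIntegrable_inv_sq_of_one_le h1 hy)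
    intro t ht
    rw [Set.uIcc_of_le h2] at ht
    refine (hasDerivAt_inv (by linarith [ht.1] : t ≠ 0)).neg.congr_deriv ?_
    ring
  rw [intervalIntegral.integral_const_mul, h3]
  ring

lemma exists_rootBound_divLogSum : ∃ c, RootBound (fun y => divLogSum y -
    (Real.log y ^ 2 / 2 + 2 * Real.eulerMascheroniConstant * Real.log y + c)) := by
  set g : ℝ := Real.eulerMascheroniConstant
  have hE : RootBound (fun y => (divSum y - y * (Real.log y + 2 * g - 1)) * y⁻¹) := by
    refine ⟨11, by norm_num, fun y hy => ?_⟩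
    have hy0 : 0 < y := by linarith
    rw [abs_mul, abs_of_pos (inv_pos.2 hy0)]
    calc _ ≤ 11 * √y * y⁻¹ := by gcongr; exact abs_divSum_sub_le hy0
      _ = 11 * √y * (√y * √y)⁻¹ := by rw [Real.mul_self_sqrt hy0.le]
      _ = _ := by
        have := Real.sqrt_pos.2 hy0
        field_simp
  have hEm : Measurable (fun y => (divSum y - y * (Real.log y + 2 * g - 1)) * y⁻¹) :=
    (measurable_divSum.sub (measurable_id.mul
      ((Real.measurable_log.add_const _).sub_const _))).mul measurable_id.inv
  obtain ⟨c, hc⟩ := hE.exists_integral_sub_const hEm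
  refine ⟨2 * g - 1 + c, (hE.add hc).congr fun y hy => ?_⟩
  have hy0 : 0 < y := by linarith
  have hi1 : IntervalIntegrable (fun t => (divSum t - t * (Real.log t + 2 * g - 1)) * t⁻¹ * t⁻¹)
      MeasureTheory.volume 1 y :=
    (hE.powBound.mul PowBound.inv).intervalIntegrable (hEm.mul measurable_id.inv) le_rfl hy
  have hcont : ContinuousOn (fun t : ℝ => (Real.log t + (2 * g - 1)) * t⁻¹) (Set.Ici 1) := by
    refine (continuousOn_log_Ici.add continuousOn_const).mul (continuousOn_inv₀.mono fun t ht => ?_)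
    have : (1 : ℝ) ≤ t := ht
    simp only [Set.mem_compl_iff, Set.mem_singleton_iff]; linarith
  have h2 : ∫ t in (1 : ℝ)..y, (Real.log t + (2 * g - 1)) * t⁻¹
      = Real.log y ^ 2 / 2 + (2 * g - 1) * Real.log y := by
    rw [integral_deriv_eq_sub_of_Ici
      (f := fun t => Real.log t ^ 2 / 2 + (2 * g - 1) * Real.log t) ?_ hcont hy]
    · simp
    · intro t ht
      have hl := Real.hasDerivAt_log (by linarith : t ≠ 0)
      refine (((hl.pow 2).div_const 2).add (hl.const_mul (2 * g - 1))).congr_deriv ?_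
      push_cast
      ring
  have h3 : ∫ t in (1 : ℝ)..y, divSum t * (t ^ 2)⁻¹
      = (∫ t in (1 : ℝ)..y, (divSum t - t * (Real.log t + 2 * g - 1)) * t⁻¹ * t⁻¹)
        + ∫ t in (1 : ℝ)..y, (Real.log t + (2 * g - 1)) * t⁻¹ := by
    rw [← intervalIntegral.integral_add hi1 (intervalIntegrable_of_continuousOn_Ici hcont hy)]
    refine intervalIntegral.integral_congr fun t ht => ?_
    rw [Set.uIcc_of_le hy] at ht
    have : t ≠ 0 := by linarith [ht.1]
    field_simp
    ring
  rw [divLogSum_eq hy, h3, h2]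
  field_simp
  ring

/-- `Σ_{n ≤ y} (d(n) / n) log (y / n)`. -/
noncomputable def divLogSumInt (y : ℝ) : ℝ :=
  ∑ n ∈ Icc 1 ⌊y⌋₊, divCount n / n * Real.log (y / n)

lemma divLogSumInt_eq {y : ℝ} (hy : 1 ≤ y) :
    divLogSumInt y = ∫ t in (1 : ℝ)..y, divLogSum t * t⁻¹ := by
  have hii : ∀ n : ℕ, 1 ≤ n → IntervalIntegrable (fun t : ℝ => t⁻¹) MeasureTheory.volume n y :=
    fun n hn => PowBound.inv.intervalIntegrable measurable_id.inv (by exact_mod_cast hn) hy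
  have hs := sum_integral_swap le_rfl hy (fun n t => divCount n / n * t⁻¹) (fun n hn => by
    rw [mem_Icc] at hn
    exact (hii n hn.1).const_mul _)
  simp only [← Finset.sum_mul] at hs
  rw [show (fun t => divLogSum t * t⁻¹) = fun t => (∑ n ∈ Icc 1 ⌊t⌋₊, divCount n / n) * t⁻¹
    from rfl, ← hs, divLogSumInt]
  refine Finset.sum_congr rfl fun n hn => ?_
  rw [mem_Icc] at hn
  have h1 : (1 : ℝ) ≤ n := by exact_mod_cast hn.1
  rw [intervalIntegral.integral_const_mul, integral_inv_of_pos (by linarith) (by linarith)]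

lemma exists_rootBound_divLogSumInt : ∃ c c', RootBound (fun y => divLogSum y -
    (Real.log y ^ 2 / 2 + 2 * Real.eulerMascheroniConstant * Real.log y + c)) ∧
    RootBound (fun y => divLogSumInt y - (Real.log y ^ 3 / 6
      + Real.eulerMascheroniConstant * Real.log y ^ 2 + c * Real.log y + c')) := by
  set g : ℝ := Real.eulerMascheroniConstant
  obtain ⟨c, hc⟩ := exists_rootBound_divLogSum
  have hm : Measurable (fun y => divLogSum y - (Real.log y ^ 2 / 2 + 2 * g * Real.log y + c)) :=
    measurable_divLogSum.sub ((((Real.measurable_log.pow_const 2).div_const 2).add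
      (Real.measurable_log.const_mul _)).add_const _)
  obtain ⟨c', hc'⟩ := hc.exists_integral_sub_const hm
  refine ⟨c, c', hc, hc'.congr fun y hy => ?_⟩
  have hcont : ContinuousOn (fun t : ℝ => (Real.log t ^ 2 / 2 + 2 * g * Real.log t + c) * t⁻¹)
      (Set.Ici 1) := by
    refine ((((continuousOn_log_Ici.pow 2).div_const 2).add
      (continuousOn_const.mul continuousOn_log_Ici)).add continuousOn_const).mul
      (continuousOn_inv₀.mono fun t ht => ?_)
    have : (1 : ℝ) ≤ t := ht
    simp only [Set.mem_compl_iff, Set.mem_singleton_iff]; linarith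
  have h2 : ∫ t in (1 : ℝ)..y, (Real.log t ^ 2 / 2 + 2 * g * Real.log t + c) * t⁻¹
      = Real.log y ^ 3 / 6 + g * Real.log y ^ 2 + c * Real.log y := by
    rw [integral_deriv_eq_sub_of_Ici
      (f := fun t => Real.log t ^ 3 / 6 + g * Real.log t ^ 2 + c * Real.log t) ?_ hcont hy]
    · simp
    · intro t ht
      have hl := Real.hasDerivAt_log (by linarith : t ≠ 0)
      refine ((((hl.pow 3).div_const 6).add ((hl.pow 2).const_mul g)).add
        (hl.const_mul c)).congr_deriv ?_
      push_cast
      ring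
  have hi1 : IntervalIntegrable (fun t => (divLogSum t
      - (Real.log t ^ 2 / 2 + 2 * g * Real.log t + c)) * t⁻¹) MeasureTheory.volume 1 y :=
    (hc.powBound.mul PowBound.inv).intervalIntegrable (hm.mul measurable_id.inv) le_rfl hy
  have h3 : divLogSumInt y = (∫ t in (1 : ℝ)..y, (divLogSum t
      - (Real.log t ^ 2 / 2 + 2 * g * Real.log t + c)) * t⁻¹)
      + ∫ t in (1 : ℝ)..y, (Real.log t ^ 2 / 2 + 2 * g * Real.log t + c) * t⁻¹ := by
    rw [divLogSumInt_eq hy,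
      ← intervalIntegral.integral_add hi1 (intervalIntegrable_of_continuousOn_Ici hcont hy)]
    congr 1
    ext t
    ring
  rw [h3, h2]
  ring

/-- The summatory function of the four-fold divisor function. -/
noncomputable def quadSum (t : ℝ) : ℝ :=
  ∑ n ∈ Icc 1 ⌊t⌋₊, ∑ p ∈ n.divisorsAntidiagonal, divCount p.1 * divCount p.2

lemma quadSum_sq {y : ℝ} (hy : 1 ≤ y) : quadSum (y ^ 2)
    = 2 * ∑ u ∈ Icc 1 ⌊y⌋₊, divCount u * divSum (y ^ 2 / u) - divSum y ^ 2 := by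
  rw [quadSum, sum_divisorsAntidiagonal_hyperbola (fun u v => divCount u * divCount v)
    (fun u v => mul_comm _ _), natSqrt_floor (by positivity), Real.sqrt_sq (by linarith)]
  simp only [← Finset.mul_sum, ← Finset.sum_mul, divSum, Nat.floor_div_natCast]
  ring

lemma sum_divCount_mul_mainTerm {y : ℝ} (hy : 1 ≤ y) (a : ℝ) :
    ∑ u ∈ Icc 1 ⌊y⌋₊, divCount u * (y ^ 2 / u * (Real.log (y ^ 2 / u) + a))
      = y ^ 2 * ((Real.log y + a) * divLogSum y + divLogSumInt y) := by
  rw [divLogSum, divLogSumInt, Finset.mul_sum, ← Finset.sum_add_distrib, Finset.mul_sum]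
  refine Finset.sum_congr rfl fun u hu => ?_
  rw [mem_Icc] at hu
  have hu0 : (u : ℝ) ≠ 0 := by have := hu.1; positivity
  have hy0 : y ≠ 0 := by linarith
  rw [show y ^ 2 / u = y * (y / u) by ring, Real.log_mul hy0 (div_ne_zero hy0 hu0)]
  field_simp
  ring

lemma exists_quadSum_bound : ∃ q₀ q₁ q₂ C : ℝ, 0 ≤ C ∧ ∀ y : ℝ, 1 ≤ y →
    |quadSum (y ^ 2) - y ^ 2 * (4 / 3 * Real.log y ^ 3 + q₂ * Real.log y ^ 2 + q₁ * Real.log y +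
        q₀)|
      ≤ C * (y * √y * (1 + Real.log y) ^ 2) := by
  obtain ⟨c, c', ⟨C1, hC1, h1⟩, ⟨C2, hC2, h2⟩⟩ := exists_rootBound_divLogSumInt
  obtain ⟨hg0, hg1⟩ := eulerMascheroni_bounds
  set g : ℝ := Real.eulerMascheroniConstant
  set a : ℝ := 2 * g - 1 with ha
  refine ⟨2 * a * c + 2 * c' - a ^ 2, 4 * g * a + 4 * c - 2 * a, a + 6 * g - 1,
    165 + 2 * C1 + 2 * C2, by positivity, fun y hy => ?_⟩
  have hy0 : 0 < y := by linarith
  have hω := Real.log_nonneg hy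
  have hs := Real.sqrt_pos.2 hy0
  have hs1 : 1 ≤ √y := Real.one_le_sqrt.2 hy
  have hss := Real.mul_self_sqrt hy0.le
  set B := y * √y * (1 + Real.log y) ^ 2 with hB
  have e1 : |∑ u ∈ Icc 1 ⌊y⌋₊, divCount u * divSum (y ^ 2 / u)
      - y ^ 2 * ((Real.log y + a) * divLogSum y + divLogSumInt y)| ≤ 11 * B := by
    rw [← sum_divCount_mul_mainTerm hy, ← Finset.sum_sub_distrib]
    refine (Finset.abs_sum_le_sum_abs _ _).trans ?_
    calc _ ≤ ∑ u ∈ Icc 1 ⌊y⌋₊, 11 * (y * √y) * (divCount u / u) := by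
          refine Finset.sum_le_sum fun u hu => ?_
          rw [mem_Icc] at hu
          have hu0 : (0 : ℝ) < u := by have := hu.1; positivity
          have huy : (u : ℝ) ≤ y := (Nat.le_floor_iff' (by omega)).1 hu.2
          have hd := divCount_nonneg u
          have := abs_divSum_sub_le (show 0 < y ^ 2 / u by positivity)
          rw [← mul_sub, abs_mul, abs_of_nonneg hd, add_sub_assoc] at *
          have h3 : √(y ^ 2 / u) ≤ y * √y / u := by
            rw [Real.sqrt_div (by positivity), Real.sqrt_sq hy0.le,
              div_le_div_iff₀ (Real.sqrt_pos.2 hu0) hu0]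
            have h5 : √(u : ℝ) ≤ √y := Real.sqrt_le_sqrt huy
            calc y * u = y * (√(u : ℝ) * √(u : ℝ)) := by rw [Real.mul_self_sqrt hu0.le]
              _ ≤ y * (√y * √(u : ℝ)) := by gcongr
              _ = _ := by ring
          calc _ ≤ divCount u * (11 * (y * √y / u)) := by
                refine mul_le_mul_of_nonneg_left ?_ hd
                linarith
            _ = _ := by ring
      _ = 11 * (y * √y) * divLogSum y := by rw [← Finset.mul_sum, divLogSum]
      _ ≤ 11 * (y * √y) * (1 + Real.log y) ^ 2 := by gcongr; exact divLogSum_le hy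
      _ = _ := by rw [hB]; ring
  have hYB : y * √y * (1 + Real.log y) ≤ B := by
    rw [hB]
    refine mul_le_mul_of_nonneg_left ?_ (by positivity)
    nlinarith
  have hYB1 : y * √y ≤ B := by nlinarith [mul_nonneg (mul_pos hy0 hs).le hω]
  have hyy : y ^ 2 / √y = y * √y := by
    rw [div_eq_iff hs.ne', mul_assoc, hss]; ring
  have e2 := h1 y hy
  have e3 := h2 y hy
  have e2' : |y ^ 2 * ((Real.log y + a) * (divLogSum y
      - (Real.log y ^ 2 / 2 + 2 * g * Real.log y + c)))| ≤ C1 * B := by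
    rw [abs_mul, abs_mul, abs_of_nonneg (by positivity : 0 ≤ y ^ 2)]
    have : |Real.log y + a| ≤ 1 + Real.log y := by
      rw [abs_le]; constructor <;> linarith
    calc _ ≤ y ^ 2 * ((1 + Real.log y) * (C1 / √y)) := by gcongr
      _ = C1 * (y ^ 2 / √y * (1 + Real.log y)) := by ring
      _ ≤ _ := by rw [hyy]; gcongr
  have e3' : |y ^ 2 * (divLogSumInt y - (Real.log y ^ 3 / 6 + g * Real.log y ^ 2
      + c * Real.log y + c'))| ≤ C2 * B := by
    rw [abs_mul, abs_of_nonneg (by positivity : 0 ≤ y ^ 2)]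
    calc _ ≤ y ^ 2 * (C2 / √y) := by gcongr
      _ = C2 * (y ^ 2 / √y) := by ring
      _ ≤ _ := by rw [hyy]; gcongr
  have e4 := abs_divSum_sub_le hy0
  rw [add_sub_assoc, ← ha] at e4
  have e4' : |divSum y ^ 2 - (y * (Real.log y + a)) ^ 2| ≤ 143 * B := by
    set e := divSum y - y * (Real.log y + a) with he
    rw [show divSum y ^ 2 - (y * (Real.log y + a)) ^ 2 = e * (2 * divSum y - e) by rw [he]; ring,
      abs_mul]
    have h5 := divSum_le hy
    have h6 := divSum_nonneg y
    have h7 : |2 * divSum y - e| ≤ 2 * (y * (1 + Real.log y)) + 11 * √y := by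
      refine (abs_sub _ _).trans ?_
      rw [abs_of_nonneg (by positivity)]
      gcongr
    calc _ ≤ 11 * √y * (2 * (y * (1 + Real.log y)) + 11 * √y) := by gcongr
      _ = 22 * (y * √y * (1 + Real.log y)) + 121 * (√y * √y) := by ring
      _ ≤ 22 * B + 121 * B := by
        rw [hss]
        have : y ≤ B := le_trans (by nlinarith) hYB1
        gcongr
      _ = _ := by ring
  rw [quadSum_sq hy]
  rw [abs_le] at *
  constructor <;> linarith [e1.1, e1.2, e2'.1, e2'.2, e3'.1, e3'.2, e4'.1, e4'.2]

/-- The arithmetic function supported on squares with value `μ(e)` at `e ^ 2`. -/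
noncomputable def sqMoebius : ArithmeticFunction ℝ :=
  ⟨fun n => if IsSquare n then (ArithmeticFunction.moebius (Nat.sqrt n) : ℝ) else 0, by simp⟩

lemma sqMoebius_sq (e : ℕ) : sqMoebius (e ^ 2) = ArithmeticFunction.moebius e := by
  change (if IsSquare (e ^ 2) then _ else _) = _
  rw [if_pos (IsSquare.sq e), Nat.sqrt_eq']

lemma sqMoebius_of_not_isSquare {n : ℕ} (h : ¬ IsSquare n) : sqMoebius n = 0 := if_neg h

lemma isSquare_left_of_coprime {m n : ℕ} (hmn : m.Coprime n) (h : IsSquare (m * n)) :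
    IsSquare m := by
  obtain ⟨c, hc⟩ := isSquare_iff_exists_sq _ |>.1 h
  have hu : IsUnit (GCDMonoid.gcd m n) := by
    rw [Nat.isUnit_iff]; exact hmn
  obtain ⟨d, hd⟩ := exists_eq_pow_of_mul_eq_pow hu hc
  exact hd ▸ IsSquare.sq d

lemma isMultiplicative_sqMoebius : sqMoebius.IsMultiplicative := by
  rw [ArithmeticFunction.IsMultiplicative.iff_ne_zero]
  refine ⟨by simpa using sqMoebius_sq 1, fun {m n} _ _ hmn => ?_⟩
  by_cases h : IsSquare (m * n)
  · obtain ⟨a, rfl⟩ := isSquare_iff_exists_sq _ |>.1 (isSquare_left_of_coprime hmn h)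
    obtain ⟨b, rfl⟩ := isSquare_iff_exists_sq _ |>.1
      (isSquare_left_of_coprime hmn.symm (by rwa [mul_comm]))
    have hab : a.Coprime b :=
      (Nat.coprime_pow_left_iff two_pos _ _).1 ((Nat.coprime_pow_right_iff two_pos _ _).1 hmn)
    rw [← mul_pow, sqMoebius_sq, sqMoebius_sq, sqMoebius_sq,
      ArithmeticFunction.isMultiplicative_moebius.map_mul_of_coprime hab]
    push_cast; rfl
  · rw [sqMoebius_of_not_isSquare h]
    by_cases hm : IsSquare m
    · by_cases hn : IsSquare n
      · exact absurd (hm.mul hn) h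
      · rw [sqMoebius_of_not_isSquare hn, mul_zero]
    · rw [sqMoebius_of_not_isSquare hm, zero_mul]

lemma sqMoebius_prime_pow {p : ℕ} (hp : p.Prime) (i : ℕ) :
    sqMoebius (p ^ i) = if i = 0 then 1 else if i = 2 then -1 else 0 := by
  rcases Nat.even_or_odd' i with ⟨j, rfl | rfl⟩
  · rw [pow_mul', sqMoebius_sq]
    rcases Nat.eq_zero_or_pos j with rfl | hj
    · simp
    · rw [ArithmeticFunction.moebius_apply_prime_pow hp hj.ne']
      by_cases h : j = 1
      · simp [h]
      · rw [if_neg h, if_neg (by omega), if_neg (by omega)]; simp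
  · rw [if_neg (by omega), if_neg (by omega)]
    refine sqMoebius_of_not_isSquare fun h => ?_
    obtain ⟨c, hc⟩ := isSquare_iff_exists_sq _ |>.1 h
    have h1 := congrArg (fun n => n.factorization p) hc
    simp only [Nat.factorization_pow, hp.factorization, Finsupp.smul_apply, smul_eq_mul,
      Finsupp.single_eq_same] at h1
    omega

noncomputable def divCountArith : ArithmeticFunction ℝ := ((ArithmeticFunction.sigma 0 :
  ArithmeticFunction ℕ) : ArithmeticFunction ℝ)

lemma divCountArith_apply (n : ℕ) : divCountArith n = divCount n := by
  simp [divCountArith, divCount, ArithmeticFunction.sigma_zero_apply]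

lemma isMultiplicative_divCountArith : divCountArith.IsMultiplicative :=
  ArithmeticFunction.isMultiplicative_sigma.natCast

lemma divCountArith_prime_pow {p : ℕ} (hp : p.Prime) (i : ℕ) : divCountArith (p ^ i) = i + 1 := by
  simp [divCountArith, ArithmeticFunction.sigma_zero_apply_prime_pow hp]

lemma mul_apply_prime_pow (f g : ArithmeticFunction ℝ) {p : ℕ} (hp : p.Prime) (k : ℕ) :
    (f * g) (p ^ k) = ∑ i ∈ Finset.range (k + 1), f (p ^ i) * g (p ^ (k - i)) := by
  rw [ArithmeticFunction.mul_apply, Nat.sum_divisorsAntidiagonal (fun a b => f a * g b),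
    Nat.sum_divisors_prime_pow hp]
  refine Finset.sum_congr rfl fun i hi => ?_
  rw [Nat.pow_div (by simpa [Nat.lt_succ_iff] using hi) hp.pos]

lemma divCountArith_mul_self_prime_pow {p : ℕ} (hp : p.Prime) (k : ℕ) :
    (divCountArith * divCountArith) (p ^ k) = ((k : ℝ) + 1) * (k + 2) * (k + 3) / 6 := by
  have h : ∀ m : ℕ, ∑ i ∈ Finset.range m, ((i : ℝ) + 1) * (k - i + 1)
      = (k + 2) * (m * (m + 1) / 2) - m * (m + 1) * (2 * m + 1) / 6 := by
    intro m
    induction m with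
    | zero => simp
    | succ m ih =>
      rw [Finset.sum_range_succ, ih]
      push_cast; ring
  rw [mul_apply_prime_pow _ _ hp]
  calc _ = ∑ i ∈ Finset.range (k + 1), ((i : ℝ) + 1) * (k - i + 1) := by
        refine Finset.sum_congr rfl fun i hi => ?_
        rw [Finset.mem_range] at hi
        rw [divCountArith_prime_pow hp, divCountArith_prime_pow hp, Nat.cast_sub (by omega)]
    _ = _ := by
      rw [h]; push_cast; ring

lemma pmul_divCountArith : divCountArith.pmul divCountArith
    = sqMoebius * (divCountArith * divCountArith) := by
  have hd := isMultiplicative_divCountArith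
  rw [(hd.pmul hd).eq_iff_eq_on_prime_powers _ _ (isMultiplicative_sqMoebius.mul (hd.mul hd))]
  intro p k hp
  rw [ArithmeticFunction.pmul_apply, divCountArith_prime_pow hp, mul_apply_prime_pow _ _ hp]
  simp only [sqMoebius_prime_pow hp, divCountArith_mul_self_prime_pow hp]
  rcases Nat.lt_or_ge k 2 with h | h
  · interval_cases k
    · norm_num
    · norm_num [Finset.sum_range_succ]
  · obtain ⟨j, rfl⟩ := Nat.exists_eq_add_of_le' h
    rw [show j + 2 + 1 = j + 1 + 1 + 1 by ring, Finset.sum_range_succ', Finset.sum_range_succ',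
      Finset.sum_range_succ', Finset.sum_eq_zero]
    · simp
      ring
    · intro i _
      rw [if_neg (by omega), if_neg (by omega), zero_mul]

lemma divSqSum_sq {y : ℝ} (hy : 0 ≤ y) : divSqSum (y ^ 2)
    = ∑ e ∈ Icc 1 ⌊y⌋₊, (ArithmeticFunction.moebius e : ℝ) * quadSum ((y / e) ^ 2) := by
  have h1 : divSqSum (y ^ 2) = ∑ n ∈ Icc 1 ⌊y ^ 2⌋₊, ∑ p ∈ n.divisorsAntidiagonal,
      sqMoebius p.1 * (divCountArith * divCountArith) p.2 := by
    rw [divSqSum]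
    refine Finset.sum_congr rfl fun n _ => ?_
    have := congrArg (fun f => f n) pmul_divCountArith
    simp only [ArithmeticFunction.pmul_apply, divCountArith_apply] at this
    rw [sq, this, ArithmeticFunction.mul_apply]
  rw [h1, sum_Icc_divisorsAntidiagonal (fun a b => sqMoebius a * (divCountArith * divCountArith) b)]
  have h2 : ⌊y⌋₊ = Nat.sqrt ⌊y ^ 2⌋₊ := by rw [natSqrt_floor (by positivity), Real.sqrt_sq hy]
  set N := ⌊y ^ 2⌋₊ with hN
  have h3 : ∀ e : ℕ, (divCountArith * divCountArith) e = ∑ p ∈ e.divisorsAntidiagonal,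
      divCount p.1 * divCount p.2 := by
    intro e
    simp only [ArithmeticFunction.mul_apply, divCountArith_apply]
  have h4 : ∀ e : ℕ, ⌊(y / e) ^ 2⌋₊ = N / e ^ 2 := by
    intro e
    rw [div_pow, ← Nat.cast_pow, Nat.floor_div_natCast]
  have h5 : ((Icc 1 ⌊y⌋₊).image (fun e => e ^ 2)) ⊆ Icc 1 N := by
    intro n hn
    rw [Finset.mem_image] at hn
    obtain ⟨e, he, rfl⟩ := hn
    rw [mem_Icc, h2] at he
    rw [mem_Icc]
    exact ⟨Nat.one_le_pow _ _ he.1, by rw [sq]; exact Nat.le_sqrt.1 he.2⟩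
  rw [← Finset.sum_subset h5, Finset.sum_image]
  · refine Finset.sum_congr rfl fun e _ => ?_
    simp only [quadSum, h4, sqMoebius_sq, ← Finset.mul_sum, h3]
  · intro a _ b _ hab
    exact Nat.pow_left_injective (by norm_num) hab
  · intro n hn hn'
    rw [mem_Icc] at hn
    rw [sqMoebius_of_not_isSquare]
    · simp
    · intro h
      obtain ⟨c, rfl⟩ := isSquare_iff_exists_sq _ |>.1 h
      refine hn' (Finset.mem_image.2 ⟨c, ?_, rfl⟩)
      rw [mem_Icc, h2, Nat.le_sqrt, ← sq]
      exact ⟨Nat.pos_of_ne_zero fun h => by simp [h] at hn, hn.2⟩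

/-- Truncations of `Σ μ(e) (log e)^j / e²`. -/
noncomputable def moebiusLogSum (j : ℕ) (y : ℝ) : ℝ :=
  ∑ e ∈ Icc 1 ⌊y⌋₊, (ArithmeticFunction.moebius e : ℝ) / (e : ℝ) ^ 2 * Real.log e ^ j

lemma exists_moebiusLogSum_powBound (j : ℕ) :
    ∃ c, PowBound (-1) (fun y => moebiusLogSum j y - c) := by
  have hp : PowBound (-2) (fun t => (t ^ 2)⁻¹ * Real.log t ^ j) := by
    simpa using PowBound.inv_sq.mul (PowBound.log_pow j)
  have hb := powBound_floor
    (fun e : ℕ => (ArithmeticFunction.moebius e : ℝ) / (e : ℝ) ^ 2 * Real.log e ^ j)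
    (fun t => (t ^ 2)⁻¹ * Real.log t ^ j) hp (fun n _ => by
      rw [abs_mul, abs_mul, abs_div, abs_inv, div_eq_mul_inv]
      gcongr
      refine mul_le_of_le_one_left (by positivity) ?_
      exact_mod_cast ArithmeticFunction.abs_moebius_le_one)
  obtain ⟨c, hc⟩ := exists_sum_sub_const_powBound (show (-2 : ℝ) < -1 by norm_num)
    (fun e : ℕ => (ArithmeticFunction.moebius e : ℝ) / (e : ℝ) ^ 2 * Real.log e ^ j) hb
  refine ⟨c, ?_⟩
  norm_num at hc
  exact hc

lemma sum_moebius_mul_cubic (q₀ q₁ q₂ q₃ : ℝ) {y : ℝ} (hy : 1 ≤ y) :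
    ∑ e ∈ Icc 1 ⌊y⌋₊, (ArithmeticFunction.moebius e : ℝ) * ((y / e) ^ 2 *
      (q₃ * Real.log (y / e) ^ 3 + q₂ * Real.log (y / e) ^ 2 + q₁ * Real.log (y / e) + q₀))
    = y ^ 2 * (moebiusLogSum 0 y * (q₃ * Real.log y ^ 3 + q₂ * Real.log y ^ 2 + q₁ * Real.log y +
        q₀)
      - moebiusLogSum 1 y * (3 * q₃ * Real.log y ^ 2 + 2 * q₂ * Real.log y + q₁)
      + moebiusLogSum 2 y * (3 * q₃ * Real.log y + q₂) - moebiusLogSum 3 y * q₃) := by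
  simp only [moebiusLogSum, Finset.sum_mul, ← Finset.sum_sub_distrib, ← Finset.sum_add_distrib,
    Finset.mul_sum]
  refine Finset.sum_congr rfl fun e he => ?_
  rw [mem_Icc] at he
  have he0 : (e : ℝ) ≠ 0 := by have := he.1; positivity
  rw [Real.log_div (by linarith) he0]
  field_simp
  ring

lemma moebiusLogSum_zero_powBound : PowBound (-1) (fun y => moebiusLogSum 0 y - 6 / Real.pi ^ 2) :=
  moebius_sum_powBound.congr fun y _ => by simp [moebiusLogSum]

lemma exists_abs_divSqSum_sub_le : ∃ b₀ b₁ b₂ C : ℝ, 0 ≤ C ∧ ∀ x : ℝ, 1 ≤ x →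
    |divSqSum x - x * (Real.log x ^ 3 / Real.pi ^ 2 + b₂ * Real.log x ^ 2 + b₁ * Real.log x + b₀)|
      ≤ C * (x ^ (3 / 4 : ℝ) * (1 + Real.log x) ^ 3) := by
  obtain ⟨q₀, q₁, q₂, C, hC, hq⟩ := exists_quadSum_bound
  have h0 := moebiusLogSum_zero_powBound
  obtain ⟨c1, h1⟩ := exists_moebiusLogSum_powBound 1
  obtain ⟨c2, h2⟩ := exists_moebiusLogSum_powBound 2
  obtain ⟨c3, h3⟩ := exists_moebiusLogSum_powBound 3
  set c0 := 6 / Real.pi ^ 2 with hc0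
  have hR : PowBound (-1) (fun y =>
      (moebiusLogSum 0 y - c0) * (4 / 3 * Real.log y ^ 3 + q₂ * Real.log y ^ 2 + q₁ * Real.log y +
          q₀)
      - (moebiusLogSum 1 y - c1) * (4 * Real.log y ^ 2 + 2 * q₂ * Real.log y + q₁)
      + (moebiusLogSum 2 y - c2) * (4 * Real.log y + q₂) - (moebiusLogSum 3 y - c3) * (4 / 3)) := by
    have l := PowBound.log
    have k0 := h0.mul (((((PowBound.log_pow 3).const_mul (4 / 3)).add
      ((PowBound.log_pow 2).const_mul q₂)).add (l.const_mul q₁)).add (PowBound.const q₀))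
    have k1 := h1.mul ((((PowBound.log_pow 2).const_mul 4).add (l.const_mul (2 * q₂))).add
      (PowBound.const q₁))
    have k2 := h2.mul ((l.const_mul 4).add (PowBound.const q₂))
    have k3 := h3.mul (PowBound.const (4 / 3))
    simp only [add_zero] at k0 k1 k2 k3
    exact ((k0.sub k1).add k2).sub k3
  obtain ⟨D, hD, hR⟩ := hR (1 / 2) (by norm_num)
  refine ⟨c0 * q₀ - c1 * q₁ + c2 * q₂ - c3 * (4 / 3), (c0 * q₁ - 2 * c1 * q₂ + 4 * c2) / 2,
    (c0 * q₂ - 4 * c1) / 4, C + D, by positivity, fun x hx => ?_⟩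
  have hx0 : 0 < x := by linarith
  set y := √x with hy
  have hy1 : 1 ≤ y := Real.one_le_sqrt.2 hx
  have hy0 : 0 < y := by linarith
  have hxy : x = y ^ 2 := (Real.sq_sqrt hx0.le).symm
  have hlog : Real.log x = 2 * Real.log y := by rw [hxy, Real.log_pow]; norm_num
  have hω := Real.log_nonneg hy1
  have hp : x ^ (3 / 4 : ℝ) = y * √y := by
    rw [hxy, ← Real.rpow_natCast, ← Real.rpow_mul hy0.le, Real.sqrt_eq_rpow]
    nth_rewrite 2 [← Real.rpow_one y]
    rw [← Real.rpow_add hy0]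
    norm_num
  rw [hp, hlog]
  have e1 := hR y hy1
  have e2 := sum_moebius_mul_cubic q₀ q₁ q₂ (4 / 3) hy1
  have e3 : |divSqSum x - ∑ e ∈ Icc 1 ⌊y⌋₊, (ArithmeticFunction.moebius e : ℝ) * ((y / e) ^ 2 *
      (4 / 3 * Real.log (y / e) ^ 3 + q₂ * Real.log (y / e) ^ 2 + q₁ * Real.log (y / e) + q₀))|
      ≤ C * (y * √y * (1 + Real.log y) ^ 3) := by
    rw [hxy, divSqSum_sq hy0.le, ← Finset.sum_sub_distrib]
    refine (Finset.abs_sum_le_sum_abs _ _).trans ?_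
    calc _ ≤ ∑ e ∈ Icc 1 ⌊y⌋₊, C * (y * √y * (1 + Real.log y) ^ 2) * (1 / (e : ℝ)) := by
          refine Finset.sum_le_sum fun e he => ?_
          rw [mem_Icc] at he
          have he1 : (1 : ℝ) ≤ e := by exact_mod_cast he.1
          have hey : (e : ℝ) ≤ y := (Nat.le_floor_iff' (by omega)).1 he.2
          have h1 : 1 ≤ y / e := by rwa [one_le_div (by linarith)]
          have h2 : y / e ≤ y := div_le_self hy0.le he1
          rw [← mul_sub, abs_mul]
          refine (mul_le_of_le_one_left (abs_nonneg _)
            (by exact_mod_cast ArithmeticFunction.abs_moebius_le_one)).trans ((hq _ h1).trans ?_)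
          have h3 := Real.log_nonneg h1
          calc _ ≤ C * (y / e * √y * (1 + Real.log y) ^ 2) := by gcongr
            _ = _ := by ring
      _ = C * (y * √y * (1 + Real.log y) ^ 2) * harmonicReal ⌊y⌋₊ := by
          rw [← Finset.mul_sum, harmonicReal]
      _ ≤ C * (y * √y * (1 + Real.log y) ^ 2) * (1 + Real.log y) := by
          gcongr; exact harmonicReal_floor_le hy1
      _ = _ := by ring
  have e4 : y ^ 2 * (D * y ^ (-1 + 1 / 2 : ℝ)) = D * (y * √y) := by
    have : y ^ (-1 + 1 / 2 : ℝ) * y = √y := by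
      rw [Real.sqrt_eq_rpow]
      nth_rewrite 2 [← Real.rpow_one y]
      rw [← Real.rpow_add hy0]
      norm_num
    rw [← this]; ring
  have e5 : y ^ 2 * |(moebiusLogSum 0 y - c0) * (4 / 3 * Real.log y ^ 3 + q₂ * Real.log y ^ 2
      + q₁ * Real.log y + q₀)
      - (moebiusLogSum 1 y - c1) * (4 * Real.log y ^ 2 + 2 * q₂ * Real.log y + q₁)
      + (moebiusLogSum 2 y - c2) * (4 * Real.log y + q₂) - (moebiusLogSum 3 y - c3) * (4 / 3)|
      ≤ D * (y * √y) := by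
    rw [← e4]; gcongr
  rw [← abs_of_pos (by positivity : 0 < y ^ 2), ← abs_mul] at e5
  have e6 : y * √y * (1 + Real.log y) ^ 3 ≤ y * √y * (1 + 2 * Real.log y) ^ 3 := by
    gcongr; linarith
  have e7 : y * √y ≤ y * √y * (1 + 2 * Real.log y) ^ 3 :=
    le_mul_of_one_le_right (by positivity) (one_le_pow₀ (by linarith))
  rw [e2] at e3
  have e8 : |divSqSum x - x * ((2 * Real.log y) ^ 3 / Real.pi ^ 2
      + (c0 * q₂ - 4 * c1) / 4 * (2 * Real.log y) ^ 2
      + (c0 * q₁ - 2 * c1 * q₂ + 4 * c2) / 2 * (2 * Real.log y)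
      + (c0 * q₀ - c1 * q₁ + c2 * q₂ - c3 * (4 / 3)))| ≤ C * (y * √y * (1 + Real.log y) ^ 3)
      + D * (y * √y) := by
    refine le_trans (le_of_eq ?_) ((abs_add_le _ _).trans (add_le_add e3 e5))
    congr 1
    rw [hc0]
    nth_rewrite 2 [hxy]
    ring
  refine e8.trans ?_
  rw [add_mul]
  gcongr

noncomputable def trigSum (a : ℕ → ℂ) (N : ℕ) (α : ℝ) : ℂ :=
  ∑ n ∈ Icc 1 N, a n * expTwoPi (n * α)

lemma hasDerivAt_expTwoPi (n : ℕ) (α : ℝ) :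
    HasDerivAt (fun α : ℝ => expTwoPi (n * α)) (2 * Real.pi * Complex.I * n * expTwoPi (n * α)) α
        := by
  have h : HasDerivAt (fun t : ℝ => (2 * Real.pi * Complex.I * n) * (t : ℂ))
      (2 * Real.pi * Complex.I * n) α := by
    simpa using (Complex.ofRealCLM.hasDerivAt (x := α)).const_mul (2 * Real.pi * Complex.I * n)
  have h2 := h.cexp
  refine (h2.congr_of_eventuallyEq (Filter.Eventually.of_forall fun t => ?_)).congr_deriv ?_
  · simp only [expTwoPi]; congr 1; push_cast; ring
  · simp only [expTwoPi]
    rw [mul_comm]; congr 2; push_cast; ring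

lemma hasDerivAt_trigSum (a : ℕ → ℂ) (N : ℕ) (α : ℝ) : HasDerivAt (trigSum a N)
    (trigSum (fun n => 2 * Real.pi * Complex.I * n * a n) N α) α := by
  have := HasDerivAt.fun_sum (u := Icc 1 N) fun n _ => (hasDerivAt_expTwoPi n α).const_mul (a n)
  refine this.congr_deriv ?_
  rw [trigSum]
  exact Finset.sum_congr rfl fun n _ => by ring

lemma continuous_trigSum (a : ℕ → ℂ) (N : ℕ) : Continuous (trigSum a N) :=
  continuous_iff_continuousAt.2 fun α => (hasDerivAt_trigSum a N α).continuousAt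

lemma integral_expTwoPi_int (k : ℤ) :
    ∫ t in (0 : ℝ)..2, expTwoPi (k * t) = if k = 0 then 2 else 0 := by
  split_ifs with h
  · simp [h, expTwoPi]
  · have hc : (2 * Real.pi * Complex.I * k : ℂ) ≠ 0 := by
      simp [h, Real.pi_ne_zero, Complex.I_ne_zero]
    have h1 : ∀ t : ℝ, expTwoPi (k * t) = Complex.exp (2 * Real.pi * Complex.I * k * t) := by
      intro t; rw [expTwoPi]; congr 1; push_cast; ring
    have h2 : expTwoPi (k * (2 : ℝ)) = 1 := by exact_mod_cast expTwoPi_int (k * 2)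
    have h3 : expTwoPi (k * (0 : ℝ)) = 1 := by simpa using expTwoPi_int 0
    simp only [h1] at h2 h3 ⊢
    rw [integral_exp_mul_complex hc, h2, h3, sub_self, zero_div]

lemma integral_norm_trigSum_sq (a : ℕ → ℂ) (N : ℕ) :
    ∫ t in (0 : ℝ)..2, ‖trigSum a N t‖ ^ 2 = 2 * ∑ n ∈ Icc 1 N, ‖a n‖ ^ 2 := by
  have h1 : ∀ t : ℝ, ((‖trigSum a N t‖ ^ 2 : ℝ) : ℂ) = ∑ m ∈ Icc 1 N, ∑ n ∈ Icc 1 N,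
      a m * (starRingEnd ℂ) (a n) * expTwoPi ((m - n : ℤ) * t) := by
    intro t
    push_cast
    rw [← Complex.mul_conj', trigSum, map_sum, Finset.sum_mul_sum]
    refine Finset.sum_congr rfl fun m _ => Finset.sum_congr rfl fun n _ => ?_
    rw [map_mul, star_expTwoPi, show ((m : ℝ) - n) * t = m * t + -(n * t) by ring, expTwoPi_add]
    ring
  have h2 : ((∫ t in (0 : ℝ)..2, ‖trigSum a N t‖ ^ 2 : ℝ) : ℂ)
      = ((2 * ∑ n ∈ Icc 1 N, ‖a n‖ ^ 2 : ℝ) : ℂ) := by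
    rw [← intervalIntegral.integral_ofReal]
    simp only [h1]
    have hcont : ∀ k : ℤ, Continuous fun t : ℝ => expTwoPi (k * t) := by
      intro k; unfold expTwoPi; fun_prop
    have hcont2 : ∀ m n : ℕ, Continuous fun t : ℝ =>
        a m * (starRingEnd ℂ) (a n) * expTwoPi ((m - n : ℤ) * t) := fun m n =>
      continuous_const.mul (hcont _)
    have hcont3 : ∀ m : ℕ, Continuous fun t : ℝ => ∑ n ∈ Icc 1 N,
        a m * (starRingEnd ℂ) (a n) * expTwoPi ((m - n : ℤ) * t) := fun m =>
      continuous_finsetSum _ fun n _ => hcont2 m n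
    rw [intervalIntegral.integral_finsetSum fun m _ => (hcont3 m).intervalIntegrable _ _]
    have h3 : ∀ m ∈ Icc 1 N, ∫ t in (0 : ℝ)..2, ∑ n ∈ Icc 1 N,
        a m * (starRingEnd ℂ) (a n) * expTwoPi ((m - n : ℤ) * t)
        = 2 * (a m * (starRingEnd ℂ) (a m)) := by
      intro m hm
      rw [intervalIntegral.integral_finsetSum fun n _ => (hcont2 m n).intervalIntegrable _ _]
      rw [Finset.sum_eq_single m]
      · rw [intervalIntegral.integral_const_mul, integral_expTwoPi_int, if_pos (sub_self _)]
        ring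
      · intro n _ hn
        rw [intervalIntegral.integral_const_mul, integral_expTwoPi_int, if_neg (by omega), mul_zero]
      · exact fun h => absurd hm h
    rw [Finset.sum_congr rfl h3, ← Finset.mul_sum]
    push_cast
    simp only [Complex.mul_conj']
  exact_mod_cast h2

/-- Gallagher's inequality. -/
lemma mul_le_integral_add_deriv {f f' : ℝ → ℝ} (hf : ∀ t, HasDerivAt f (f' t) t)
    (hf' : Continuous f') (α : ℝ) {δ : ℝ} (hδ : 0 < δ) :
    δ * f α ≤ ∫ t in α..(α + δ), (f t + δ * |f' t|) := by
  have hfc : Continuous f := continuous_iff_continuousAt.2 fun t => (hf t).continuousAt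
  set J := ∫ t in α..(α + δ), |f' t| with hJ
  have h1 : ∀ t ∈ Set.Icc α (α + δ), f α ≤ f t + J := by
    intro t ht
    have h2 : ∫ s in α..t, f' s = f t - f α :=
      intervalIntegral.integral_eq_sub_of_hasDerivAt (fun s _ => hf s) (hf'.intervalIntegrable _ _)
    have h3 : |∫ s in α..t, f' s| ≤ ∫ s in α..t, |f' s| :=
      intervalIntegral.abs_integral_le_integral_abs ht.1
    have h4 : ∫ s in α..t, |f' s| ≤ J :=
      intervalIntegral.integral_mono_interval le_rfl ht.1 ht.2
        (Filter.Eventually.of_forall fun s => abs_nonneg _) (hf'.abs.intervalIntegrable _ _)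
    have h5 := neg_abs_le (∫ s in α..t, f' s)
    linarith
  have h6 : ∫ t in α..(α + δ), f α ≤ ∫ t in α..(α + δ), (f t + J) :=
    intervalIntegral.integral_mono_on (by linarith) (continuous_const.intervalIntegrable _ _)
      ((hfc.add continuous_const).intervalIntegrable _ _) h1
  rw [intervalIntegral.integral_add (hfc.intervalIntegrable _ _)
    (continuous_const.intervalIntegrable _ _)] at h6
  simp only [intervalIntegral.integral_const, smul_eq_mul, add_sub_cancel_left] at h6
  have hc : Continuous fun t => δ * |f' t| := continuous_const.mul hf'.abs
  rw [intervalIntegral.integral_add (hfc.intervalIntegrable _ _)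
    (hc.intervalIntegrable _ _), intervalIntegral.integral_const_mul]
  exact h6

/-- The large sieve inequality, for well-spaced points of `[0, 1]`. -/
lemma large_sieve {ι : Type*} (s : Finset ι) (α : ι → ℝ) (h0 : ∀ i ∈ s, 0 ≤ α i)
    (h1 : ∀ i ∈ s, α i ≤ 1) {δ : ℝ} (hδ : 0 < δ) (hδ1 : δ ≤ 1)
    (hs : ∀ i ∈ s, ∀ j ∈ s, i ≠ j → δ ≤ |α i - α j|) (a : ℕ → ℂ) {N : ℕ} (hN : 0 < N) :
    ∑ i ∈ s, ‖trigSum a N (α i)‖ ^ 2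
      ≤ (2 / δ + 8 * Real.pi * N) * ∑ n ∈ Icc 1 N, ‖a n‖ ^ 2 := by
  set b : ℕ → ℂ := fun n => 2 * Real.pi * Complex.I * n * a n with hb
  set f : ℝ → ℝ := fun t => ‖trigSum a N t‖ ^ 2 with hf
  set f' : ℝ → ℝ := fun t => 2 * inner ℝ (trigSum a N t) (trigSum b N t) with hf'
  have hd : ∀ t, HasDerivAt f (f' t) t := fun t => (hasDerivAt_trigSum a N t).norm_sq
  have hac := continuous_trigSum a N
  have hbc := continuous_trigSum b N
  have hf'c : Continuous f' := continuous_const.mul (hac.inner hbc)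
  have hfc : Continuous f := hac.norm.pow 2
  set g : ℝ → ℝ := fun t => f t + δ * |f' t| with hg
  have hgc : Continuous g := hfc.add (continuous_const.mul hf'c.abs)
  have hg0 : ∀ t, 0 ≤ g t := fun t => by positivity
  set l : ℝ := 2 * Real.pi * N with hl
  have hN0 : (0 : ℝ) < N := by exact_mod_cast hN
  have hl0 : 0 < l := by positivity
  set A := ∑ n ∈ Icc 1 N, ‖a n‖ ^ 2 with hA
  have hi : ∀ x y : ℝ, MeasureTheory.IntegrableOn g (Set.Ioc x y) := fun x y =>
    (hgc.integrableOn_Icc).mono_set Set.Ioc_subset_Icc_self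
  have h2 : ∑ i ∈ s, ∫ t in Set.Ioc (α i) (α i + δ), g t ≤ ∫ t in Set.Ioc (0 : ℝ) 2, g t := by
    rw [← MeasureTheory.integral_biUnion_finset s (fun _ _ => measurableSet_Ioc) ?_
      (fun i _ => hi _ _)]
    · refine MeasureTheory.setIntegral_mono_set (hi _ _) (Filter.Eventually.of_forall hg0)
        (Set.iUnion₂_subset fun i hi => ?_).eventuallyLE
      exact Set.Ioc_subset_Ioc (h0 i hi) (by linarith [h1 i hi])
    · intro i hi' j hj hij
      refine Set.disjoint_left.2 fun t ht ht' => ?_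
      have := hs i hi' j hj hij
      rcases le_abs.1 this with h | h <;> linarith [ht.1, ht.2, ht'.1, ht'.2]
  have h3 : ∀ i ∈ s, δ * f (α i) ≤ ∫ t in Set.Ioc (α i) (α i + δ), g t := by
    intro i _
    rw [← intervalIntegral.integral_of_le (by linarith)]
    exact mul_le_integral_add_deriv hd hf'c _ hδ
  have h4 : ∫ t in (0 : ℝ)..2, ‖trigSum b N t‖ ^ 2 ≤ 2 * (l ^ 2 * A) := by
    rw [integral_norm_trigSum_sq, hA, Finset.mul_sum _ _ (l ^ 2)]
    refine mul_le_mul_of_nonneg_left (Finset.sum_le_sum fun n hn => ?_)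
        (show (0 : ℝ) ≤ 2 by norm_num)
    rw [mem_Icc] at hn
    have hnN : (n : ℝ) ≤ N := by exact_mod_cast hn.2
    have : ‖b n‖ = 2 * Real.pi * n * ‖a n‖ := by
      simp [hb, abs_of_pos Real.pi_pos]
    rw [this, mul_pow]
    have := Real.pi_pos
    rw [hl]
    gcongr
  have h5 : ∫ t in (0 : ℝ)..2, g t ≤ ∫ t in (0 : ℝ)..2,
      ((1 + δ * l) * ‖trigSum a N t‖ ^ 2 + δ * l⁻¹ * ‖trigSum b N t‖ ^ 2) := by
    refine intervalIntegral.integral_mono_on (by norm_num) (hgc.intervalIntegrable _ _)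
      (((continuous_const.mul hfc).add (continuous_const.mul (hbc.norm.pow 2))).intervalIntegrable
        _ _) fun t _ => ?_
    have h6 : |f' t| ≤ 2 * (‖trigSum a N t‖ * ‖trigSum b N t‖) := by
      rw [hf', abs_mul, abs_of_pos two_pos]
      gcongr
      exact abs_real_inner_le_norm _ _
    have h7 : 2 * (‖trigSum a N t‖ * ‖trigSum b N t‖)
        ≤ l * ‖trigSum a N t‖ ^ 2 + l⁻¹ * ‖trigSum b N t‖ ^ 2 := by
      have h8 : 0 ≤ l⁻¹ * (l * ‖trigSum a N t‖ - ‖trigSum b N t‖) ^ 2 := by positivity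
      have h9 : l⁻¹ * (l * ‖trigSum a N t‖ - ‖trigSum b N t‖) ^ 2 = l * ‖trigSum a N t‖ ^ 2
        + l⁻¹ * ‖trigSum b N t‖ ^ 2 - 2 * (‖trigSum a N t‖ * ‖trigSum b N t‖) := by
        field_simp
        ring
      linarith
    calc g t = ‖trigSum a N t‖ ^ 2 + δ * |f' t| := rfl
      _ ≤ ‖trigSum a N t‖ ^ 2 + δ * (l * ‖trigSum a N t‖ ^ 2 + l⁻¹ * ‖trigSum b N t‖ ^ 2) := by
        gcongr; exact h6.trans h7
      _ = _ := by ring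
  have hc1 : Continuous fun t => (1 + δ * l) * ‖trigSum a N t‖ ^ 2 := continuous_const.mul hfc
  have hc2 : Continuous fun t => δ * l⁻¹ * ‖trigSum b N t‖ ^ 2 :=
    continuous_const.mul (hbc.norm.pow 2)
  rw [intervalIntegral.integral_add (hc1.intervalIntegrable _ _) (hc2.intervalIntegrable _ _),
    intervalIntegral.integral_const_mul, intervalIntegral.integral_const_mul,
    integral_norm_trigSum_sq, ← hA] at h5
  have h10 : δ * ∑ i ∈ s, f (α i) ≤ δ * ((2 / δ + 8 * Real.pi * N) * A) := by
    rw [Finset.mul_sum]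
    refine (Finset.sum_le_sum h3).trans (h2.trans ?_)
    rw [← intervalIntegral.integral_of_le (by norm_num)]
    calc _ ≤ _ := h5
      _ ≤ (1 + δ * l) * (2 * A) + δ * l⁻¹ * (2 * (l ^ 2 * A)) := by gcongr
      _ = _ := by
        rw [hl]; field_simp; ring
  exact le_of_mul_le_mul_left h10 hδ

/-- The large sieve inequality over Farey fractions. -/
lemma large_sieve_farey (a : ℕ → ℂ) {N : ℕ} (hN : 0 < N) {P : ℕ} (hP : 0 < P) :
    ∑ r ∈ Icc 1 P, ∑ b ∈ (Icc 1 r).filter (fun b => Nat.gcd b r = 1), ‖trigSum a N (b / r)‖ ^ 2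
      ≤ (2 * (P : ℝ) ^ 2 + 8 * Real.pi * N) * ∑ n ∈ Icc 1 N, ‖a n‖ ^ 2 := by
  have hP0 : (1 : ℝ) ≤ P := by exact_mod_cast hP
  rw [Finset.sum_sigma']
  have h := large_sieve ((Icc 1 P).sigma fun r => (Icc 1 r).filter (fun b => Nat.gcd b r = 1))
    (fun i : Σ _ : ℕ, ℕ => (i.2 : ℝ) / i.1) (δ := 1 / (P : ℝ) ^ 2) ?_ ?_ (by positivity)
    (by rw [div_le_one (by positivity)]; nlinarith) ?_ a hN
  · refine h.trans_eq ?_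
    rw [div_div_eq_mul_div, div_one]
  · intro i _; positivity
  · rintro ⟨r, b⟩ hi
    simp only [Finset.mem_sigma, Finset.mem_filter, mem_Icc] at hi
    have : (0 : ℝ) < r := by exact_mod_cast hi.1.1
    simp only
    rw [div_le_one this]
    exact_mod_cast hi.2.1.2
  · rintro ⟨r, b⟩ hi ⟨r', b'⟩ hi' hne
    simp only [Finset.mem_sigma, Finset.mem_filter, mem_Icc] at hi hi'
    have hr : (0 : ℝ) < r := by exact_mod_cast hi.1.1
    have hr' : (0 : ℝ) < r' := by exact_mod_cast hi'.1.1
    have hrP : (r : ℝ) ≤ P := by exact_mod_cast hi.1.2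
    have hrP' : (r' : ℝ) ≤ P := by exact_mod_cast hi'.1.2
    have hne' : (b : ℤ) * r' - b' * r ≠ 0 := by
      intro h
      have h1 : b * r' = b' * r := by exact_mod_cast sub_eq_zero.1 h
      have h2 : r ∣ r' := (Nat.Coprime.symm hi.2.2).dvd_of_dvd_mul_left (h1 ▸ dvd_mul_left r b')
      have h3 : r' ∣ r := (Nat.Coprime.symm hi'.2.2).dvd_of_dvd_mul_left (h1 ▸ dvd_mul_left r' b)
      obtain rfl := Nat.dvd_antisymm h2 h3
      have := Nat.eq_of_mul_eq_mul_right hi.1.1 h1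
      exact hne (by rw [this])
    have h1 : (1 : ℝ) ≤ |(b : ℝ) * r' - b' * r| := by exact_mod_cast Int.one_le_abs hne'
    simp only
    rw [div_sub_div _ _ hr.ne' hr'.ne', abs_div, abs_of_pos (mul_pos hr hr'), mul_comm (r : ℝ) b']
    rw [div_le_div_iff₀ (by positivity) (by positivity), one_mul]
    calc (r : ℝ) * r' ≤ P * P := by gcongr
      _ = 1 * (P : ℝ) ^ 2 := by ring
      _ ≤ _ := by gcongr

lemma sum_div_eq_abel (e : ℕ → ℝ) (T : ℕ) : ∑ r ∈ Icc 1 T, e r / r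
    = (∑ r ∈ Icc 1 T, e r) / (T + 1) + ∑ k ∈ Icc 1 T, (∑ r ∈ Icc 1 k, e r) / (k * (k + 1)) := by
  induction T with
  | zero => simp
  | succ T ih =>
    rw [Finset.sum_Icc_succ_top (by omega), ih, Finset.sum_Icc_succ_top (b := T) (by omega),
      Finset.sum_Icc_succ_top (b := T) (by omega), Finset.sum_Icc_succ_top (b := T) (by omega)]
    push_cast
    have : (T : ℝ) + 1 + 1 ≠ 0 := by positivity
    have : (T : ℝ) + 1 ≠ 0 := by positivity
    field_simp
    ring

/-- Partial summation for a sequence supported on `n > R` with quadratically growing sums. -/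
lemma sum_div_le_of_sum_le {e : ℕ → ℝ} {R : ℕ} (h0 : ∀ n ≤ R, e n = 0) {a b : ℝ} (ha : 0 ≤ a)
    (hb : 0 ≤ b) (h : ∀ k, 0 < k → ∑ r ∈ Icc 1 k, e r ≤ a * (k : ℝ) ^ 2 + b) (T : ℕ) :
    ∑ r ∈ Icc 1 T, e r / r ≤ 2 * a * T + b / (R + 1) := by
  have hz : ∀ k ≤ R, ∑ r ∈ Icc 1 k, e r = 0 := fun k hk =>
    Finset.sum_eq_zero fun r hr => h0 r ((mem_Icc.1 hr).2.trans hk)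
  have hs : ∀ T, R ≤ T → ∑ k ∈ Icc 1 T, (∑ r ∈ Icc 1 k, e r) / (k * (k + 1) : ℝ)
      ≤ a * T + b * (1 / (R + 1) - 1 / (T + 1)) := by
    intro T hT
    induction T, hT using Nat.le_induction with
    | base =>
      rw [Finset.sum_eq_zero fun k hk => by rw [hz k (mem_Icc.1 hk).2, zero_div]]
      rw [sub_self, mul_zero, add_zero]
      positivity
    | succ T hT ih =>
      rw [Finset.sum_Icc_succ_top (by omega)]
      have h1 := h (T + 1) (by omega)
      have h2 : (∑ r ∈ Icc 1 (T + 1), e r) / ((T + 1 : ℕ) * ((T + 1 : ℕ) + 1) : ℝ)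
          ≤ (a * ((T + 1 : ℕ) : ℝ) ^ 2 + b) / ((T + 1 : ℕ) * ((T + 1 : ℕ) + 1) : ℝ) := by gcongr
      have h3 : (a * ((T + 1 : ℕ) : ℝ) ^ 2 + b) / ((T + 1 : ℕ) * ((T + 1 : ℕ) + 1) : ℝ)
          = a * (1 - 1 / (T + 2)) + b * (1 / (T + 1) - 1 / (T + 1 + 1)) := by
        push_cast
        field_simp
        ring
      have h4 : a * (1 - 1 / ((T : ℝ) + 2)) ≤ a * 1 := by
        gcongr
        have : (0 : ℝ) ≤ 1 / ((T : ℝ) + 2) := by positivity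
        linarith
      push_cast at *
      nlinarith
  rw [sum_div_eq_abel]
  rcases le_total T R with hT | hT
  · rw [hz T hT, Finset.sum_eq_zero fun k hk => by rw [hz k ((mem_Icc.1 hk).2.trans hT), zero_div]]
    simp only [zero_div, add_zero]
    positivity
  · have h1 := hs T hT
    rcases Nat.eq_zero_or_pos T with rfl | hT0
    · simp; positivity
    have h2 : (∑ r ∈ Icc 1 T, e r) / ((T : ℝ) + 1) ≤ (a * (T : ℝ) ^ 2 + b) / (T + 1) := by
      have := h T hT0
      gcongr
    have h3 : (a * (T : ℝ) ^ 2 + b) / (T + 1) = a * (T * (T / (T + 1))) + b * (1 / (T + 1)) := by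
      field_simp
    have h4 : a * ((T : ℝ) * (T / (T + 1))) ≤ a * (T * 1) := by
      gcongr
      rw [div_le_one (by positivity)]
      linarith
    have h5 : b / ((R : ℝ) + 1) = b * (1 / (R + 1)) := by ring
    rw [h5]
    linarith

lemma farey2_nonneg (x : ℝ) (r : ℕ) : 0 ≤ farey2 x r :=
  Finset.sum_nonneg fun _ _ => by positivity

lemma farey2_le_sq_mul {x : ℝ} (hx : 0 < x) {r : ℕ} (hr : 0 < r) : farey2 x r ≤ 121 * r ^ 2 *
    x := by
  have h1 := sum_sq_Adiv_sub_Mdiv x r hr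
  have h2 : ∑ a ∈ Icc 1 r, (Adiv x r a - Mdiv x r a) ^ 2 ≤ r * (121 * x) := by
    calc _ ≤ ∑ a ∈ Icc 1 r, 121 * x := Finset.sum_le_sum fun a _ => by
          rw [← sq_abs]
          calc _ ≤ (11 * √x) ^ 2 := by gcongr; exact abs_Adiv_sub_Mdiv_le x hx r a hr
            _ = 121 * x := by rw [mul_pow, Real.sq_sqrt hx.le]; norm_num
      _ = _ := by simp
  have h3 : farey2 x r ≤ ∑ d ∈ r.divisors, farey2 x d :=
    Finset.single_le_sum (f := farey2 x) (fun d _ => farey2_nonneg x d)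
      (Nat.mem_divisors_self r hr.ne')
  have hr0 : (0 : ℝ) < r := by exact_mod_cast hr
  have h4 : ∑ d ∈ r.divisors, farey2 x d
      = r * ∑ a ∈ Icc 1 r, (Adiv x r a - Mdiv x r a) ^ 2 := by
    rw [h1]; field_simp
  calc _ ≤ _ := h3
    _ = _ := h4
    _ ≤ r * (r * (121 * x)) := by gcongr
    _ = _ := by ring

/-- `Σ*_{b mod r} |S(b/r)|²`. -/
noncomputable def fareyOne (x : ℝ) (r : ℕ) : ℝ :=
  ∑ b ∈ (Icc 1 r).filter (fun b => Nat.gcd b r = 1), ‖divExpSum x (b / r)‖ ^ 2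

lemma farey2_le_fareyOne {x : ℝ} (hx : 2 ≤ x) {r : ℕ} (hr : 0 < r) (hrx : (r : ℝ) ≤ x) :
    farey2 x r ≤ 2 * fareyOne x r + 32 * (x * Real.log x) ^ 2 / r := by
  have hr0 : (0 : ℝ) < r := by exact_mod_cast hr
  have h1 := abs_mainF_le hx r hr hrx (by linarith) le_rfl
  have h2 : (mainF r x / r) ^ 2 ≤ 16 * (x * Real.log x) ^ 2 / r ^ 2 := by
    rw [div_pow, ← sq_abs]
    gcongr
    calc _ ≤ (4 * x * Real.log x) ^ 2 := by gcongr
      _ = _ := by ring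
  calc farey2 x r ≤ ∑ b ∈ (Icc 1 r).filter (fun b => Nat.gcd b r = 1),
        (2 * ‖divExpSum x (b / r)‖ ^ 2 + 2 * (mainF r x / r) ^ 2) := by
        refine Finset.sum_le_sum fun b _ => ?_
        have h3 := norm_sub_le (divExpSum x (b / r)) ((mainF r x / r : ℝ) : ℂ)
        rw [Complex.norm_real, Real.norm_eq_abs] at h3
        calc _ ≤ (‖divExpSum x (b / r)‖ + |mainF r x / r|) ^ 2 := by gcongr
          _ ≤ 2 * ‖divExpSum x (b / r)‖ ^ 2 + 2 * |mainF r x / r| ^ 2 := by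
            nlinarith [sq_nonneg (‖divExpSum x (b / r)‖ - |mainF r x / r|)]
          _ = _ := by rw [sq_abs]
    _ = 2 * fareyOne x r + Nat.totient r * (2 * (mainF r x / r) ^ 2) := by
        rw [Finset.sum_add_distrib, ← Finset.mul_sum, Finset.sum_const, card_coprime_filter,
          nsmul_eq_mul, fareyOne]
    _ ≤ 2 * fareyOne x r + r * (2 * (16 * (x * Real.log x) ^ 2 / r ^ 2)) := by
        have : (Nat.totient r : ℝ) ≤ r := by exact_mod_cast Nat.totient_le r
        gcongr
    _ = _ := by field_simp; ring

lemma sum_fareyOne_le {x : ℝ} (hx : 1 ≤ x) {P : ℕ} (hP : 0 < P) :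
    ∑ r ∈ Icc 1 P, fareyOne x r ≤ (2 * (P : ℝ) ^ 2 + 8 * Real.pi * x) * divSqSum x := by
  have hN : 0 < ⌊x⌋₊ := (Nat.one_le_floor_iff x).2 hx
  have h := large_sieve_farey (fun n => (divCount n : ℂ)) hN hP
  have h1 : ∑ n ∈ Icc 1 ⌊x⌋₊, ‖(divCount n : ℂ)‖ ^ 2 = divSqSum x := by
    simp only [divSqSum, Complex.norm_real, Real.norm_eq_abs, sq_abs]
  rw [h1] at h
  refine h.trans ?_
  have h2 : 0 ≤ divSqSum x := Finset.sum_nonneg fun _ _ => by positivity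
  have h3 := Nat.floor_le (show 0 ≤ x by linarith)
  have := Real.pi_pos
  gcongr

lemma sum_farey2_div_le {x : ℝ} (hx : 2 ≤ x) (R T : ℕ) (hT : (T : ℝ) ≤ x) :
    ∑ r ∈ Icc 1 T, farey2 x r / r ≤ 121 * (R : ℝ) ^ 2 * x + 8 * divSqSum x * T
      + (16 * Real.pi * x * divSqSum x + 64 * (x * Real.log x) ^ 2) / (R + 1) := by
  have hD : 0 ≤ divSqSum x := Finset.sum_nonneg fun _ _ => by positivity
  have hpi := Real.pi_pos
  set e : ℕ → ℝ := fun r => if r ≤ R then 0 else 2 * fareyOne x r with he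
  have hf0 : ∀ r, 0 ≤ fareyOne x r := fun r => Finset.sum_nonneg fun _ _ => by positivity
  have h1 : ∀ r ∈ Icc 1 T, farey2 x r / r
      ≤ (if r ≤ R then 121 * R * x else 0) + e r / r + 64 * (x * Real.log x) ^ 2 *
        (if r ≤ R then 0 else (1 / (r * (r + 1)) : ℝ)) := by
    intro r hr
    rw [mem_Icc] at hr
    have hr0 : (0 : ℝ) < r := by exact_mod_cast hr.1
    have hr1 : (1 : ℝ) ≤ r := by exact_mod_cast hr.1
    simp only [he]
    split_ifs with h
    · have hR : (r : ℝ) ≤ R := by exact_mod_cast h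
      rw [zero_div, mul_zero, add_zero, add_zero, div_le_iff₀ hr0]
      refine (farey2_le_sq_mul (by linarith) hr.1).trans ?_
      calc 121 * (r : ℝ) ^ 2 * x = 121 * r * x * r := by ring
        _ ≤ _ := by gcongr
    · have h2 : (r : ℝ) ≤ x := le_trans (by exact_mod_cast hr.2) hT
      have h3 := farey2_le_fareyOne hx hr.1 h2
      rw [zero_add]
      calc _ ≤ (2 * fareyOne x r + 32 * (x * Real.log x) ^ 2 / r) / r := by gcongr
        _ = 2 * fareyOne x r / r + 64 * (x * Real.log x) ^ 2 * (1 / (r * (2 * r))) := by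
          field_simp; ring
        _ ≤ _ := by gcongr; linarith
  refine (Finset.sum_le_sum h1).trans ?_
  rw [Finset.sum_add_distrib, Finset.sum_add_distrib, ← Finset.mul_sum]
  have h2 : ∑ r ∈ Icc 1 T, (if r ≤ R then 121 * R * x else 0) ≤ 121 * (R : ℝ) ^ 2 * x := by
    rw [← Finset.sum_filter]
    have hsub : (Icc 1 T).filter (fun r => r ≤ R) ⊆ Icc 1 R := fun r hr => by
      simp only [Finset.mem_filter, mem_Icc] at hr ⊢; exact ⟨hr.1.1, hr.2⟩
    calc _ ≤ ∑ r ∈ Icc 1 R, 121 * R * x :=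
          Finset.sum_le_sum_of_subset_of_nonneg hsub fun _ _ _ => by positivity
      _ = _ := by simp; ring
  have h3 : ∑ r ∈ Icc 1 T, e r / r ≤ 2 * (4 * divSqSum x) * T
      + 16 * Real.pi * x * divSqSum x / (R + 1) := by
    refine sum_div_le_of_sum_le (e := e) (fun n hn => if_pos hn) (by positivity) (by positivity) ?_
        T
    intro k hk
    calc _ ≤ ∑ r ∈ Icc 1 k, 2 * fareyOne x r := Finset.sum_le_sum fun r _ => by
          have := hf0 r
          simp only [he]; split_ifs <;> linarith
      _ ≤ 2 * ((2 * (k : ℝ) ^ 2 + 8 * Real.pi * x) * divSqSum x) := by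
          rw [← Finset.mul_sum]
          gcongr
          exact sum_fareyOne_le (by linarith) hk
      _ = _ := by ring
  have h4 : ∑ r ∈ Icc 1 T, (if r ≤ R then 0 else (1 / (r * (r + 1)) : ℝ)) ≤ 1 / (R + 1) := by
    have h5 : ∀ T : ℕ, ∑ r ∈ Icc 1 T, (if r ≤ R then 0 else (1 / (r * (r + 1)) : ℝ))
        ≤ if T ≤ R then 0 else 1 / ((R : ℝ) + 1) - 1 / (T + 1) := by
      intro T
      induction T with
      | zero => simp
      | succ T ih =>
        rw [Finset.sum_Icc_succ_top (by omega)]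
        have h6 : (1 : ℝ) / ((T + 1 : ℕ) * ((T + 1 : ℕ) + 1)) = 1 / (T + 1) -
            1 / ((T + 1 : ℕ) + 1) := by
          push_cast; field_simp; ring
        rw [h6]
        rcases lt_trichotomy T R with h7 | h7 | h7
        · rw [if_pos (show T ≤ R by omega)] at ih
          rw [if_pos (show T + 1 ≤ R by omega), if_pos (show T + 1 ≤ R by omega)]
          linarith
        · subst h7
          rw [if_pos le_rfl] at ih
          rw [if_neg (show ¬ T + 1 ≤ T by omega)]
          linarith
        · rw [if_neg (by omega)] at ih
          rw [if_neg (by omega), if_neg (by omega)]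
          linarith
    refine (h5 T).trans ?_
    split_ifs
    · positivity
    · have : (0 : ℝ) ≤ 1 / (T + 1) := by positivity
      linarith
  have h5 : 64 * (x * Real.log x) ^ 2 *
      ∑ r ∈ Icc 1 T, (if r ≤ R then 0 else (1 / (r * (r + 1)) : ℝ))
      ≤ 64 * (x * Real.log x) ^ 2 * (1 / (R + 1)) := by gcongr
  rw [add_div, div_eq_mul_one_div (64 * (x * Real.log x) ^ 2)]
  linarith

lemma sum_one_div_sq_le (N : ℕ) : ∑ m ∈ Icc 1 N, 1 / (m : ℝ) ^ 2 ≤ 2 := by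
  have h : ∀ N : ℕ, 0 < N → ∑ m ∈ Icc 1 N, 1 / (m : ℝ) ^ 2 ≤ 2 - 1 / (N : ℝ) := by
    intro N hN
    induction N, hN using Nat.le_induction with
    | base => simp; norm_num
    | succ N hN ih =>
      rw [Finset.sum_Icc_succ_top (by omega)]
      have h0 : (0 : ℝ) < N := by exact_mod_cast hN
      have h1 : 1 / ((N + 1 : ℕ) : ℝ) ^ 2 ≤ 1 / (N : ℝ) - 1 / ((N + 1 : ℕ) : ℝ) := by
        push_cast
        rw [div_sub_div _ _ (by positivity) (by positivity), div_le_div_iff₀ (by positivity)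
          (by positivity)]
        nlinarith
      linarith
  rcases Nat.eq_zero_or_pos N with rfl | hN
  · simp
  · have := h N hN
    have : (0 : ℝ) ≤ 1 / (N : ℝ) := by positivity
    linarith

lemma Vdiv_nonneg (x Q : ℝ) : 0 ≤ Vdiv x Q :=
  Finset.sum_nonneg fun _ _ => Finset.sum_nonneg fun _ _ => by positivity

lemma Vdiv_eq_sum_farey2 (x Q : ℝ) : Vdiv x Q
    = ∑ m ∈ Icc 1 ⌊Q⌋₊, 1 / (m : ℝ) * ∑ r ∈ Icc 1 (⌊Q⌋₊ / m), farey2 x r / r := by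
  have h1 : Vdiv x Q = ∑ q ∈ Icc 1 ⌊Q⌋₊, 1 / (q : ℝ) * ∑ r ∈ q.divisors, farey2 x r :=
    Finset.sum_congr rfl fun q hq => sum_sq_Adiv_sub_Mdiv x q (mem_Icc.1 hq).1
  rw [h1, sum_one_div_mul_sum_divisors, sum_Icc_comm_div]
  refine Finset.sum_congr rfl fun m _ => ?_
  rw [Finset.mul_sum]
  exact Finset.sum_congr rfl fun r _ => mul_comm _ _

lemma Vdiv_le {x Q : ℝ} (hx : 2 ≤ x) (hQ : 1 ≤ Q) (hQx : Q ≤ x) (R : ℕ) :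
    Vdiv x Q ≤ 16 * divSqSum x * Q + (1 + Real.log x) * (121 * (R : ℝ) ^ 2 * x
      + (16 * Real.pi * x * divSqSum x + 64 * (x * Real.log x) ^ 2) / (R + 1)) := by
  have hD : 0 ≤ divSqSum x := Finset.sum_nonneg fun _ _ => by positivity
  have hpi := Real.pi_pos
  set B := 121 * (R : ℝ) ^ 2 * x
      + (16 * Real.pi * x * divSqSum x + 64 * (x * Real.log x) ^ 2) / (R + 1) with hB
  have hB0 : 0 ≤ B := by positivity
  have hfl := Nat.floor_le (show 0 ≤ Q by linarith)
  rw [Vdiv_eq_sum_farey2]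
  have h1 : ∀ m ∈ Icc 1 ⌊Q⌋₊, 1 / (m : ℝ) * ∑ r ∈ Icc 1 (⌊Q⌋₊ / m), farey2 x r / r
      ≤ 8 * divSqSum x * Q * (1 / (m : ℝ) ^ 2) + B * (1 / m) := by
    intro m hm
    rw [mem_Icc] at hm
    have hm0 : (0 : ℝ) < m := by exact_mod_cast hm.1
    have hm1 : (1 : ℝ) ≤ m := by exact_mod_cast hm.1
    have h2 : ((⌊Q⌋₊ / m : ℕ) : ℝ) ≤ Q / m := Nat.cast_div_le.trans (by gcongr)
    have h3 : Q / m ≤ x := (div_le_self (by linarith) hm1).trans hQx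
    have h4 := sum_farey2_div_le hx R _ (h2.trans h3)
    calc _ ≤ 1 / (m : ℝ) * (8 * divSqSum x * (Q / m) + B) := by
          gcongr
          have h5 : 8 * divSqSum x * ((⌊Q⌋₊ / m : ℕ) : ℝ) ≤ 8 * divSqSum x * (Q / m) := by gcongr
          linarith
      _ = _ := by field_simp
  refine (Finset.sum_le_sum h1).trans ?_
  rw [Finset.sum_add_distrib, ← Finset.mul_sum, ← Finset.mul_sum]
  have h2 := sum_one_div_sq_le ⌊Q⌋₊
  have h3 : ∑ m ∈ Icc 1 ⌊Q⌋₊, 1 / (m : ℝ) ≤ 1 + Real.log x :=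
    (harmonicReal_floor_le hQ).trans (by gcongr)
  calc _ ≤ 8 * divSqSum x * Q * 2 + B * (1 + Real.log x) := by gcongr
    _ = _ := by ring

lemma exists_divSqSum_le : ∃ C : ℝ, 0 ≤ C ∧ ∀ x : ℝ, 2 ≤ x →
    divSqSum x ≤ C * (x * Real.log x ^ 3) := by
  obtain ⟨b₀, b₁, b₂, C, hC, h⟩ := exists_abs_divSqSum_sub_le
  refine ⟨1 + |b₂| * 2 + |b₁| * 4 + |b₀| * 8 + C * 27, by positivity, fun x hx => ?_⟩
  have h1 := (abs_le.1 (h x (by linarith))).2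
  set X := Real.log x with hX
  have hX2 : 1 ≤ 2 * X := one_le_two_mul_log hx
  have hX0 : 0 ≤ X := by linarith
  have h2 : x ^ (3 / 4 : ℝ) ≤ x := by
    conv_rhs => rw [← Real.rpow_one x]
    exact Real.rpow_le_rpow_of_exponent_le (by linarith) (by norm_num)
  have h3 : X ^ 3 / Real.pi ^ 2 ≤ X ^ 3 :=
    div_le_self (by positivity) (by nlinarith [Real.pi_gt_three])
  have e2 : b₂ * X ^ 2 ≤ |b₂| * (2 * X ^ 3) :=
    mul_le_mul (le_abs_self _) (by nlinarith [sq_nonneg X]) (by positivity) (by positivity)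
  have e1 : b₁ * X ≤ |b₁| * (4 * X ^ 3) :=
    mul_le_mul (le_abs_self _) (by nlinarith [sq_nonneg X]) (by positivity) (by positivity)
  have e0 : b₀ ≤ |b₀| * (8 * X ^ 3) := by
    have : 1 ≤ 8 * X ^ 3 := by nlinarith [sq_nonneg X]
    exact (le_abs_self _).trans (le_mul_of_one_le_right (by positivity) this)
  have e3 : C * (x ^ (3 / 4 : ℝ) * (1 + X) ^ 3) ≤ C * (x * (3 * X) ^ 3) := by
    gcongr; linarith
  have e4 : x * (X ^ 3 / Real.pi ^ 2 + b₂ * X ^ 2 + b₁ * X + b₀)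
      ≤ x * (X ^ 3 + |b₂| * (2 * X ^ 3) + |b₁| * (4 * X ^ 3) + |b₀| * (8 * X ^ 3)) := by
    gcongr
  calc divSqSum x ≤ x * (X ^ 3 + |b₂| * (2 * X ^ 3) + |b₁| * (4 * X ^ 3) + |b₀| * (8 * X ^ 3))
        + C * (x * (3 * X) ^ 3) := by linarith
    _ = _ := by ring

/-- An upper bound for the variance of the correct order of magnitude when `Q ≥ x ^ (3 / 4)`. -/
lemma exists_Vdiv_le : ∃ C : ℝ, 0 ≤ C ∧ ∀ x Q : ℝ, 2 ≤ x → 1 ≤ Q → Q ≤ x →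
    Vdiv x Q ≤ C * (Q * x * Real.log x ^ 3 + x ^ (7 / 4 : ℝ) * Real.log x ^ 3) := by
  obtain ⟨C, hC, h⟩ := exists_divSqSum_le
  have hpi := Real.pi_pos
  refine ⟨16 * C + 3 * (121 * 4 + 8 * (16 * Real.pi * C + 128)), by positivity,
    fun x Q hx hQ hQx => ?_⟩
  have hD := h x hx
  have hD0 : 0 ≤ divSqSum x := Finset.sum_nonneg fun _ _ => by positivity
  have h1 := Vdiv_le hx hQ hQx ⌊x ^ (3 / 8 : ℝ)⌋₊
  set X := Real.log x with hX
  have hX2 : 1 ≤ 2 * X := one_le_two_mul_log hx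
  have hX0 : 0 ≤ X := by linarith
  have hx0 : 0 < x := by linarith
  have hR : ((⌊x ^ (3 / 8 : ℝ)⌋₊ : ℕ) : ℝ) ≤ x ^ (3 / 8 : ℝ) := Nat.floor_le (by positivity)
  have hR' : x ^ (3 / 8 : ℝ) ≤ (⌊x ^ (3 / 8 : ℝ)⌋₊ : ℕ) + 1 := (Nat.lt_floor_add_one _).le
  have hXe : X ≤ 8 * x ^ (1 / 8 : ℝ) := by
    have := Real.log_le_rpow_div hx0.le (show (0 : ℝ) < 1 / 8 by norm_num)
    linarith
  have e1 : 121 * ((⌊x ^ (3 / 8 : ℝ)⌋₊ : ℕ) : ℝ) ^ 2 * x ≤ 121 * x ^ (7 / 4 : ℝ) := by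
    calc _ ≤ 121 * (x ^ (3 / 8 : ℝ)) ^ 2 * x := by gcongr
      _ = 121 * (x ^ (3 / 8 : ℝ) * x ^ (3 / 8 : ℝ) * x ^ (1 : ℝ)) := by rw [Real.rpow_one]; ring
      _ = _ := by rw [← Real.rpow_add hx0, ← Real.rpow_add hx0]; norm_num
  have e2 : (16 * Real.pi * x * divSqSum x + 64 * (x * X) ^ 2) / ((⌊x ^ (3 / 8 : ℝ)⌋₊ : ℕ) + 1)
      ≤ (16 * Real.pi * C + 128) * 8 * (x ^ (7 / 4 : ℝ) * X ^ 2) := by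
    rw [div_le_iff₀ (by positivity)]
    calc 16 * Real.pi * x * divSqSum x + 64 * (x * X) ^ 2
        ≤ 16 * Real.pi * x * (C * (x * X ^ 3)) + 64 * (x * X) ^ 2 * (2 * X) := by
          have : 64 * (x * X) ^ 2 * 1 ≤ 64 * (x * X) ^ 2 * (2 * X) := by gcongr
          have : 16 * Real.pi * x * divSqSum x ≤ 16 * Real.pi * x * (C * (x * X ^ 3)) := by gcongr
          linarith
      _ = (16 * Real.pi * C + 128) * (x ^ 2 * X ^ 2) * X := by ring
      _ ≤ (16 * Real.pi * C + 128) * (x ^ 2 * X ^ 2) * (8 * x ^ (1 / 8 : ℝ)) := by gcongr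
      _ = (16 * Real.pi * C + 128) * 8 * ((x ^ (2 : ℝ) * x ^ (1 / 8 : ℝ)) * X ^ 2) := by
          rw [Real.rpow_two]; ring
      _ = (16 * Real.pi * C + 128) * 8 * ((x ^ (7 / 4 : ℝ) * x ^ (3 / 8 : ℝ)) * X ^ 2) := by
          rw [← Real.rpow_add hx0, ← Real.rpow_add hx0]; norm_num
      _ ≤ (16 * Real.pi * C + 128) * 8 * ((x ^ (7 / 4 : ℝ) *
            ((⌊x ^ (3 / 8 : ℝ)⌋₊ : ℕ) + 1)) * X ^ 2) := by gcongr
      _ = _ := by ring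
  set B := 121 * ((⌊x ^ (3 / 8 : ℝ)⌋₊ : ℕ) : ℝ) ^ 2 * x
    + (16 * Real.pi * x * divSqSum x + 64 * (x * X) ^ 2) / ((⌊x ^ (3 / 8 : ℝ)⌋₊ : ℕ) + 1)
  have e3 : B ≤ (121 * 4 + 8 * (16 * Real.pi * C + 128)) * (x ^ (7 / 4 : ℝ) * X ^ 2) := by
    have h4 : 121 * x ^ (7 / 4 : ℝ) * 1 ≤ 121 * x ^ (7 / 4 : ℝ) * (2 * X) ^ 2 := by
      gcongr; nlinarith
    calc B ≤ 121 * x ^ (7 / 4 : ℝ) * 1 + (16 * Real.pi * C + 128) * 8 *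
        (x ^ (7 / 4 : ℝ) * X ^ 2) := by
          simp only [B]; linarith
      _ ≤ 121 * x ^ (7 / 4 : ℝ) * (2 * X) ^ 2
          + (16 * Real.pi * C + 128) * 8 * (x ^ (7 / 4 : ℝ) * X ^ 2) := by linarith
      _ = _ := by ring
  have e4 : (1 + X) * B ≤ (3 * X) * ((121 * 4 + 8 * (16 * Real.pi * C + 128))
      * (x ^ (7 / 4 : ℝ) * X ^ 2)) := by
    have : 0 ≤ B := by simp only [B]; positivity
    gcongr
    linarith
  have e5 : 16 * divSqSum x * Q ≤ 16 * (C * (x * X ^ 3)) * Q := by gcongr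
  have e6 : 0 ≤ Q * x * X ^ 3 := by positivity
  have e7 : 0 ≤ x ^ (7 / 4 : ℝ) * X ^ 3 := by positivity
  calc Vdiv x Q ≤ 16 * (C * (x * X ^ 3)) * Q + (3 * X) * ((121 * 4 + 8 * (16 * Real.pi * C + 128))
      * (x ^ (7 / 4 : ℝ) * X ^ 2)) := by linarith
    _ = (16 * C) * (Q * x * X ^ 3)
        + (3 * (121 * 4 + 8 * (16 * Real.pi * C + 128))) * (x ^ (7 / 4 : ℝ) * X ^ 3) := by ring
    _ ≤ (16 * C + 3 * (121 * 4 + 8 * (16 * Real.pi * C + 128))) * (Q * x * X ^ 3)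
        + (16 * C + 3 * (121 * 4 + 8 * (16 * Real.pi * C + 128))) * (x ^ (7 / 4 : ℝ) * X ^ 3) := by
        gcongr
        · have : 0 ≤ 3 * (121 * 4 + 8 * (16 * Real.pi * C + 128)) := by positivity
          linarith
        · linarith
    _ = _ := by ring

noncomputable def totLogSum (i : ℕ) (Q : ℝ) : ℝ :=
  ∑ r ∈ Icc 1 ⌊Q⌋₊, (Nat.totient r : ℝ) / (r : ℝ) ^ 3 * Real.log r ^ i

noncomputable def totLogHarmonicSum (i : ℕ) (Q : ℝ) : ℝ :=
  ∑ r ∈ Icc 1 ⌊Q⌋₊, (Nat.totient r : ℝ) / (r : ℝ) ^ 3 * Real.log r ^ i * harmonicReal (⌊Q⌋₊ / r)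

lemma exists_totLogSum_powBound (i : ℕ) :
    ∃ c : ℝ, PowBound (-1) (fun Q => totLogSum i Q - c) := by
  have hb : PowBound (-2) (fun t : ℝ =>
      (fun r : ℕ => (Nat.totient r : ℝ) / (r : ℝ) ^ 3 * Real.log r ^ i) ⌊t⌋₊) := by
    have h0 : PowBound (-2) (fun y => (y ^ 2)⁻¹ * Real.log y ^ i) := by
      simpa using PowBound.inv_sq.mul (PowBound.log_pow i)
    refine powBound_floor (fun r : ℕ => (Nat.totient r : ℝ) / (r : ℝ) ^ 3 * Real.log r ^ i) _ h0
      fun n hn => ?_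
    have hn0 : (0 : ℝ) < n := by exact_mod_cast hn
    have h1 : (Nat.totient n : ℝ) ≤ n := by exact_mod_cast Nat.totient_le n
    rw [abs_mul, abs_mul]
    refine mul_le_mul_of_nonneg_right ?_ (abs_nonneg _)
    rw [abs_of_nonneg (by positivity), abs_of_nonneg (by positivity), div_le_iff₀ (by positivity)]
    calc (Nat.totient n : ℝ) ≤ n := h1
      _ = _ := by field_simp
  obtain ⟨c, hc⟩ := exists_sum_sub_const_powBound (p := -2) (by norm_num)
    (fun r : ℕ => (Nat.totient r : ℝ) / (r : ℝ) ^ 3 * Real.log r ^ i) hb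
  exact ⟨c, by norm_num at hc; exact hc⟩

lemma exists_totLogHarmonicSum_powBound (i : ℕ) : ∃ c d : ℝ,
    PowBound (-1) (fun Q => totLogHarmonicSum i Q - (c * Real.log Q + d)) := by
  obtain ⟨c, hc⟩ := exists_totLogSum_powBound i
  obtain ⟨c', hc'⟩ := exists_totLogSum_powBound (i + 1)
  set g := Real.eulerMascheroniConstant with hg
  have hE : PowBound (-1) (fun Q => totLogHarmonicSum i Q
      - ((Real.log Q + g) * totLogSum i Q - totLogSum (i + 1) Q)) := by
    have h0 : PowBound (-1) (fun Q => 2 * (Q⁻¹ * ((1 + Real.log Q) * Real.log Q ^ i))) := by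
      have := (PowBound.inv.mul (((PowBound.const 1).add PowBound.log).mul
        (PowBound.log_pow i))).const_mul 2
      simpa using this
    refine h0.of_abs_le fun Q hQ => ?_
    have hQ0 : 0 < Q := by linarith
    have hL := Real.log_nonneg hQ
    have h1 : totLogHarmonicSum i Q - ((Real.log Q + g) * totLogSum i Q - totLogSum (i + 1) Q)
        = ∑ r ∈ Icc 1 ⌊Q⌋₊, (Nat.totient r : ℝ) / (r : ℝ) ^ 3 * Real.log r ^ i *
          (harmonicReal ⌊Q / r⌋₊ - Real.log (Q / r) - g) := by
      rw [totLogHarmonicSum, totLogSum, totLogSum, Finset.mul_sum, ← Finset.sum_sub_distrib,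
        ← Finset.sum_sub_distrib]
      refine Finset.sum_congr rfl fun r hr => ?_
      have hr0 : (0 : ℝ) < r := by exact_mod_cast (mem_Icc.1 hr).1
      rw [Nat.floor_div_natCast, Real.log_div hQ0.ne' hr0.ne']
      ring
    rw [h1, abs_of_nonneg (by positivity : 0 ≤ 2 * (Q⁻¹ * ((1 + Real.log Q) * Real.log Q ^ i)))]
    refine (Finset.abs_sum_le_sum_abs _ _).trans ?_
    have h2 : ∀ r ∈ Icc 1 ⌊Q⌋₊, |(Nat.totient r : ℝ) / (r : ℝ) ^ 3 * Real.log r ^ i *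
          (harmonicReal ⌊Q / r⌋₊ - Real.log (Q / r) - g)|
          ≤ 2 * (Q⁻¹ * Real.log Q ^ i) * (1 / r) := by
      intro r hr
      rw [mem_Icc] at hr
      have hr0 : (0 : ℝ) < r := by exact_mod_cast hr.1
      have hr1 : (1 : ℝ) ≤ r := by exact_mod_cast hr.1
      have hrQ : (r : ℝ) ≤ Q := (Nat.le_floor_iff' (by omega)).1 hr.2
      have h3 := abs_mul_harmonicReal_sub_le (div_pos hQ0 hr0)
      set e := harmonicReal ⌊Q / r⌋₊ - Real.log (Q / r) - g with he
      rw [abs_mul, abs_of_pos (div_pos hQ0 hr0)] at h3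
      have h4 : |e| ≤ 2 * r / Q := by
        rw [le_div_iff₀ hQ0]
        calc |e| * Q = r * (Q / r * |e|) := by field_simp
          _ ≤ r * 2 := by gcongr
          _ = _ := mul_comm _ _
      have h5 : (Nat.totient r : ℝ) ≤ r := by exact_mod_cast Nat.totient_le r
      have h6 := Real.log_nonneg hr1
      rw [abs_mul, abs_of_nonneg (by positivity)]
      calc _ ≤ (r : ℝ) / r ^ 3 * Real.log Q ^ i * (2 * r / Q) := by gcongr
        _ = _ := by field_simp
    refine (Finset.sum_le_sum h2).trans ?_
    rw [← Finset.mul_sum]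
    calc _ ≤ 2 * (Q⁻¹ * Real.log Q ^ i) * (1 + Real.log Q) := by
          have := harmonicReal_floor_le hQ
          rw [harmonicReal] at this
          gcongr
      _ = _ := by ring
  refine ⟨c, g * c - c', ?_⟩
  have h1 : PowBound (-1) (fun Q => (Real.log Q + g) * (totLogSum i Q - c)) := by
    simpa using (PowBound.log.add (PowBound.const g)).mul hc
  exact ((hE.add h1).sub hc').congr fun Q _ => by ring

/-- The mean square of the expected main terms. -/
lemma exists_sum_sq_Mdiv_bound : ∃ c₀ d₀ c₁ d₁ c₂ d₂ : ℝ, ∀ δ : ℝ, 0 < δ → ∃ C : ℝ, 0 ≤ C ∧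
    ∀ x Q : ℝ, 2 ≤ x → 1 ≤ Q →
      |∑ q ∈ Icc 1 ⌊Q⌋₊, ∑ a ∈ Icc 1 q, Mdiv x q a ^ 2
        - x ^ 2 * ((Real.log x + 2 * Real.eulerMascheroniConstant - 1) ^ 2 * (c₀ * Real.log Q + d₀)
          + (Real.log x + 2 * Real.eulerMascheroniConstant - 1) * (c₁ * Real.log Q + d₁)
          + (c₂ * Real.log Q + d₂))| ≤ C * (x ^ 2 * Real.log x ^ 2 * Q ^ (-1 + δ)) := by
  obtain ⟨c₀, d₀, h₀⟩ := exists_totLogHarmonicSum_powBound 0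
  obtain ⟨c₁, d₁, h₁⟩ := exists_totLogHarmonicSum_powBound 1
  obtain ⟨c₂, d₂, h₂⟩ := exists_totLogHarmonicSum_powBound 2
  refine ⟨c₀, d₀, -4 * c₁, -4 * d₁, 4 * c₂, 4 * d₂, fun δ hδ => ?_⟩
  obtain ⟨C₀, hC₀, h₀⟩ := h₀ δ hδ
  obtain ⟨C₁, hC₁, h₁⟩ := h₁ δ hδ
  obtain ⟨C₂, hC₂, h₂⟩ := h₂ δ hδ
  refine ⟨9 * C₀ + 24 * C₁ + 16 * C₂, by positivity, fun x Q hx hQ => ?_⟩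
  have h₀ := h₀ Q hQ
  have h₁ := h₁ Q hQ
  have h₂ := h₂ Q hQ
  set X := Real.log x with hX
  have hX2 : 1 ≤ 2 * X := one_le_two_mul_log hx
  have hx0 : 0 < x := by linarith
  have hgm := eulerMascheroni_bounds
  set g := Real.eulerMascheroniConstant with hg
  have h1 : ∑ q ∈ Icc 1 ⌊Q⌋₊, ∑ a ∈ Icc 1 q, Mdiv x q a ^ 2
      = x ^ 2 * ((X + 2 * g - 1) ^ 2 * totLogHarmonicSum 0 Q
        - 4 * (X + 2 * g - 1) * totLogHarmonicSum 1 Q + 4 * totLogHarmonicSum 2 Q) := by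
    rw [Finset.sum_congr rfl fun q hq => sum_sq_Mdiv x q (mem_Icc.1 hq).1,
      sum_one_div_mul_sum_divisors_eq_harmonic]
    simp only [totLogHarmonicSum, Finset.mul_sum, ← Finset.sum_sub_distrib,
      ← Finset.sum_add_distrib]
    refine Finset.sum_congr rfl fun r hr => ?_
    have hr0 : (0 : ℝ) < r := by exact_mod_cast (mem_Icc.1 hr).1
    rw [mainF, Real.log_div hx0.ne' (by positivity), Real.log_pow]
    field_simp
    push_cast
    ring
  set m := X + 2 * g - 1 with hm
  have hX0 : 0 ≤ X := by linarith
  have hm3 : |m| ≤ 3 * X := by rw [abs_le]; constructor <;> linarith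
  rw [h1]
  set P := Q ^ (-1 + δ) with hP
  have hP0 : 0 ≤ P := by positivity
  set E₀ := totLogHarmonicSum 0 Q - (c₀ * Real.log Q + d₀)
  set E₁ := totLogHarmonicSum 1 Q - (c₁ * Real.log Q + d₁)
  set E₂ := totLogHarmonicSum 2 Q - (c₂ * Real.log Q + d₂)
  have h2 : |m ^ 2 * E₀ - 4 * m * E₁ + 4 * E₂| ≤ (9 * C₀ + 24 * C₁ + 16 * C₂) * (X ^ 2 * P) := by
    have a0 : |m ^ 2 * E₀| ≤ (3 * X) ^ 2 * (C₀ * P) := by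
      rw [abs_mul, abs_pow]; gcongr
    have a1 : |4 * m * E₁| ≤ 4 * (3 * X) * (C₁ * P) * (2 * X) := by
      rw [abs_mul, abs_mul, abs_of_pos (by norm_num : (0 : ℝ) < 4)]
      calc _ ≤ 4 * (3 * X) * (C₁ * P) := by gcongr
        _ ≤ _ := le_mul_of_one_le_right (by positivity) hX2
    have a2 : |4 * E₂| ≤ 4 * (C₂ * P) * (2 * X) ^ 2 := by
      rw [abs_mul, abs_of_pos (by norm_num : (0 : ℝ) < 4)]
      calc _ ≤ 4 * (C₂ * P) := by gcongr
        _ ≤ _ := le_mul_of_one_le_right (by positivity) (by nlinarith)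
    calc _ ≤ |m ^ 2 * E₀| + |4 * m * E₁| + |4 * E₂| :=
          (abs_add_le _ _).trans (by gcongr; exact abs_sub _ _)
      _ ≤ _ := by linarith
  rw [show x ^ 2 * (m ^ 2 * totLogHarmonicSum 0 Q - 4 * m * totLogHarmonicSum 1 Q
      + 4 * totLogHarmonicSum 2 Q) - x ^ 2 * (m ^ 2 * (c₀ * Real.log Q + d₀)
      + m * (-4 * c₁ * Real.log Q + -4 * d₁) + (4 * c₂ * Real.log Q + 4 * d₂))
      = x ^ 2 * (m ^ 2 * E₀ - 4 * m * E₁ + 4 * E₂) by ring, abs_mul, abs_of_pos (by positivity)]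
  calc _ ≤ x ^ 2 * ((9 * C₀ + 24 * C₁ + 16 * C₂) * (X ^ 2 * P)) := by gcongr
    _ = _ := by ring

lemma mvEval_aeval (v : Fin 2 → ℝ) (y : MvPolynomial (Fin 2) ℝ) (P : Polynomial ℝ) :
    MvPolynomial.eval v (Polynomial.aeval y P) = P.eval (MvPolynomial.eval v y) := by
  have := Polynomial.aeval_algHom_apply (MvPolynomial.aeval v : MvPolynomial (Fin 2) ℝ →ₐ[ℝ] ℝ) y P
  rw [← MvPolynomial.coe_aeval_eq_eval]
  simp only [RingHom.coe_coe]
  rw [← this]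
  simp [Polynomial.aeval_def]

lemma exists_mvPolynomial_quadratic (a b c d e f : ℝ) : ∃ P : MvPolynomial (Fin 2) ℝ,
    P.totalDegree ≤ 2 ∧ ∀ X L : ℝ, MvPolynomial.eval ![X, L] P
      = a + b * X + c * L + d * X ^ 2 + e * X * L + f * L ^ 2 := by
  have hm : ∀ (u : ℝ) (i j : ℕ), i + j ≤ 2 →
      (MvPolynomial.C u * (MvPolynomial.X 0 ^ i * MvPolynomial.X 1 ^ j) :
        MvPolynomial (Fin 2) ℝ).totalDegree ≤ 2 := by
    intro u i j hij
    refine (MvPolynomial.totalDegree_mul _ _).trans ?_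
    rw [MvPolynomial.totalDegree_C, zero_add]
    refine (MvPolynomial.totalDegree_mul _ _).trans ?_
    rw [MvPolynomial.totalDegree_X_pow, MvPolynomial.totalDegree_X_pow]
    exact hij
  have ha : ∀ p q : MvPolynomial (Fin 2) ℝ, p.totalDegree ≤ 2 → q.totalDegree ≤ 2 →
      (p + q).totalDegree ≤ 2 := fun p q hp hq =>
    (MvPolynomial.totalDegree_add p q).trans (max_le hp hq)
  refine ⟨_, ha _ _ (ha _ _ (ha _ _ (ha _ _ (ha _ _ (hm a 0 0 (by norm_num))
    (hm b 1 0 (by norm_num))) (hm c 0 1 (by norm_num))) (hm d 2 0 (by norm_num)))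
    (hm e 1 1 (by norm_num))) (hm f 0 2 (by norm_num)), fun X L => ?_⟩
  simp
  ring

/-- A polynomial of total degree at most `k` is `≪ X ^ k` in the region `0 ≤ L ≤ X`. -/
lemma exists_abs_mvEval_le (P : MvPolynomial (Fin 2) ℝ) : ∃ C : ℝ, 0 ≤ C ∧
    ∀ X L : ℝ, 1 ≤ 2 * X → 0 ≤ L → L ≤ X →
      |MvPolynomial.eval ![X, L] P| ≤ C * X ^ P.totalDegree := by
  refine ⟨(∑ d ∈ P.support, |P.coeff d|) * 2 ^ P.totalDegree, by positivity,
    fun X L hX hL hLX => ?_⟩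
  have hX0 : 0 ≤ X := by linarith
  rw [MvPolynomial.eval_eq', mul_assoc, ← mul_pow, Finset.sum_mul]
  refine (Finset.abs_sum_le_sum_abs _ _).trans (Finset.sum_le_sum fun d hd => ?_)
  rw [abs_mul]
  refine mul_le_mul_of_nonneg_left ?_ (abs_nonneg _)
  simp only [Fin.prod_univ_two, Matrix.cons_val_zero, Matrix.cons_val_one]
  rw [abs_of_nonneg (by positivity)]
  have h1 : d 0 + d 1 ≤ P.totalDegree := by
    have := MvPolynomial.le_totalDegree hd
    rwa [Finsupp.sum_fintype _ _ (fun _ => rfl), Fin.sum_univ_two] at this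
  calc X ^ d 0 * L ^ d 1 ≤ (2 * X) ^ d 0 * (2 * X) ^ d 1 := by gcongr <;> linarith
    _ = (2 * X) ^ (d 0 + d 1) := by rw [pow_add]
    _ ≤ _ := pow_le_pow_right₀ hX h1

lemma exists_linear_term_eq {R₂ R₁ R₀ : Polynomial ℝ} (hd₂ : R₂.natDegree ≤ 1)
    (hc₂ : R₂.coeff 1 = 3 / Real.pi ^ 2) (hd₁ : R₁.natDegree ≤ 2)
    (hc₁ : R₁.coeff 2 = 6 / Real.pi ^ 2) (hd₀ : R₀.natDegree ≤ 3)
    (hc₀ : R₀.coeff 3 = 4 / Real.pi ^ 2) (g : ℝ) :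
    ∃ P : MvPolynomial (Fin 2) ℝ, P.totalDegree ≤ 2 ∧ ∀ X L : ℝ,
      (2 * L - X + 2 * g) ^ 2 * R₂.eval (X - L) + (2 * L - X + 2 * g) * R₁.eval (X - L)
        + R₀.eval (X - L) = (X ^ 3 - (2 * L - X) ^ 3) / (2 * Real.pi ^ 2)
          + MvPolynomial.eval ![X, L] P := by
  have hpi := Real.pi_pos
  have hR₂ : ∀ t, R₂.eval t = R₂.coeff 0 + 3 / Real.pi ^ 2 * t := fun t => by
    rw [Polynomial.eval_eq_sum_range' (Nat.lt_succ_of_le hd₂), ← hc₂]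
    simp [Finset.sum_range_succ]
  have hR₁ : ∀ t, R₁.eval t = R₁.coeff 0 + R₁.coeff 1 * t + 6 / Real.pi ^ 2 * t ^ 2 := fun t => by
    rw [Polynomial.eval_eq_sum_range' (Nat.lt_succ_of_le hd₁), ← hc₁]
    simp [Finset.sum_range_succ]
  have hR₀ : ∀ t, R₀.eval t = R₀.coeff 0 + R₀.coeff 1 * t + R₀.coeff 2 * t ^ 2
      + 4 / Real.pi ^ 2 * t ^ 3 := fun t => by
    rw [Polynomial.eval_eq_sum_range' (Nat.lt_succ_of_le hd₀), ← hc₀]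
    simp [Finset.sum_range_succ]
  obtain ⟨P, hP, hPe⟩ := exists_mvPolynomial_quadratic
    (R₂.coeff 0 * (2 * g) ^ 2 + R₁.coeff 0 * (2 * g) + R₀.coeff 0)
    (12 * g ^ 2 / Real.pi ^ 2 - 4 * g * R₂.coeff 0 - R₁.coeff 0 + 2 * g * R₁.coeff 1 + R₀.coeff 1)
    (-12 * g ^ 2 / Real.pi ^ 2 + 8 * g * R₂.coeff 0 + 2 * R₁.coeff 0 - 2 * g * R₁.coeff 1
      - R₀.coeff 1)
    (R₂.coeff 0 - R₁.coeff 1 + R₀.coeff 2)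
    (12 * g / Real.pi ^ 2 - 4 * R₂.coeff 0 + 3 * R₁.coeff 1 - 2 * R₀.coeff 2)
    (-12 * g / Real.pi ^ 2 + 4 * R₂.coeff 0 - 2 * R₁.coeff 1 + R₀.coeff 2)
  refine ⟨P, hP, fun X L => ?_⟩
  rw [hPe, hR₂, hR₁, hR₀]
  field_simp
  ring

lemma abs_quadratic_error_le {X θ Z E₂ E₁ E₀ C₂ C₁ C₀ : ℝ} (hX2 : 1 ≤ 2 * X) (hθX : |θ| ≤ 5 * X)
    (hZ0 : 0 ≤ Z) (hC₁ : 0 ≤ C₁) (hC₀ : 0 ≤ C₀) (hb₂ : |E₂| ≤ C₂ * Z)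
    (hb₁ : |E₁| ≤ C₁ * Z) (hb₀ : |E₀| ≤ C₀ * Z) :
    |θ ^ 2 * E₂ + θ * E₁ + E₀| ≤ (25 * C₂ + 10 * C₁ + 4 * C₀) * (Z * X ^ 2) := by
  have hX0 : 0 ≤ X := by linarith
  have a2 : |θ ^ 2 * E₂| ≤ (5 * X) ^ 2 * (C₂ * Z) := by
    rw [abs_mul, abs_pow]; gcongr
  have a1 : |θ * E₁| ≤ (5 * X) * (C₁ * Z) * (2 * X) := by
    rw [abs_mul]
    calc _ ≤ (5 * X) * (C₁ * Z) := by gcongr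
      _ ≤ _ := le_mul_of_one_le_right (by positivity) hX2
  have a0 : |E₀| ≤ (C₀ * Z) * (2 * X) ^ 2 :=
    hb₀.trans (le_mul_of_one_le_right (by positivity) (by nlinarith))
  calc _ ≤ |θ ^ 2 * E₂| + |θ * E₁| + |E₀| :=
        (abs_add_le _ _).trans (by gcongr; exact abs_add_le _ _)
    _ ≤ (5 * X) ^ 2 * (C₂ * Z) + (5 * X) * (C₁ * Z) * (2 * X) + (C₀ * Z) * (2 * X) ^ 2 := by gcongr
    _ = _ := by ring

lemma exists_switchSum_expansion : ∃ S P : MvPolynomial (Fin 2) ℝ, P.totalDegree ≤ 2 ∧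
    ∀ ε : ℝ, 0 < ε → ∃ C : ℝ, 0 ≤ C ∧ ∀ x Q : ℝ, 2 ≤ x → 1 ≤ Q → Q ≤ x →
      |switchSum x Q - (x ^ 2 * MvPolynomial.eval ![Real.log x, Real.log Q] S
        + Q * x * ((Real.log x ^ 3 - (2 * Real.log Q - Real.log x) ^ 3) / (2 * Real.pi ^ 2)
          + MvPolynomial.eval ![Real.log x, Real.log Q] P))|
        ≤ C * (Q ^ 2 * (x / Q) ^ ε * Real.log x ^ 2 + x * √x * Real.log x * (x / Q)
          + x * √x * Real.log x ^ 4) := by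
  obtain ⟨P₂, R₂, hd₂, hc₂, hb₂⟩ := hasExp_switchTwo
  obtain ⟨P₁, R₁, hd₁, hc₁, hb₁⟩ := hasExp_switchOne
  obtain ⟨P₀, R₀, hd₀, hc₀, hb₀⟩ := hasExp_switchZero
  set g := Real.eulerMascheroniConstant with hg
  have hgm := eulerMascheroni_bounds
  have hpi := Real.pi_pos
  let Yp : MvPolynomial (Fin 2) ℝ := MvPolynomial.X 0 - MvPolynomial.X 1
  let Tp : MvPolynomial (Fin 2) ℝ :=
    MvPolynomial.C 2 * MvPolynomial.X 1 - MvPolynomial.X 0 + MvPolynomial.C (2 * g)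
  obtain ⟨P, hP, hPe⟩ := exists_linear_term_eq hd₂ hc₂ hd₁ hc₁ hd₀ hc₀ g
  refine ⟨Tp ^ 2 * Polynomial.aeval Yp P₂ + Tp * Polynomial.aeval Yp P₁ + Polynomial.aeval Yp P₀,
    P, hP, fun ε hε => ?_⟩
  obtain ⟨C₂, hC₂, hb₂⟩ := hb₂ ε hε
  obtain ⟨C₁, hC₁, hb₁⟩ := hb₁ ε hε
  obtain ⟨C₀, hC₀, hb₀⟩ := hb₀ ε hε
  refine ⟨(25 * C₂ + 10 * C₁ + 4 * C₀) + 22 * 3 + 66 * 27, by positivity, fun x Q hx hQ hQx => ?_⟩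
  have hx0 : 0 < x := by linarith
  have hQ0 : 0 < Q := by linarith
  have hy : 1 ≤ x / Q := (one_le_div hQ0).2 hQx
  have hmain := abs_switchSum_sub_le hx hQ hQx
  have hb₂ := hb₂ (x / Q) hy
  have hb₁ := hb₁ (x / Q) hy
  have hb₀ := hb₀ (x / Q) hy
  have hX2 : 1 ≤ 2 * Real.log x := one_le_two_mul_log hx
  have hL0 := Real.log_nonneg hQ
  have hLX := Real.log_le_log hQ0 hQx
  have hlogy : Real.log (x / Q) = Real.log x - Real.log Q := Real.log_div hx0.ne' hQ0.ne'
  have hlogq : Real.log (Q ^ 2 / x) = 2 * Real.log Q - Real.log x := by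
    rw [Real.log_div (by positivity) hx0.ne', Real.log_pow]; norm_num
  rw [switchMain, hlogq] at hmain
  simp only [hlogy, zero_add] at hb₂ hb₁ hb₀
  have hS : MvPolynomial.eval ![Real.log x, Real.log Q] (Tp ^ 2 * Polynomial.aeval Yp P₂
      + Tp * Polynomial.aeval Yp P₁ + Polynomial.aeval Yp P₀)
      = (2 * Real.log Q - Real.log x + 2 * g) ^ 2 * P₂.eval (Real.log x - Real.log Q)
        + (2 * Real.log Q - Real.log x + 2 * g) * P₁.eval (Real.log x - Real.log Q)
        + P₀.eval (Real.log x - Real.log Q) := by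
    simp only [map_add, map_mul, map_pow, mvEval_aeval, Tp, Yp, map_sub, MvPolynomial.eval_X,
      MvPolynomial.eval_C, Matrix.cons_val_zero, Matrix.cons_val_one]
  rw [hS, ← hPe]
  clear hS hPe
  set X := Real.log x with hX
  set L := Real.log Q with hL
  set θ := 2 * L - X + 2 * g with hθ
  have hX0 : 0 ≤ X := by linarith
  have hθX : |θ| ≤ 5 * X := by rw [abs_le]; constructor <;> linarith
  set y := x / Q with hydef
  have hxy : x = Q * y := by rw [hydef]; field_simp
  set Z := y ^ ε with hZ
  have hZ0 : 0 ≤ Z := by positivity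
  set E₂ := totConv innerTwo y - (y ^ 2 * P₂.eval (X - L) + y * R₂.eval (X - L))
  set E₁ := switchOne y - (y ^ 2 * P₁.eval (X - L) + y * R₁.eval (X - L))
  set E₀ := switchZero y - (y ^ 2 * P₀.eval (X - L) + y * R₀.eval (X - L))
  have key : Q ^ 2 * (θ ^ 2 * totConv innerTwo y + θ * switchOne y + switchZero y)
      - (x ^ 2 * (θ ^ 2 * P₂.eval (X - L) + θ * P₁.eval (X - L) + P₀.eval (X - L))
        + Q * x * (θ ^ 2 * R₂.eval (X - L) + θ * R₁.eval (X - L) + R₀.eval (X - L)))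
      = Q ^ 2 * (θ ^ 2 * E₂ + θ * E₁ + E₀) := by
    simp only [E₂, E₁, E₀]
    rw [hxy]
    ring
  have hE : |Q ^ 2 * (θ ^ 2 * E₂ + θ * E₁ + E₀)|
      ≤ (25 * C₂ + 10 * C₁ + 4 * C₀) * (Q ^ 2 * Z * X ^ 2) := by
    rw [abs_mul, abs_of_nonneg (by positivity : 0 ≤ Q ^ 2)]
    calc _ ≤ Q ^ 2 * ((25 * C₂ + 10 * C₁ + 4 * C₀) * (Z * X ^ 2)) :=
          mul_le_mul_of_nonneg_left (abs_quadratic_error_le hX2 hθX hZ0 hC₁ hC₀ hb₂ hb₁ hb₀)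
            (by positivity)
      _ = _ := by ring
  have h1X : 1 + X ≤ 3 * X := by linarith
  have e1 : 22 * (x * √x) * (1 + X) * y ≤ 22 * (x * √x) * (3 * X) * y := by gcongr
  have e2 : 66 * (x * √x * X) * (1 + X) ^ 3 ≤ 66 * (x * √x * X) * (3 * X) ^ 3 := by gcongr
  have n1 : 0 ≤ Q ^ 2 * Z * X ^ 2 := by positivity
  have n2 : 0 ≤ x * √x * X * y := by positivity
  have n3 : 0 ≤ x * √x * X ^ 4 := by positivity
  set K := 25 * C₂ + 10 * C₁ + 4 * C₀ with hK
  have hK0 : 0 ≤ K := by positivity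
  rw [← key] at hE
  refine (abs_sub_le _ _ _).trans ((add_le_add hmain hE).trans ?_)
  have m1 : 0 ≤ K * (x * √x * X * y) := mul_nonneg hK0 n2
  have m2 : 0 ≤ K * (x * √x * X ^ 4) := mul_nonneg hK0 n3
  calc _ ≤ 22 * (x * √x) * (3 * X) * y + 66 * (x * √x * X) * (3 * X) ^ 3 + K *
      (Q ^ 2 * Z * X ^ 2) :=
        add_le_add (add_le_add e1 e2) le_rfl
    _ ≤ _ := by linarith

lemma exists_abs_mvEval_le_cube {P : MvPolynomial (Fin 2) ℝ} (hP : P.totalDegree ≤ 3) :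
    ∃ C : ℝ, 0 ≤ C ∧ ∀ X L : ℝ, 1 ≤ 2 * X → 0 ≤ L → L ≤ X →
      |MvPolynomial.eval ![X, L] P| ≤ C * X ^ 3 := by
  obtain ⟨C, hC, h⟩ := exists_abs_mvEval_le P
  refine ⟨C * 8, by positivity, fun X L hX hL hLX => (h X L hX hL hLX).trans ?_⟩
  have hX0 : 0 ≤ X := by linarith
  rw [mul_assoc]
  refine mul_le_mul_of_nonneg_left ?_ hC
  calc X ^ P.totalDegree ≤ (2 * X) ^ P.totalDegree := by gcongr; linarith
    _ ≤ (2 * X) ^ 3 := pow_le_pow_right₀ hX hP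
    _ = _ := by ring

lemma exists_sum_sq_Mdiv_expansion : ∃ W : MvPolynomial (Fin 2) ℝ, ∀ δ : ℝ, 0 < δ →
    ∃ C : ℝ, 0 ≤ C ∧ ∀ x Q : ℝ, 2 ≤ x → 1 ≤ Q →
      |∑ q ∈ Icc 1 ⌊Q⌋₊, ∑ a ∈ Icc 1 q, Mdiv x q a ^ 2
        - x ^ 2 * MvPolynomial.eval ![Real.log x, Real.log Q] W|
        ≤ C * (x ^ 2 * Real.log x ^ 2 * Q ^ (-1 + δ)) := by
  obtain ⟨c₀, d₀, c₁, d₁, c₂, d₂, h⟩ := exists_sum_sq_Mdiv_bound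
  let m : MvPolynomial (Fin 2) ℝ :=
    MvPolynomial.X 0 + MvPolynomial.C (2 * Real.eulerMascheroniConstant - 1)
  refine ⟨m ^ 2 * (MvPolynomial.C c₀ * MvPolynomial.X 1 + MvPolynomial.C d₀)
    + m * (MvPolynomial.C c₁ * MvPolynomial.X 1 + MvPolynomial.C d₁)
    + (MvPolynomial.C c₂ * MvPolynomial.X 1 + MvPolynomial.C d₂), fun δ hδ => ?_⟩
  obtain ⟨C, hC, h⟩ := h δ hδ
  refine ⟨C, hC, fun x Q hx hQ => ?_⟩
  have h1 := h x Q hx hQ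
  simp only [m, map_add, map_mul, map_pow, MvPolynomial.eval_X, MvPolynomial.eval_C,
    Matrix.cons_val_zero, Matrix.cons_val_one]
  rwa [← add_sub_assoc]

lemma exists_mvPolynomial_sub_slice (S : MvPolynomial (Fin 2) ℝ) (c : ℝ) :
    ∃ D : MvPolynomial (Fin 2) ℝ, ∀ X L : ℝ, MvPolynomial.eval ![X, L] D
      = MvPolynomial.eval ![X, c * X] S - MvPolynomial.eval ![X, L] S := by
  refine ⟨MvPolynomial.bind₁ ![MvPolynomial.X 0, MvPolynomial.C c * MvPolynomial.X 0] S - S,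
    fun X L => ?_⟩
  rw [map_sub]
  congr 1
  have h := MvPolynomial.eval₂Hom_bind₁ (RingHom.id ℝ) ![X, L]
    ![MvPolynomial.X 0, MvPolynomial.C c * MvPolynomial.X 0] S
  have h2 : (fun i => (MvPolynomial.eval₂Hom (RingHom.id ℝ) ![X, L])
      ((![MvPolynomial.X 0, MvPolynomial.C c * MvPolynomial.X 0] :
        Fin 2 → MvPolynomial (Fin 2) ℝ) i)) = ![X, c * X] := by
    funext i
    fin_cases i <;> simp
  rw [h2] at h
  exact h

lemma one_le_rpow_le {x : ℝ} (hx : 2 ≤ x) : 1 ≤ x ^ (3 / 4 : ℝ) ∧ x ^ (3 / 4 : ℝ) ≤ x := by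
  refine ⟨Real.one_le_rpow (by linarith) (by norm_num), ?_⟩
  conv_rhs => rw [← Real.rpow_one x]
  exact Real.rpow_le_rpow_of_exponent_le (by linarith) (by norm_num)

lemma mul_sqrt_mul_log_pow_le {x : ℝ} (hx : 2 ≤ x) :
    x * √x * Real.log x ^ 4 ≤ 4 * (x ^ (7 / 4 : ℝ) * Real.log x ^ 3) := by
  have hx0 : 0 < x := by linarith
  have hX0 : 0 ≤ Real.log x := Real.log_nonneg (by linarith)
  have hXe : Real.log x ≤ 4 * x ^ (1 / 4 : ℝ) := by
    have := Real.log_le_rpow_div hx0.le (show (0 : ℝ) < 1 / 4 by norm_num)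
    linarith
  calc x * √x * Real.log x ^ 4 = x * √x * Real.log x ^ 3 * Real.log x := by ring
    _ ≤ x * √x * Real.log x ^ 3 * (4 * x ^ (1 / 4 : ℝ)) := by gcongr
    _ = 4 * ((x ^ (1 : ℝ) * x ^ (1 / 2 : ℝ) * x ^ (1 / 4 : ℝ)) * Real.log x ^ 3) := by
        rw [Real.sqrt_eq_rpow, Real.rpow_one]; ring
    _ = _ := by rw [← Real.rpow_add hx0, ← Real.rpow_add hx0]; norm_num

lemma mul_sqrt_mul_div_le {x Q : ℝ} (hx : 2 ≤ x) (hQ : x ^ (3 / 4 : ℝ) ≤ Q) :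
    x * √x * Real.log x * (x / Q) ≤ 4 * (x ^ (7 / 4 : ℝ) * Real.log x ^ 3) := by
  have hx0 : 0 < x := by linarith
  have hX2 := one_le_two_mul_log hx
  have hX0 : 0 ≤ Real.log x := by linarith
  have h1 : x / Q ≤ x ^ (1 / 4 : ℝ) := by
    calc x / Q ≤ x / x ^ (3 / 4 : ℝ) := by gcongr
      _ = x ^ (1 : ℝ) / x ^ (3 / 4 : ℝ) := by rw [Real.rpow_one]
      _ = _ := by rw [← Real.rpow_sub hx0]; norm_num
  have h2 : Real.log x ≤ Real.log x * (2 * Real.log x) ^ 2 :=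
    le_mul_of_one_le_right hX0 (one_le_pow₀ hX2)
  have h3 : 0 ≤ x / Q := div_nonneg hx0.le ((by positivity : 0 ≤ x ^ (3 / 4 : ℝ)).trans hQ)
  calc x * √x * Real.log x * (x / Q)
      ≤ x * √x * (Real.log x * (2 * Real.log x) ^ 2) * x ^ (1 / 4 : ℝ) :=
        mul_le_mul (mul_le_mul_of_nonneg_left h2 (by positivity)) h1 h3 (by positivity)
    _ = 4 * ((x ^ (1 : ℝ) * x ^ (1 / 2 : ℝ) * x ^ (1 / 4 : ℝ)) * Real.log x ^ 3) := by
        rw [Real.sqrt_eq_rpow, Real.rpow_one]; ring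
    _ = _ := by rw [← Real.rpow_add hx0, ← Real.rpow_add hx0]; norm_num

lemma sq_mul_rpow_neg_le {x Q : ℝ} (hx : 2 ≤ x) (hQ : x ^ (3 / 4 : ℝ) ≤ Q) :
    x ^ 2 * Real.log x ^ 2 * Q ^ (-1 + 1 / 4 : ℝ) ≤ 2 * (x ^ (7 / 4 : ℝ) * Real.log x ^ 3) := by
  have hx0 : 0 < x := by linarith
  have hX2 := one_le_two_mul_log hx
  have hX0 : 0 ≤ Real.log x := by linarith
  have h1 : Q ^ (-1 + 1 / 4 : ℝ) ≤ x ^ (-(1 / 4) : ℝ) := by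
    calc Q ^ (-1 + 1 / 4 : ℝ) ≤ (x ^ (3 / 4 : ℝ)) ^ (-1 + 1 / 4 : ℝ) :=
          Real.rpow_le_rpow_of_nonpos (by positivity) hQ (by norm_num)
      _ = x ^ (3 / 4 * (-1 + 1 / 4) : ℝ) := by rw [← Real.rpow_mul hx0.le]
      _ ≤ _ := Real.rpow_le_rpow_of_exponent_le (by linarith) (by norm_num)
  have h2 : Real.log x ^ 2 ≤ Real.log x ^ 2 * (2 * Real.log x) :=
    le_mul_of_one_le_right (by positivity) hX2
  have hQ0 : 0 < Q := lt_of_lt_of_le (by positivity) hQ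
  calc _ ≤ x ^ 2 * (Real.log x ^ 2 * (2 * Real.log x)) * x ^ (-(1 / 4) : ℝ) :=
        mul_le_mul (mul_le_mul_of_nonneg_left h2 (by positivity)) h1 (by positivity)
          (by positivity)
    _ = 2 * ((x ^ (2 : ℝ) * x ^ (-(1 / 4) : ℝ)) * Real.log x ^ 3) := by
        rw [Real.rpow_two]; ring
    _ = _ := by rw [← Real.rpow_add hx0]; norm_num

lemma rpow_sq_mul_div_le {x : ℝ} (hx : 2 ≤ x) :
    (x ^ (3 / 4 : ℝ)) ^ 2 * (x / x ^ (3 / 4 : ℝ)) ^ (1 : ℝ) * Real.log x ^ 2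
      ≤ 2 * (x ^ (7 / 4 : ℝ) * Real.log x ^ 3) := by
  have hx0 : 0 < x := by linarith
  have hX2 := one_le_two_mul_log hx
  have h1 : (x ^ (3 / 4 : ℝ)) ^ 2 * (x / x ^ (3 / 4 : ℝ)) ^ (1 : ℝ) = x ^ (7 / 4 : ℝ) := by
    have h2 : x ^ (7 / 4 : ℝ) = x ^ (3 / 4 : ℝ) * x := by
      rw [← Real.rpow_add_one hx0.ne']; norm_num
    rw [Real.rpow_one, h2]
    field_simp
  rw [h1]
  calc _ ≤ x ^ (7 / 4 : ℝ) * (Real.log x ^ 2 * (2 * Real.log x)) := by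
        gcongr
        exact le_mul_of_one_le_right (by positivity) hX2
    _ = _ := by ring

lemma self_le_rpow {x : ℝ} (hx : 2 ≤ x) : x ≤ x ^ (7 / 4 : ℝ) := by
  conv_lhs => rw [← Real.rpow_one x]
  exact Real.rpow_le_rpow_of_exponent_le (by linarith) (by norm_num)

lemma rpow_three_quarters_mul {x : ℝ} (hx : 0 < x) : x ^ (3 / 4 : ℝ) * x = x ^ (7 / 4 : ℝ) := by
  rw [← Real.rpow_add_one hx.ne']; norm_num

/-- The diagonal contribution. -/
lemma exists_diagonal_bound : ∃ P : MvPolynomial (Fin 2) ℝ, P.totalDegree ≤ 2 ∧ ∃ C : ℝ, 0 ≤ C ∧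
    ∀ x Q : ℝ, 2 ≤ x → x ^ (3 / 4 : ℝ) ≤ Q → Q ≤ x →
      |((⌊Q⌋₊ : ℝ) - ⌊x ^ (3 / 4 : ℝ)⌋₊) * divSqSum x
        - Q * x * (Real.log x ^ 3 / Real.pi ^ 2
          + MvPolynomial.eval ![Real.log x, Real.log Q] P)|
        ≤ C * (x ^ (7 / 4 : ℝ) * Real.log x ^ 3) := by
  obtain ⟨b₀, b₁, b₂, C, hC, h⟩ := exists_abs_divSqSum_sub_le
  obtain ⟨P, hP, hPe⟩ := exists_mvPolynomial_quadratic b₀ b₁ 0 b₂ 0 0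
  obtain ⟨K, hK, hKb⟩ := exists_abs_mvEval_le_cube (hP.trans (by norm_num))
  refine ⟨P, hP, C * 27 + 2 * (1 + K), by positivity, fun x Q hx hQ hQx => ?_⟩
  have hx0 : 0 < x := by linarith
  have hQ1 : 1 ≤ Q := (one_le_rpow_le hx).1.trans hQ
  have hX2 := one_le_two_mul_log hx
  have hL0 := Real.log_nonneg hQ1
  have hLX := Real.log_le_log (by linarith) hQx
  have h1 := h x (by linarith)
  have h2 := hKb _ _ hX2 hL0 hLX
  have h3 : MvPolynomial.eval ![Real.log x, Real.log Q] P
      = b₂ * Real.log x ^ 2 + b₁ * Real.log x + b₀ := by rw [hPe]; ring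
  have h7 := rpow_three_quarters_mul hx0
  have h8 := self_le_rpow hx
  set X := Real.log x
  set e := MvPolynomial.eval ![X, Real.log Q] P
  rw [show X ^ 3 / Real.pi ^ 2 + b₂ * X ^ 2 + b₁ * X + b₀ = X ^ 3 / Real.pi ^ 2 + e by
    rw [h3]; ring] at h1
  have hX0 : 0 ≤ X := by linarith
  have h4 : |X ^ 3 / Real.pi ^ 2 + e| ≤ (1 + K) * X ^ 3 := by
    refine (abs_add_le _ _).trans ?_
    rw [add_mul, one_mul]
    refine add_le_add ?_ h2
    rw [abs_of_nonneg (by positivity)]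
    exact div_le_self (by positivity) (by nlinarith [Real.pi_gt_three])
  set q := x ^ (3 / 4 : ℝ)
  have hq1 : 1 ≤ q := (one_le_rpow_le hx).1
  set n := (⌊Q⌋₊ : ℝ) - ⌊q⌋₊ with hn
  have f1 := Nat.floor_le (show 0 ≤ Q by linarith)
  have f2 := Nat.floor_le (show 0 ≤ q by linarith)
  have f3 := Nat.lt_floor_add_one Q
  have f4 : (⌊q⌋₊ : ℝ) ≤ ⌊Q⌋₊ := by exact_mod_cast Nat.floor_le_floor hQ
  have f5 : (0 : ℝ) ≤ ⌊q⌋₊ := by positivity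
  have hn1 : |n| ≤ x := by rw [abs_of_nonneg (by linarith)]; linarith
  have hn2 : |n - Q| ≤ 2 * q := by rw [abs_le]; constructor <;> linarith
  calc _ = |n * (divSqSum x - x * (X ^ 3 / Real.pi ^ 2 + e))
        + (n - Q) * (x * (X ^ 3 / Real.pi ^ 2 + e))| := by congr 1; ring
    _ ≤ |n| * |divSqSum x - x * (X ^ 3 / Real.pi ^ 2 + e)|
        + |n - Q| * (x * |X ^ 3 / Real.pi ^ 2 + e|) := by
        refine (abs_add_le _ _).trans ?_
        rw [abs_mul, abs_mul, abs_mul, abs_of_pos hx0]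
    _ ≤ x * (C * (q * (1 + X) ^ 3)) + 2 * q * (x * ((1 + K) * X ^ 3)) := by gcongr
    _ ≤ x * (C * (q * (3 * X) ^ 3)) + 2 * q * (x * ((1 + K) * X ^ 3)) := by
        gcongr; linarith
    _ = (C * 27 + 2 * (1 + K)) * (q * x * X ^ 3) := by ring
    _ = _ := by rw [h7]

/-- Assembling the difference of two variances from its parts. -/
lemma abs_sub_le_of_parts {V V₀ A A₀ M M₀ s s₀ n w w₀ z z₀ g g₀ p b₁ b₂ b₃ b₄ b₅ b₆ b₇ b₈ b₉ : ℝ}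
    (h1 : |V - (A - M)| ≤ b₁) (h2 : |V₀ - (A₀ - M₀)| ≤ b₂) (hA : A - A₀ = n + 2 * (s₀ - s))
    (h3 : |n - p| ≤ b₃) (h4 : |M - w| ≤ b₄) (h5 : |M₀ - w₀| ≤ b₅) (h6 : |s - (z + g)| ≤ b₆)
    (h7 : |s₀ - (z₀ + g₀)| ≤ b₇) (h8 : |V₀| ≤ b₈) (h9 : |g₀| ≤ b₉) :
    |V - ((2 * z₀ + w₀ - (2 * z + w)) + (p - 2 * g))|
      ≤ b₁ + b₂ + b₃ + b₄ + b₅ + 2 * b₆ + 2 * b₇ + b₈ + 2 * b₉ := by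
  rw [abs_le] at *
  constructor <;> linarith

lemma abs_cube_slice_add_le {X K p : ℝ} (hX : 0 ≤ X) (hp : |p| ≤ K * X ^ 3) :
    |(X ^ 3 - (2 * (3 / 4 * X) - X) ^ 3) / (2 * Real.pi ^ 2) + p| ≤ (1 + K) * X ^ 3 := by
  refine (abs_add_le _ _).trans ?_
  rw [add_mul, one_mul]
  refine add_le_add ?_ hp
  have hX3 : 0 ≤ X ^ 3 := by positivity
  have hπ : 1 ≤ 2 * Real.pi ^ 2 := by nlinarith [Real.pi_gt_three]
  rw [show X ^ 3 - (2 * (3 / 4 * X) - X) ^ 3 = 7 / 8 * X ^ 3 by ring,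
    abs_of_nonneg (by positivity)]
  refine (div_le_self (by positivity) hπ).trans ?_
  linarith

lemma exists_Vdiv_expansion : ∃ D P : MvPolynomial (Fin 2) ℝ, P.totalDegree ≤ 2 ∧
    (∀ X : ℝ, MvPolynomial.eval ![X, 3 / 4 * X] D = 0) ∧
    ∀ ε : ℝ, 0 < ε → ∃ C : ℝ, 0 ≤ C ∧ ∀ x Q : ℝ, 2 ≤ x → x ^ (3 / 4 : ℝ) ≤ Q → Q ≤ x →
      |Vdiv x Q - (x ^ 2 * MvPolynomial.eval ![Real.log x, Real.log Q] D
        + Q * x * ((2 * Real.log Q - Real.log x) ^ 3 / Real.pi ^ 2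
          + MvPolynomial.eval ![Real.log x, Real.log Q] P))|
        ≤ C * (x ^ (7 / 4 : ℝ) * Real.log x ^ 3 + Q ^ 2 * (x / Q) ^ ε * Real.log x ^ 2) := by
  obtain ⟨S, P₁, hP₁, hS⟩ := exists_switchSum_expansion
  obtain ⟨W, hW⟩ := exists_sum_sq_Mdiv_expansion
  obtain ⟨P₂, hP₂, C₂, hC₂, hdiag⟩ := exists_diagonal_bound
  obtain ⟨C₃, hC₃, hV⟩ := exists_Vdiv_le
  obtain ⟨C₄, hC₄, hW⟩ := hW (1 / 4) (by norm_num)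
  obtain ⟨C₅, hC₅, hS1⟩ := hS 1 one_pos
  obtain ⟨K, hK, hKb⟩ := exists_abs_mvEval_le_cube (hP₁.trans (by norm_num))
  obtain ⟨D, hD⟩ := exists_mvPolynomial_sub_slice (MvPolynomial.C 2 * S + W) (3 / 4)
  refine ⟨D, P₂ - MvPolynomial.C 2 * P₁, ?_, fun X => by rw [hD, sub_self], fun ε hε => ?_⟩
  · refine (MvPolynomial.totalDegree_sub _ _).trans (max_le hP₂ ?_)
    refine (MvPolynomial.totalDegree_mul _ _).trans ?_
    rwa [MvPolynomial.totalDegree_C, zero_add]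
  obtain ⟨C₆, hC₆, hS⟩ := hS ε hε
  refine ⟨2 * C₃ + 2 * (88 * 27 * 4) + C₂ + 2 * (2 * C₄) + 2 * (10 * C₅) + 2 * (8 * C₆)
    + 2 * (1 + K), by positivity, fun x Q hx hQ hQx => ?_⟩
  have hx0 : 0 < x := by linarith
  obtain ⟨hq1, hqx⟩ := one_le_rpow_le hx
  have hQ1 : 1 ≤ Q := hq1.trans hQ
  have hQ0 : 0 < Q := by linarith
  have hX2 := one_le_two_mul_log hx
  have hlq : Real.log (x ^ (3 / 4 : ℝ)) = 3 / 4 * Real.log x := Real.log_rpow hx0 _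
  have eV := hV x _ hx hq1 hqx
  have eV0 := Vdiv_nonneg x (x ^ (3 / 4 : ℝ))
  have e1 := abs_Vdiv_sub_le hx hQ1 hQx
  have e2 := abs_Vdiv_sub_le hx hq1 hqx
  have e3 := hdiag x Q hx hQ hQx
  have e4 := hW x Q hx hQ1
  have e5 := hW x _ hx hq1
  have e6 := hS x Q hx hQ1 hQx
  have e7 := hS1 x _ hx hq1 hqx
  have hA := sum_sum_sq_Adiv_sub x Q (x ^ (3 / 4 : ℝ)) hx0.le hQ0 (by positivity)
  have t1 := mul_sqrt_mul_log_pow_le hx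
  have t2 := mul_sqrt_mul_div_le hx hQ
  have t3 := mul_sqrt_mul_div_le hx (le_refl (x ^ (3 / 4 : ℝ)))
  have t4 := sq_mul_rpow_neg_le hx hQ
  have t5 := sq_mul_rpow_neg_le hx (le_refl (x ^ (3 / 4 : ℝ)))
  have t6 := rpow_sq_mul_div_le hx
  have t7 := rpow_three_quarters_mul hx0
  have hKb := hKb (Real.log x) (3 / 4 * Real.log x) hX2 (by linarith) (by linarith)
  rw [hlq] at e5 e7
  rw [Finset.sum_sub_distrib] at e1 e2
  rw [hD]
  simp only [map_add, map_sub, map_mul, MvPolynomial.eval_C]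
  have hlQ0 := Real.log_nonneg hQ1
  set X := Real.log x with hX
  have hX0 : 0 ≤ X := by linarith
  set B := x ^ (7 / 4 : ℝ) * X ^ 3 with hB
  set B' := Q ^ 2 * (x / Q) ^ ε * X ^ 2 with hB'
  have hB0 : 0 ≤ B := by positivity
  have hB'0 : 0 ≤ B' := by positivity
  set q := x ^ (3 / 4 : ℝ) with hq
  have hbase : 88 * (x * √x * X) * (1 + X) ^ 3 ≤ 88 * 27 * 4 * B := by
    calc 88 * (x * √x * X) * (1 + X) ^ 3 ≤ 88 * (x * √x * X) * (3 * X) ^ 3 :=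
          mul_le_mul_of_nonneg_left (pow_le_pow_left₀ (by positivity) (by linarith) 3)
            (by positivity)
      _ = 88 * 27 * (x * √x * X ^ 4) := by ring
      _ ≤ 88 * 27 * (4 * B) := mul_le_mul_of_nonneg_left t1 (by norm_num)
      _ = _ := by ring
  have hV0 : |Vdiv x q| ≤ 2 * C₃ * B := by
    rw [abs_of_nonneg eV0]
    refine eV.trans (le_of_eq ?_)
    rw [t7]; ring
  have h4 := e4.trans (mul_le_mul_of_nonneg_left t4 hC₄)
  have h5 := e5.trans (mul_le_mul_of_nonneg_left t5 hC₄)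
  have h6 := e6.trans (mul_le_mul_of_nonneg_left
    (show _ ≤ B' + 4 * B + 4 * B from add_le_add (add_le_add le_rfl t2) t1) hC₆)
  have h7 := e7.trans (mul_le_mul_of_nonneg_left
    (show _ ≤ 2 * B + 4 * B + 4 * B from add_le_add (add_le_add t6 t3) t1) hC₅)
  have h9 : |q * x * ((X ^ 3 - (2 * (3 / 4 * X) - X) ^ 3) / (2 * Real.pi ^ 2)
      + MvPolynomial.eval ![X, 3 / 4 * X] P₁)| ≤ (1 + K) * B := by
    rw [t7, abs_mul, abs_of_nonneg (show 0 ≤ x ^ (7 / 4 : ℝ) by positivity), hB,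
      mul_left_comm (1 + K)]
    exact mul_le_mul_of_nonneg_left (abs_cube_slice_add_le hX0 hKb) (by positivity)
  have key := abs_sub_le_of_parts (e1.trans hbase) (e2.trans hbase) hA e3 h4 h5 h6 h7 hV0 h9
  refine (le_of_eq ?_).trans (key.trans ?_)
  · congr 1
    ring
  · clear_value B B'
    linarith [mul_nonneg hC₃ hB'0, mul_nonneg hC₂ hB'0, mul_nonneg hC₄ hB'0,
      mul_nonneg hC₅ hB'0, mul_nonneg hC₆ hB'0, mul_nonneg hK hB'0, mul_nonneg hC₆ hB0]

open Filter Topology in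
/-- A real polynomial dominated by a decaying exponential vanishes identically. -/
lemma polynomial_eq_zero_of_abs_eval_le_exp {p : Polynomial ℝ} {K b c : ℝ} (hb : 0 < b)
    (hc : 0 < c) (h : ∀ X : ℝ, 1 ≤ X →
      |p.eval X| ≤ K * (X ^ 3 * Real.exp (-b * X) + X ^ 3 * Real.exp (-c * X))) : p = 0 := by
  have aux : ∀ b : ℝ, 0 < b → Tendsto (fun X : ℝ => X ^ 3 * Real.exp (-b * X)) atTop (𝓝 0) := by
    intro b hb
    have := tendsto_rpow_mul_exp_neg_mul_atTop_nhds_zero 3 b hb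
    refine this.congr fun X => ?_
    norm_cast
  have h0 : Tendsto (fun X : ℝ =>
      K * (X ^ 3 * Real.exp (-b * X) + X ^ 3 * Real.exp (-c * X))) atTop (𝓝 0) := by
    simpa using ((aux b hb).add (aux c hc)).const_mul K
  have h1 : Tendsto (fun X : ℝ => p.eval X) atTop (𝓝 0) := by
    refine squeeze_zero_norm' ?_ h0
    filter_upwards [eventually_ge_atTop 1] with X hX
    exact h X hX
  exact Polynomial.leadingCoeff_eq_zero.1 ((Polynomial.tendsto_nhds_iff p).1 h1).1

lemma abs_two_mul_sub_cube_div_pi_sq_le {X L : ℝ} (hL : 0 ≤ L) (hLX : L ≤ X) :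
    |(2 * L - X) ^ 3 / Real.pi ^ 2| ≤ X ^ 3 := by
  have h1 : |2 * L - X| ≤ X := by rw [abs_le]; constructor <;> linarith
  rw [abs_div, abs_pow, abs_of_pos (show 0 < Real.pi ^ 2 by positivity)]
  exact (div_le_self (by positivity) (by nlinarith [Real.pi_gt_three])).trans
    (pow_le_pow_left₀ (abs_nonneg _) h1 3)

/-- The second order term of the expansion of the variance is small. -/
lemma exists_sq_mul_abs_le {D P : MvPolynomial (Fin 2) ℝ} (hP : P.totalDegree ≤ 2) {C : ℝ}
    (hC : 0 ≤ C) (h : ∀ x Q : ℝ, 2 ≤ x → x ^ (3 / 4 : ℝ) ≤ Q → Q ≤ x →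
      |Vdiv x Q - (x ^ 2 * MvPolynomial.eval ![Real.log x, Real.log Q] D
        + Q * x * ((2 * Real.log Q - Real.log x) ^ 3 / Real.pi ^ 2
          + MvPolynomial.eval ![Real.log x, Real.log Q] P))|
        ≤ C * (x ^ (7 / 4 : ℝ) * Real.log x ^ 3
          + Q ^ 2 * (x / Q) ^ (1 : ℝ) * Real.log x ^ 2)) :
    ∃ K : ℝ, 0 ≤ K ∧ ∀ x Q : ℝ, 2 ≤ x → x ^ (3 / 4 : ℝ) ≤ Q → Q ≤ x →
      x ^ 2 * |MvPolynomial.eval ![Real.log x, Real.log Q] D|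
        ≤ K * (Q * x * Real.log x ^ 3 + x ^ (7 / 4 : ℝ) * Real.log x ^ 3) := by
  obtain ⟨C₁, hC₁, hV⟩ := exists_Vdiv_le
  obtain ⟨K, hK, hKb⟩ := exists_abs_mvEval_le_cube (hP.trans (by norm_num))
  refine ⟨C₁ + (1 + K) + 2 * C, by positivity, fun x Q hx hQ hQx => ?_⟩
  have hx0 : 0 < x := by linarith
  have hQ1 : 1 ≤ Q := (one_le_rpow_le hx).1.trans hQ
  have hQ0 : 0 < Q := by linarith
  have hX2 := one_le_two_mul_log hx
  have hL0 := Real.log_nonneg hQ1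
  have hLX := Real.log_le_log hQ0 hQx
  have e1 := h x Q hx hQ hQx
  have e2 := hV x Q hx hQ1 hQx
  have e3 := Vdiv_nonneg x Q
  have e4 := hKb _ _ hX2 hL0 hLX
  have e5 := abs_two_mul_sub_cube_div_pi_sq_le hL0 hLX
  have e6 : Q ^ 2 * (x / Q) ^ (1 : ℝ) = Q * x := by rw [Real.rpow_one]; field_simp
  rw [e6] at e1
  set X := Real.log x
  have hX0 : 0 ≤ X := by linarith
  set G := (2 * Real.log Q - X) ^ 3 / Real.pi ^ 2 + MvPolynomial.eval ![X, Real.log Q] P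
  have e7 : |Q * x * G| ≤ (1 + K) * (Q * x * X ^ 3) := by
    rw [abs_mul, abs_of_pos (mul_pos hQ0 hx0), mul_left_comm]
    refine mul_le_mul_of_nonneg_left ((abs_add_le _ _).trans ?_) (by positivity)
    rw [add_mul, one_mul]
    exact add_le_add e5 e4
  have e8 : Q * x * X ^ 2 ≤ 2 * (Q * x * X ^ 3) := by
    have : 0 ≤ Q * x * X ^ 2 := by positivity
    nlinarith
  have hB0 : 0 ≤ x ^ (7 / 4 : ℝ) * X ^ 3 := by positivity
  have hB1 : 0 ≤ Q * x * X ^ 3 := by positivity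
  set B := x ^ (7 / 4 : ℝ) * X ^ 3
  set B₁ := Q * x * X ^ 3
  have e9 : C * (B + Q * x * X ^ 2) ≤ C * (B + 2 * B₁) := by gcongr
  rw [← abs_of_nonneg (sq_nonneg x), ← abs_mul]
  have e10 : |x ^ 2 * MvPolynomial.eval ![X, Real.log Q] D|
      ≤ C * (B + 2 * B₁) + C₁ * (B₁ + B) + (1 + K) * B₁ := by
    rw [abs_le] at e1 e7 ⊢
    constructor <;> linarith
  refine e10.trans ?_
  linarith [mul_nonneg hC hB0, mul_nonneg hK hB0]

lemma mvEval_eq_zero_of_sq_mul_abs_le {D : MvPolynomial (Fin 2) ℝ} {K : ℝ}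
    (h : ∀ x Q : ℝ, 2 ≤ x → x ^ (3 / 4 : ℝ) ≤ Q → Q ≤ x →
      x ^ 2 * |MvPolynomial.eval ![Real.log x, Real.log Q] D|
        ≤ K * (Q * x * Real.log x ^ 3 + x ^ (7 / 4 : ℝ) * Real.log x ^ 3))
    {a : ℝ} (ha : 3 / 4 < a) (ha1 : a < 1) (X : ℝ) : MvPolynomial.eval ![X, a * X] D = 0 := by
  let p : Polynomial ℝ := MvPolynomial.aeval ![Polynomial.X, Polynomial.C a * Polynomial.X] D
  have hp : ∀ X, p.eval X = MvPolynomial.eval ![X, a * X] D := by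
    intro X
    have h1 := MvPolynomial.eval₂_comp_left (Polynomial.evalRingHom X) (algebraMap ℝ (Polynomial ℝ))
      ![Polynomial.X, Polynomial.C a * Polynomial.X] D
    have h2 : (Polynomial.evalRingHom X) ∘ ![Polynomial.X, Polynomial.C a * Polynomial.X]
        = ![X, a * X] := by
      funext i
      fin_cases i <;> simp
    have h3 : (Polynomial.evalRingHom X).comp (algebraMap ℝ (Polynomial ℝ)) = RingHom.id ℝ := by
      ext; simp
    rw [h2, h3] at h1
    exact h1
  rw [← hp]
  suffices p = 0 by rw [this, Polynomial.eval_zero]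
  refine polynomial_eq_zero_of_abs_eval_le_exp (K := K) (sub_pos.2 ha1)
    (show (0 : ℝ) < 1 / 4 by norm_num) fun X hX => ?_
  have hx : 2 ≤ Real.exp X := by linarith [Real.add_one_le_exp X]
  have h1 := h (Real.exp X) (Real.exp (a * X)) hx
    (by rw [← Real.exp_mul]; exact Real.exp_le_exp.2 (by nlinarith))
    (Real.exp_le_exp.2 (by nlinarith))
  rw [Real.log_exp, Real.log_exp, ← hp, ← Real.exp_mul, ← Real.exp_add, ← Real.exp_nat_mul] at h1
  have h2 := mul_le_mul_of_nonneg_left h1 (Real.exp_pos (-(2 * X))).le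
  rw [← mul_assoc, ← Real.exp_add] at h2
  have h3 : Real.exp (-(1 - a) * X) = Real.exp (-(2 * X)) * Real.exp (a * X + X) := by
    rw [← Real.exp_add]; ring_nf
  have h4 : Real.exp (-(1 / 4) * X) = Real.exp (-(2 * X)) * Real.exp (X * (7 / 4)) := by
    rw [← Real.exp_add]; ring_nf
  rw [show -(2 * X) + ((2 : ℕ) : ℝ) * X = 0 by push_cast; ring, Real.exp_zero, one_mul] at h2
  rw [h3, h4]
  refine h2.trans (le_of_eq (by ring))

lemma mvEval_eq_zero_of_forall_Ioo {D : MvPolynomial (Fin 2) ℝ} {X : ℝ}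
    (h : ∀ a : ℝ, 3 / 4 < a → a < 1 → MvPolynomial.eval ![X, a * X] D = 0) {a : ℝ}
    (ha : 3 / 4 ≤ a) (ha1 : a ≤ 1) : MvPolynomial.eval ![X, a * X] D = 0 := by
  have hc : Continuous fun a : ℝ => MvPolynomial.eval ![X, a * X] D :=
    (MvPolynomial.continuous_eval D).comp (by fun_prop)
  have hcl : IsClosed {a : ℝ | MvPolynomial.eval ![X, a * X] D = 0} :=
    isClosed_eq hc continuous_const
  have hsub : Set.Ioo (3 / 4 : ℝ) 1 ⊆ {a : ℝ | MvPolynomial.eval ![X, a * X] D = 0} :=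
    fun a ha => h a ha.1 ha.2
  have := hcl.closure_subset_iff.2 hsub
  rw [closure_Ioo (by norm_num)] at this
  exact this ⟨ha, ha1⟩

lemma exists_Vdiv_expansion_of_rpow_le : ∃ P : MvPolynomial (Fin 2) ℝ, P.totalDegree ≤ 2 ∧
    ∀ ε : ℝ, 0 < ε → ∃ C : ℝ, 0 ≤ C ∧ ∀ x Q : ℝ, 2 ≤ x → x ^ (3 / 4 : ℝ) ≤ Q → Q ≤ x →
      |Vdiv x Q - Q * x * ((2 * Real.log Q - Real.log x) ^ 3 / Real.pi ^ 2
          + MvPolynomial.eval ![Real.log x, Real.log Q] P)|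
        ≤ C * (x ^ (7 / 4 : ℝ) * Real.log x ^ 3 + Q ^ 2 * (x / Q) ^ ε * Real.log x ^ 2) := by
  obtain ⟨D, P, hP, -, h⟩ := exists_Vdiv_expansion
  obtain ⟨C, hC, h1⟩ := h 1 one_pos
  obtain ⟨K, -, hK⟩ := exists_sq_mul_abs_le hP hC h1
  refine ⟨P, hP, fun ε hε => ?_⟩
  obtain ⟨C, hC, h⟩ := h ε hε
  refine ⟨C, hC, fun x Q hx hQ hQx => ?_⟩
  have hx0 : 0 < x := by linarith
  have hX0 : 0 < Real.log x := by linarith [one_le_two_mul_log hx]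
  have hQ0 : 0 < Q := lt_of_lt_of_le (by positivity) hQ
  have hlow := Real.log_le_log (by positivity) hQ
  rw [Real.log_rpow hx0] at hlow
  have hD := mvEval_eq_zero_of_forall_Ioo (D := D) (X := Real.log x)
    (fun a ha ha1 => mvEval_eq_zero_of_sq_mul_abs_le hK ha ha1 _)
    (a := Real.log Q / Real.log x) ((le_div_iff₀ hX0).2 hlow)
    ((div_le_one hX0).2 (Real.log_le_log hQ0 hQx))
  rw [div_mul_cancel₀ _ hX0.ne'] at hD
  have h2 := h x Q hx hQ hQx
  rwa [hD, mul_zero, zero_add] at h2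

/-- Pongsriiam–Vaughan: the variance of the divisor function in arithmetic
progressions, with the cubic main term and a degree-2 polynomial correction. -/
theorem divisor_variance :
    ∃ P : MvPolynomial (Fin 2) ℝ, P.totalDegree ≤ 2 ∧
      ∀ ε : ℝ, 0 < ε → ∃ C : ℝ, 0 < C ∧
        ∀ x Q : ℝ, 2 ≤ x → 1 ≤ Q → Q ≤ x →
          |Vdiv x Q - Q * x / Real.pi ^ 2 * Real.log (Q ^ 2 / x) ^ 3 -
              Q * x * MvPolynomial.eval ![Real.log x, Real.log Q] P| ≤
            C * (x ^ ((7 : ℝ) / 4) * Real.log x ^ 3 +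
              Q ^ 2 * (x / Q) ^ ε * Real.log x ^ 2) := by
  obtain ⟨P, hP, h⟩ := exists_Vdiv_expansion_of_rpow_le
  obtain ⟨C₁, hC₁, hV⟩ := exists_Vdiv_le
  obtain ⟨K, hK, hKb⟩ := exists_abs_mvEval_le_cube (hP.trans (by norm_num))
  refine ⟨P, hP, fun ε hε => ?_⟩
  obtain ⟨C, hC, h⟩ := h ε hε
  refine ⟨C + 2 * C₁ + (1 + K), by positivity, fun x Q hx hQ hQx => ?_⟩
  have hx0 : 0 < x := by linarith
  have hQ0 : 0 < Q := by linarith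
  have hX2 := one_le_two_mul_log hx
  have hX0 : 0 ≤ Real.log x := by linarith
  have hlog : Real.log (Q ^ 2 / x) = 2 * Real.log Q - Real.log x := by
    rw [Real.log_div (by positivity) hx0.ne', Real.log_pow]; norm_num
  have hform : Vdiv x Q - Q * x / Real.pi ^ 2 * Real.log (Q ^ 2 / x) ^ 3
      - Q * x * MvPolynomial.eval ![Real.log x, Real.log Q] P
      = Vdiv x Q - Q * x * ((2 * Real.log Q - Real.log x) ^ 3 / Real.pi ^ 2
          + MvPolynomial.eval ![Real.log x, Real.log Q] P) := by
    rw [hlog]; ring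
  rw [hform]
  have hB0 : 0 ≤ x ^ (7 / 4 : ℝ) * Real.log x ^ 3 := by positivity
  have hB'0 : 0 ≤ Q ^ 2 * (x / Q) ^ ε * Real.log x ^ 2 := by positivity
  rcases le_total (x ^ (3 / 4 : ℝ)) Q with hc | hc
  · refine (h x Q hx hc hQx).trans (mul_le_mul_of_nonneg_right ?_ (by positivity))
    linarith
  have hL0 := Real.log_nonneg hQ
  have hLX := Real.log_le_log hQ0 hQx
  have e2 := hV x Q hx hQ hQx
  have e3 := Vdiv_nonneg x Q
  have e4 := hKb _ _ hX2 hL0 hLX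
  have e5 := abs_two_mul_sub_cube_div_pi_sq_le hL0 hLX
  have e6 : Q * x * Real.log x ^ 3 ≤ x ^ (7 / 4 : ℝ) * Real.log x ^ 3 := by
    rw [← rpow_three_quarters_mul hx0]
    gcongr
  set X := Real.log x
  set B := x ^ (7 / 4 : ℝ) * X ^ 3
  set B' := Q ^ 2 * (x / Q) ^ ε * X ^ 2
  have e7 : |Q * x * ((2 * Real.log Q - X) ^ 3 / Real.pi ^ 2
      + MvPolynomial.eval ![X, Real.log Q] P)| ≤ (1 + K) * B := by
    rw [abs_mul, abs_of_pos (mul_pos hQ0 hx0)]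
    calc _ ≤ Q * x * ((1 + K) * X ^ 3) := by
          refine mul_le_mul_of_nonneg_left ((abs_add_le _ _).trans ?_) (by positivity)
          rw [add_mul, one_mul]
          exact add_le_add e5 e4
      _ = (1 + K) * (Q * x * X ^ 3) := by ring
      _ ≤ _ := mul_le_mul_of_nonneg_left e6 (by linarith)
  have e8 : |Vdiv x Q| ≤ 2 * C₁ * B := by
    rw [abs_of_nonneg e3]
    refine e2.trans ?_
    have := mul_le_mul_of_nonneg_left e6 hC₁
    linarith
  calc _ ≤ 2 * C₁ * B + (1 + K) * B := (abs_sub _ _).trans (add_le_add e8 e7)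
    _ ≤ (C + 2 * C₁ + (1 + K)) * B := by linarith [mul_nonneg hC hB0]
    _ ≤ _ := mul_le_mul_of_nonneg_left (by linarith) (by positivity)
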